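/- Let λ ∈ Λ_I⁺ be regular with μ the antidominant weight in W_{[λ]}·λ. The parabolic Verma module M_I(λ) is simple (isomorphic to L(λ)) if and only if λ = w_I·ν for some antidominant weight ν (necessarily ν = μ), where w_I is the longest element of W_I and the action is the dot action. -/

import Mathlib

section

open LieAlgebra

universe u v

variable {L : Type u} [LieRing L] [LieAlgebra ℂ L]
  {H : LieSubalgebra ℂ L}

/-- `v` is a highest weight vector of weight `lam` with respect to the positive
system `Φpos`: it is nonzero, `H` acts on it by `lam`, and the positive root
spaces annihilate it. -/
def IsHWVector [H.IsCartanSubalgebra] [IsNoetherian ℂ L]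
    (Φpos : Finset (Module.Dual ℂ H)) (lam : Module.Dual ℂ H)
    {M : Type v} [AddCommGroup M] [Module ℂ M] [LieRingModule L M] [LieModule ℂ L M]
    (v : M) : Prop :=
  v ≠ 0 ∧ (∀ h : H, ⁅(h : L), v⁆ = lam h • v) ∧
    ∀ α ∈ Φpos, ∀ x ∈ rootSpace H (⇑α), ⁅x, v⁆ = 0

/-- `M` is a Verma module of highest weight `lam`: it has a highest weight vector
`v` of weight `lam` which is universal, i.e. for every Lie module `N` and every
highest weight vector `n ∈ N` of weight `lam` there is a unique morphism of Lie
modules `M → N` carrying `v` to `n`. -/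
def IsVermaModule [H.IsCartanSubalgebra] [IsNoetherian ℂ L]
    (Φpos : Finset (Module.Dual ℂ H)) (lam : Module.Dual ℂ H)
    (M : Type v) [AddCommGroup M] [Module ℂ M] [LieRingModule L M]
    [LieModule ℂ L M] : Prop :=
  ∃ v : M, IsHWVector Φpos lam v ∧
    ∀ (N : Type v) (_ : AddCommGroup N) (_ : Module ℂ N) (_ : LieRingModule L N)
      (_ : LieModule ℂ L N) (n : N), IsHWVector Φpos lam n →
        ∃! f : M →ₗ⁅ℂ,L⁆ N, f v = n

/-- Axioms tying the data `(Φpos, coroot, ρ)` to the root system of `(L, H)`: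
`Φpos` is a positive system for the set of roots, `coroot α` is the coroot of `α`,
and `ρ` is the half sum of the positive roots. -/
structure IsRootData [H.IsCartanSubalgebra] [IsNoetherian ℂ L]
    (Φpos : Finset (Module.Dual ℂ H))
    (coroot : Module.Dual ℂ H → H) (ρ : Module.Dual ℂ H) : Prop where
  root_iff : ∀ α : Module.Dual ℂ H,
    (α ≠ 0 ∧ rootSpace H (⇑α) ≠ ⊥) ↔ (α ∈ Φpos ∨ -α ∈ Φpos)
  pos_neg : ∀ α ∈ Φpos, -α ∉ Φpos
  coroot_mem : ∀ α ∈ Φpos, coroot α ∈ corootSpace (⇑α) ∧ α (coroot α) = 2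
  coroot_neg : ∀ α : Module.Dual ℂ H, coroot (-α) = -coroot α
  rho_def : 2 • ρ = ∑ α ∈ Φpos, α

/-- `lam` is antidominant: `⟨lam+ρ, α∨⟩` is not a positive integer for any
positive root `α`. -/
def IsAntidominantWt {H : LieSubalgebra ℂ L}
    (Φpos : Finset (Module.Dual ℂ H)) (coroot : Module.Dual ℂ H → H)
    (ρ lam : Module.Dual ℂ H) : Prop :=
  ∀ α ∈ Φpos, ¬ ∃ n : ℤ, 0 < n ∧ (lam + ρ) (coroot α) = (n : ℂ)

open scoped Classical

/-- `v` is a highest weight vector of weight `lam` satisfying in addition the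
parabolic relations for `I`: for each simple root `α ∈ I` with `⟨lam, α∨⟩ = n ∈ ℕ`,
the `(n+1)`-st power of any element of the `(-α)`-root space annihilates `v`.
(These are exactly the defining relations of the parabolic Verma module
`M_I(lam) = U(g) ⊗_{U(p)} F(lam)`.) -/
def IsParaHWVector [H.IsCartanSubalgebra] [IsNoetherian ℂ L]
    (Φpos I : Finset (Module.Dual ℂ H)) (coroot : Module.Dual ℂ H → H)
    (lam : Module.Dual ℂ H)
    {M : Type v} [AddCommGroup M] [Module ℂ M] [LieRingModule L M] [LieModule ℂ L M]
    (v : M) : Prop :=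
  IsHWVector Φpos lam v ∧
    ∀ α ∈ I, ∀ n : ℕ, lam (coroot α) = (n : ℂ) →
      ∀ y ∈ rootSpace H (⇑(-α)), ((LieModule.toEnd ℂ L M y) ^ (n + 1)) v = 0

/-- `M` is the parabolic Verma module `M_I(lam)`: it has a highest weight vector
`v` of weight `lam` satisfying the parabolic relations for `I`, universal among
all such. -/
def IsParabolicVermaModule [H.IsCartanSubalgebra] [IsNoetherian ℂ L]
    (Φpos I : Finset (Module.Dual ℂ H)) (coroot : Module.Dual ℂ H → H)
    (lam : Module.Dual ℂ H)
    (M : Type v) [AddCommGroup M] [Module ℂ M] [LieRingModule L M]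
    [LieModule ℂ L M] : Prop :=
  ∃ v : M, IsParaHWVector Φpos I coroot lam v ∧
    ∀ (N : Type v) (_ : AddCommGroup N) (_ : Module ℂ N) (_ : LieRingModule L N)
      (_ : LieModule ℂ L N) (n : N), IsParaHWVector Φpos I coroot lam n →
        ∃! f : M →ₗ⁅ℂ,L⁆ N, f v = n

/-- The simple (indecomposable) roots of the positive system `Φpos`. -/
noncomputable def simpleRoots {H : LieSubalgebra ℂ L}
    (Φpos : Finset (Module.Dual ℂ H)) : Finset (Module.Dual ℂ H) :=
  Φpos.filter (fun α => ¬ ∃ β ∈ Φpos, ∃ γ ∈ Φpos, α = β + γ)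

/-- The reflection `s_α` acting on `h*`. -/
noncomputable def reflWt {H : LieSubalgebra ℂ L} (coroot : Module.Dual ℂ H → H)
    (α ν : Module.Dual ℂ H) : Module.Dual ℂ H :=
  ν - ν (coroot α) • α


end


set_option linter.unusedSectionVars false
set_option linter.unusedSimpArgs false
namespace Vrm
open MvPolynomial

/-- data for inducing a character. -/
structure IndData (ι : Type) [Fintype ι] (L : Type*) [LieRing L] [LieAlgebra ℂ L]
    (R : Type*) [CommRing R] [Algebra ℂ R] where
  c : L →ₗ[ℂ] (ι → ℂ)
  f : ι → L
  chi : L →ₗ[ℂ] R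
  c_f : ∀ i, c (f i) = fun k => open Classical in if k = i then 1 else 0
  chi_f : ∀ i, chi (f i) = 0
  c_lie : ∀ x y, c x = 0 → c y = 0 → c ⁅x, y⁆ = 0
  chi_lie : ∀ x y, c x = 0 → c y = 0 → chi ⁅x, y⁆ = 0

variable {ι : Type} [Fintype ι] [LinearOrder ι] {L : Type*} [LieRing L] [LieAlgebra ℂ L]
    {R : Type*} [CommRing R] [Algebra ℂ R]

/-- build a bilinear map from values on monomials -/
noncomputable def linMon (g : (ι →₀ ℕ) → L →ₗ[ℂ] MvPolynomial ι R) :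
    L →ₗ[ℂ] (MvPolynomial ι R →ₗ[R] MvPolynomial ι R) where
  toFun x := (basisMonomials ι R).constr R (fun m => g m x)
  map_add' x y := by
    apply (basisMonomials ι R).ext; intro m
    simp only [Module.Basis.constr_basis, LinearMap.add_apply, map_add]
  map_smul' a x := by
    apply (basisMonomials ι R).ext; intro m
    simp only [Module.Basis.constr_basis, LinearMap.smul_apply, map_smul, RingHom.id_apply]

theorem linMon_monomial (g : (ι →₀ ℕ) → L →ₗ[ℂ] MvPolynomial ι R) (x : L) (m : ι →₀ ℕ) :
    linMon g x (monomial m 1) = g m x := by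
  have := (basisMonomials ι R).constr_basis R (fun m => g m x) m
  simpa [linMon] using this

namespace IndData
variable (D : IndData ι L R)

/-- multiplication by the symbol of `x`. -/
noncomputable def sym (x : L) : MvPolynomial ι R := ∑ i, D.c x i • X i

/-- kill the components up to `j` -/
noncomputable def cut (j : ι) : L →ₗ[ℂ] L where
  toFun x := x - ∑ i ∈ Finset.univ.filter (· ≤ j), D.c x i • D.f i
  map_add' x y := by
    simp only [map_add, Pi.add_apply, add_smul, Finset.sum_add_distrib]; abel
  map_smul' a x := by
    simp only [map_smul, Pi.smul_apply, smul_eq_mul, mul_smul, Finset.smul_sum, smul_sub,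
      RingHom.id_apply]

theorem sym_add (x y : L) : D.sym (x + y) = D.sym x + D.sym y := by
  simp [sym, add_smul, Finset.sum_add_distrib]
theorem sym_smul (a : ℂ) (x : L) : D.sym (a • x) = a • D.sym x := by
  simp [sym, mul_smul, Finset.smul_sum]
theorem sym_f (i : ι) : D.sym (D.f i) = X i := by
  simp [sym, D.c_f]

noncomputable def symL : L →ₗ[ℂ] MvPolynomial ι R where
  toFun := D.sym
  map_add' := D.sym_add
  map_smul' := D.sym_smul

/-- minimal index of a monomial -/
noncomputable def mn (m : ι →₀ ℕ) (h : m ≠ 0) : ι :=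
  m.support.min' (Finsupp.support_nonempty_iff.2 h)

/-- lower order part of the action, level by level -/
noncomputable def rr : ℕ → L →ₗ[ℂ] (MvPolynomial ι R →ₗ[R] MvPolynomial ι R)
  | 0 => linMon (fun m => open Classical in if m = 0 then
      ((Algebra.linearMap R (MvPolynomial ι R)).restrictScalars ℂ).comp D.chi else 0)
  | n+1 => linMon (fun m => open Classical in if h : m = 0 then
      ((Algebra.linearMap R (MvPolynomial ι R)).restrictScalars ℂ).comp D.chi else
      { toFun := fun x =>
          rr n (D.f (mn m h)) (rr n (D.cut (mn m h) x) (monomial (m - Finsupp.single (mn m h) 1) 1))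
          + X (mn m h) * rr n (D.cut (mn m h) x) (monomial (m - Finsupp.single (mn m h) 1) 1)
          + D.symL ⁅D.cut (mn m h) x, D.f (mn m h)⁆ * monomial (m - Finsupp.single (mn m h) 1) 1
          + rr n ⁅D.cut (mn m h) x, D.f (mn m h)⁆ (monomial (m - Finsupp.single (mn m h) 1) 1)
        map_add' := by
          intro x y
          simp only [map_add, add_lie, LinearMap.add_apply, mul_add, add_mul]; abel
        map_smul' := by
          intro a x
          simp only [map_smul, smul_lie, LinearMap.smul_apply, mul_smul_comm, smul_mul_assoc,
            RingHom.id_apply, smul_add]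
          congr 3
          exact map_smul ((rr n (D.f (mn m h))).restrictScalars ℂ) a _ } )

/-- the final lower order part -/
noncomputable def r : L →ₗ[ℂ] (MvPolynomial ι R →ₗ[R] MvPolynomial ι R) :=
  linMon (fun m => 
     { toFun := fun x => D.rr m.degree x (monomial m 1)
       map_add' := by intro x y; simp
       map_smul' := by intro a x; simp })

/-- degree filtration -/
noncomputable def fil (ι : Type) (R : Type*) [CommRing R] (n : ℕ) :
    Submodule R (MvPolynomial ι R) :=
  Submodule.span R {p | ∃ m : ι →₀ ℕ, m.degree ≤ n ∧ p = monomial m 1}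

theorem mon_mem_fil {n : ℕ} {m : ι →₀ ℕ} (h : m.degree ≤ n) :
    (monomial m 1 : MvPolynomial ι R) ∈ fil ι R n := Submodule.subset_span ⟨m, h, rfl⟩

theorem fil_mono {n n' : ℕ} (h : n ≤ n') : fil ι R n ≤ fil ι R n' := by
  apply Submodule.span_mono
  rintro p ⟨m, hm, rfl⟩
  exact ⟨m, hm.trans h, rfl⟩

theorem fil_ind {n : ℕ} {p : MvPolynomial ι R} (hp : p ∈ fil ι R n)
    (S : Submodule R (MvPolynomial ι R)) (h : ∀ m : ι →₀ ℕ, m.degree ≤ n → monomial m 1 ∈ S) :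
    p ∈ S := by
  have : fil ι R n ≤ S := by
    apply Submodule.span_le.2
    rintro p ⟨m, hm, rfl⟩
    exact h m hm
  exact this hp

theorem exists_mem_fil (p : MvPolynomial ι R) : ∃ n, p ∈ fil ι R n := by
  induction p using MvPolynomial.induction_on' with
  | monomial u a =>
    refine ⟨u.degree, ?_⟩
    have : monomial u a = a • (monomial u 1 : MvPolynomial ι R) := by simp [smul_monomial]
    rw [this]
    exact Submodule.smul_mem _ _ (mon_mem_fil le_rfl)
  | add p q hp hq =>
    obtain ⟨a, ha⟩ := hp
    obtain ⟨b, hb⟩ := hq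
    exact ⟨max a b, Submodule.add_mem _ (fil_mono (le_max_left _ _) ha) (fil_mono (le_max_right _ _) hb)⟩

theorem X_mul_mon (i : ι) (m : ι →₀ ℕ) :
    X i * (monomial m 1 : MvPolynomial ι R) = monomial (m + Finsupp.single i 1) 1 := by
  rw [X, monomial_mul, add_comm, one_mul]

theorem X_mul_mem {n : ℕ} {p : MvPolynomial ι R} (i : ι) (hp : p ∈ fil ι R n) :
    X i * p ∈ fil ι R (n + 1) := by
  refine fil_ind hp ((fil ι R (n+1)).comap (LinearMap.mulLeft R (X i))) ?_
  intro m hm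
  rw [Submodule.mem_comap, LinearMap.mulLeft_apply, X_mul_mon]
  apply mon_mem_fil
  rw [map_add, Finsupp.degree_single]; omega

theorem csmul_mem (S : Submodule R (MvPolynomial ι R)) (a : ℂ) {p : MvPolynomial ι R} (h : p ∈ S) :
    a • p ∈ S := by
  rw [← algebraMap_smul R a p]
  exact S.smul_mem _ h

theorem sym_mul_mem {n : ℕ} {p : MvPolynomial ι R} (x : L) (hp : p ∈ fil ι R n) :
    D.sym x * p ∈ fil ι R (n + 1) := by
  rw [sym, Finset.sum_mul]
  refine Submodule.sum_mem _ fun i _ => ?_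
  rw [smul_mul_assoc]
  exact csmul_mem _ _ (X_mul_mem i hp)

theorem mn_mem (m : ι →₀ ℕ) (h : m ≠ 0) : m (mn m h) ≠ 0 :=
  Finsupp.mem_support_iff.1 (Finset.min'_mem _ _)

theorem mn_le (m : ι →₀ ℕ) (h : m ≠ 0) (i : ι) (hi : m i ≠ 0) : mn m h ≤ i :=
  Finset.min'_le _ _ (Finsupp.mem_support_iff.2 hi)

theorem mn_add (m : ι →₀ ℕ) (h : m ≠ 0) :
    (m - Finsupp.single (mn m h) 1) + Finsupp.single (mn m h) 1 = m := by
  apply tsub_add_cancel_of_le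
  rw [Finsupp.single_le_iff]
  exact Nat.one_le_iff_ne_zero.2 (mn_mem m h)

theorem mn_degree (m : ι →₀ ℕ) (h : m ≠ 0) :
    (m - Finsupp.single (mn m h) 1).degree + 1 = m.degree := by
  conv_rhs => rw [← mn_add m h]
  rw [map_add, Finsupp.degree_single]

theorem rr_zero (n : ℕ) (x : L) : D.rr n x (monomial 0 1) = C (D.chi x) := by
  cases n
  · rw [rr, linMon_monomial, if_pos rfl]; rfl
  · rw [rr, linMon_monomial, dif_pos rfl]; rfl

theorem rr_succ (n : ℕ) (x : L) (m : ι →₀ ℕ) (h : m ≠ 0) :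
    D.rr (n + 1) x (monomial m 1) =
     D.rr n (D.f (mn m h)) (D.rr n (D.cut (mn m h) x) (monomial (m - Finsupp.single (mn m h) 1) 1))
          + X (mn m h) * D.rr n (D.cut (mn m h) x) (monomial (m - Finsupp.single (mn m h) 1) 1)
          + D.sym ⁅D.cut (mn m h) x, D.f (mn m h)⁆ * monomial (m - Finsupp.single (mn m h) 1) 1
          + D.rr n ⁅D.cut (mn m h) x, D.f (mn m h)⁆ (monomial (m - Finsupp.single (mn m h) 1) 1) := by
  rw [rr, linMon_monomial, dif_neg h]
  rfl

theorem rr_stab (n : ℕ) : ∀ (x : L) (p : MvPolynomial ι R), p ∈ fil ι R n →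
    D.rr n x p ∈ fil ι R n ∧ D.rr (n + 1) x p = D.rr n x p := by
  induction n with
  | zero =>
    intro x p hp
    refine fil_ind hp ((fil ι R 0).comap (D.rr 0 x) ⊓ LinearMap.eqLocus (D.rr 1 x) (D.rr 0 x)) ?_
    intro m hm
    have : m = 0 := (Finsupp.degree_eq_zero_iff m).1 (Nat.le_zero.1 hm)
    subst this
    constructor
    · rw [SetLike.mem_coe, Submodule.mem_comap, rr_zero]
      have : (C (D.chi x) : MvPolynomial ι R) = D.chi x • monomial 0 1 := by
        rw [smul_monomial]; simp
      rw [this]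
      exact Submodule.smul_mem _ _ (mon_mem_fil (by simp))
    · rw [SetLike.mem_coe, LinearMap.mem_eqLocus, rr_zero, rr_zero]
  | succ n ih =>
    intro x p hp
    refine fil_ind hp ((fil ι R (n+1)).comap (D.rr (n+1) x) ⊓
      LinearMap.eqLocus (D.rr (n+2) x) (D.rr (n+1) x)) ?_
    intro m hm
    by_cases h : m = 0
    · subst h
      constructor
      · rw [SetLike.mem_coe, Submodule.mem_comap, rr_zero]
        have : (C (D.chi x) : MvPolynomial ι R) = D.chi x • monomial 0 1 := by
          rw [smul_monomial]; simp
        rw [this]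
        exact Submodule.smul_mem _ _ (mon_mem_fil (by simp))
      · rw [SetLike.mem_coe, LinearMap.mem_eqLocus, rr_zero, rr_zero]
    · have hT : (monomial (m - Finsupp.single (mn m h) 1) 1 : MvPolynomial ι R) ∈ fil ι R n := by
        apply mon_mem_fil
        have := mn_degree m h
        omega
      constructor
      · rw [SetLike.mem_coe, Submodule.mem_comap, rr_succ _ _ _ _ h]
        have h1 := (ih (D.cut (mn m h) x) _ hT).1
        refine add_mem (add_mem (add_mem ?_ ?_) ?_) ?_
        · exact fil_mono (Nat.le_succ n) (ih _ _ h1).1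
        · exact X_mul_mem _ h1
        · exact D.sym_mul_mem _ hT
        · exact fil_mono (Nat.le_succ n) (ih _ _ hT).1
      · rw [SetLike.mem_coe, LinearMap.mem_eqLocus, rr_succ _ _ _ _ h, rr_succ _ _ _ _ h]
        rw [(ih (D.cut (mn m h) x) _ hT).2, (ih _ _ (ih (D.cut (mn m h) x) _ hT).1).2, 
          (ih ⁅D.cut (mn m h) x, D.f (mn m h)⁆ _ hT).2]

theorem rr_le {n n' : ℕ} (h : n ≤ n') (x : L) {p : MvPolynomial ι R} (hp : p ∈ fil ι R n) :
    D.rr n' x p = D.rr n x p := by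
  induction n', h using Nat.le_induction with
  | base => rfl
  | succ k hk ih => rw [(D.rr_stab k x p (fil_mono hk hp)).2, ih]

theorem r_eq (n : ℕ) (x : L) {p : MvPolynomial ι R} (hp : p ∈ fil ι R n) :
    D.r x p = D.rr n x p := by
  refine fil_ind hp (LinearMap.eqLocus (D.r x) (D.rr n x)) ?_
  intro m hm
  rw [LinearMap.mem_eqLocus, r, linMon_monomial]
  exact (D.rr_le hm x (mon_mem_fil le_rfl)).symm

theorem r_mem {n : ℕ} (x : L) {p : MvPolynomial ι R} (hp : p ∈ fil ι R n) :
    D.r x p ∈ fil ι R n := by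
  rw [D.r_eq n x hp]; exact (D.rr_stab n x p hp).1

/-- the action -/
noncomputable def act : L →ₗ[ℂ] (MvPolynomial ι R →ₗ[R] MvPolynomial ι R) where
  toFun x := LinearMap.mulLeft R (D.sym x) + D.r x
  map_add' x y := by
    refine LinearMap.ext fun p => ?_
    simp only [sym_add, map_add, LinearMap.add_apply, LinearMap.mulLeft_apply, add_mul]; abel
  map_smul' a x := by
    refine LinearMap.ext fun p => ?_
    simp only [sym_smul, map_smul, LinearMap.add_apply, LinearMap.mulLeft_apply, smul_mul_assoc,
      LinearMap.smul_apply, RingHom.id_apply, smul_add]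

theorem act_apply (x : L) (p : MvPolynomial ι R) : D.act x p = D.sym x * p + D.r x p := rfl

theorem act_one (x : L) : D.act x 1 = D.sym x + C (D.chi x) := by
  rw [act_apply, mul_one]
  congr 1
  change D.r x (monomial 0 1) = _
  rw [D.r_eq 0 x (mon_mem_fil (m := 0) (by simp))]
  exact D.rr_zero 0 x

theorem r_mon (x : L) (m : ι →₀ ℕ) (h : m ≠ 0) :
    D.r x (monomial m 1) =
     D.act (D.f (mn m h)) (D.r (D.cut (mn m h) x) (monomial (m - Finsupp.single (mn m h) 1) 1))
      + D.act ⁅D.cut (mn m h) x, D.f (mn m h)⁆ (monomial (m - Finsupp.single (mn m h) 1) 1) := by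
  have hd := mn_degree m h
  have hT : (monomial (m - Finsupp.single (mn m h) 1) 1 : MvPolynomial ι R) ∈
    fil ι R (m - Finsupp.single (mn m h) 1).degree := mon_mem_fil le_rfl
  rw [D.r_eq ((m - Finsupp.single (mn m h) 1).degree + 1) x (mon_mem_fil hd.ge), rr_succ _ _ _ _ h,
    act_apply, act_apply, ← D.r_eq _ _ hT, ← D.r_eq _ _ hT, ← D.r_eq _ _ (D.r_mem _ hT), sym_f]
  abel

theorem c_cut (j : ι) (x : L) (i : ι) : D.c (D.cut j x) i = if i ≤ j then 0 else D.c x i := by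
  simp only [cut, LinearMap.coe_mk, AddHom.coe_mk, map_sub, map_sum, map_smul, D.c_f, Pi.sub_apply,
    Finset.sum_apply, Pi.smul_apply, smul_eq_mul, mul_ite, mul_one, mul_zero]
  rw [Finset.sum_ite_eq]
  by_cases h : i ≤ j <;> simp [h]

theorem cut_eq (j : ι) (x : L) :
    x = D.cut j x + ∑ i ∈ Finset.univ.filter (· ≤ j), D.c x i • D.f i := by
  simp [cut]

theorem cut_f_of_le {i j : ι} (h : i ≤ j) : D.cut j (D.f i) = 0 := by
  simp only [cut, LinearMap.coe_mk, AddHom.coe_mk, D.c_f, ite_smul, one_smul, zero_smul]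
  rw [Finset.sum_ite_eq', if_pos (by simp [h]), sub_self]

theorem cut_f_of_lt {i j : ι} (h : j < i) : D.cut j (D.f i) = D.f i := by
  simp only [cut, LinearMap.coe_mk, AddHom.coe_mk, D.c_f, ite_smul, one_smul, zero_smul]
  rw [Finset.sum_ite_eq', if_neg (by simp [h]), sub_zero]

theorem cut_of_c (j : ι) (x : L) (h : ∀ i ≤ j, D.c x i = 0) : D.cut j x = x := by
  simp only [cut, LinearMap.coe_mk, AddHom.coe_mk]
  rw [Finset.sum_eq_zero, sub_zero]
  intro i hi
  rw [h i (by simpa using hi), zero_smul]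

theorem act_f (i : ι) (m : ι →₀ ℕ) (h : ∀ k, m k ≠ 0 → i ≤ k) :
    D.act (D.f i) (monomial m 1) = monomial (m + Finsupp.single i 1) 1 := by
  rw [act_apply, sym_f, X_mul_mon]
  by_cases h0 : m = 0
  · subst h0
    rw [D.r_eq 0 _ (mon_mem_fil (by simp)), rr_zero, chi_f, map_zero, add_zero]
  · rw [r_mon _ _ _ h0, cut_f_of_le _ (h _ (mn_mem m h0))]
    simp

theorem mn_eq (j : ι) (T : ι →₀ ℕ) (h : ∀ k, T k ≠ 0 → j ≤ k) (hm : T + Finsupp.single j 1 ≠ 0) :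
    mn (T + Finsupp.single j 1) hm = j := by
  apply le_antisymm
  · apply mn_le; simp
  · have := mn_mem _ hm
    by_cases hh : T (mn (T + Finsupp.single j 1) hm) = 0
    · have h2 : (Finsupp.single j 1 : ι →₀ ℕ) (mn (T + Finsupp.single j 1) hm) ≠ 0 := by
        intro h3; apply this; rw [Finsupp.add_apply, hh, h3]
      rw [Finsupp.single_apply] at h2
      simp only [ne_eq, ite_eq_right_iff, one_ne_zero, imp_false, not_not] at h2
      exact h2.le
    · exact h _ hh

theorem act_mon (x : L) (j : ι) (T : ι →₀ ℕ) (h : ∀ k, T k ≠ 0 → j ≤ k)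
    (hx : ∀ i ≤ j, D.c x i = 0) :
    D.act x (monomial (T + Finsupp.single j 1) 1) =
      D.act (D.f j) (D.act x (monomial T 1)) + D.act ⁅x, D.f j⁆ (monomial T 1) := by
  have hm : T + Finsupp.single j 1 ≠ 0 := by
    intro h; have := DFunLike.congr_fun h j; simp at this
  conv_lhs => rw [act_apply, r_mon _ _ _ hm]
  rw [mn_eq j T h hm]
  rw [add_tsub_cancel_right, D.cut_of_c j x hx, ← add_assoc]
  congr 1
  rw [D.act_apply x (monomial T 1), map_add]
  congr 1
  rw [sym, Finset.sum_mul, Finset.sum_mul, map_sum]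
  refine Finset.sum_congr rfl fun i _ => ?_
  by_cases hij : i ≤ j
  · rw [hx i hij]; simp
  · rw [smul_mul_assoc, smul_mul_assoc, X_mul_mon, X_mul_mon]
    have : D.act (D.f j) (D.c x i • (monomial (T + Finsupp.single i 1)) 1) = 
       D.c x i • D.act (D.f j) ((monomial (T + Finsupp.single i 1)) 1) :=
      map_smul ((D.act (D.f j)).restrictScalars ℂ) _ _
    rw [this, D.act_f, add_right_comm]
    intro k hk
    by_cases hT : T k = 0
    · have h2 : (Finsupp.single i 1 : ι →₀ ℕ) k ≠ 0 := by
        intro h3; apply hk; rw [Finsupp.add_apply, hT, h3]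
      rw [Finsupp.single_apply] at h2
      simp only [ne_eq, ite_eq_right_iff, one_ne_zero, imp_false, not_not] at h2
      rw [← h2]; exact (not_le.1 hij).le
    · exact h k hT

/-- commutation defect -/
noncomputable def dfc (x y : L) : MvPolynomial ι R →ₗ[R] MvPolynomial ι R :=
  D.act x ∘ₗ D.act y - D.act y ∘ₗ D.act x - D.act ⁅x, y⁆

theorem dfc_add_left (x x' y : L) : D.dfc (x + x') y = D.dfc x y + D.dfc x' y := by
  simp only [dfc, map_add, add_lie, LinearMap.add_comp, LinearMap.comp_add]; abel
theorem dfc_swap (x y : L) : D.dfc x y = - D.dfc y x := by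
  rw [dfc, dfc, ← lie_skew, map_neg]; abel
theorem dfc_smul_left (a : ℂ) (x y : L) : D.dfc (a • x) y = a • D.dfc x y := by
  refine LinearMap.ext fun p => ?_
  have : D.act y (a • D.act x p) = a • D.act y (D.act x p) :=
      map_smul ((D.act y).restrictScalars ℂ) _ _
  simp only [dfc, map_smul, smul_lie, LinearMap.sub_apply, LinearMap.comp_apply,
    LinearMap.smul_apply, this, smul_sub]

theorem dfc_f_left (j : ι) (x : L) (T : ι →₀ ℕ) (h : ∀ k, T k ≠ 0 → j ≤ k) :
    D.dfc (D.f j) x (monomial T 1) = 0 := by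
  -- case x has no components ≤ j
  have key : ∀ (j : ι) (x : L) (T : ι →₀ ℕ), (∀ k, T k ≠ 0 → j ≤ k) → (∀ i ≤ j, D.c x i = 0) →
      D.dfc (D.f j) x (monomial T 1) = 0 := by
    intro j x T h hx
    rw [dfc_swap, dfc]
    simp only [LinearMap.neg_apply, LinearMap.sub_apply, LinearMap.comp_apply]
    rw [D.act_f j T h, D.act_mon x j T h hx]; abel
  rw [D.cut_eq j x, dfc_swap, dfc_add_left, neg_add, ← dfc_swap, LinearMap.add_apply, key j _ T h,
    zero_add, LinearMap.neg_apply, neg_eq_zero]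
  · have : ∀ s : Finset ι, (∀ i ∈ s, i ≤ j) →
       D.dfc (∑ i ∈ s, D.c x i • D.f i) (D.f j) (monomial T 1) = 0 := by
      intro s
      induction s using Finset.induction_on with
      | empty => intro _; simp [dfc]
      | insert a s ha ih =>
        intro hs
        rw [Finset.sum_insert ha, dfc_add_left, dfc_smul_left, LinearMap.add_apply,
          ih (fun i hi => hs i (Finset.mem_insert_of_mem hi)), add_zero, LinearMap.smul_apply]
        have haj := hs a (Finset.mem_insert_self _ _)
        rcases haj.eq_or_lt with rfl | hlt
        · rw [dfc, sub_self, zero_sub, lie_self]; simp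
        · rw [key a (D.f j) T (fun k hk => hlt.le.trans (h k hk)), smul_zero]
          intro i hi
          rw [D.c_f]
          exact if_neg (fun (h : i = j) => absurd hlt (not_lt.2 (h ▸ hi)))
    exact this _ (by simp)
  · intro i hi
    rw [c_cut, if_pos hi]

theorem dfc_zero (n : ℕ) : ∀ (x y : L) (p : MvPolynomial ι R), p ∈ fil ι R n →
    D.dfc x y p = 0 := by
  -- reduction
  have red : ∀ (s : Finset ι) (T : ι →₀ ℕ), (∀ j ∈ s, ∀ k, T k ≠ 0 → j ≤ k) →
     ∀ x y x' y' : L, x = x' + ∑ i ∈ s, D.c x i • D.f i → y = y' + ∑ i ∈ s, D.c y i • D.f i →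
     D.dfc x' y' (monomial T 1) = 0 → D.dfc x y (monomial T 1) = 0 := by
    intro s T hs x y x' y' hx hy h
    have one : ∀ (a : ι → ℂ) (z : L) (s : Finset ι), (∀ j ∈ s, ∀ k, T k ≠ 0 → j ≤ k) →
        D.dfc (∑ i ∈ s, a i • D.f i) z (monomial T 1) = 0 := by
      intro a z s
      induction s using Finset.induction_on with
      | empty => intro _; simp [dfc]
      | insert b s hb ih =>
        intro hs
        rw [Finset.sum_insert hb, dfc_add_left, dfc_smul_left, LinearMap.add_apply,
          ih (fun i hi => hs i (Finset.mem_insert_of_mem hi)), add_zero, LinearMap.smul_apply,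
          D.dfc_f_left b z T (hs b (Finset.mem_insert_self _ _)), smul_zero]
    rw [hx, dfc_add_left, LinearMap.add_apply, one _ _ _ hs, add_zero, dfc_swap, hy, dfc_add_left,
      LinearMap.neg_apply, LinearMap.add_apply, one _ _ _ hs, add_zero, ← LinearMap.neg_apply,
      ← dfc_swap, h]
  induction n with
  | zero =>
    intro x y p hp
    refine fil_ind hp (LinearMap.ker (D.dfc x y)) ?_
    intro m hm
    have : m = 0 := (Finsupp.degree_eq_zero_iff m).1 (Nat.le_zero.1 hm)
    subst this
    rw [LinearMap.mem_ker]
    have h0 : ∀ z : L, D.c (z - ∑ i, D.c z i • D.f i) = 0 := by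
      intro z
      ext k
      simp [D.c_f, Finset.sum_apply]
    refine red Finset.univ 0 (by simp) x y (x - ∑ i, D.c x i • D.f i) (y - ∑ i, D.c y i • D.f i)
      (by abel) (by abel) ?_
    generalize (x - ∑ i, D.c x i • D.f i) = x', (y - ∑ i, D.c y i • D.f i) = y', h0 x = hx, h0 y = hy
    have hs : ∀ z : L, D.c z = 0 → D.sym z = 0 := by intro z hz; simp [sym, hz]
    have h1 : (monomial 0 1 : MvPolynomial ι R) = 1 := rfl
    have h2 : ∀ (z : L) (a : R), D.c z = 0 → D.act z (C a) = C (a * D.chi z) := by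
      intro z a hz
      have : (C a : MvPolynomial ι R) = a • 1 := by rw [smul_eq_C_mul, mul_one]
      rw [this, map_smul, act_one, hs z hz, zero_add, smul_eq_C_mul, ← C_mul]
    simp only [dfc, LinearMap.sub_apply, LinearMap.comp_apply, h1, act_one]
    rw [hs x' hx, hs y' hy, hs _ (D.c_lie x' y' hx hy), D.chi_lie x' y' hx hy, zero_add, zero_add,
      h2 _ _ hx, h2 _ _ hy, mul_comm]
    simp
  | succ n ih =>
    intro x y p hp
    refine fil_ind hp (LinearMap.ker (D.dfc x y)) ?_
    intro m hm
    rw [LinearMap.mem_ker]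
    by_cases h : m = 0
    · subst h
      exact ih x y _ (mon_mem_fil (by simp))
    obtain ⟨j, T, hT, hdeg, rfl⟩ : ∃ (j : ι) (T : ι →₀ ℕ), (∀ k, T k ≠ 0 → j ≤ k) ∧ T.degree ≤ n ∧
        T + Finsupp.single j 1 = m := by
      refine ⟨mn m h, m - Finsupp.single (mn m h) 1, ?_, ?_, mn_add m h⟩
      · intro k hk
        apply mn_le
        intro h0; apply hk; simp [h0]
      · have := mn_degree m h; omega
    have hTT : ∀ k, (T + Finsupp.single j 1 : ι →₀ ℕ) k ≠ 0 → j ≤ k := by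
      intro k hk
      by_cases hT0 : T k = 0
      · have h2 : (Finsupp.single j 1 : ι →₀ ℕ) k ≠ 0 := by
          intro h3; apply hk; rw [Finsupp.add_apply, hT0, h3]
        rw [Finsupp.single_apply] at h2
        simp only [ne_eq, ite_eq_right_iff, one_ne_zero, imp_false, not_not] at h2
        exact h2.le
      · exact hT k hT0
    refine red (Finset.univ.filter (· ≤ j)) _ ?_ x y (D.cut j x) (D.cut j y) (D.cut_eq j x)
      (D.cut_eq j y) ?_
    · intro i hi k hk
      exact (by simpa using hi : i ≤ j).trans (hTT k hk)
    have cx : ∀ i ≤ j, D.c (D.cut j x) i = 0 := fun i hi => by rw [c_cut, if_pos hi]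
    have cy : ∀ i ≤ j, D.c (D.cut j y) i = 0 := fun i hi => by rw [c_cut, if_pos hi]
    generalize D.cut j x = x' at *
    generalize D.cut j y = y' at *
    have hTm : (monomial T 1 : MvPolynomial ι R) ∈ fil ι R n := mon_mem_fil hdeg
    have hsub : ∀ x y p, D.dfc x y p = 0 → D.act x (D.act y p) = D.act y (D.act x p) + D.act ⁅x, y⁆ p := by
      intro x y p hp
      simp only [dfc, LinearMap.sub_apply, LinearMap.comp_apply] at hp
      rw [sub_sub, sub_eq_zero] at hp
      exact hp
    -- (*) 
    have st : ∀ z : L, D.act z (monomial (T + Finsupp.single j 1) 1) =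
        D.act (D.f j) (D.act z (monomial T 1)) + D.act ⁅z, D.f j⁆ (monomial T 1) := by
      intro z
      rw [← D.act_f j T hT]
      apply hsub
      rw [dfc_swap, LinearMap.neg_apply, D.dfc_f_left j z T hT, neg_zero]
    have st2 : ∀ z w : L, (∀ i ≤ j, D.c w i = 0) → 
        D.act z (D.act (D.f j) (D.act w (monomial T 1))) = 
        D.act (D.f j) (D.act z (D.act w (monomial T 1))) + D.act ⁅z, D.f j⁆ (D.act w (monomial T 1)) := by
      intro z w hw
      apply hsub
      rw [D.act_apply w, map_add, ih _ _ _ (D.r_mem w hTm), add_zero, sym, Finset.sum_mul, map_sum]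
      refine Finset.sum_eq_zero fun i _ => ?_
      by_cases hij : i ≤ j
      · rw [hw i hij]; simp
      · rw [smul_mul_assoc, X_mul_mon]
        have : D.dfc z (D.f j) (D.c w i • (monomial (T + Finsupp.single i 1)) 1) = 
            D.c w i • D.dfc z (D.f j) ((monomial (T + Finsupp.single i 1)) 1) :=
          map_smul ((D.dfc z (D.f j)).restrictScalars ℂ) _ _
        rw [this, dfc_swap, LinearMap.neg_apply, D.dfc_f_left j z, neg_zero, smul_zero]
        intro k hk
        by_cases hT0 : T k = 0
        · have h2 : (Finsupp.single i 1 : ι →₀ ℕ) k ≠ 0 := by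
            intro h3; apply hk; rw [Finsupp.add_apply, hT0, h3]
          rw [Finsupp.single_apply] at h2
          simp only [ne_eq, ite_eq_right_iff, one_ne_zero, imp_false, not_not] at h2
          rw [← h2]; exact (not_le.1 hij).le
        · exact hT k hT0
    have e1 := hsub _ _ _ (ih ⁅x', D.f j⁆ y' _ hTm)
    have e2 := hsub _ _ _ (ih ⁅y', D.f j⁆ x' _ hTm)
    have e3 := hsub _ _ _ (ih x' y' _ hTm)
    have jac : ⁅⁅x', y'⁆, D.f j⁆ = ⁅⁅x', D.f j⁆, y'⁆ - ⁅⁅y', D.f j⁆, x'⁆ := by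
      rw [lie_lie, ← lie_skew x' ⁅y', D.f j⁆, ← lie_skew y' ⁅x', D.f j⁆]; abel
    simp only [dfc, LinearMap.sub_apply, LinearMap.comp_apply]
    rw [st, st, st, map_add, map_add, st2 x' y' cy, st2 y' x' cx, e1, e2, e3, jac]
    simp only [map_add, map_sub, LinearMap.sub_apply]
    abel

theorem act_lie (x y : L) (p : MvPolynomial ι R) :
    D.act ⁅x, y⁆ p = D.act x (D.act y p) - D.act y (D.act x p) := by
  obtain ⟨n, hn⟩ := exists_mem_fil p
  have := D.dfc_zero n x y p hn
  simp only [dfc, LinearMap.sub_apply, LinearMap.comp_apply] at this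
  rw [sub_eq_zero] at this
  exact this.symm

end IndData
end Vrm


set_option linter.unusedSectionVars false
set_option linter.unusedSimpArgs false

namespace Vrm
open MvPolynomial
variable {ι : Type} [Fintype ι] [LinearOrder ι] {L : Type*} [LieRing L] [LieAlgebra ℂ L]
    {R : Type*} [CommRing R] [Algebra ℂ R]
namespace IndData
variable (D : IndData ι L R)

section univ
variable {N : Type*} [AddCommGroup N] [Module R N]

/-- the ordered product of the `f`s applied to `n` -/
noncomputable def mprod (a : L → (N →ₗ[R] N)) (n : N) (m : ι →₀ ℕ) : N :=
  ((Finsupp.toMultiset m).sort (· ≤ ·)).foldr (fun i y => a (D.f i) y) n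

theorem mprod_zero (a : L → (N →ₗ[R] N)) (n : N) : D.mprod a n 0 = n := by
  simp [mprod]

theorem mprod_add (a : L → (N →ₗ[R] N)) (n : N) (j : ι) (T : ι →₀ ℕ)
    (h : ∀ k, T k ≠ 0 → j ≤ k) :
    D.mprod a n (T + Finsupp.single j 1) = a (D.f j) (D.mprod a n T) := by
  rw [mprod, map_add, Finsupp.toMultiset_single, one_smul, add_comm, Multiset.singleton_add,
    Multiset.sort_cons, List.foldr_cons]
  · rfl
  · intro b hb
    rw [Finsupp.mem_toMultiset, Finsupp.mem_support_iff] at hb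
    exact h b hb

/-- the universal map -/
noncomputable def lift (a : L → (N →ₗ[R] N)) (n : N) : MvPolynomial ι R →ₗ[R] N :=
  (basisMonomials ι R).constr R (D.mprod a n)

theorem lift_mon (a : L → (N →ₗ[R] N)) (n : N) (m : ι →₀ ℕ) :
    D.lift a n (monomial m 1) = D.mprod a n m := by
  have := (basisMonomials ι R).constr_basis R (D.mprod a n) m
  simpa [lift] using this

theorem lift_one (a : L → (N →ₗ[R] N)) (n : N) : D.lift a n 1 = n := by
  have := D.lift_mon a n 0
  rw [mprod_zero] at this
  exact this

theorem mon_ind_le (j : ι) (T : ι →₀ ℕ) (hT : ∀ k, T k ≠ 0 → j ≤ k) (i : ι) (hi : j ≤ i) :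
    ∀ k, (T + Finsupp.single i 1 : ι →₀ ℕ) k ≠ 0 → j ≤ k := by
  intro k hk
  by_cases hT0 : T k = 0
  · have h2 : (Finsupp.single i 1 : ι →₀ ℕ) k ≠ 0 := by
      intro h3; apply hk; rw [Finsupp.add_apply, hT0, h3]
    rw [Finsupp.single_apply] at h2
    simp only [ne_eq, ite_eq_right_iff, one_ne_zero, imp_false, not_not] at h2
    rw [← h2]; exact hi
  · exact hT k hT0

theorem exists_split (m : ι →₀ ℕ) (h : m ≠ 0) : 
    ∃ (j : ι) (T : ι →₀ ℕ), (∀ k, T k ≠ 0 → j ≤ k) ∧ T.degree + 1 = m.degree ∧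
        T + Finsupp.single j 1 = m := by
  refine ⟨mn m h, m - Finsupp.single (mn m h) 1, ?_, mn_degree m h, mn_add m h⟩
  intro k hk
  apply mn_le
  intro h0; apply hk; simp [h0]

/-- induction over monomials -/
theorem mon_ind {P : (ι →₀ ℕ) → Prop} (h0 : P 0)
    (hs : ∀ j T, (∀ k, T k ≠ 0 → j ≤ k) → P T → P (T + Finsupp.single j 1)) : ∀ m, P m := by
  intro m
  induction hn : m.degree using Nat.strong_induction_on generalizing m with
  | _ n ih =>
    by_cases h : m = 0
    · rw [h]; exact h0
    · obtain ⟨j, T, hT, hd, rfl⟩ := exists_split m h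
      exact hs j T hT (ih T.degree (by omega) T rfl)

variable [Module ℂ N] [IsScalarTower ℂ R N]

theorem lift_act (a : L →ₗ[ℂ] (N →ₗ[R] N)) (ha : ∀ x y n, a ⁅x, y⁆ n = a x (a y n) - a y (a x n))
    (n : N) (hn : ∀ x, D.c x = 0 → a x n = D.chi x • n) (x : L) (p : MvPolynomial ι R) :
    D.lift a n (D.act x p) = a x (D.lift a n p) := by
  have hf : ∀ i m, (∀ k, m k ≠ 0 → i ≤ k) →
      D.lift a n (D.act (D.f i) (monomial m 1)) = a (D.f i) (D.lift a n (monomial m 1)) := by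
    intro i m h
    rw [D.act_f i m h, lift_mon, lift_mon, mprod_add _ _ _ _ _ h]
  have red : ∀ (s : Finset ι) (T : ι →₀ ℕ), (∀ j ∈ s, ∀ k, T k ≠ 0 → j ≤ k) →
     ∀ x x' : L, x = x' + ∑ i ∈ s, D.c x i • D.f i →
     D.lift a n (D.act x' (monomial T 1)) = a x' (D.lift a n (monomial T 1)) →
     D.lift a n (D.act x (monomial T 1)) = a x (D.lift a n (monomial T 1)) := by
    intro s T hs x x' hx h
    rw [hx]
    simp only [map_add, LinearMap.add_apply, h, map_sum, LinearMap.sum_apply, map_smul]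
    congr 1
    refine Finset.sum_congr rfl fun i hi => ?_
    simp only [LinearMap.smul_apply]
    rw [← hf i T (hs i hi)]
    exact map_smul ((D.lift a n).restrictScalars ℂ) _ _
  have key : ∀ (d : ℕ) (x : L) (p : MvPolynomial ι R), p ∈ fil ι R d →
      D.lift a n (D.act x p) = a x (D.lift a n p) := by
    intro d
    induction d with
    | zero =>
      intro x p hp
      refine fil_ind hp (LinearMap.eqLocus (D.lift a n ∘ₗ D.act x) (a x ∘ₗ D.lift a n)) ?_
      intro m hm
      have : m = 0 := (Finsupp.degree_eq_zero_iff m).1 (Nat.le_zero.1 hm)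
      subst this
      rw [LinearMap.mem_eqLocus, LinearMap.comp_apply, LinearMap.comp_apply]
      have h0 : D.c (x - ∑ i, D.c x i • D.f i) = 0 := by
        ext k
        simp [D.c_f, Finset.sum_apply]
      refine red Finset.univ 0 (by simp) x (x - ∑ i, D.c x i • D.f i) (by abel) ?_
      generalize (x - ∑ i, D.c x i • D.f i) = x' at *
      have h1 : (monomial 0 1 : MvPolynomial ι R) = 1 := rfl
      have hs : D.sym x' = 0 := by simp [sym, h0]
      rw [h1, act_one, lift_one, hs, zero_add, hn x' h0]
      have : (C (D.chi x') : MvPolynomial ι R) = D.chi x' • 1 := by rw [smul_eq_C_mul, mul_one]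
      rw [this, map_smul, lift_one]
    | succ d ih =>
      intro x p hp
      refine fil_ind hp (LinearMap.eqLocus (D.lift a n ∘ₗ D.act x) (a x ∘ₗ D.lift a n)) ?_
      intro m hm
      rw [LinearMap.mem_eqLocus, LinearMap.comp_apply, LinearMap.comp_apply]
      by_cases h : m = 0
      · subst h; exact ih x _ (mon_mem_fil (by simp))
      obtain ⟨j, T, hT, hd, rfl⟩ := exists_split m h
      have hTT := mon_ind_le j T hT j le_rfl
      refine red (Finset.univ.filter (· ≤ j)) _ ?_ x (D.cut j x) (D.cut_eq j x) ?_
      · intro i hi k hk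
        exact (by simpa using hi : i ≤ j).trans (hTT k hk)
      have cx : ∀ i ≤ j, D.c (D.cut j x) i = 0 := fun i hi => by rw [c_cut, if_pos hi]
      generalize D.cut j x = x' at *
      have hTm : (monomial T 1 : MvPolynomial ι R) ∈ fil ι R d := mon_mem_fil (by omega)
      rw [D.act_mon x' j T hT cx, map_add, ih _ _ hTm]
      have e1 : D.lift a n (D.act (D.f j) (D.act x' (monomial T 1))) =
          a (D.f j) (D.lift a n (D.act x' (monomial T 1))) := by
        rw [D.act_apply x', map_add, map_add, ih _ _ (D.r_mem x' hTm), map_add, map_add]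
        congr 1
        rw [sym, Finset.sum_mul]
        simp only [map_sum]
        refine Finset.sum_congr rfl fun i _ => ?_
        by_cases hij : i ≤ j
        · rw [cx i hij]; simp
        · rw [smul_mul_assoc, X_mul_mon]
          have l1 := map_smul ((D.lift a n ∘ₗ D.act (D.f j)).restrictScalars ℂ) (D.c x' i)
            (monomial (T + Finsupp.single i 1) 1)
          have l2 := map_smul ((a (D.f j) ∘ₗ D.lift a n).restrictScalars ℂ) (D.c x' i)
            (monomial (T + Finsupp.single i 1) 1)
          simp only [LinearMap.coe_restrictScalars, LinearMap.comp_apply] at l1 l2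
          rw [l1, l2, hf j]
          exact mon_ind_le j T hT i (not_le.1 hij).le
      rw [e1, ih _ _ hTm, lift_mon, lift_mon, mprod_add _ _ _ _ _ hT, ha]
      abel
  obtain ⟨d, hd⟩ := exists_mem_fil p
  exact key d x p hd

end univ

/-- induction on generated submodule -/
theorem mem_of_one (S : Submodule R (MvPolynomial ι R)) (h1 : (1 : MvPolynomial ι R) ∈ S)
    (hf : ∀ i, ∀ p ∈ S, D.act (D.f i) p ∈ S) (p : MvPolynomial ι R) : p ∈ S := by
  obtain ⟨n, hn⟩ := exists_mem_fil p
  refine fil_ind hn S fun m hm => ?_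
  clear hm
  induction m using mon_ind with
  | h0 => exact h1
  | hs j T hT ih => rw [← D.act_f j T hT]; exact hf j _ ih

theorem act_f_sub_mem {n : ℕ} {p : MvPolynomial ι R} (i : ι) (hp : p ∈ fil ι R n) :
    D.act (D.f i) p - X i * p ∈ fil ι R n := by
  rw [act_apply, sym_f, add_sub_cancel_left]; exact D.r_mem _ hp

end IndData
end Vrm


set_option linter.unusedSectionVars false
set_option linter.unusedSimpArgs false

namespace Vrm
open MvPolynomial

/-- triangular decomposition data. -/
structure TriData (ι : Type) [Fintype ι] (L : Type*) [LieRing L] [LieAlgebra ℂ L]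
    (H : Type*) [AddCommGroup H] [Module ℂ H] where
  hh : H →ₗ[ℂ] L
  e : ι → L
  f : ι → L
  c : L →ₗ[ℂ] (ι → ℂ)
  d : L →ₗ[ℂ] (ι → ℂ)
  pH : L →ₗ[ℂ] H
  wt : ι → Module.Dual ℂ H
  co : ι → H
  hz : H
  ht : ι → ℕ
  decomp : ∀ x, x = ∑ i, c x i • f i + hh (pH x) + ∑ i, d x i • e i
  c_f : ∀ i, c (f i) = fun k => open Classical in if k = i then 1 else 0
  d_e : ∀ i, d (e i) = fun k => open Classical in if k = i then 1 else 0
  c_h : ∀ h, c (hh h) = 0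
  d_h : ∀ h, d (hh h) = 0
  c_e : ∀ i, c (e i) = 0
  d_f : ∀ i, d (f i) = 0
  pH_h : ∀ h, pH (hh h) = h
  pH_e : ∀ i, pH (e i) = 0
  pH_f : ∀ i, pH (f i) = 0
  hh_lie : ∀ h h', ⁅hh h, hh h'⁆ = 0
  h_e : ∀ h i, ⁅hh h, e i⁆ = wt i h • e i
  h_f : ∀ h i, ⁅hh h, f i⁆ = - (wt i h • f i)
  e_f : ∀ i, ⁅e i, f i⁆ = hh (co i)
  wt_co : ∀ i, wt i (co i) = 2
  ht_pos : ∀ i, 0 < ht i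
  wt_hz : ∀ i, wt i hz = ht i
  wt_inj : Function.Injective wt

variable {ι : Type} [Fintype ι] [LinearOrder ι] {L : Type*} [LieRing L] [LieAlgebra ℂ L]
    {H : Type*} [AddCommGroup H] [Module ℂ H]
    {R : Type*} [CommRing R] [Algebra ℂ R]

namespace TriData
variable (T : TriData ι L H)

/-- opposite -/
def op : TriData ι L H where
  hh := T.hh
  e := T.f
  f := T.e
  c := T.d
  d := T.c
  pH := T.pH
  wt i := - T.wt i
  co i := - T.co i
  hz := - T.hz
  ht := T.ht
  decomp x := by
    conv_lhs => rw [T.decomp x]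
    abel
  c_f := T.d_e
  d_e := T.c_f
  c_h := T.d_h
  d_h := T.c_h
  c_e := T.d_f
  d_f := T.c_e
  pH_h := T.pH_h
  pH_e := T.pH_f
  pH_f := T.pH_e
  hh_lie := T.hh_lie
  h_e h i := by rw [T.h_f]; simp
  h_f h i := by rw [T.h_e]; simp
  e_f i := by rw [← lie_skew, T.e_f]; simp
  wt_co i := by simp [T.wt_co]
  ht_pos := T.ht_pos
  wt_hz i := by simp [T.wt_hz]
  wt_inj i j h := T.wt_inj (neg_injective h)

/-- `x` has weight `g` -/
def IsW (g : Module.Dual ℂ H) (x : L) : Prop := ∀ h, ⁅T.hh h, x⁆ = g h • x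

theorem lie_decomp (h : H) (x : L) : ⁅T.hh h, x⁆ =
    ∑ i, (- (T.wt i h * T.c x i)) • T.f i + ∑ i, (T.wt i h * T.d x i) • T.e i := by
  conv_lhs => rw [T.decomp x]
  simp only [lie_add, lie_sum, lie_smul, T.h_f, T.h_e, T.hh_lie, add_zero]
  congr 1
  · refine Finset.sum_congr rfl fun i _ => ?_
    rw [smul_neg, smul_smul, neg_smul, mul_comm]
  · refine Finset.sum_congr rfl fun i _ => ?_
    rw [smul_smul, mul_comm]

theorem c_lie_h (h : H) (x : L) (i : ι) : T.c ⁅T.hh h, x⁆ i = - (T.wt i h * T.c x i) := by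
  rw [lie_decomp]
  simp [T.c_f, T.c_e, Finset.sum_apply]

theorem d_lie_h (h : H) (x : L) (i : ι) : T.d ⁅T.hh h, x⁆ i = T.wt i h * T.d x i := by
  rw [lie_decomp]
  simp [T.d_e, T.d_f, Finset.sum_apply]

theorem pH_lie_h (h : H) (x : L) : T.pH ⁅T.hh h, x⁆ = 0 := by
  rw [lie_decomp]
  simp [T.pH_e, T.pH_f]

theorem IsW.lie {T : TriData ι L H} {g g' : Module.Dual ℂ H} {x y : L} (hx : T.IsW g x)
    (hy : T.IsW g' y) : T.IsW (g + g') ⁅x, y⁆ := by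
  intro h
  rw [leibniz_lie, hx h, hy h, smul_lie, lie_smul, LinearMap.add_apply, add_smul]

theorem isW_e (i : ι) : T.IsW (T.wt i) (T.e i) := fun h => T.h_e h i
theorem isW_f (i : ι) : T.IsW (- T.wt i) (T.f i) := fun h => by rw [T.h_f h i]; simp
theorem isW_h (h : H) : T.IsW 0 (T.hh h) := fun h' => by rw [T.hh_lie]; simp

theorem IsW.c_eq {T : TriData ι L H} {g : Module.Dual ℂ H} {x : L} (hx : T.IsW g x) {i : ι}
    (h : T.c x i ≠ 0) : g = - T.wt i := by
  ext h'
  have := T.c_lie_h h' x i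
  rw [hx h', map_smul, Pi.smul_apply, smul_eq_mul, ← neg_mul] at this
  simpa using mul_right_cancel₀ h this

theorem IsW.d_eq {T : TriData ι L H} {g : Module.Dual ℂ H} {x : L} (hx : T.IsW g x) {i : ι}
    (h : T.d x i ≠ 0) : g = T.wt i := by
  ext h'
  have := T.d_lie_h h' x i
  rw [hx h', map_smul, Pi.smul_apply, smul_eq_mul] at this
  simpa using mul_right_cancel₀ h this

theorem IsW.pH_eq {T : TriData ι L H} {g : Module.Dual ℂ H} {x : L} (hx : T.IsW g x)
    (h : T.pH x ≠ 0) : g = 0 := by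
  ext h'
  have := T.pH_lie_h h' x
  rw [hx h', map_smul, smul_eq_zero] at this
  simpa using this.resolve_right h

theorem c_pH_lie_e (i j : ι) : T.c ⁅T.e i, T.e j⁆ = 0 ∧ T.pH ⁅T.e i, T.e j⁆ = 0 := by
  have hw := (T.isW_e i).lie (T.isW_e j)
  constructor
  · ext k
    by_contra hk
    have := congrArg (fun g => g T.hz) (hw.c_eq hk)
    simp only [LinearMap.add_apply, LinearMap.neg_apply, T.wt_hz] at this
    have h3 : ((T.ht i + T.ht j + T.ht k : ℕ) : ℂ) = 0 := by push_cast; rw [this]; ring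
    have := T.ht_pos i
    norm_cast at h3; omega
  · by_contra hk
    have := congrArg (fun g => g T.hz) (hw.pH_eq hk)
    simp only [LinearMap.add_apply, LinearMap.zero_apply, T.wt_hz] at this
    have := T.ht_pos i
    norm_cast at *; omega

theorem borel_lie (x y : L) (hx : T.c x = 0) (hy : T.c y = 0) :
    T.c ⁅x, y⁆ = 0 ∧ T.pH ⁅x, y⁆ = 0 := by
  have key : ∀ i, T.c ⁅T.e i, y⁆ = 0 ∧ T.pH ⁅T.e i, y⁆ = 0 := by
    intro i
    rw [T.decomp y, hy]
    simp only [Pi.zero_apply, zero_smul, Finset.sum_const_zero, zero_add, lie_add, lie_sum,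
      lie_smul, map_add, map_sum, map_smul, (T.c_pH_lie_e i _).1, (T.c_pH_lie_e i _).2, smul_zero,
      add_zero]
    rw [← lie_skew, T.h_e]
    simp [T.c_e, T.pH_e]
  rw [T.decomp x, hx]
  simp only [Pi.zero_apply, zero_smul, Finset.sum_const_zero, zero_add, add_lie, sum_lie,
      smul_lie, map_add, map_sum, map_smul, (key _).1, (key _).2, smul_zero, add_zero]
  refine ⟨?_, T.pH_lie_h _ _⟩
  ext k
  rw [c_lie_h, hy]; simp

/-- induction data for a character -/
noncomputable def ind (χ : H →ₗ[ℂ] R) : IndData ι L R where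
  c := T.c
  f := T.f
  chi := χ ∘ₗ T.pH
  c_f := T.c_f
  chi_f i := by simp [T.pH_f]
  c_lie x y hx hy := (T.borel_lie x y hx hy).1
  chi_lie x y hx hy := by simp [(T.borel_lie x y hx hy).2]

@[simp] theorem ind_f (χ : H →ₗ[ℂ] R) : (T.ind χ).f = T.f := rfl
@[simp] theorem ind_c (χ : H →ₗ[ℂ] R) : (T.ind χ).c = T.c := rfl
@[simp] theorem ind_chi (χ : H →ₗ[ℂ] R) (x : L) : (T.ind χ).chi x = χ (T.pH x) := rfl

/-- the action on the Verma module -/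
noncomputable abbrev act (χ : H →ₗ[ℂ] R) := (T.ind χ).act

/-- weight of a monomial -/
noncomputable def wm : (ι →₀ ℕ) →+ Module.Dual ℂ H :=
  Finsupp.liftAddHom (fun i => (multiplesHom _) (T.wt i))

theorem wm_single (i : ι) : T.wm (Finsupp.single i 1) = T.wt i := by
  simp [wm]

/-- height of a monomial -/
noncomputable def hm : (ι →₀ ℕ) →+ ℕ :=
  Finsupp.liftAddHom (fun i => (multiplesHom _) (T.ht i))

theorem hm_single (i : ι) : T.hm (Finsupp.single i 1) = T.ht i := by
  simp [hm]

theorem wm_op (m : ι →₀ ℕ) : T.op.wm m = - T.wm m := by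
  induction m using IndData.mon_ind with
  | h0 => simp
  | hs j S hS ih => rw [map_add, map_add, wm_single, wm_single, ih, neg_add]; rfl

theorem wm_hz (m : ι →₀ ℕ) : T.wm m T.hz = T.hm m := by
  induction m using IndData.mon_ind with
  | h0 => simp
  | hs j S hS ih =>
    rw [map_add, map_add, wm_single, hm_single, LinearMap.add_apply, ih, T.wt_hz, Nat.cast_add]

theorem le_hm (m : ι →₀ ℕ) (i : ι) : m i ≤ T.hm m := by
  have : m = (m - Finsupp.single i (m i)) + Finsupp.single i (m i) := by
    rw [tsub_add_cancel_of_le]; simp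
  conv_rhs => rw [this]
  rw [map_add]
  have h2 : T.hm (Finsupp.single i (m i)) = m i * T.ht i := by simp [hm]
  have := T.ht_pos i
  rw [h2]; nlinarith

theorem hm_zero {m : ι →₀ ℕ} (h : T.hm m = 0) : m = 0 := by
  ext i
  have := T.le_hm m i
  simp; omega

theorem wm_eq_zero {m : ι →₀ ℕ} (h : T.wm m = 0) : m = 0 := by
  apply T.hm_zero
  have := T.wm_hz m
  rw [h] at this
  simpa using this.symm

theorem idx_finite (θ : Module.Dual ℂ H) : {m : ι →₀ ℕ | T.wm m = θ}.Finite := by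
  by_cases h : ∃ m0, T.wm m0 = θ
  · obtain ⟨m0, h0⟩ := h
    apply Set.Finite.subset (Set.finite_Iic (Finsupp.equivFunOnFinite.symm (fun _ : ι => T.hm m0)))
    intro m hm i
    have : T.hm m = T.hm m0 := by
      have h1 := T.wm_hz m
      have h2 := T.wm_hz m0
      rw [Set.mem_ofPred_eq] at hm
      rw [hm, ← h0] at h1
      rw [h1] at h2
      exact_mod_cast h2
    simpa [← this] using T.le_hm m i
  · convert Set.finite_empty
    ext m
    simp only [Set.mem_ofPred_eq, Set.mem_empty_iff_false, iff_false]
    exact fun hh => h ⟨m, hh⟩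

/-- index set of Kostant partitions -/
noncomputable def idx (θ : Module.Dual ℂ H) : Finset (ι →₀ ℕ) := (T.idx_finite θ).toFinset

theorem mem_idx {θ : Module.Dual ℂ H} {m : ι →₀ ℕ} : m ∈ T.idx θ ↔ T.wm m = θ := by
  simp [idx]

theorem act_h (χ : H →ₗ[ℂ] R) (h : H) (m : ι →₀ ℕ) :
    T.act χ (T.hh h) (monomial m 1) = (χ h - algebraMap ℂ R (T.wm m h)) • monomial m 1 := by
  induction m using IndData.mon_ind with
  | h0 =>
    have := (T.ind χ).act_one (T.hh h)
    have h1 : (monomial 0 1 : MvPolynomial ι R) = 1 := rfl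
    rw [h1, act, this]
    simp [IndData.sym, T.c_h, T.pH_h, smul_eq_C_mul]
  | hs j S hS ih =>
    rw [act, (T.ind χ).act_mon (T.hh h) j S hS (by simp [T.c_h])]
    rw [act] at ih
    rw [ih, map_smul, (T.ind χ).act_f j S hS]
    simp only [ind_f]
    rw [T.h_f, map_neg, map_smul, LinearMap.neg_apply, LinearMap.smul_apply]
    have := (T.ind χ).act_f j S hS
    simp only [ind_f] at this
    rw [this, map_add, wm_single, LinearMap.add_apply, map_add, ← algebraMap_smul R (T.wt j h),
      ← neg_smul, ← add_smul]
    congr 1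
    ring

/-- weight space of depth `θ` -/
def vw (θ : Module.Dual ℂ H) : Submodule R (MvPolynomial ι R) where
  carrier := {p | ∀ m, coeff m p ≠ 0 → T.wm m = θ}
  zero_mem' := by simp
  add_mem' {a b} ha hb m hm := by
    rw [coeff_add] at hm
    by_cases h : coeff m a = 0
    · rw [h, zero_add] at hm; exact hb m hm
    · exact ha m h
  smul_mem' r a ha m hm := by
    apply ha m
    intro h0
    rw [coeff_smul, h0, smul_zero] at hm
    exact hm rfl

theorem coeff_act_h (χ : H →ₗ[ℂ] R) (h : H) (p : MvPolynomial ι R) (m : ι →₀ ℕ) :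
    coeff m (T.act χ (T.hh h) p) = (χ h - algebraMap ℂ R (T.wm m h)) * coeff m p := by
  induction p using MvPolynomial.induction_on' with
  | monomial u a =>
    have : monomial u a = a • (monomial u 1 : MvPolynomial ι R) := by simp [smul_monomial]
    rw [this, map_smul, act_h, coeff_smul, coeff_smul, coeff_smul, coeff_monomial]
    split_ifs with hu
    · subst hu; simp [mul_comm]
    · simp
  | add p q hp hq => rw [map_add, coeff_add, coeff_add, hp, hq, mul_add]

theorem mem_vw_iff (χ : H →ₗ[ℂ] R) (θ : Module.Dual ℂ H) (p : MvPolynomial ι R) :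
    p ∈ T.vw θ ↔ ∀ h, T.act χ (T.hh h) p = (χ h - algebraMap ℂ R (θ h)) • p := by
  constructor
  · intro hp h
    ext m
    rw [coeff_act_h, coeff_smul, smul_eq_mul]
    by_cases h0 : coeff m p = 0
    · rw [h0, mul_zero, mul_zero]
    · rw [hp m h0]
  · intro hp m hm
    ext h
    have h1 := congrArg (coeff m) (hp h)
    rw [coeff_act_h, coeff_smul, smul_eq_mul, ← sub_eq_zero, ← sub_mul, sub_sub_sub_cancel_left,
      ← map_sub, ← Algebra.smul_def, smul_eq_zero] at h1
    exact (sub_eq_zero.1 (h1.resolve_right hm)).symm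

theorem mon_mem_vw (m : ι →₀ ℕ) : (monomial m 1 : MvPolynomial ι R) ∈ T.vw (T.wm m) := by
  intro m' hm'
  rw [coeff_monomial] at hm'
  by_contra h
  exact hm' (if_neg (by rintro rfl; exact h rfl))

theorem act_mem_vw (χ : H →ₗ[ℂ] R) {γ θ : Module.Dual ℂ H} {x : L} (hx : T.IsW γ x)
    {p : MvPolynomial ι R} (hp : p ∈ T.vw θ) : T.act χ x p ∈ T.vw (θ - γ) := by
  rw [mem_vw_iff T χ] at hp ⊢
  intro h
  have := (T.ind χ).act_lie (T.hh h) x p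
  rw [hx h, map_smul, LinearMap.smul_apply] at this
  rw [eq_sub_iff_add_eq] at this
  rw [act, ← this]
  rw [act] at hp
  rw [hp h, map_smul, ← algebraMap_smul R (γ h), ← add_smul]
  congr 1
  rw [LinearMap.sub_apply, map_sub]; ring

theorem coeff_zero_act_f (χ : H →ₗ[ℂ] R) (i : ι) (p : MvPolynomial ι R) :
    coeff 0 (T.act χ (T.f i) p) = 0 := by
  induction p using MvPolynomial.induction_on' with
  | monomial u a =>
    have : monomial u a = a • (monomial u 1 : MvPolynomial ι R) := by simp [smul_monomial]
    rw [this, map_smul, coeff_smul]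
    have h2 := T.act_mem_vw χ (T.isW_f i) (T.mon_mem_vw (R := R) u)
    by_cases h3 : coeff 0 (T.act χ (T.f i) (monomial u 1)) = 0
    · rw [h3, smul_zero]
    · exfalso
      have h4 := congrArg (fun g => g T.hz) (h2 0 h3)
      simp only [map_zero, LinearMap.zero_apply, LinearMap.sub_apply, LinearMap.neg_apply, T.wt_hz,
        T.wm_hz, sub_neg_eq_add, LinearMap.add_apply] at h4
      have := T.ht_pos i
      rw [← Nat.cast_add] at h4
      have h5 := h4.symm
      rw [Nat.cast_eq_zero] at h5; omega
  | add p q hp hq => rw [map_add, coeff_add, hp, hq, add_zero]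

/-- action on the dual -/
noncomputable def dact (χ : H →ₗ[ℂ] R) :
    L →ₗ[ℂ] (Module.Dual R (MvPolynomial ι R) →ₗ[R] Module.Dual R (MvPolynomial ι R)) where
  toFun x := - Module.Dual.transpose (T.act χ x)
  map_add' x y := by
    refine LinearMap.ext fun φ => LinearMap.ext fun p => ?_
    simp [Module.Dual.transpose]; ring
  map_smul' a x := by
    refine LinearMap.ext fun φ => LinearMap.ext fun p => ?_
    have : φ (a • T.act χ x p) = a • φ (T.act χ x p) :=
      map_smul (φ.restrictScalars ℂ) _ _
    simp only [Module.Dual.transpose, map_smul, LinearMap.neg_apply, RingHom.id_apply,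
      LinearMap.flip_apply, LinearMap.llcomp_apply, LinearMap.smul_apply, this, smul_neg]

theorem dact_apply (χ : H →ₗ[ℂ] R) (x : L) (φ : Module.Dual R (MvPolynomial ι R))
    (p : MvPolynomial ι R) : T.dact χ x φ p = - φ (T.act χ x p) := rfl

/-- the invariant pairing -/
noncomputable def pair (χ : H →ₗ[ℂ] R) :
    MvPolynomial ι R →ₗ[R] MvPolynomial ι R →ₗ[R] R :=
  (T.op.ind (-χ)).lift (T.dact χ) (lcoeff R 0)

theorem pair_one (χ : H →ₗ[ℂ] R) (q : MvPolynomial ι R) : T.pair χ 1 q = coeff 0 q := by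
  rw [pair, IndData.lift_one]; rfl

theorem pair_act (χ : H →ₗ[ℂ] R) (x : L) (p q : MvPolynomial ι R) :
    T.pair χ (T.op.act (-χ) x p) q = - T.pair χ p (T.act χ x q) := by
  rw [pair, IndData.lift_act]
  · rfl
  · intro x y φ
    refine LinearMap.ext fun p => ?_
    simp only [dact_apply, LinearMap.sub_apply, neg_neg]
    rw [act, IndData.act_lie, map_sub]; ring
  · intro x hx
    refine LinearMap.ext fun p => ?_
    rw [dact_apply]
    have hx : T.d x = 0 := hx
    have : T.act χ x p = ∑ i, T.c x i • T.act χ (T.f i) p + T.act χ (T.hh (T.pH x)) p := by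
      conv_lhs => rw [T.decomp x, hx]
      simp [LinearMap.sum_apply]
    rw [this]
    rw [LinearMap.smul_apply, lcoeff_apply, lcoeff_apply, ind_chi]
    have hp : T.op.pH = T.pH := rfl
    rw [hp, coeff_add, coeff_sum, coeff_act_h]
    simp [coeff_smul, coeff_zero_act_f]

theorem pair_ne_zero (χ : H →ₗ[ℂ] R) {m m' : ι →₀ ℕ}
    (h : T.pair χ (monomial m 1) (monomial m' 1) ≠ 0) : T.wm m = T.wm m' := by
  ext x
  have h1 := T.pair_act χ (T.hh x) (monomial m 1) (monomial m' 1)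
  have h2 := T.op.act_h (-χ) x m
  rw [wm_op] at h2
  have h4 : T.op.hh = T.hh := rfl
  rw [h4] at h2
  rw [h2, act_h, map_smul, map_smul, LinearMap.smul_apply, smul_eq_mul, smul_eq_mul,
    ← sub_eq_zero, sub_neg_eq_add, ← add_mul] at h1
  have h3 : ((-χ) x - algebraMap ℂ R ((-T.wm m) x) + (χ x - algebraMap ℂ R (T.wm m' x))) =
    algebraMap ℂ R (T.wm m x - T.wm m' x) := by simp; ring
  rw [h3, ← Algebra.smul_def, smul_eq_zero] at h1
  exact sub_eq_zero.1 (h1.resolve_right h)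

theorem pair_ne_zero' (χ : H →ₗ[ℂ] R) {θ : Module.Dual ℂ H} {m : ι →₀ ℕ} {q : MvPolynomial ι R}
    (hq : q ∈ T.vw θ) (h : T.pair χ (monomial m 1) q ≠ 0) : T.wm m = θ := by
  have : q = ∑ m' ∈ q.support, coeff m' q • monomial m' 1 := by
    conv_lhs => rw [q.as_sum]
    refine Finset.sum_congr rfl fun i _ => ?_
    rw [smul_monomial]; simp
  rw [this, map_sum] at h
  obtain ⟨m', hm', h2⟩ := Finset.exists_ne_zero_of_sum_ne_zero h
  rw [map_smul] at h2
  rw [T.pair_ne_zero χ (right_ne_zero_of_smul h2)]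
  exact hq m' (mem_support_iff.1 hm')

/-- Gram matrix -/
noncomputable def gram (χ : H →ₗ[ℂ] R) (θ : Module.Dual ℂ H) :
    Matrix (T.idx θ) (T.idx θ) R :=
  Matrix.of fun π m => T.pair χ (monomial π.1 1) (monomial m.1 1)

section basechange
variable {S : Type*} [CommRing S] [Algebra ℂ S] [Algebra R S] [IsScalarTower ℂ R S]

/-- base change of characters -/
noncomputable def bc (S : Type*) [CommRing S] [Algebra ℂ S] [Algebra R S] [IsScalarTower ℂ R S]
    (χ : H →ₗ[ℂ] R) : H →ₗ[ℂ] S :=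
  (IsScalarTower.toAlgHom ℂ R S).toLinearMap ∘ₗ χ

theorem bc_apply (χ : H →ₗ[ℂ] R) (h : H) : bc S χ h = algebraMap R S (χ h) := rfl

theorem map_act (χ : H →ₗ[ℂ] R) (x : L) (p : MvPolynomial ι R) :
    MvPolynomial.map (algebraMap R S) (T.act χ x p) =
      T.act (bc S χ) x (MvPolynomial.map (algebraMap R S) p) := by
  let a : L →ₗ[ℂ] (MvPolynomial ι S →ₗ[R] MvPolynomial ι S) :=
    { toFun := fun x => (T.act (bc S χ) x).restrictScalars R
      map_add' := fun x y => by ext; simp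
      map_smul' := fun r x => by ext; simp }
  have haa : ∀ x p, a x p = T.act (bc S χ) x p := fun x p => rfl
  have key : ∀ p, (T.ind χ).lift a 1 p = MvPolynomial.map (algebraMap R S) p := by
    have h1 : ∀ m, (T.ind χ).lift a 1 (monomial m 1) = monomial m 1 := by
      intro m
      rw [IndData.lift_mon]
      induction m using IndData.mon_ind with
      | h0 => rw [IndData.mprod_zero]; rfl
      | hs j U hU ih =>
        rw [IndData.mprod_add _ _ _ _ _ hU, ih, haa]
        exact (T.ind (bc S χ)).act_f j U hU
    intro p
    induction p using MvPolynomial.induction_on' with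
    | monomial u a =>
      have : monomial u a = a • (monomial u 1 : MvPolynomial ι R) := by simp [smul_monomial]
      rw [this, map_smul, h1, ← this, map_monomial, Algebra.smul_def, MvPolynomial.algebraMap_apply,
        C_mul_monomial, mul_one]
    | add p q hp hq => rw [map_add, map_add, hp, hq]
  rw [← key, ← key, IndData.lift_act, haa]
  · intro x y n
    simp only [haa]
    rw [act, IndData.act_lie]
  · intro x hx
    rw [haa, act, IndData.act_one]
    have hx : T.c x = 0 := hx
    simp [IndData.sym, hx, bc_apply, Algebra.smul_def, MvPolynomial.algebraMap_apply]

theorem bc_neg (χ : H →ₗ[ℂ] R) : bc S (-χ) = - bc S χ := by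
  ext h; simp [bc_apply]

theorem map_pair (χ : H →ₗ[ℂ] R) (p q : MvPolynomial ι R) :
    algebraMap R S (T.pair χ p q) = T.pair (bc S χ) (MvPolynomial.map (algebraMap R S) p)
      (MvPolynomial.map (algebraMap R S) q) := by
  let P : Submodule R (MvPolynomial ι R) :=
    { carrier := {p | ∀ q, algebraMap R S (T.pair χ p q) =
        T.pair (bc S χ) (MvPolynomial.map (algebraMap R S) p) (MvPolynomial.map (algebraMap R S) q)}
      zero_mem' := by intro q; simp
      add_mem' := by
        intro a b ha hb q
        rw [map_add, LinearMap.add_apply, map_add, ha q, hb q, map_add, map_add, LinearMap.add_apply]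
      smul_mem' := by
        intro r a ha q
        rw [map_smul, LinearMap.smul_apply, smul_eq_mul, map_mul, ha q, smul_eq_C_mul, map_mul,
          map_C, ← smul_eq_C_mul, map_smul, LinearMap.smul_apply, smul_eq_mul] }
  have : p ∈ P := by
    apply (T.op.ind (-χ)).mem_of_one P
    · intro q
      rw [pair_one, map_one, pair_one, coeff_map]
    · intro i p hp q
      have h1 := T.pair_act χ (T.op.f i) p q
      have h2 := T.op.map_act (S := S) (-χ) (T.op.f i) p
      rw [bc_neg] at h2
      rw [act] at h1 h2
      rw [ind_f, h1, h2, pair_act, map_neg, hp, map_act]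
  exact this q

theorem map_gram (χ : H →ₗ[ℂ] R) (θ : Module.Dual ℂ H) :
    (T.gram χ θ).map (algebraMap R S) = T.gram (bc S χ) θ := by
  ext π m
  simp [gram, map_pair (S := S)]

end basechange

end TriData
end Vrm


set_option linter.unusedSectionVars false
set_option linter.unusedSimpArgs false

namespace Vrm
open MvPolynomial

variable {ι : Type} [Fintype ι] [LinearOrder ι] {L : Type*} [LieRing L] [LieAlgebra ℂ L]
    {H : Type*} [AddCommGroup H] [Module ℂ H]

/-- the linear family of characters -/
noncomputable def linf (lam zt : Module.Dual ℂ H) : H →ₗ[ℂ] Polynomial ℂ where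
  toFun h := Polynomial.C (lam h) + Polynomial.C (zt h) * Polynomial.X
  map_add' x y := by simp; ring
  map_smul' a x := by simp [Polynomial.smul_eq_C_mul]; ring

/-- filtration -/
def ff (ι : Type) (d : ℕ) : Submodule ℂ (MvPolynomial ι (Polynomial ℂ)) where
  carrier := {w | ∀ k (m : ι →₀ ℕ), d < 2 * k + m.degree → (coeff m w).coeff k = 0}
  zero_mem' := by simp
  add_mem' {a b} ha hb k m h := by rw [coeff_add, Polynomial.coeff_add, ha k m h, hb k m h, add_zero]
  smul_mem' r a ha k m h := by rw [coeff_smul, Polynomial.coeff_smul, ha k m h, smul_zero]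

theorem ff_mono {d d' : ℕ} (h : d ≤ d') : ff ι d ≤ ff ι d' :=
  fun w hw k m hk => hw k m (h.trans_lt hk)

theorem ff_smul {d a b : ℕ} (r : Polynomial ℂ) (hr : ∀ k, d < 2 * k + a → r.coeff k = 0)
    {w : MvPolynomial ι (Polynomial ℂ)} (hw : w ∈ ff ι (a + b)) : r • w ∈ ff ι (d + b) := by
  intro k m hk
  rw [coeff_smul, smul_eq_mul, Polynomial.coeff_mul]
  apply Finset.sum_eq_zero
  rintro ⟨i, j⟩ hij
  rw [Finset.HasAntidiagonal.mem_antidiagonal] at hij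
  simp only at hij ⊢
  by_cases h1 : d < 2 * i + a
  · rw [hr i h1, zero_mul]
  · rw [hw j m (by omega), mul_zero]

theorem ff_mon {m : ι →₀ ℕ} {d : ℕ} (h : m.degree ≤ d) : (monomial m 1) ∈ ff ι d := by
  intro k m' hk
  rw [coeff_monomial]
  split_ifs with hm
  · subst hm
    rw [Polynomial.coeff_one, if_neg (by omega)]
  · simp

theorem ff_X_mul {d : ℕ} (i : ι) {w : MvPolynomial ι (Polynomial ℂ)} (hw : w ∈ ff ι d) :
    X i * w ∈ ff ι (d + 1) := by
  intro k m hk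
  rw [mul_comm, coeff_mul_X']
  split_ifs with h
  · apply hw
    have : m = (m - Finsupp.single i 1) + Finsupp.single i 1 := by
      rw [tsub_add_cancel_of_le]
      rw [Finsupp.single_le_iff]
      exact Nat.one_le_iff_ne_zero.2 (Finsupp.mem_support_iff.1 h)
    have h2 := congrArg Finsupp.degree this
    rw [map_add, Finsupp.degree_single] at h2
    omega
  · simp

theorem ff_map {d s : ℕ} (A : MvPolynomial ι (Polynomial ℂ) →ₗ[Polynomial ℂ] MvPolynomial ι (Polynomial ℂ))
    (hA : ∀ m : ι →₀ ℕ, m.degree ≤ d → A (monomial m 1) ∈ ff ι (m.degree + s))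
    {w : MvPolynomial ι (Polynomial ℂ)} (hw : w ∈ ff ι d) : A w ∈ ff ι (d + s) := by
  have : w = ∑ m' ∈ w.support, coeff m' w • monomial m' 1 := by
    conv_lhs => rw [w.as_sum]
    refine Finset.sum_congr rfl fun i _ => ?_
    rw [smul_monomial]; simp
  rw [this, map_sum]
  refine Submodule.sum_mem _ fun m hm => ?_
  rw [map_smul]
  have hd : m.degree ≤ d := by
    by_contra hlt
    apply mem_support_iff.1 hm
    ext k
    rw [Polynomial.coeff_zero]
    exact hw k m (by omega)
  exact ff_smul (a := m.degree) _ (fun k hk => hw k m hk) (hA m hd)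

namespace TriData
variable (T : TriData ι L H) (lam zt : Module.Dual ℂ H)

theorem lead_f (n : ℕ) : ∀ (i : ι) (m : ι →₀ ℕ), m.degree ≤ n →
    T.act (linf lam zt) (T.f i) (monomial m 1) - X i * monomial m 1 ∈ ff ι m.degree := by
  induction n with
  | zero =>
    intro i m hm
    have : m = 0 := (Finsupp.degree_eq_zero_iff m).1 (Nat.le_zero.1 hm)
    subst this
    have := (T.ind (linf lam zt)).act_f i 0 (by simp)
    rw [IndData.X_mul_mon, act, ← this, ind_f, sub_self]
    exact Submodule.zero_mem _
  | succ n ih =>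
    intro i m hm
    by_cases h0 : m = 0
    · exact ih i m (by simp [h0])
    obtain ⟨j, U, hU, hd, rfl⟩ := IndData.exists_split m h0
    by_cases hij : i ≤ j
    · have := (T.ind (linf lam zt)).act_f i (U + Finsupp.single j 1)
        (fun k hk => hij.trans (IndData.mon_ind_le j U hU j le_rfl k hk))
      rw [IndData.X_mul_mon, act, ← this, ind_f, sub_self]
      exact Submodule.zero_mem _
    have hstep : ∀ k w, w ∈ ff ι U.degree → T.act (linf lam zt) (T.f k) w ∈ ff ι (U.degree + 1) := by
      intro k w hw
      refine ff_map (T.act (linf lam zt) (T.f k)) ?_ hw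
      intro m' hm'
      have h1 := ff_mono (Nat.le_succ _) (ih k m' (by omega))
      have h2 := ff_X_mul k (ff_mon (ι := ι) (m := m') le_rfl)
      have := Submodule.add_mem _ h1 h2
      rwa [sub_add_cancel] at this
    rw [act, (T.ind (linf lam zt)).act_mon (T.f i) j U hU, ind_f]
    · have h1 := hstep j _ (ih i U (by omega))
      rw [map_sub, IndData.X_mul_mon] at h1
      have h3 := (T.ind (linf lam zt)).act_f j (U + Finsupp.single i 1)
        (IndData.mon_ind_le j U hU i (not_le.1 hij).le)
      rw [ind_f] at h3
      rw [act, h3] at h1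
      have h2 : T.act (linf lam zt) ⁅T.f i, T.f j⁆ (monomial U 1) ∈ ff ι (U.degree + 1) := by
        have hb := T.op.c_pH_lie_e i j
        have e1 : T.d ⁅T.f i, T.f j⁆ = 0 := hb.1
        have e2 : T.pH ⁅T.f i, T.f j⁆ = 0 := hb.2
        rw [T.decomp ⁅T.f i, T.f j⁆, e1, e2]
        simp only [Pi.zero_apply, zero_smul, Finset.sum_const_zero, add_zero, map_zero, map_sum,
          map_smul, LinearMap.sum_apply, LinearMap.smul_apply]
        exact Submodule.sum_mem _ fun k _ => Submodule.smul_mem _ _ (hstep k _ (ff_mon le_rfl))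
      rw [IndData.X_mul_mon, ← hd, add_right_comm]
      have := Submodule.add_mem _ h1 h2
      rw [sub_add_eq_add_sub] at this
      exact this
    · intro k hk
      rw [ind_c, T.c_f]
      exact if_neg (fun (h : k = i) => hij (h ▸ hk))

theorem act_f_ff {d : ℕ} (i : ι) {w : MvPolynomial ι (Polynomial ℂ)} (hw : w ∈ ff ι d) :
    T.act (linf lam zt) (T.f i) w ∈ ff ι (d + 1) := by
  refine ff_map (T.act (linf lam zt) (T.f i)) ?_ hw
  intro m' hm'
  have h1 := ff_mono (Nat.le_succ _) (T.lead_f lam zt m'.degree i m' le_rfl)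
  have h2 := ff_X_mul i (ff_mon (ι := ι) (m := m') le_rfl)
  have := Submodule.add_mem _ h1 h2
  rwa [sub_add_cancel] at this

/-- leading part of `e_j` -/
noncomputable def le (j : ι) (m : ι →₀ ℕ) : MvPolynomial ι (Polynomial ℂ) :=
  (Polynomial.C (zt (T.co j) * m j) * Polynomial.X) • monomial (m - Finsupp.single j 1) 1

theorem t_smul_ff {d : ℕ} (a : ℂ) {w : MvPolynomial ι (Polynomial ℂ)} (hw : w ∈ ff ι d) :
    (Polynomial.C a * Polynomial.X : Polynomial ℂ) • w ∈ ff ι (d + 2) := by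
  have := ff_smul (a := 0) (b := d) (d := 2) (Polynomial.C a * Polynomial.X) ?_ (w := w) (by simpa using hw)
  · rwa [add_comm] at this
  · intro k hk
    rw [Polynomial.coeff_C_mul, Polynomial.coeff_X, if_neg (by omega), mul_zero]

theorem deg_sub (j : ι) (m : ι →₀ ℕ) (h : m j ≠ 0) :
    (m - Finsupp.single j 1) + Finsupp.single j 1 = m ∧ (m - Finsupp.single j 1).degree + 1 = m.degree := by
  have : (m - Finsupp.single j 1) + Finsupp.single j 1 = m := by
    rw [tsub_add_cancel_of_le]
    rw [Finsupp.single_le_iff]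
    exact Nat.one_le_iff_ne_zero.2 h
  have h2 := congrArg Finsupp.degree this
  rw [map_add, Finsupp.degree_single] at h2
  exact ⟨this, h2⟩

theorem le_mem (j : ι) (m : ι →₀ ℕ) : T.le zt j m ∈ ff ι (m.degree + 1) := by
  by_cases h : m j = 0
  · simp [le, h]
  · have h2 := t_smul_ff (zt (T.co j) * m j) (ff_mon (ι := ι) (m := m - Finsupp.single j 1) le_rfl)
    refine ff_mono ?_ h2
    have := (deg_sub j m h).2
    omega

theorem lead_e (m : ι →₀ ℕ) : ∀ j : ι,
    T.act (linf lam zt) (T.e j) (monomial m 1) - T.le zt j m ∈ ff ι m.degree := by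
  induction m using IndData.mon_ind with
  | h0 =>
    intro j
    have h1 : (monomial 0 1 : MvPolynomial ι (Polynomial ℂ)) = 1 := rfl
    rw [h1, act, IndData.act_one]
    simp [le, T.c_e, T.pH_e, IndData.sym]
  | hs i U hU ih =>
    intro j
    rw [act, (T.ind (linf lam zt)).act_mon (T.e j) i U hU (by simp [T.c_e]), ind_f, map_add,
      Finsupp.degree_single]
    -- first term
    have h1 := T.act_f_ff lam zt i (ih j)
    rw [map_sub] at h1
    have h2 : T.act (linf lam zt) (T.f i) (T.le zt j U) - X i * T.le zt j U ∈ ff ι (U.degree + 1) := by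
      by_cases h : U j = 0
      · simp [le, h]
      · have h2 := t_smul_ff (zt (T.co j) * U j)
          (T.lead_f lam zt (U - Finsupp.single j 1).degree i (U - Finsupp.single j 1) le_rfl)
        rw [smul_sub] at h2
        have := (deg_sub j U h).2
        rw [le, map_smul, mul_smul_comm]
        refine ff_mono ?_ h2
        omega
    have h3 : ∃ w ∈ ff ι (U.degree + 1), T.act (linf lam zt) ⁅T.e j, T.f i⁆ (monomial U 1) = 
       w + (T.le zt j (U + Finsupp.single i 1) - X i * T.le zt j U) := by
      have e5 : ∀ k, T.act (linf lam zt) (T.e k) (monomial U 1) ∈ ff ι (U.degree + 1) := by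
        intro k
        have := Submodule.add_mem _ (ff_mono (Nat.le_succ _) (ih k)) (T.le_mem zt k U)
        rwa [sub_add_cancel] at this
      by_cases hij : i = j
      · subst hij
        rw [T.e_f, act_h]
        refine ⟨(Polynomial.C (lam (T.co i) - T.wm U (T.co i))) • monomial U 1, ?_, ?_⟩
        · rw [← Polynomial.algebraMap_eq, algebraMap_smul]
          exact Submodule.smul_mem _ _ (ff_mon (Nat.le_succ _))
        · have : T.le zt i (U + Finsupp.single i 1) - X i * T.le zt i U =
             (Polynomial.C (zt (T.co i)) * Polynomial.X) • monomial U 1 := by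
            rw [le, le, add_tsub_cancel_right, mul_smul_comm, IndData.X_mul_mon]
            by_cases h : U i = 0
            · simp [h]
            · rw [(deg_sub i U h).1, ← sub_smul]
              congr 1
              simp; ring
          rw [this, ← add_smul]
          congr 1
          simp [linf]; ring
      · have e1 : T.pH ⁅T.e j, T.f i⁆ = 0 := by
          by_contra hne
          have := ((T.isW_e j).lie (T.isW_f i)).pH_eq hne
          rw [← sub_eq_add_neg, sub_eq_zero] at this
          exact hij (T.wt_inj this).symm
        have e2 : T.le zt j (U + Finsupp.single i 1) - X i * T.le zt j U = 0 := by
          rw [le, le, mul_smul_comm, IndData.X_mul_mon]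
          have : (Finsupp.single i 1 : ι →₀ ℕ) j = 0 := by simp [Finsupp.single_apply, hij]
          rw [Finsupp.add_apply, this, add_zero]
          by_cases h : U j = 0
          · simp [h]
          · have e3 : U + Finsupp.single i 1 - Finsupp.single j 1 = 
              U - Finsupp.single j 1 + Finsupp.single i 1 := by
              symm
              apply tsub_add_eq_add_tsub
              rw [Finsupp.single_le_iff]
              exact Nat.one_le_iff_ne_zero.2 h
            rw [e3, sub_self]
        rw [e2]
        refine ⟨_, ?_, (add_zero _).symm⟩
        rw [T.decomp ⁅T.e j, T.f i⁆, e1]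
        simp only [add_zero, map_zero, map_sum, map_add,
          map_smul, LinearMap.sum_apply, LinearMap.smul_apply, LinearMap.add_apply]
        refine Submodule.add_mem _ ?_ ?_
        · exact Submodule.sum_mem _ fun k _ => Submodule.smul_mem _ _ (T.act_f_ff lam zt k (ff_mon le_rfl))
        · exact Submodule.sum_mem _ fun k _ => Submodule.smul_mem _ _ (e5 k)
    obtain ⟨w, hw, h4⟩ := h3
    rw [h4]
    convert Submodule.add_mem _ (Submodule.add_mem _ h1 h2) hw using 1
    abel

theorem pair_ff (π : ι →₀ ℕ) : ∀ {d : ℕ} {w : MvPolynomial ι (Polynomial ℂ)} (_ : w ∈ ff ι d) (k : ℕ),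
    π.degree + d < 2 * k → (T.pair (linf lam zt) (monomial π 1) w).coeff k = 0 := by
  induction π using IndData.mon_ind with
  | h0 =>
    intro d w hw k hk
    have h1 : (monomial 0 1 : MvPolynomial ι (Polynomial ℂ)) = 1 := rfl
    rw [h1, pair_one]
    exact hw k 0 (by simpa using hk)
  | hs j U hU ih =>
    intro d w hw k hk
    have h1 := (T.op.ind (-(linf lam zt))).act_f j U hU
    rw [← h1, pair_act, Polynomial.coeff_neg, ind_f, neg_eq_zero]
    rw [map_add, Finsupp.degree_single] at hk
    refine ih (d := d + 1) ?_ k (by omega)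
    refine ff_map _ ?_ hw
    intro m' _
    have := Submodule.add_mem _ (ff_mono (Nat.le_succ _) (T.lead_e lam zt m' j)) (T.le_mem zt j m')
    rwa [sub_add_cancel] at this

/-- leading coefficient -/
noncomputable def lu (π : ι →₀ ℕ) : ℂ := ∏ i, ((-zt (T.co i)) ^ (π i) * ((π i).factorial : ℂ))

theorem lu_ne (h : ∀ i, zt (T.co i) ≠ 0) (π : ι →₀ ℕ) : T.lu zt π ≠ 0 := by
  rw [lu, Finset.prod_ne_zero_iff]
  intro i _
  exact mul_ne_zero (pow_ne_zero _ (neg_ne_zero.2 (h i))) (by exact_mod_cast Nat.factorial_ne_zero _)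

theorem lu_add (j : ι) (U : ι →₀ ℕ) :
    T.lu zt (U + Finsupp.single j 1) = - (zt (T.co j)) * (U j + 1) * T.lu zt U := by
  rw [lu, lu, Fintype.prod_eq_mul_prod_compl j, Fintype.prod_eq_mul_prod_compl j]
  have : ∏ i ∈ {j}ᶜ, (-zt (T.co i)) ^ (U + Finsupp.single j 1 : ι →₀ ℕ) i *
      (((U + Finsupp.single j 1 : ι →₀ ℕ) i).factorial : ℂ) =
      ∏ i ∈ {j}ᶜ, (-zt (T.co i)) ^ U i * ((U i).factorial : ℂ) := by
    refine Finset.prod_congr rfl fun i hi => ?_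
    have : (Finsupp.single j 1 : ι →₀ ℕ) i = 0 := by
      rw [Finsupp.single_apply, if_neg]
      rintro rfl; simp at hi
    rw [Finsupp.add_apply, this, add_zero]
  rw [this]
  simp only [Finsupp.add_apply, Finsupp.single_eq_same, Nat.factorial_succ, pow_succ, Nat.cast_mul]
  push_cast; ring

theorem pair_lead (π : ι →₀ ℕ) : ∀ (m : ι →₀ ℕ) (k : ℕ), 2 * k = π.degree + m.degree →
    (T.pair (linf lam zt) (monomial π 1) (monomial m 1)).coeff k =
      open Classical in if m = π then T.lu zt π else 0 := by
  induction π using IndData.mon_ind with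
  | h0 =>
    intro m k hk
    have h1 : (monomial 0 1 : MvPolynomial ι (Polynomial ℂ)) = 1 := rfl
    rw [h1, pair_one, coeff_monomial]
    split_ifs with hm
    · subst hm
      simp only [map_zero, add_zero, mul_eq_zero, OfNat.ofNat_ne_zero, false_or] at hk
      simp [lu, hk]
    · simp
  | hs j U hU ih =>
    intro m k hk
    have h1 := (T.op.ind (-(linf lam zt))).act_f j U hU
    rw [← h1, pair_act, Polynomial.coeff_neg, ind_f]
    rw [map_add, Finsupp.degree_single] at hk
    have h2 := T.pair_ff lam zt U (T.lead_e lam zt m j) k (by omega)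
    rw [map_sub, Polynomial.coeff_sub, sub_eq_zero] at h2
    have h3 : T.op.f j = T.e j := rfl
    rw [h3, h2, le, map_smul, smul_eq_mul, mul_assoc, Polynomial.coeff_C_mul]
    by_cases h : m j = 0
    · rw [if_neg]
      · simp [h]
      · rintro rfl; simp at h
    · obtain ⟨e1, e2⟩ := deg_sub j m h
      obtain ⟨k, rfl⟩ : ∃ k', k = k' + 1 := ⟨k - 1, by omega⟩
      rw [Polynomial.coeff_X_mul, ih _ k (by omega)]
      by_cases hm : m = U + Finsupp.single j 1
      · rw [if_pos (by rw [hm, add_tsub_cancel_right]), if_pos hm, lu_add, hm]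
        simp
      · rw [if_neg, if_neg hm]
        · simp
        · rintro rfl; exact hm e1.symm

end TriData

section detlemma
open Polynomial

theorem coeff_prod_top {α : Type*} (s : Finset α) (p : α → Polynomial ℂ) (b : α → ℕ)
    (h : ∀ i ∈ s, (p i).natDegree ≤ b i) :
    (∏ i ∈ s, p i).natDegree ≤ ∑ i ∈ s, b i ∧
      (∏ i ∈ s, p i).coeff (∑ i ∈ s, b i) = ∏ i ∈ s, (p i).coeff (b i) := by
  classical
  induction s using Finset.induction_on with
  | empty => simp
  | insert a s ha ih =>
    obtain ⟨h1, h2⟩ := ih (fun i hi => h i (Finset.mem_insert_of_mem hi))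
    have h3 := h a (Finset.mem_insert_self _ _)
    rw [Finset.prod_insert ha, Finset.sum_insert ha, Finset.prod_insert ha]
    exact ⟨natDegree_mul_le.trans (add_le_add h3 h1), by rw [coeff_mul_add_eq_of_natDegree_le h3 h1, h2]⟩

theorem det_lead {n : Type*} [Fintype n] [DecidableEq n] (G : Matrix n n (Polynomial ℂ)) (a : n → ℕ)
    (u : n → ℂ) (h1 : ∀ i j k, a i + a j < 2 * k → (G i j).coeff k = 0)
    (h2 : ∀ i j k, 2 * k = a i + a j → (G i j).coeff k = if j = i then u i else 0) :
    G.det.natDegree ≤ ∑ i, a i ∧ G.det.coeff (∑ i, a i) = ∏ i, u i := by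
  have hd : ∀ i j, (expand ℂ 2 (G i j)).natDegree ≤ a i + a j := by
    intro i j
    rw [natDegree_expand]
    by_contra hlt
    have := h1 i j _ (by omega : a i + a j < 2 * (G i j).natDegree)
    rw [coeff_natDegree, leadingCoeff_eq_zero] at this
    rw [this] at hlt; simp at hlt
  have hc : ∀ i j, (expand ℂ 2 (G i j)).coeff (a i + a j) = if j = i then u i else 0 := by
    intro i j
    rw [coeff_expand (by norm_num)]
    split_ifs with hdv hij hij
    · rw [h2 i j _ (Nat.mul_div_cancel' hdv), if_pos hij]
    · rw [h2 i j _ (Nat.mul_div_cancel' hdv), if_neg hij]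
    · subst hij; exact absurd ⟨a j, by ring⟩ hdv
    · rfl
  have hsum : ∀ σ : Equiv.Perm n, ∑ i, (a (σ i) + a i) = 2 * ∑ i, a i := by
    intro σ
    rw [Finset.sum_add_distrib, Equiv.sum_comp σ a]; ring
  have hE : expand ℂ 2 G.det = ∑ σ : Equiv.Perm n, Equiv.Perm.sign σ • ∏ i, expand ℂ 2 (G (σ i) i) := by
    rw [Matrix.det_apply, map_sum]
    refine Finset.sum_congr rfl fun σ _ => ?_
    rw [Units.smul_def, Units.smul_def, map_zsmul, map_prod]
  have hp : ∀ σ : Equiv.Perm n, _ := fun σ => coeff_prod_top Finset.univ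
    (fun i => expand ℂ 2 (G (σ i) i)) (fun i => a (σ i) + a i) (fun i _ => hd _ _)
  constructor
  · have : (expand ℂ 2 G.det).natDegree ≤ 2 * ∑ i, a i := by
      rw [hE]
      refine natDegree_sum_le_of_forall_le _ _ fun σ _ => ?_
      rw [← hsum σ]
      refine (natDegree_smul_le _ _).trans (hp σ).1
    rw [natDegree_expand] at this
    omega
  · have e1 : (expand ℂ 2 G.det).coeff (2 * ∑ i, a i) = G.det.coeff (∑ i, a i) := by
      rw [coeff_expand_mul' (by norm_num)]
    rw [← e1, hE, finsetSum_coeff, Finset.sum_eq_single 1]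
    · rw [Polynomial.coeff_smul, ← hsum 1, (hp 1).2]
      simp [hc]
    · intro σ _ hσ
      obtain ⟨i, hi⟩ : ∃ i, σ i ≠ i := by
        by_contra hcon; push Not at hcon
        exact hσ (Equiv.ext hcon)
      rw [Polynomial.coeff_smul, ← hsum σ, (hp σ).2, Finset.prod_eq_zero (Finset.mem_univ i), smul_zero]
      rw [hc, if_neg (Ne.symm hi)]
    · simp

end detlemma

namespace TriData
variable (T : TriData ι L H) (lam zt : Module.Dual ℂ H)

theorem det_gram_lead (θ : Module.Dual ℂ H) [DecidableEq (T.idx θ)] :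
    (T.gram (linf lam zt) θ).det.natDegree ≤ ∑ π ∈ T.idx θ, π.degree ∧
    (T.gram (linf lam zt) θ).det.coeff (∑ π ∈ T.idx θ, π.degree) = ∏ π ∈ T.idx θ, T.lu zt π := by
  have := det_lead (T.gram (linf lam zt) θ) (fun π => π.1.degree) (fun π => T.lu zt π.1) ?_ ?_
  · rw [Finset.sum_coe_sort (T.idx θ) (fun π => π.degree),
      Finset.prod_coe_sort (T.idx θ) (fun π => T.lu zt π)] at this
    exact this
  · intro i j k hk
    exact T.pair_ff lam zt i.1 (ff_mon le_rfl) k hk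
  · intro i j k hk
    have := T.pair_lead lam zt i.1 j.1 k hk
    simp only [gram, Matrix.of_apply, this, Subtype.ext_iff]

end TriData
end Vrm


set_option linter.unusedSectionVars false
set_option linter.unusedSimpArgs false

namespace Vrm

section polymat
open Polynomial

theorem poly_ker_step {r c : Type*} [Fintype r] [Fintype c] (S : Matrix r c (Polynomial ℂ)) :
    ∀ (N : ℕ) (v : c → Polynomial ℂ) (j : c), S.mulVec v = 0 → v j ≠ 0 → (v j).natDegree ≤ N →
      ∃ w : c → ℂ, w ≠ 0 ∧ (S.map (evalRingHom 0)).mulVec w = 0 := by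
  intro N
  induction N with
  | zero =>
    intro v j h1 h2 h3
    refine ⟨fun k => (v k).eval 0, ?_, ?_⟩
    · intro h
      have h5 : (v j).eval 0 = 0 := congrFun h j
      obtain ⟨z, hz⟩ := natDegree_eq_zero.1 (Nat.le_zero.1 h3)
      rw [← hz, eval_C] at h5
      exact h2 (by rw [← hz, h5, map_zero])
    · ext i
      have := congrArg (eval 0) (congrFun h1 i)
      simpa [Matrix.mulVec, dotProduct, eval_finsetSum] using this
  | succ N ih =>
    intro v j h1 h2 h3
    by_cases h : (fun k => (v k).eval 0) = (0 : c → ℂ)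
    · have hX : ∀ k, ∃ w, v k = X * w := by
        intro k
        have : (v k).eval 0 = 0 := congrFun h k
        obtain ⟨w, hw⟩ := (X_dvd_iff (f := v k)).2 (by rwa [coeff_zero_eq_eval_zero])
        exact ⟨w, hw⟩
      choose w hw using hX
      have hw0 : w j ≠ 0 := by
        intro h0; apply h2; rw [hw, h0, mul_zero]
      refine ih w j ?_ hw0 ?_
      · have : v = (X : Polynomial ℂ) • w := _root_.funext hw
        rw [this, Matrix.mulVec_smul] at h1
        exact (smul_eq_zero.1 h1).resolve_left X_ne_zero
      · rw [hw, natDegree_mul X_ne_zero hw0, natDegree_X] at h3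
        omega
    · refine ⟨_, h, ?_⟩
      ext i
      have := congrArg (eval 0) (congrFun h1 i)
      simpa [Matrix.mulVec, dotProduct, eval_finsetSum] using this

theorem poly_ker {r c : Type*} [Fintype r] [Fintype c] (S : Matrix r c (Polynomial ℂ))
    (h : {t : ℂ | ∃ w : c → ℂ, w ≠ 0 ∧ (S.map (evalRingHom t)).mulVec w = 0}.Infinite) :
    ∃ w : c → ℂ, w ≠ 0 ∧ (S.map (evalRingHom 0)).mulVec w = 0 := by
  classical
  let K := FractionRing (Polynomial ℂ)
  by_cases hinj : Function.Injective (S.map (algebraMap _ K)).mulVecLin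
  · exfalso
    obtain ⟨g, hg⟩ := LinearMap.exists_leftInverse_of_injective _ (LinearMap.ker_eq_bot.2 hinj)
    let B := LinearMap.toMatrix' g
    have hB : B * S.map (algebraMap _ K) = 1 := by
      have := congrArg LinearMap.toMatrix' hg
      rw [LinearMap.toMatrix'_comp, LinearMap.toMatrix'_id, ← Matrix.toLin'_apply',
        LinearMap.toMatrix'_toLin'] at this
      exact this
    obtain ⟨d, hd⟩ := IsLocalization.exist_integer_multiples_of_finite (nonZeroDivisors (Polynomial ℂ))
      (fun ij : c × r => B ij.1 ij.2)
    choose B' hB' using hd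
    have key : (Matrix.of fun i j => B' (i, j)) * S = (d : Polynomial ℂ) • (1 : Matrix c c (Polynomial ℂ)) := by
      have hi : Function.Injective (algebraMap (Polynomial ℂ) K) := IsFractionRing.injective _ _
      ext1 i j
      apply hi
      have := congrFun (congrFun hB i) j
      rw [Matrix.mul_apply] at this ⊢
      rw [map_sum]
      simp only [map_mul, Matrix.of_apply, hB', Matrix.map_apply] at this ⊢
      rw [Matrix.smul_apply, smul_eq_mul, map_mul]
      have h9 : ∀ k, ((d : Polynomial ℂ) • B i k) = algebraMap (Polynomial ℂ) K d * B i k := fun k => Algebra.smul_def _ _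
      simp only [h9, mul_assoc, ← Finset.mul_sum]
      rw [this, Matrix.one_apply, Matrix.one_apply]
      split_ifs <;> simp
    apply h
    refine Set.Finite.subset (s := ↑(d : Polynomial ℂ).roots.toFinset) (Finset.finite_toSet _) ?_
    rintro t ⟨w, hw, h0⟩
    rw [Finset.mem_coe, Multiset.mem_toFinset, mem_roots (nonZeroDivisors.coe_ne_zero d), IsRoot.def]
    by_contra hne
    have := congrArg (fun M => (M.map (evalRingHom t)).mulVec w) key
    simp only [Matrix.map_mul, ← Matrix.mulVec_mulVec, h0, Matrix.mulVec_zero] at this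
    apply hw
    have h2 : (((d : Polynomial ℂ) • (1 : Matrix c c (Polynomial ℂ))).map (evalRingHom t)) = 
      ((d : Polynomial ℂ).eval t) • (1 : Matrix c c ℂ) := by
      ext i j
      simp only [Matrix.map_apply, Matrix.smul_apply, Matrix.one_apply]
      split_ifs <;> simp
    rw [h2, Matrix.smul_mulVec, Matrix.one_mulVec] at this
    exact (smul_eq_zero.1 this.symm).resolve_left hne
  · rw [← LinearMap.ker_eq_bot, Submodule.eq_bot_iff] at hinj
    push Not at hinj
    obtain ⟨v, hv, hv0⟩ := hinj
    obtain ⟨d, hd⟩ := IsLocalization.exist_integer_multiples_of_finite (nonZeroDivisors (Polynomial ℂ)) v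
    choose v' hv' using hd
    obtain ⟨j, hj⟩ := Function.ne_iff.1 hv0
    have hi : Function.Injective (algebraMap (Polynomial ℂ) K) := IsFractionRing.injective _ _
    have hd0 : algebraMap (Polynomial ℂ) K d ≠ 0 := by
      rw [Ne, map_eq_zero_iff _ hi]; exact nonZeroDivisors.coe_ne_zero d
    refine poly_ker_step S _ v' j ?_ ?_ le_rfl
    · ext1 i
      apply hi
      have := congrFun (LinearMap.mem_ker.1 hv) i
      simp only [Matrix.mulVecLin_apply, Matrix.mulVec, dotProduct, Matrix.map_apply, Pi.zero_apply] at this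
      simp only [Matrix.mulVec, dotProduct, map_sum, map_mul, hv', Algebra.smul_def, Pi.zero_apply, map_zero]
      simp only [mul_left_comm _ (algebraMap (Polynomial ℂ) K d), ← Finset.mul_sum, this, mul_zero]
    · intro h0
      have := hv' j
      rw [h0, map_zero, Algebra.smul_def] at this
      exact hj ((mul_eq_zero.1 this.symm).resolve_left hd0)

end polymat

open MvPolynomial

section rep
variable {L : Type*} [LieRing L] [LieAlgebra ℂ L] {N : Type*} [AddCommGroup N] [Module ℂ N]
  (a : L →ₗ[ℂ] (N →ₗ[ℂ] N))

/-- representation property -/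
def IsRep : Prop := ∀ x y n, a ⁅x, y⁆ n = a x (a y n) - a y (a x n)

variable {a}

theorem sl2_h (ha : IsRep a) {f h : L} (hf : ⁅h, f⁆ = -((2 : ℂ) • f)) {n : N} {μ : ℂ}
    (hh : a h n = μ • n) (k : ℕ) : a h ((a f ^ k) n) = (μ - 2 * k) • (a f ^ k) n := by
  induction k with
  | zero => simp [hh]
  | succ k ih =>
    rw [pow_succ', Module.End.mul_apply]
    have := ha h f ((a f ^ k) n)
    rw [hf, ih, map_smul, map_neg, map_smul, LinearMap.neg_apply, LinearMap.smul_apply,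
      eq_sub_iff_add_eq] at this
    rw [← this, ← neg_smul, ← add_smul]
    congr 1; push_cast; ring

theorem sl2_e (ha : IsRep a) {e f h : L} (hef : ⁅e, f⁆ = h) (hf : ⁅h, f⁆ = -((2 : ℂ) • f)) {n : N}
    {μ : ℂ} (he : a e n = 0) (hh : a h n = μ • n) (k : ℕ) :
    a e ((a f ^ (k + 1)) n) = ((k + 1) * (μ - k)) • (a f ^ k) n := by
  induction k with
  | zero =>
    have := ha e f n
    rw [hef, hh, he, map_zero, sub_zero] at this
    simpa using this.symm
  | succ k ih =>
    rw [pow_succ', Module.End.mul_apply]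
    have := ha e f ((a f ^ (k + 1)) n)
    have h9 : a f ((a f ^ k) n) = (a f ^ (k + 1)) n := by rw [pow_succ', Module.End.mul_apply]
    rw [hef, sl2_h ha hf hh, ih, map_smul, h9, eq_sub_iff_add_eq] at this
    rw [← this, ← add_smul]
    congr 1; push_cast; ring

theorem sl2_nat (ha : IsRep a) {e f h : L} (hef : ⁅e, f⁆ = h) (hf : ⁅h, f⁆ = -((2 : ℂ) • f)) {n : N}
    {μ : ℂ} (he : a e n = 0) (hh : a h n = μ • n) (h0 : n ≠ 0) (hn : ∃ k, (a f ^ k) n = 0) :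
    ∃ k : ℕ, μ = k ∧ (a f ^ (k + 1)) n = 0 := by
  classical
  have h1 := Nat.find_spec hn
  obtain ⟨k, hk⟩ : ∃ k, Nat.find hn = k + 1 := by
    apply Nat.exists_eq_succ_of_ne_zero
    intro h2
    rw [h2] at h1
    exact h0 (by simpa using h1)
  rw [hk] at h1
  refine ⟨k, ?_, h1⟩
  have h2 := sl2_e ha hef hf he hh k
  rw [h1, map_zero] at h2
  have h3 := Nat.find_min hn (m := k) (by omega)
  have h4 := (smul_eq_zero.1 h2.symm).resolve_right h3
  rcases mul_eq_zero.1 h4 with h5 | h5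
  · exact absurd h5 (by exact_mod_cast Nat.succ_ne_zero k)
  · exact sub_eq_zero.1 h5

theorem pow_zero_of_le (A : N →ₗ[ℂ] N) {n : N} {k l : ℕ} (h : (A ^ k) n = 0) (hkl : k ≤ l) :
    (A ^ l) n = 0 := by
  obtain ⟨d, rfl⟩ := Nat.exists_eq_add_of_le' hkl
  rw [pow_add, Module.End.mul_apply, h, map_zero]

theorem locnil_lie (ha : IsRep a) (f : L) (k : ℕ) : ∀ (x : L), ((LieAlgebra.ad ℂ L f) ^ k) x = 0 →
    ∀ (M : ℕ) (n : N), (a f ^ M) n = 0 → ∃ K, (a f ^ K) (a x n) = 0 := by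
  induction k with
  | zero =>
    intro x hx M n _
    have : x = 0 := by simpa using hx
    exact ⟨0, by simp [this]⟩
  | succ k ih =>
    intro x hx M
    rw [pow_succ, Module.End.mul_apply, LieAlgebra.ad_apply] at hx
    induction M with
    | zero =>
      intro n hn
      have : n = 0 := by simpa using hn
      exact ⟨0, by simp [this]⟩
    | succ M ihM =>
      intro n hn
      obtain ⟨K1, h1⟩ := ih _ hx _ n hn
      obtain ⟨K2, h2⟩ := ihM (a f n) (by rwa [← Module.End.mul_apply, ← pow_succ])
      refine ⟨max K1 K2 + 1, ?_⟩
      rw [pow_succ, Module.End.mul_apply]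
      have := ha f x n
      rw [eq_sub_iff_add_eq] at this
      rw [← this, map_add, pow_zero_of_le _ h1 (le_max_left _ _), pow_zero_of_le _ h2 (le_max_right _ _),
        add_zero]

end rep

end Vrm


set_option linter.unusedSectionVars false
set_option linter.unusedSimpArgs false

namespace Vrm
open MvPolynomial

variable {ι : Type} [Fintype ι] [LinearOrder ι] {L : Type*} [LieRing L] [LieAlgebra ℂ L]
    {H : Type*} [AddCommGroup H] [Module ℂ H]

theorem fil_totalDegree {p : MvPolynomial ι ℂ} {n : ℕ} (h : p ∈ IndData.fil ι ℂ n) : p.totalDegree ≤ n := by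
  let S : Submodule ℂ (MvPolynomial ι ℂ) := restrictTotalDegree ι ℂ n
  have : p ∈ S := by
    refine IndData.fil_ind h S fun m hm => ?_
    rw [mem_restrictTotalDegree]
    refine (totalDegree_monomial_le m 1).trans ?_
    simpa [Finsupp.sum, Finsupp.degree_apply] using hm
  rwa [mem_restrictTotalDegree] at this

theorem mem_fil_totalDegree (p : MvPolynomial ι ℂ) : p ∈ IndData.fil ι ℂ p.totalDegree := by
  suffices h : ∑ m ∈ p.support, monomial m (coeff m p) ∈ IndData.fil ι ℂ p.totalDegree by
    rwa [← p.as_sum] at h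
  refine Submodule.sum_mem _ fun m hm => ?_
  have : monomial m (coeff m p) = coeff m p • (monomial m 1 : MvPolynomial ι ℂ) := by simp [smul_monomial]
  rw [this]
  refine Submodule.smul_mem _ _ (IndData.mon_mem_fil ?_)
  have := le_totalDegree hm
  simpa [Finsupp.sum, Finsupp.degree_apply] using this

namespace TriData
variable (T : TriData ι L H) (χ : Module.Dual ℂ H)

theorem isRep : IsRep (T.act χ) := fun x y n => (T.ind χ).act_lie x y n

/-- stable subspaces -/
def Stab (A : Submodule ℂ (MvPolynomial ι ℂ)) : Prop := ∀ x, ∀ p ∈ A, T.act χ x p ∈ A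

/-- quotient action -/
noncomputable def qact (B : Submodule ℂ (MvPolynomial ι ℂ)) (hB : T.Stab χ B) :
    L →ₗ[ℂ] ((MvPolynomial ι ℂ ⧸ B) →ₗ[ℂ] (MvPolynomial ι ℂ ⧸ B)) where
  toFun x := B.mapQ B (T.act χ x) (fun p hp => hB x p hp)
  map_add' x y := by
    refine LinearMap.ext fun p => ?_
    obtain ⟨p, rfl⟩ := Submodule.mkQ_surjective B p
    simp
  map_smul' r x := by
    refine LinearMap.ext fun p => ?_
    obtain ⟨p, rfl⟩ := Submodule.mkQ_surjective B p
    simp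

theorem qact_mk (B : Submodule ℂ (MvPolynomial ι ℂ)) (hB : T.Stab χ B) (x : L) (p : MvPolynomial ι ℂ) :
    T.qact χ B hB x (B.mkQ p) = B.mkQ (T.act χ x p) := rfl

theorem qact_rep (B : Submodule ℂ (MvPolynomial ι ℂ)) (hB : T.Stab χ B) : IsRep (T.qact χ B hB) := by
  intro x y n
  obtain ⟨p, rfl⟩ := Submodule.mkQ_surjective B n
  simp only [qact_mk]
  rw [T.isRep χ x y p, map_sub]

theorem qact_pow (B : Submodule ℂ (MvPolynomial ι ℂ)) (hB : T.Stab χ B) (x : L) (p : MvPolynomial ι ℂ) (k : ℕ) :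
    (T.qact χ B hB x ^ k) (B.mkQ p) = B.mkQ ((T.act χ x ^ k) p) := by
  induction k with
  | zero => rfl
  | succ k ih => rw [pow_succ', Module.End.mul_apply, ih, qact_mk, pow_succ', Module.End.mul_apply]

section hom
variable {N : Type*} [AddCommGroup N] [Module ℂ N] (a : L →ₗ[ℂ] (N →ₗ[ℂ] N))

/-- singular vector of weight κ in a representation -/
def IsSing (κ : Module.Dual ℂ H) (n : N) : Prop := (∀ h, a (T.hh h) n = κ h • n) ∧ ∀ i, a (T.e i) n = 0

/-- the homomorphism out of a Verma module -/
noncomputable def hom (n : N) : MvPolynomial ι ℂ →ₗ[ℂ] N := (T.ind (0 : Module.Dual ℂ H)).lift a n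

theorem hom_eq (κ : Module.Dual ℂ H) (n : N) : T.hom a n = (T.ind κ).lift a n := rfl

theorem hom_one (n : N) : T.hom a n 1 = n := IndData.lift_one _ _ _

theorem hom_act (ha : IsRep a) {κ : Module.Dual ℂ H} {n : N} (hn : T.IsSing a κ n) (x : L)
    (p : MvPolynomial ι ℂ) : T.hom a n (T.act κ x p) = a x (T.hom a n p) := by
  rw [T.hom_eq a κ, IndData.lift_act _ _ ha]
  intro y hy
  have hy : T.c y = 0 := hy
  conv_lhs => rw [T.decomp y, hy]
  simp [hn.1, hn.2, LinearMap.sum_apply]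

theorem hom_pow (ha : IsRep a) {κ : Module.Dual ℂ H} {n : N} (hn : T.IsSing a κ n) (x : L)
    (p : MvPolynomial ι ℂ) (k : ℕ) : T.hom a n ((T.act κ x ^ k) p) = (a x ^ k) (T.hom a n p) := by
  induction k with
  | zero => rfl
  | succ k ih => rw [pow_succ', pow_succ', Module.End.mul_apply, Module.End.mul_apply, T.hom_act a ha hn, ih]

end hom

theorem one_sing : T.IsSing (T.act χ) χ (1 : MvPolynomial ι ℂ) := by
  constructor
  · intro h
    rw [act, IndData.act_one]; simp [IndData.sym, T.c_h, T.pH_h, smul_eq_C_mul]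
  · intro i
    rw [act, IndData.act_one]; simp [IndData.sym, T.c_e, T.pH_e]

theorem one_vw : (1 : MvPolynomial ι ℂ) ∈ T.vw 0 := by
  have := T.mon_mem_vw (R := ℂ) 0
  rwa [map_zero] at this

theorem sing_iff {θ : Module.Dual ℂ H} {q : MvPolynomial ι ℂ} :
    T.IsSing (T.act χ) (χ - θ) q ↔ q ∈ T.vw θ ∧ ∀ i, T.act χ (T.e i) q = 0 := by
  rw [T.mem_vw_iff χ]; rfl

theorem act_f_inj (i : ι) {p : MvPolynomial ι ℂ} (h : T.act χ (T.f i) p = 0) : p = 0 := by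
  by_contra hp
  have h1 := (T.ind χ).act_f_sub_mem i (mem_fil_totalDegree p)
  rw [ind_f, h, zero_sub] at h1
  have h2 := fil_totalDegree h1
  rw [totalDegree_neg, totalDegree_mul_of_isDomain (X_ne_zero i) hp, totalDegree_X] at h2
  omega

theorem act_f_pow_inj (i : ι) (k : ℕ) {p : MvPolynomial ι ℂ} (h : (T.act χ (T.f i) ^ k) p = 0) : p = 0 := by
  induction k with
  | zero => exact h
  | succ k ih =>
    rw [pow_succ', Module.End.mul_apply] at h
    exact ih (T.act_f_inj χ i h)

theorem hom_lead (q : MvPolynomial ι ℂ) (d : ℕ) (hq : q ∈ IndData.fil ι ℂ d) (m : ι →₀ ℕ) :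
    T.hom (T.act χ) q (monomial m 1) ∈ IndData.fil ι ℂ (m.degree + d) ∧
    (m ≠ 0 → T.hom (T.act χ) q (monomial m 1) - monomial m 1 * q ∈ IndData.fil ι ℂ (m.degree + d - 1)) := by
  induction m using IndData.mon_ind with
  | h0 =>
    have h1 : (monomial 0 1 : MvPolynomial ι ℂ) = 1 := rfl
    rw [h1, hom_one]; simpa using hq
  | hs j U hU ih =>
    have e1 : T.hom (T.act χ) q (monomial (U + Finsupp.single j 1) 1) =
        T.act χ (T.f j) (T.hom (T.act χ) q (monomial U 1)) := by
      rw [hom, IndData.lift_mon, IndData.lift_mon, IndData.mprod_add _ _ _ _ _ hU]; rfl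
    have h1 := (T.ind χ).act_f_sub_mem j ih.1
    have h3 := IndData.X_mul_mem j ih.1
    rw [e1, map_add, Finsupp.degree_single]
    have h2 := Submodule.add_mem _ (IndData.fil_mono (Nat.le_succ _) h1) h3
    rw [sub_add_cancel] at h2
    refine ⟨by rw [add_right_comm]; exact h2, fun _ => ?_⟩
    have e2 : U.degree + 1 + d - 1 = U.degree + d := by omega
    rw [e2, ← IndData.X_mul_mon]
    by_cases hU0 : U = 0
    · subst hU0
      have h1' : (monomial 0 1 : MvPolynomial ι ℂ) = 1 := rfl
      rw [h1', hom_one] at h1 ⊢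
      simpa using h1
    · have h4 := IndData.X_mul_mem j (ih.2 hU0)
      have hpos : U.degree ≠ 0 := fun h => hU0 ((Finsupp.degree_eq_zero_iff U).1 h)
      have e3 : U.degree + d - 1 + 1 = U.degree + d := by omega
      rw [e3] at h4
      have := Submodule.add_mem _ h1 h4
      convert this using 1
      rw [ind_f]; ring

theorem hom_inj {q : MvPolynomial ι ℂ} (hq : q ≠ 0) : Function.Injective (T.hom (T.act χ) q) := by
  rw [← LinearMap.ker_eq_bot, Submodule.eq_bot_iff]
  intro p hp
  rw [LinearMap.mem_ker] at hp
  by_contra hp0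
  by_cases hn : p.totalDegree = 0
  · rw [totalDegree_eq_zero_iff_eq_C] at hn
    rw [hn, C_eq_smul_one, map_smul, hom_one] at hp
    rcases smul_eq_zero.1 hp with h | h
    · apply hp0; rw [hn, h, map_zero]
    · exact hq h
  · have key : T.hom (T.act χ) q p - p * q ∈ IndData.fil ι ℂ (p.totalDegree + q.totalDegree - 1) := by
      let S : Submodule ℂ (MvPolynomial ι ℂ) :=
        (IndData.fil ι ℂ (p.totalDegree + q.totalDegree - 1)).comap
          (T.hom (T.act χ) q - LinearMap.mulRight ℂ q)
      have : p ∈ S := by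
        refine IndData.fil_ind (mem_fil_totalDegree p) S fun m hm => ?_
        rw [Submodule.mem_comap, LinearMap.sub_apply, LinearMap.mulRight_apply]
        by_cases hm0 : m = 0
        · subst hm0
          have h1' : (monomial 0 1 : MvPolynomial ι ℂ) = 1 := rfl
          rw [h1', hom_one, one_mul, sub_self]; exact Submodule.zero_mem _
        · exact IndData.fil_mono (by omega) ((T.hom_lead χ q _ (mem_fil_totalDegree q) m).2 hm0)
      exact this
    rw [hp, zero_sub] at key
    have h2 := fil_totalDegree key
    rw [totalDegree_neg, totalDegree_mul_of_isDomain hp0 hq] at h2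
    omega

theorem hom_vw {q : MvPolynomial ι ℂ} {θ : Module.Dual ℂ H} (hq : q ∈ T.vw θ) {δ : Module.Dual ℂ H}
    {p : MvPolynomial ι ℂ} (hp : p ∈ T.vw δ) : T.hom (T.act χ) q p ∈ T.vw (θ + δ) := by
  have key : ∀ m, T.hom (T.act χ) q (monomial m 1) ∈ T.vw (θ + T.wm m) := by
    intro m
    induction m using IndData.mon_ind with
    | h0 =>
      have h1' : (monomial 0 1 : MvPolynomial ι ℂ) = 1 := rfl
      rw [h1', hom_one, map_zero, add_zero]; exact hq
    | hs j U hU ih =>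
      have e1 : T.hom (T.act χ) q (monomial (U + Finsupp.single j 1) 1) =
          T.act χ (T.f j) (T.hom (T.act χ) q (monomial U 1)) := by
        rw [hom, IndData.lift_mon, IndData.lift_mon, IndData.mprod_add _ _ _ _ _ hU]; rfl
      rw [e1, map_add, wm_single]
      have := T.act_mem_vw χ (T.isW_f j) ih
      rwa [sub_neg_eq_add, add_assoc] at this
  rw [p.as_sum, map_sum]
  refine Submodule.sum_mem _ fun m hm => ?_
  have : monomial m (coeff m p) = coeff m p • (monomial m 1 : MvPolynomial ι ℂ) := by simp [smul_monomial]
  rw [this, map_smul]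
  refine Submodule.smul_mem _ _ ?_
  rw [← hp m (mem_support_iff.1 hm)]; exact key m

theorem range_stab {κ : Module.Dual ℂ H} {q : MvPolynomial ι ℂ} (hq : T.IsSing (T.act χ) κ q) :
    T.Stab χ (LinearMap.range (T.hom (T.act χ) q)) := by
  rintro x _ ⟨p, rfl⟩
  exact ⟨T.act κ x p, T.hom_act _ (T.isRep χ) hq x p⟩

/-- ad nilpotence of `f i` -/
theorem ad_f_nil (i : ι) (x : L) : ∃ k, ((LieAlgebra.ad ℂ L (T.f i)) ^ k) x = 0 := by
  have hw : ∀ (g : Module.Dual ℂ H) (x : L), T.IsW g x → (∃ z : ℤ, g T.hz = z) →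
      ∃ k, ((LieAlgebra.ad ℂ L (T.f i)) ^ k) x = 0 := by
    rintro g x hx ⟨z, hz⟩
    have h1 : ∀ k : ℕ, T.IsW (g - (k : ℂ) • T.wt i) (((LieAlgebra.ad ℂ L (T.f i)) ^ k) x) := by
      intro k
      induction k with
      | zero => simpa using hx
      | succ k ih =>
        rw [pow_succ', Module.End.mul_apply, LieAlgebra.ad_apply]
        have := (T.isW_f i).lie ih
        convert this using 1
        push_cast; rw [add_smul, one_smul]; abel
    refine ⟨z.toNat + ∑ j, T.ht j + 1, ?_⟩
    set k := z.toNat + ∑ j, T.ht j + 1 with hk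
    have h2 := h1 k
    have hval : (g - (k : ℂ) • T.wt i) T.hz = ((z - k * T.ht i : ℤ) : ℂ) := by
      simp [hz, T.wt_hz]
    have hti := T.ht_pos i
    have hneg : (z - k * T.ht i : ℤ) < - (∑ j, T.ht j : ℕ) := by
      have : (k : ℤ) ≤ k * T.ht i := by
        have : (1 : ℤ) ≤ T.ht i := by exact_mod_cast hti
        nlinarith [Int.natCast_nonneg k]
      have h4 : z ≤ z.toNat := Int.self_le_toNat z
      have h5 : (k : ℤ) = z.toNat + (∑ j, T.ht j : ℕ) + 1 := by rw [hk]; push_cast; ring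
      omega
    have hle : ∀ j, T.ht j ≤ ∑ j, T.ht j := fun j =>
      Finset.single_le_sum (f := T.ht) (fun _ _ => Nat.zero_le _) (Finset.mem_univ j)
    set y := ((LieAlgebra.ad ℂ L (T.f i)) ^ k) x
    rw [T.decomp y]
    have c0 : ∀ j, T.c y j = 0 := by
      intro j
      by_contra hne
      have := h2.c_eq hne
      rw [this, LinearMap.neg_apply, T.wt_hz] at hval
      have h6 : (-(T.ht j : ℤ)) = z - k * T.ht i := by exact_mod_cast hval
      have := hle j
      omega
    have d0 : ∀ j, T.d y j = 0 := by
      intro j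
      by_contra hne
      have := h2.d_eq hne
      rw [this, T.wt_hz] at hval
      have h6 : ((T.ht j : ℤ)) = z - k * T.ht i := by exact_mod_cast hval
      omega
    have p0 : T.pH y = 0 := by
      by_contra hne
      have := h2.pH_eq hne
      rw [this, LinearMap.zero_apply] at hval
      have h6 : ((0 : ℤ)) = z - k * T.ht i := by exact_mod_cast hval
      omega
    simp [c0, d0, p0]
  let S : Submodule ℂ L :=
    { carrier := {x | ∃ k, ((LieAlgebra.ad ℂ L (T.f i)) ^ k) x = 0}
      zero_mem' := ⟨0, by simp⟩
      add_mem' := by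
        rintro a b ⟨k, hk⟩ ⟨l, hl⟩
        exact ⟨max k l, by rw [map_add, pow_zero_of_le _ hk (le_max_left _ _),
          pow_zero_of_le _ hl (le_max_right _ _), add_zero]⟩
      smul_mem' := by
        rintro r a ⟨k, hk⟩
        exact ⟨k, by rw [map_smul, hk, smul_zero]⟩ }
  have : x ∈ S := by
    rw [T.decomp x]
    refine Submodule.add_mem _ (Submodule.add_mem _ ?_ ?_) ?_
    · exact Submodule.sum_mem _ fun j _ => Submodule.smul_mem _ _
        (hw _ _ (T.isW_f j) ⟨-(T.ht j), by simp [T.wt_hz]⟩)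
    · exact hw _ _ (T.isW_h _) ⟨0, by simp⟩
    · exact Submodule.sum_mem _ fun j _ => Submodule.smul_mem _ _
        (hw _ _ (T.isW_e j) ⟨T.ht j, by simp [T.wt_hz]⟩)
  exact this

/-- local nilpotence of `f i` on a quotient -/
theorem locnil_quot (B : Submodule ℂ (MvPolynomial ι ℂ)) (hB : T.Stab χ B) (i : ι) (k : ℕ)
    (hk : (T.act χ (T.f i) ^ k) 1 ∈ B) (q : MvPolynomial ι ℂ) :
    ∃ K, (T.qact χ B hB (T.f i) ^ K) (B.mkQ q) = 0 := by
  let S : Submodule ℂ (MvPolynomial ι ℂ) :=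
    { carrier := {q | ∃ K, (T.qact χ B hB (T.f i) ^ K) (B.mkQ q) = 0}
      zero_mem' := ⟨0, by simp⟩
      add_mem' := by
        rintro a b ⟨k, hk⟩ ⟨l, hl⟩
        exact ⟨max k l, by rw [map_add, map_add, pow_zero_of_le _ hk (le_max_left _ _),
          pow_zero_of_le _ hl (le_max_right _ _), add_zero]⟩
      smul_mem' := by
        rintro r a ⟨k, hk⟩
        exact ⟨k, by rw [map_smul, map_smul, hk, smul_zero]⟩ }
  have : q ∈ S := by
    refine (T.ind χ).mem_of_one S ⟨k, ?_⟩ ?_ q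
    · rw [qact_pow, Submodule.mkQ_apply, Submodule.Quotient.mk_eq_zero]; exact hk
    · rintro j p ⟨K, hK⟩
      obtain ⟨l, hl⟩ := T.ad_f_nil i (T.f j)
      obtain ⟨K', hK'⟩ := locnil_lie (T.qact_rep χ B hB) (T.f i) l (T.f j) hl K _ hK
      exact ⟨K', hK'⟩
  exact this

end TriData
end Vrm


set_option linter.unusedSectionVars false
set_option linter.unusedSimpArgs false

namespace Vrm
open MvPolynomial

variable {ι : Type} [Fintype ι] [LinearOrder ι] {L : Type*} [LieRing L] [LieAlgebra ℂ L]
    {H : Type*} [AddCommGroup H] [Module ℂ H]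

namespace TriData
variable (T : TriData ι L H)

/-- combinatorial root hypotheses -/
structure RootHyp (rho : Module.Dual ℂ H) (S : Set ι) : Prop where
  rho_S : ∀ g ∈ S, rho (T.co g) = 1
  indec : ∀ g ∈ S, ∀ (n : ℕ) (m : ι →₀ ℕ), T.wm m = n • T.wt g → m = Finsupp.single g n
  step : ∀ i, i ∉ S → ∃ g ∈ S, ∃ (j : ι) (k : ℕ), T.wt i (T.co g) = k ∧
    T.wt j = T.wt i - k • T.wt g ∧ T.co j = T.co i - (T.wt g (T.co i)) • T.co g ∧ T.ht j < T.ht i ∧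
    ∃ η : Module.Dual ℂ H, η (T.co i) = 0 ∧ η (T.co g) = 1

section evalt
variable (lam zt : Module.Dual ℂ H) (t : ℂ)

theorem eval_act (x : L) (p : MvPolynomial ι (Polynomial ℂ)) :
    MvPolynomial.map (Polynomial.evalRingHom t) (T.act (linf lam zt) x p) =
      T.act (lam + t • zt) x (MvPolynomial.map (Polynomial.evalRingHom t) p) := by
  letI : Algebra (Polynomial ℂ) ℂ := (Polynomial.evalRingHom t).toAlgebra
  haveI : IsScalarTower ℂ (Polynomial ℂ) ℂ := by
    refine IsScalarTower.of_algebraMap_eq fun z => ?_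
    change z = Polynomial.eval t (Polynomial.C z)
    simp
  have := T.map_act (S := ℂ) (linf lam zt) x p
  have e : bc ℂ (linf lam zt) = lam + t • zt := by
    ext h
    rw [bc_apply]
    change Polynomial.eval t _ = _
    simp [linf]; ring
  rw [e] at this
  exact this

theorem eval_pair (p q : MvPolynomial ι (Polynomial ℂ)) :
    (T.pair (linf lam zt) p q).eval t = T.pair (lam + t • zt)
      (MvPolynomial.map (Polynomial.evalRingHom t) p) (MvPolynomial.map (Polynomial.evalRingHom t) q) := by
  letI : Algebra (Polynomial ℂ) ℂ := (Polynomial.evalRingHom t).toAlgebra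
  haveI : IsScalarTower ℂ (Polynomial ℂ) ℂ := by
    refine IsScalarTower.of_algebraMap_eq fun z => ?_
    change z = Polynomial.eval t (Polynomial.C z)
    simp
  have := T.map_pair (S := ℂ) (linf lam zt) p q
  have e : bc ℂ (linf lam zt) = lam + t • zt := by
    ext h
    rw [bc_apply]
    change Polynomial.eval t _ = _
    simp [linf]; ring
  rw [e] at this
  exact this

theorem eval_gram (θ : Module.Dual ℂ H) :
    (T.gram (linf lam zt) θ).map (Polynomial.evalRingHom t) = T.gram (lam + t • zt) θ := by
  ext π m
  simp [gram, eval_pair]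

end evalt

/-- linear combination of monomials in `idx θ` -/
noncomputable def comb {R : Type*} [CommRing R] {θ : Module.Dual ℂ H} (w : T.idx θ → R) : MvPolynomial ι R :=
  ∑ m, w m • monomial m.1 1

theorem coeff_comb {R : Type*} [CommRing R] {θ : Module.Dual ℂ H} (w : T.idx θ → R) (m : T.idx θ) :
    coeff m.1 (T.comb w) = w m := by
  classical
  rw [comb, coeff_sum, Finset.sum_eq_single m]
  · simp
  · intro b _ hb
    rw [coeff_smul, coeff_monomial, if_neg, smul_zero]
    exact fun h => hb (Subtype.ext h)
  · simp

theorem comb_mem {R : Type*} [CommRing R] [Algebra ℂ R] {θ : Module.Dual ℂ H} (w : T.idx θ → R) :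
    T.comb w ∈ T.vw θ := by
  refine Submodule.sum_mem _ fun m _ => Submodule.smul_mem _ _ ?_
  have := T.mon_mem_vw (R := R) m.1
  rwa [T.mem_idx.1 m.2] at this

theorem eq_comb {R : Type*} [CommRing R] [Algebra ℂ R] {θ : Module.Dual ℂ H} {p : MvPolynomial ι R}
    (hp : p ∈ T.vw θ) : p = T.comb (fun m : T.idx θ => coeff m.1 p) := by
  ext m
  by_cases hm : T.wm m = θ
  · rw [T.coeff_comb (fun m : T.idx θ => coeff m.1 p) ⟨m, T.mem_idx.2 hm⟩]
  · have h1 : coeff m p = 0 := by by_contra h; exact hm (hp m h)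
    have h2 : coeff m (T.comb (fun m : T.idx θ => coeff m.1 p)) = 0 := by
      by_contra h; exact hm (T.comb_mem _ m h)
    rw [h1, h2]

/-- existence of a nonzero singular vector of given depth -/
def HasSing (χ θ : Module.Dual ℂ H) : Prop := ∃ q, q ≠ 0 ∧ T.IsSing (T.act χ) (χ - θ) q

theorem hasSing_closed (χ η θ : Module.Dual ℂ H) (h : {t : ℂ | T.HasSing (χ + t • η) θ}.Infinite) :
    T.HasSing χ θ := by
  classical
  let S : Matrix (Σ i : ι, T.idx (θ - T.wt i)) (T.idx θ) (Polynomial ℂ) := Matrix.of fun im m =>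
    coeff im.2.1 (T.act (linf χ η) (T.e im.1) (monomial m.1 1))
  have key : ∀ t (w : T.idx θ → ℂ), (S.map (Polynomial.evalRingHom t)).mulVec w = 0 ↔
      ∀ i, T.act (χ + t • η) (T.e i) (T.comb w) = 0 := by
    intro t w
    have e1 : ∀ im, (S.map (Polynomial.evalRingHom t)).mulVec w im =
        coeff im.2.1 (T.act (χ + t • η) (T.e im.1) (T.comb w)) := by
      intro im
      rw [comb, map_sum, coeff_sum, Matrix.mulVec, dotProduct]
      refine Finset.sum_congr rfl fun m _ => ?_
      rw [map_smul, coeff_smul, smul_eq_mul, mul_comm]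
      congr 1
      have := T.eval_act χ η t (T.e im.1) (monomial m.1 1)
      rw [map_monomial, (Polynomial.evalRingHom t).map_one] at this
      rw [← this, coeff_map]
      rfl
    constructor
    · intro h0 i
      have h2 := T.act_mem_vw (χ + t • η) (T.isW_e i) (T.comb_mem w)
      rw [T.eq_comb h2]
      rw [comb]
      refine Finset.sum_eq_zero fun m _ => ?_
      rw [← e1 ⟨i, m⟩, h0]; simp
    · intro h0
      ext im
      rw [e1, h0]; simp
  have := poly_ker S ?_
  · obtain ⟨w, hw, h0⟩ := this
    rw [key, zero_smul, add_zero] at h0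
    refine ⟨T.comb w, ?_, (T.sing_iff χ).2 ⟨T.comb_mem w, h0⟩⟩
    intro hc
    apply hw
    ext m
    rw [← T.coeff_comb w, hc]; simp
  · refine h.mono ?_
    rintro t ⟨q, hq0, hq⟩
    rw [sing_iff] at hq
    refine ⟨fun m => coeff m.1 q, ?_, ?_⟩
    · intro h0
      apply hq0
      rw [T.eq_comb hq.1, h0]; simp [comb]
    · rw [key, ← T.eq_comb hq.1]
      exact hq.2

theorem h_f2 (i : ι) : ⁅T.hh (T.co i), T.f i⁆ = -((2 : ℂ) • T.f i) := by
  rw [T.h_f, T.wt_co]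

variable {T} {rho : Module.Dual ℂ H} {S : Set ι} (hR : T.RootHyp rho S)
include hR

theorem RootHyp.base {g : ι} (hg : g ∈ S) {χ : Module.Dual ℂ H} {n : ℕ} (hn : 0 < n)
    (h : (χ + rho) (T.co g) = n) :
    T.IsSing (T.act χ) (χ - n • T.wt g) ((T.act χ (T.f g) ^ n) 1) := by
  have hvw : ∀ k : ℕ, (T.act χ (T.f g) ^ k) 1 ∈ T.vw (k • T.wt g) := by
    intro k
    induction k with
    | zero => simpa using T.one_vw
    | succ k ih =>
      rw [pow_succ', Module.End.mul_apply]
      have := T.act_mem_vw χ (T.isW_f g) ih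
      rwa [sub_neg_eq_add, ← succ_nsmul] at this
  rw [sing_iff]
  refine ⟨hvw n, fun i => ?_⟩
  by_cases hi : i = g
  · subst hi
    obtain ⟨k, rfl⟩ := Nat.exists_eq_succ_of_ne_zero hn.ne'
    have h1 := (T.one_sing χ)
    rw [Nat.succ_eq_add_one, sl2_e (T.isRep χ) (T.e_f i) (T.h_f2 i) (h1.2 i) (h1.1 _)]
    rw [LinearMap.add_apply, hR.rho_S i hg] at h
    have : χ (T.co i) - k = 0 := by push_cast at h; linear_combination h
    rw [this, mul_zero, zero_smul]
  · have h2 := T.act_mem_vw χ (T.isW_e i) (hvw n)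
    ext m
    rw [coeff_zero]
    by_contra hne
    have h3 := h2 m hne
    rw [eq_sub_iff_add_eq, ← T.wm_single i, ← map_add] at h3
    have h4 := hR.indec g hg n _ h3
    have h5 := DFunLike.congr_fun h4 i
    simp [Finsupp.single_apply, Ne.symm hi] at h5

theorem RootHyp.hasSing (N : ℕ) : ∀ (i : ι), T.ht i ≤ N → ∀ (χ : Module.Dual ℂ H) (n : ℕ), 0 < n →
    (χ + rho) (T.co i) = n → T.HasSing χ (n • T.wt i) := by
  induction N with
  | zero => intro i hi; have := T.ht_pos i; omega
  | succ N ih =>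
    intro i hi χ n hn hχ
    by_cases hiS : i ∈ S
    · refine ⟨_, ?_, hR.base hiS hn hχ⟩
      intro h0
      exact one_ne_zero (T.act_f_pow_inj χ i n h0)
    obtain ⟨g, hg, j, k, h1, h2, h3, h4, η, h5, h6⟩ := hR.step i hiS
    have special : ∀ (χ : Module.Dual ℂ H) (p : ℕ), 0 < p → (χ + rho) (T.co i) = n →
        (χ + rho) (T.co g) = -p → T.HasSing χ (n • T.wt i) := by
      clear hχ χ
      intro χ p hp hχ hχg
      set χ' := χ + p • T.wt g with hχ'
      have e1 : (χ' + rho) (T.co g) = p := by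
        rw [LinearMap.add_apply] at hχg
        simp only [hχ', LinearMap.add_apply, LinearMap.smul_apply, T.wt_co, nsmul_eq_mul]
        linear_combination hχg
      have e2 : (χ' + rho) (T.co j) = n := by
        rw [LinearMap.add_apply] at hχg hχ
        simp only [hχ', LinearMap.add_apply, LinearMap.smul_apply, T.wt_co, nsmul_eq_mul, h3, map_sub,
          map_smul, smul_eq_mul]
        linear_combination hχ - (T.wt g (T.co i)) * hχg
      obtain ⟨u, hu0, hu⟩ := ih j (by omega) χ' n hn e2
      have hs := hR.base hg hp e1
      have eχ : χ' - p • T.wt g = χ := by rw [hχ']; simp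
      rw [eχ] at hs
      set q := (T.act χ' (T.f g) ^ p) 1 with hq
      have hq0 : q ≠ 0 := fun h0 => one_ne_zero (T.act_f_pow_inj χ' g p h0)
      set B := LinearMap.range (T.hom (T.act χ') q) with hBdef
      have hB : T.Stab χ' B := T.range_stab χ' hs
      -- weight of u
      have hwu : (χ' - n • T.wt j) (T.co g) = ((p + n * k - 1 : ℕ) : ℂ) := by
        have : 1 ≤ p + n * k := by omega
        rw [LinearMap.add_apply, hR.rho_S g hg] at e1
        rw [Nat.cast_sub this]
        simp only [h2, LinearMap.sub_apply, LinearMap.smul_apply, nsmul_eq_mul, h1, T.wt_co]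
        push_cast
        linear_combination e1
      have hnil : (T.qact χ' B hB (T.f g) ^ (p + n * k)) (B.mkQ u) = 0 := by
        by_cases hu0' : B.mkQ u = 0
        · rw [hu0', map_zero]
        · obtain ⟨l, hl, hl'⟩ := sl2_nat (T.qact_rep χ' B hB) (T.e_f g) (T.h_f2 g) (n := B.mkQ u)
            (μ := (χ' - n • T.wt j) (T.co g)) (by rw [qact_mk, hu.2 g, map_zero])
            (by rw [qact_mk, hu.1, map_smul]) hu0'
            (T.locnil_quot χ' B hB g p ⟨1, T.hom_one _ _⟩ u)
          rw [hwu] at hl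
          have : p + n * k = l + 1 := by
            have : p + n * k - 1 = l := by exact_mod_cast hl
            omega
          rw [this]; exact hl'
      rw [qact_pow, Submodule.mkQ_apply, Submodule.Quotient.mk_eq_zero] at hnil
      obtain ⟨y, hy⟩ := hnil
      -- the vector is singular
      have hsing : T.IsSing (T.act χ') (χ' - n • T.wt j - (p + n * k) • T.wt g)
          ((T.act χ' (T.f g) ^ (p + n * k)) u) := by
        have hb := hR.base hg (χ := χ' - n • T.wt j) (n := p + n * k) (by omega) (by
          rw [LinearMap.add_apply, hwu, hR.rho_S g hg, Nat.cast_sub (by omega)]; push_cast; ring)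
        have e9 := T.hom_pow (T.act χ') (T.isRep χ') hu (T.f g) 1 (p + n * k)
        rw [T.hom_one] at e9
        rw [← e9]
        constructor
        · intro h
          rw [← T.hom_act _ (T.isRep χ') hu, hb.1, map_smul]
        · intro a
          rw [← T.hom_act _ (T.isRep χ') hu, hb.2, map_zero]
      refine ⟨y, ?_, ?_, ?_⟩
      · rintro rfl
        rw [map_zero] at hy
        exact hu0 (T.act_f_pow_inj χ' g _ hy.symm)
      · intro h
        apply T.hom_inj χ' hq0
        rw [T.hom_act _ (T.isRep χ') hs, hy, hsing.1, map_smul, hy]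
        congr 1
        simp only [h2, hχ', LinearMap.sub_apply, LinearMap.add_apply, LinearMap.smul_apply, nsmul_eq_mul]
        push_cast; ring
      · intro a
        apply T.hom_inj χ' hq0
        rw [T.hom_act _ (T.isRep χ') hs, hy, hsing.2, map_zero]
    apply T.hasSing_closed χ η
    refine Set.infinite_of_injective_forall_mem (f := fun p : ℕ => - (χ + rho) (T.co g) - (p + 1 : ℕ)) ?_ ?_
    · intro a b hab
      have : ((a + 1 : ℕ) : ℂ) = (b + 1 : ℕ) := by simpa using hab
      have : a + 1 = b + 1 := by exact_mod_cast this
      omega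
    · intro p
      refine special _ (p + 1) (Nat.succ_pos p) ?_ ?_
      · rw [add_right_comm, LinearMap.add_apply, hχ, LinearMap.smul_apply, h5]; simp
      · simp only [LinearMap.add_apply, LinearMap.smul_apply, h6, smul_eq_mul]; push_cast; ring

end TriData
end Vrm


set_option linter.unusedSectionVars false
set_option linter.unusedSimpArgs false

namespace Vrm
open Polynomial

variable {n : Type*} [Fintype n] [DecidableEq n]

/-- Jantzen type filtration attached to a polynomial matrix at `t0` -/
def Mfil (G : Matrix n n ℂ[X]) (t0 : ℂ) (i : ℕ) : Submodule ℂ (n → ℂ) where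
  carrier := {v | ∃ x : n → ℂ[X], (∀ k, (X - C t0) ^ i ∣ (G.mulVec x) k) ∧ ∀ k, v k = (x k).eval t0}
  zero_mem' := ⟨0, by simp, by simp⟩
  add_mem' := by
    rintro a b ⟨x, hx, hx'⟩ ⟨y, hy, hy'⟩
    refine ⟨x + y, fun k => ?_, fun k => ?_⟩
    · rw [Matrix.mulVec_add]; exact dvd_add (hx k) (hy k)
    · simp [hx', hy']
  smul_mem' := by
    rintro a b ⟨x, hx, hx'⟩
    refine ⟨(C a : ℂ[X]) • x, fun k => ?_, fun k => ?_⟩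
    · rw [Matrix.mulVec_smul]; exact Dvd.dvd.mul_left (hx k) _
    · simp [hx']

theorem exists_smith (G : Matrix n n ℂ[X]) (hG : G.det ≠ 0) :
    ∃ (P P' B B' : Matrix n n ℂ[X]) (a : n → ℂ[X]), P * P' = 1 ∧ B * B' = 1 ∧
      G * P = B * Matrix.diagonal a := by
  have hinj : Function.Injective G.mulVecLin := Matrix.mulVec_injective_of_det_ne_zero hG
  have hr : Module.finrank ℂ[X] (LinearMap.range G.mulVecLin) = Module.finrank ℂ[X] (n → ℂ[X]) :=
    LinearMap.finrank_range_of_inj hinj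
  obtain ⟨b, a, ab, h⟩ := Submodule.exists_smith_normal_form_of_rank_eq (Pi.basisFun ℂ[X] n) hr
  let e := LinearEquiv.ofInjective G.mulVecLin hinj
  let c := ab.map e.symm
  refine ⟨(Pi.basisFun ℂ[X] n).toMatrix c, _, (Pi.basisFun ℂ[X] n).toMatrix b, _, a,
    Module.Basis.toMatrix_mul_toMatrix_flip _ _, Module.Basis.toMatrix_mul_toMatrix_flip _ _, ?_⟩
  ext k j
  have h1 : G.mulVec (c j) = a j • b j := by
    rw [← h]
    have : e (c j) = ab j := by simp [c]
    rw [← this]; rfl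
  have h2 := congrFun h1 k
  rw [Matrix.mul_diagonal, Matrix.mul_apply]
  simp only [Module.Basis.toMatrix_apply, Pi.basisFun_repr]
  rw [Pi.smul_apply, smul_eq_mul] at h2
  rw [mul_comm, ← h2]; rfl

theorem mulVec_dvd (B : Matrix n n ℂ[X]) {d : ℂ[X]} {y : n → ℂ[X]} (h : ∀ k, d ∣ y k) (k : n) :
    d ∣ B.mulVec y k := Finset.dvd_sum fun j _ => Dvd.dvd.mul_left (h j) _

theorem eval_mulVec (t : ℂ) (B : Matrix n n ℂ[X]) (y : n → ℂ[X]) (k : n) :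
    (B.mulVec y k).eval t = (B.map (evalRingHom t)).mulVec (fun j => (y j).eval t) k := by
  rw [Matrix.mulVec, dotProduct, eval_finsetSum]
  simp [Matrix.mulVec, dotProduct]

open Classical in
theorem finrank_Mfil (G : Matrix n n ℂ[X]) (t0 : ℂ) {P P' B B' : Matrix n n ℂ[X]} {a : n → ℂ[X]}
    (hP : P * P' = 1) (hB : B * B' = 1) (h : G * P = B * Matrix.diagonal a) (i : ℕ) :
    Module.finrank ℂ (Mfil G t0 i) = (Finset.univ.filter fun j => (X - C t0) ^ i ∣ a j).card := by
  have hP2 : P' * P = 1 := mul_eq_one_comm.1 hP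
  have hB2 : B' * B = 1 := mul_eq_one_comm.1 hB
  set P0 := P.map (evalRingHom t0) with hP0
  have hu : IsUnit P0 := by
    have : P0 * (P'.map (evalRingHom t0)) = 1 := by
      rw [hP0, ← Matrix.map_mul, hP]; simp
    exact IsUnit.of_mul_eq_one _ this
  have hli : LinearIndependent ℂ P0.col := Matrix.linearIndependent_cols_iff_isUnit.2 hu
  have hli2 : LinearIndependent ℂ (fun j : {j // (X - C t0) ^ i ∣ a j} => P0.col j.1) :=
    hli.comp _ Subtype.val_injective
  have hM : Mfil G t0 i = Submodule.span ℂ (Set.range (fun j : {j // (X - C t0) ^ i ∣ a j} => P0.col j.1)) := by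
    apply le_antisymm
    · rintro v ⟨x, hx, hv⟩
      set y := P'.mulVec x with hy
      have hxy : x = P.mulVec y := by rw [hy, Matrix.mulVec_mulVec, hP, Matrix.one_mulVec]
      have h1 : ∀ j, (X - C t0) ^ i ∣ a j * y j := by
        intro j
        have h2 : B'.mulVec (G.mulVec x) = (Matrix.diagonal a).mulVec y := by
          rw [hxy, Matrix.mulVec_mulVec, Matrix.mulVec_mulVec, Matrix.mul_assoc, h, ← Matrix.mul_assoc, hB2,
            Matrix.one_mul]
        have := mulVec_dvd B' hx j
        rwa [h2, Matrix.mulVec_diagonal] at this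
      have hv2 : v = P0.mulVec (fun j => (y j).eval t0) := by
        ext k; rw [hv, hxy, eval_mulVec]
      have hv3 : P0.mulVec (fun j => (y j).eval t0) = ∑ j, (y j).eval t0 • P0.col j := by
        ext k
        simp [Matrix.mulVec, dotProduct, mul_comm, Finset.sum_apply]
      rw [hv2, hv3]
      refine Submodule.sum_mem _ fun j _ => ?_
      by_cases hj : (X - C t0) ^ i ∣ a j
      · exact Submodule.smul_mem _ _ (Submodule.subset_span ⟨⟨j, hj⟩, rfl⟩)
      · have : (y j).eval t0 = 0 := by
          by_contra hne
          apply hj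
          refine IsCoprime.dvd_of_dvd_mul_right (z := y j) ?_ (h1 j)
          apply IsCoprime.pow_left
          rw [(prime_X_sub_C t0).irreducible.coprime_iff_not_dvd, dvd_iff_isRoot]
          exact hne
        rw [this]; simp
    · rw [Submodule.span_le]
      rintro _ ⟨⟨j, hj⟩, rfl⟩
      refine ⟨P.mulVec (Pi.single j 1), fun k => ?_, fun k => ?_⟩
      · rw [Matrix.mulVec_mulVec, h, ← Matrix.mulVec_mulVec]
        apply mulVec_dvd
        intro l
        rw [Matrix.mulVec_diagonal]
        by_cases hl : l = j
        · subst hl; simpa using hj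
        · simp [hl]
      · simp [hP0]
  rw [hM, finrank_span_eq_card hli2, Fintype.card_subtype]

theorem sum_Mfil (G : Matrix n n ℂ[X]) (hG : G.det ≠ 0) (t0 : ℂ) (N : ℕ)
    (hN : G.det.rootMultiplicity t0 ≤ N) :
    ∑ i ∈ Finset.Icc 1 N, Module.finrank ℂ (Mfil G t0 i) = G.det.rootMultiplicity t0 := by
  classical
  obtain ⟨P, P', B, B', a, hP, hB, h⟩ := exists_smith G hG
  have hdet : G.det * P.det = B.det * ∏ j, a j := by
    rw [← Matrix.det_mul, h, Matrix.det_mul, Matrix.det_diagonal]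
  have unitroot : ∀ Q Q' : Matrix n n ℂ[X], Q * Q' = 1 → Q.det ≠ 0 ∧ Q.det.rootMultiplicity t0 = 0 := by
    intro Q Q' hQ
    have : Q.det * Q'.det = 1 := by rw [← Matrix.det_mul, hQ, Matrix.det_one]
    have h0 : Q.det ≠ 0 := left_ne_zero_of_mul (by rw [this]; exact one_ne_zero)
    refine ⟨h0, ?_⟩
    rw [rootMultiplicity_eq_zero_iff]
    intro hr
    exfalso
    have := congrArg (eval t0) this
    rw [eval_mul, hr.eq_zero] at this
    simp at this
  have hP1 := unitroot P P' hP
  have hB1 := unitroot B B' hB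
  have hne : G.det * P.det ≠ 0 := mul_ne_zero hG hP1.1
  have h2 : G.det.rootMultiplicity t0 = (∏ j, a j).rootMultiplicity t0 := by
    have e1 := rootMultiplicity_mul (x := t0) hne
    rw [hP1.2, add_zero] at e1
    rw [← e1, hdet, rootMultiplicity_mul (hdet ▸ hne), hB1.2, zero_add]
  have hne2 : ∏ j, a j ≠ 0 := right_ne_zero_of_mul (hdet ▸ hne)
  have haj : ∀ j, a j ≠ 0 := fun j => Finset.prod_ne_zero_iff.1 hne2 j (Finset.mem_univ j)
  have hprod : ∀ s : Finset n, (∏ j ∈ s, a j).rootMultiplicity t0 = ∑ j ∈ s, (a j).rootMultiplicity t0 := by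
    intro s
    induction s using Finset.induction_on with
    | empty => simp [← C_1, -map_one]
    | insert j s hj ih =>
      rw [Finset.prod_insert hj, Finset.sum_insert hj, rootMultiplicity_mul, ih]
      exact mul_ne_zero (haj j) (Finset.prod_ne_zero_iff.2 fun k _ => haj k)
  rw [h2, hprod]
  have hle : ∀ j, (a j).rootMultiplicity t0 ≤ N := by
    intro j
    refine le_trans ?_ hN
    rw [h2, hprod]
    exact Finset.single_le_sum (f := fun j => (a j).rootMultiplicity t0) (fun _ _ => Nat.zero_le _) (Finset.mem_univ j)
  simp_rw [finrank_Mfil G t0 hP hB h, Finset.card_filter]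
  rw [Finset.sum_comm]
  refine Finset.sum_congr rfl fun j _ => ?_
  rw [← Finset.card_filter]
  have : (Finset.Icc 1 N).filter (fun i => (X - C t0) ^ i ∣ a j) = Finset.Icc 1 ((a j).rootMultiplicity t0) := by
    ext i
    simp only [Finset.mem_filter, Finset.mem_Icc]
    rw [← le_rootMultiplicity_iff (haj j)]
    have := hle j
    omega
  rw [this]; simp

theorem Mfil_one (G : Matrix n n ℂ[X]) (t0 : ℂ) (v : n → ℂ) :
    v ∈ Mfil G t0 1 ↔ (G.map (evalRingHom t0)).mulVec v = 0 := by
  constructor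
  · rintro ⟨x, hx, hv⟩
    ext k
    have := hx k
    rw [pow_one, dvd_iff_isRoot] at this
    have h2 := eval_mulVec t0 G x k
    rw [this.eq_zero] at h2
    rw [Pi.zero_apply, h2]
    congr 1
    funext j; exact hv j
  · intro h
    refine ⟨fun j => C (v j), fun k => ?_, by simp⟩
    rw [pow_one, dvd_iff_isRoot]
    change eval _ _ = _
    rw [eval_mulVec]
    have := congrFun h k
    simpa using this

theorem corank_le (G : Matrix n n ℂ[X]) (hG : G.det ≠ 0) (t0 : ℂ) (W : Submodule ℂ (n → ℂ))
    (hW : ∀ v ∈ W, (G.map (evalRingHom t0)).mulVec v = 0) :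
    Module.finrank ℂ W ≤ G.det.rootMultiplicity t0 := by
  have h1 : W ≤ Mfil G t0 1 := fun v hv => (Mfil_one G t0 v).2 (hW v hv)
  refine (Submodule.finrank_mono h1).trans ?_
  rw [← sum_Mfil G hG t0 _ (Nat.le_succ _)]
  exact Finset.single_le_sum (f := fun i => Module.finrank ℂ (Mfil G t0 i)) (fun _ _ => Nat.zero_le _)
    (by simp)

end Vrm


set_option linter.unusedSectionVars false
set_option linter.unusedSimpArgs false

namespace Vrm
open MvPolynomial

variable {ι : Type} [Fintype ι] [LinearOrder ι] {L : Type*} [LieRing L] [LieAlgebra ℂ L]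
    {H : Type*} [AddCommGroup H] [Module ℂ H]

namespace TriData
variable (T : TriData ι L H)

/-- number of partitions -/
noncomputable def cnt (θ : Module.Dual ℂ H) : ℕ := (T.idx θ).card

theorem wm_single_n (i : ι) (n : ℕ) : T.wm (Finsupp.single i n) = n • T.wt i := by
  simp [wm]

theorem card_ge (θ : Module.Dual ℂ H) (i : ι) (n : ℕ) :
    ((T.idx θ).filter fun π => n ≤ π i).card = T.cnt (θ - n • T.wt i) := by
  classical
  refine Finset.card_bij' (fun π _ => π - Finsupp.single i n) (fun π _ => π + Finsupp.single i n) ?_ ?_ ?_ ?_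
  · intro π hπ
    rw [Finset.mem_filter, mem_idx] at hπ
    rw [mem_idx, eq_sub_iff_add_eq, ← T.wm_single_n, ← map_add, tsub_add_cancel_of_le, hπ.1]
    simpa using hπ.2
  · intro π hπ
    rw [mem_idx] at hπ
    rw [Finset.mem_filter, mem_idx, map_add, T.wm_single_n, hπ]
    simp
  · intro π hπ
    rw [Finset.mem_filter, mem_idx] at hπ
    exact tsub_add_cancel_of_le (by simpa using hπ.2)
  · intro π _
    simp

theorem sum_degree (θ : Module.Dual ℂ H) (N : ℕ) (hN : ∀ π ∈ T.idx θ, ∀ i, π i ≤ N) :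
    ∑ π ∈ T.idx θ, π.degree = ∑ i, ∑ n ∈ Finset.Icc 1 N, T.cnt (θ - n • T.wt i) := by
  have : ∀ π ∈ T.idx θ, π.degree = ∑ i, ∑ n ∈ Finset.Icc 1 N, if n ≤ π i then 1 else 0 := by
    intro π hπ
    rw [Finsupp.degree_eq_sum]
    refine Finset.sum_congr rfl fun i _ => ?_
    rw [← Finset.card_filter]
    have : (Finset.Icc 1 N).filter (fun n => n ≤ π i) = Finset.Icc 1 (π i) := by
      ext n
      simp only [Finset.mem_filter, Finset.mem_Icc]
      have := hN π hπ i
      omega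
    rw [this]; simp
  rw [Finset.sum_congr rfl this, Finset.sum_comm]
  refine Finset.sum_congr rfl fun i _ => ?_
  rw [Finset.sum_comm]
  refine Finset.sum_congr rfl fun n _ => ?_
  rw [← T.card_ge, Finset.card_filter]

section rad
variable {R : Type*} [CommRing R] [Algebra ℂ R]

/-- radical of the pairing -/
noncomputable def rad (χ : H →ₗ[ℂ] R) : Submodule R (MvPolynomial ι R) := LinearMap.ker (T.pair χ).flip

theorem mem_rad {χ : H →ₗ[ℂ] R} {q : MvPolynomial ι R} : q ∈ T.rad χ ↔ ∀ p, T.pair χ p q = 0 := by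
  rw [rad, LinearMap.mem_ker]
  constructor
  · intro h p
    exact LinearMap.congr_fun h p
  · intro h
    exact LinearMap.ext h

end rad

theorem rad_stab (χ : Module.Dual ℂ H) : T.Stab χ (T.rad χ) := by
  intro x q hq
  rw [mem_rad] at hq ⊢
  intro p
  have := T.pair_act χ x p q
  rw [hq] at this
  exact (neg_eq_zero.1 this.symm)

theorem le_rad (χ : Module.Dual ℂ H) (A : Submodule ℂ (MvPolynomial ι ℂ)) (hA : T.Stab χ A)
    (h0 : ∀ q ∈ A, coeff 0 q = 0) : A ≤ T.rad χ := by
  let P : Submodule ℂ (MvPolynomial ι ℂ) :=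
    { carrier := {p | ∀ q ∈ A, T.pair χ p q = 0}
      zero_mem' := by simp
      add_mem' := fun {a b} ha hb q hq => by rw [map_add, LinearMap.add_apply, ha q hq, hb q hq, add_zero]
      smul_mem' := fun c a ha q hq => by rw [map_smul, LinearMap.smul_apply, ha q hq, smul_zero] }
  have h1 : ∀ p, p ∈ P := by
    intro p
    refine (T.op.ind (-χ)).mem_of_one P ?_ ?_ p
    · intro q hq
      rw [pair_one, h0 q hq]
    · intro i p hp q hq
      have := T.pair_act χ (T.op.f i) p q
      have h2 := hp _ (hA (T.op.f i) q hq)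
      rw [h2, neg_zero] at this
      exact this
  intro q hq
  rw [mem_rad]
  exact fun p => h1 p q hq

theorem range_le_rad (χ : Module.Dual ℂ H) {θ : Module.Dual ℂ H} {q : MvPolynomial ι ℂ}
    (hq : T.IsSing (T.act χ) (χ - θ) q) (hθ : ∀ m, T.wm m ≠ - θ) :
    LinearMap.range (T.hom (T.act χ) q) ≤ T.rad χ := by
  apply T.le_rad χ _ (T.range_stab χ hq)
  rintro _ ⟨p, rfl⟩
  induction p using MvPolynomial.induction_on' with
  | add p r hp hr => rw [map_add, coeff_add, hp, hr, add_zero]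
  | monomial m a =>
    have e : (monomial m a : MvPolynomial ι ℂ) = a • monomial m 1 := by simp [smul_monomial]
    rw [e, map_smul, coeff_smul]
    have h1 := T.hom_vw χ ((T.sing_iff χ).1 hq).1 (T.mon_mem_vw (R := ℂ) m)
    by_contra hne
    have h2 := h1 0 (right_ne_zero_of_mul hne)
    rw [map_zero] at h2
    exact hθ m (eq_neg_of_add_eq_zero_right h2.symm)

theorem gram_mulVec {R : Type*} [CommRing R] [Algebra ℂ R] (χ : H →ₗ[ℂ] R) (θ : Module.Dual ℂ H) (w : T.idx θ → R) (π : T.idx θ) :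
    (T.gram χ θ).mulVec w π = T.pair χ (monomial π.1 1) (T.comb w) := by
  rw [comb, map_sum, Matrix.mulVec, dotProduct]
  refine Finset.sum_congr rfl fun m _ => ?_
  rw [map_smul, smul_eq_mul, mul_comm]; rfl

/-- comb as a linear map -/
noncomputable def combL {R : Type*} [CommRing R] (θ : Module.Dual ℂ H) : (T.idx θ → R) →ₗ[R] MvPolynomial ι R where
  toFun := T.comb
  map_add' a b := by simp [comb, add_smul, Finset.sum_add_distrib]
  map_smul' a b := by simp only [comb, RingHom.id_apply, Finset.smul_sum, smul_smul, Pi.smul_apply, smul_eq_mul]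

theorem combL_apply {R : Type*} [CommRing R] (θ : Module.Dual ℂ H) (w : T.idx θ → R) : T.combL θ w = T.comb w := rfl

theorem combL_inj {R : Type*} [CommRing R] (θ : Module.Dual ℂ H) : Function.Injective (T.combL (R := R) θ) := by
  intro a b h
  ext m
  rw [← T.coeff_comb a, ← T.coeff_comb b]
  exact congrArg _ h

theorem range_combL {R : Type*} [CommRing R] [Algebra ℂ R] (θ : Module.Dual ℂ H) :
    LinearMap.range (T.combL (R := R) θ) = T.vw θ := by
  apply le_antisymm
  · rintro _ ⟨w, rfl⟩; exact T.comb_mem w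
  · intro p hp; exact ⟨_, (T.eq_comb hp).symm⟩

theorem finrank_vw (θ : Module.Dual ℂ H) : Module.finrank ℂ (T.vw (R := ℂ) θ) = T.cnt θ := by
  rw [← range_combL, LinearMap.finrank_range_of_inj (T.combL_inj θ)]
  simp [cnt]

theorem fin_vw (θ : Module.Dual ℂ H) : FiniteDimensional ℂ (T.vw (R := ℂ) θ) := by
  rw [← range_combL]; infer_instance

theorem wm_ne_neg {i : ι} {n : ℕ} (hn : 0 < n) (m : ι →₀ ℕ) : T.wm m ≠ - (n • T.wt i) := by
  intro h
  rw [← T.wm_single_n, eq_neg_iff_add_eq_zero, ← map_add] at h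
  have := DFunLike.congr_fun (T.wm_eq_zero h) i
  simp at this
  omega

theorem exists_ker (χ : Module.Dual ℂ H) {i : ι} {n : ℕ} (hn : 0 < n) (h : T.HasSing χ (n • T.wt i))
    (θ : Module.Dual ℂ H) :
    ∃ W : Submodule ℂ (T.idx θ → ℂ), Module.finrank ℂ W = T.cnt (θ - n • T.wt i) ∧
      ∀ v ∈ W, (T.gram χ θ).mulVec v = 0 := by
  obtain ⟨q, hq0, hq⟩ := h
  have hrad := T.range_le_rad χ hq (T.wm_ne_neg hn)
  let A := (T.vw (R := ℂ) (θ - n • T.wt i)).map (T.hom (T.act χ) q)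
  have hA : A ≤ LinearMap.range (T.combL (R := ℂ) θ) := by
    rw [range_combL]
    rintro _ ⟨p, hp, rfl⟩
    have := T.hom_vw χ ((T.sing_iff χ).1 hq).1 hp
    rwa [add_sub_cancel] at this
  refine ⟨A.comap (T.combL θ), ?_, ?_⟩
  · have e1 : (A.comap (T.combL θ)).map (T.combL θ) = A := by
      rw [Submodule.map_comap_eq, inf_eq_right]; exact hA
    rw [← T.finrank_vw]
    have e2 : Module.finrank ℂ A = Module.finrank ℂ (T.vw (R := ℂ) (θ - n • T.wt i)) :=
      LinearEquiv.finrank_eq (Submodule.equivMapOfInjective _ (T.hom_inj χ hq0) _).symm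
    rw [← e2]
    conv_rhs => rw [← e1]
    exact LinearEquiv.finrank_eq (Submodule.equivMapOfInjective _ (T.combL_inj θ) _)
  · intro v hv
    ext π
    rw [gram_mulVec]
    obtain ⟨p, _, hp2⟩ := hv
    rw [combL_apply] at hp2
    rw [← hp2]
    exact T.mem_rad.1 (hrad ⟨p, rfl⟩) _

end TriData
end Vrm


set_option linter.unusedSectionVars false
set_option linter.unusedSimpArgs false

namespace Vrm
open Polynomial

variable {ι : Type} [Fintype ι] [LinearOrder ι] {L : Type*} [LieRing L] [LieAlgebra ℂ L]
    {H : Type*} [AddCommGroup H] [Module ℂ H]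

theorem rootMult_prod {α : Type*} (t0 : ℂ) (s : Finset α) (a : α → ℂ[X]) (h : ∀ j ∈ s, a j ≠ 0) :
    (∏ j ∈ s, a j).rootMultiplicity t0 = ∑ j ∈ s, (a j).rootMultiplicity t0 := by
  classical
  induction s using Finset.induction_on with
  | empty => simp [← C_1, -map_one]
  | insert j s hj ih =>
    rw [Finset.prod_insert hj, Finset.sum_insert hj, rootMultiplicity_mul, ih]
    · exact fun k hk => h k (Finset.mem_insert_of_mem hk)
    · exact mul_ne_zero (h j (Finset.mem_insert_self _ _))
        (Finset.prod_ne_zero_iff.2 fun k hk => h k (Finset.mem_insert_of_mem hk))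

/-- a polynomial with enough roots factors -/
theorem eq_prod_of_roots {α : Type*} (s : Finset α) (r : α → ℂ) (P : α → ℕ)
    (hr : Set.InjOn r s) (D : ℂ[X]) (c : ℂ) (hc : c ≠ 0) (hdeg : D.natDegree ≤ ∑ a ∈ s, P a)
    (hcoeff : D.coeff (∑ a ∈ s, P a) = c) (hm : ∀ a ∈ s, P a ≤ D.rootMultiplicity (r a)) :
    D = C c * ∏ a ∈ s, (X - C (r a)) ^ P a := by
  have hD : D ≠ 0 := by rintro rfl; simp at hcoeff; exact hc hcoeff.symm
  have hdvd : ∏ a ∈ s, (X - C (r a)) ^ P a ∣ D := by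
    refine Finset.prod_dvd_of_coprime ?_ ?_
    · intro a ha b hb hab
      apply IsCoprime.pow
      apply isCoprime_X_sub_C_of_isUnit_sub
      exact (sub_ne_zero.2 fun h => hab (hr ha hb h)).isUnit
    · intro a ha
      exact (le_rootMultiplicity_iff hD).1 (hm a ha)
  have hmon : (∏ a ∈ s, (X - C (r a)) ^ P a).Monic := monic_prod_of_monic _ _ fun a _ => (monic_X_sub_C _).pow _
  have hnd : (∏ a ∈ s, (X - C (r a)) ^ P a).natDegree = ∑ a ∈ s, P a := by
    rw [natDegree_prod_of_monic _ _ fun a _ => (monic_X_sub_C _).pow _]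
    refine Finset.sum_congr rfl fun a _ => ?_
    rw [(monic_X_sub_C _).natDegree_pow]; simp
  obtain ⟨Q, hQ⟩ := hdvd
  have hQ0 : Q ≠ 0 := by rintro rfl; simp at hQ; exact hD hQ
  have h1 : D.natDegree = ∑ a ∈ s, P a + Q.natDegree := by
    rw [hQ, hmon.natDegree_mul' hQ0, hnd]
  have h2 : Q.natDegree = 0 := by omega
  rw [natDegree_eq_zero] at h2
  obtain ⟨q, rfl⟩ := h2
  rw [hQ, mul_comm, coeff_C_mul] at hcoeff
  rw [← hnd, hmon.coeff_natDegree, mul_one] at hcoeff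
  rw [hQ, hcoeff, mul_comm]

namespace TriData
variable (T : TriData ι L H)

theorem eval_det (lam zt θ : Module.Dual ℂ H) (t : ℂ) [DecidableEq (T.idx θ)] :
    (T.gram (linf lam zt) θ).det.eval t = (T.gram (lam + t • zt) θ).det := by
  rw [← T.eval_gram lam zt t]
  exact (RingHom.map_det (evalRingHom t) _)

variable {T} {rho : Module.Dual ℂ H} {S : Set ι} (hR : T.RootHyp rho S)
include hR

theorem RootHyp.det_generic (hrho : ∀ i, rho (T.co i) ≠ 0) (lam θ : Module.Dual ℂ H) [DecidableEq (T.idx θ)]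
    (N : ℕ) (hN : ∀ π ∈ T.idx θ, ∀ i, π i ≤ N)
    (hinj : Set.InjOn (fun a : ι × ℕ => ((a.2 : ℂ) - (lam + rho) (T.co a.1)) / rho (T.co a.1))
      ((Finset.univ ×ˢ Finset.Icc 1 N : Finset (ι × ℕ)) : Set (ι × ℕ))) :
    (T.gram (linf lam rho) θ).det = C (∏ π ∈ T.idx θ, T.lu rho π) *
      ∏ a ∈ Finset.univ ×ˢ Finset.Icc 1 N,
        (X - C (((a.2 : ℂ) - (lam + rho) (T.co a.1)) / rho (T.co a.1))) ^ T.cnt (θ - a.2 • T.wt a.1) := by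
  have hc : ∏ π ∈ T.idx θ, T.lu rho π ≠ 0 := Finset.prod_ne_zero_iff.2 fun π _ => T.lu_ne rho hrho π
  have hl := T.det_gram_lead lam rho θ
  rw [T.sum_degree θ N hN] at hl
  rw [← Finset.sum_product' Finset.univ (Finset.Icc 1 N) (fun i n => T.cnt (θ - n • T.wt i))] at hl
  refine eq_prod_of_roots (Finset.univ ×ˢ Finset.Icc 1 N)
    (fun a : ι × ℕ => ((a.2 : ℂ) - (lam + rho) (T.co a.1)) / rho (T.co a.1))
    (fun a => T.cnt (θ - a.2 • T.wt a.1)) hinj _ _ hc hl.1 hl.2 ?_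
  rintro ⟨i, n⟩ ha
  simp only [Finset.mem_product, Finset.mem_Icc, Finset.mem_univ, true_and] at ha
  set t0 := ((n : ℂ) - (lam + rho) (T.co i)) / rho (T.co i) with ht0
  have h1 : ((lam + t0 • rho) + rho) (T.co i) = n := by
    rw [add_right_comm, LinearMap.add_apply, LinearMap.smul_apply, ht0, smul_eq_mul, div_mul_cancel₀ _ (hrho i)]
    ring
  obtain ⟨W, hW, hW2⟩ := T.exists_ker (lam + t0 • rho) ha.1 (hR.hasSing _ i le_rfl _ n ha.1 h1) θ
  dsimp only
  rw [← hW]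
  apply corank_le
  · intro h0
    rw [h0] at hl
    simp at hl
    exact hc hl.symm
  · intro v hv
    rw [T.eval_gram]
    exact hW2 v hv

theorem RootHyp.det_eq (hrho : ∀ i, rho (T.co i) ≠ 0) {η : Module.Dual ℂ H}
    (hη : ∀ i j, i ≠ j → η (T.co i) * rho (T.co j) ≠ η (T.co j) * rho (T.co i))
    (lam θ : Module.Dual ℂ H) [DecidableEq (T.idx θ)]
    (N : ℕ) (hN : ∀ π ∈ T.idx θ, ∀ i, π i ≤ N) :
    (T.gram (linf lam rho) θ).det = C (∏ π ∈ T.idx θ, T.lu rho π) *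
      ∏ a ∈ Finset.univ ×ˢ Finset.Icc 1 N,
        (X - C (((a.2 : ℂ) - (lam + rho) (T.co a.1)) / rho (T.co a.1))) ^ T.cnt (θ - a.2 • T.wt a.1) := by
  -- generic s
  have hgen : {s : ℂ | ¬ Set.InjOn (fun a : ι × ℕ => ((a.2 : ℂ) - ((lam + s • η) + rho) (T.co a.1)) / rho (T.co a.1))
      ((Finset.univ ×ˢ Finset.Icc 1 N : Finset (ι × ℕ)) : Set (ι × ℕ))}.Finite := by
    let F : (ι × ℕ) × (ι × ℕ) → ℂ := fun p =>
      (((p.1.2 : ℂ) - (lam + rho) (T.co p.1.1)) * rho (T.co p.2.1) -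
        ((p.2.2 : ℂ) - (lam + rho) (T.co p.2.1)) * rho (T.co p.1.1)) /
        (η (T.co p.1.1) * rho (T.co p.2.1) - η (T.co p.2.1) * rho (T.co p.1.1))
    refine Set.Finite.subset ((Finset.univ ×ˢ Finset.Icc 1 N : Finset (ι × ℕ)) ×ˢ
      (Finset.univ ×ˢ Finset.Icc 1 N : Finset (ι × ℕ)) |>.image F).finite_toSet ?_
    intro s hs
    rw [Set.mem_ofPred_eq, Set.InjOn] at hs
    push Not at hs
    obtain ⟨⟨i, n⟩, ha, ⟨j, m⟩, hb, hab, hne⟩ := hs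
    rw [Finset.coe_image]
    refine ⟨(⟨i, n⟩, ⟨j, m⟩), ?_, ?_⟩
    · rw [Finset.coe_product]; exact ⟨ha, hb⟩
    · dsimp only at hab
      rw [div_eq_div_iff (hrho _) (hrho _)] at hab
      have hij : i ≠ j := by
        rintro rfl
        have := mul_right_cancel₀ (hrho i) hab
        apply hne
        have : (n : ℂ) = m := by linear_combination this
        rw [Prod.mk.injEq]; exact ⟨rfl, by exact_mod_cast this⟩
      simp only [F]
      rw [div_eq_iff (sub_ne_zero.2 (hη i j hij))]
      simp only [LinearMap.add_apply, LinearMap.smul_apply, smul_eq_mul] at hab ⊢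
      linear_combination hab
  apply Polynomial.funext
  intro t
  have key : (T.gram (linf (lam + t • rho) η) θ).det = C (∏ π ∈ T.idx θ, T.lu rho π) *
      ∏ a ∈ Finset.univ ×ˢ Finset.Icc 1 N,
        (C t - C (((a.2 : ℂ) - (lam + rho) (T.co a.1)) / rho (T.co a.1)) +
          C (η (T.co a.1) / rho (T.co a.1)) * X) ^ T.cnt (θ - a.2 • T.wt a.1) := by
    apply Polynomial.eq_of_infinite_eval_eq
    refine (hgen.infinite_compl).mono ?_
    intro s hs
    simp only [Set.mem_compl_iff, Set.mem_ofPred_eq, not_not] at hs ⊢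
    have h1 := congrArg (eval t) (hR.det_generic hrho (lam + s • η) θ N hN hs)
    rw [T.eval_det] at h1 ⊢
    rw [add_right_comm, h1]
    simp only [eval_mul, eval_C, eval_prod, eval_pow, eval_sub, eval_X, eval_add]
    congr 1
    refine Finset.prod_congr rfl fun a _ => ?_
    congr 1
    have := hrho a.1
    simp only [LinearMap.add_apply, LinearMap.smul_apply, smul_eq_mul]
    field_simp
    ring
  have := congrArg (eval 0) key
  rw [T.eval_det, zero_smul, add_zero] at this
  rw [T.eval_det, this]
  simp only [eval_mul, eval_C, eval_prod, eval_pow, eval_sub, eval_X, eval_add, mul_zero, add_zero]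

theorem RootHyp.ord_det (hrho : ∀ i, rho (T.co i) ≠ 0) {η : Module.Dual ℂ H}
    (hη : ∀ i j, i ≠ j → η (T.co i) * rho (T.co j) ≠ η (T.co j) * rho (T.co i))
    (lam θ : Module.Dual ℂ H) [DecidableEq (T.idx θ)]
    (N : ℕ) (hN : ∀ π ∈ T.idx θ, ∀ i, π i ≤ N) :
    (T.gram (linf lam rho) θ).det ≠ 0 ∧
    (T.gram (linf lam rho) θ).det.rootMultiplicity 0 =
      ∑ i, ∑ n ∈ Finset.Icc 1 N, open Classical in
        if (lam + rho) (T.co i) = n then T.cnt (θ - n • T.wt i) else 0 := by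
  classical
  have hc : ∏ π ∈ T.idx θ, T.lu rho π ≠ 0 := Finset.prod_ne_zero_iff.2 fun π _ => T.lu_ne rho hrho π
  have hne : ∀ a ∈ (Finset.univ ×ˢ Finset.Icc 1 N : Finset (ι × ℕ)),
      (X - C (((a.2 : ℂ) - (lam + rho) (T.co a.1)) / rho (T.co a.1))) ^ T.cnt (θ - a.2 • T.wt a.1) ≠ 0 :=
    fun a _ => pow_ne_zero _ (X_sub_C_ne_zero _)
  have h0 : (T.gram (linf lam rho) θ).det ≠ 0 := by
    rw [hR.det_eq hrho hη lam θ N hN]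
    exact mul_ne_zero (C_ne_zero.2 hc) (Finset.prod_ne_zero_iff.2 hne)
  refine ⟨h0, ?_⟩
  rw [hR.det_eq hrho hη lam θ N hN] at h0 ⊢
  rw [rootMultiplicity_mul h0, rootMultiplicity_C, zero_add, rootMult_prod _ _ _ hne,
    Finset.sum_product]
  refine Finset.sum_congr rfl fun i _ => Finset.sum_congr rfl fun n _ => ?_
  dsimp only
  split_ifs with h
  · rw [h, sub_self, zero_div, rootMultiplicity_X_sub_C_pow]
  · rw [rootMultiplicity_eq_zero]
    rw [IsRoot, eval_pow, eval_sub, eval_X, eval_C]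
    apply pow_ne_zero
    rw [zero_sub, neg_ne_zero]
    exact div_ne_zero (sub_ne_zero.2 (Ne.symm h)) (hrho i)

end TriData
end Vrm


set_option linter.unusedSectionVars false
set_option linter.unusedSimpArgs false

namespace Vrm
open MvPolynomial

variable {ι : Type} [Fintype ι] [LinearOrder ι] {L : Type*} [LieRing L] [LieAlgebra ℂ L]
    {H : Type*} [AddCommGroup H] [Module ℂ H]

namespace TriData
variable (T : TriData ι L H)

/-- specialisation at `t = 0` -/
noncomputable abbrev ev0 : MvPolynomial ι (Polynomial ℂ) →+* MvPolynomial ι ℂ := MvPolynomial.map (Polynomial.evalRingHom 0)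

/-- the Jantzen filtration -/
noncomputable def JM (lam zt : Module.Dual ℂ H) (i : ℕ) : Submodule ℂ (MvPolynomial ι ℂ) where
  carrier := {q | ∃ Q : MvPolynomial ι (Polynomial ℂ), ev0 Q = q ∧
    ∀ p, (Polynomial.X : Polynomial ℂ) ^ i ∣ T.pair (linf lam zt) p Q}
  zero_mem' := ⟨0, by simp, by simp⟩
  add_mem' := by
    rintro a b ⟨P, hP, hP'⟩ ⟨Q, hQ, hQ'⟩
    refine ⟨P + Q, by rw [map_add, hP, hQ], fun p => ?_⟩
    rw [map_add]; exact dvd_add (hP' p) (hQ' p)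
  smul_mem' := by
    rintro a b ⟨P, hP, hP'⟩
    refine ⟨Polynomial.C a • P, ?_, fun p => ?_⟩
    · rw [smul_eq_C_mul, map_mul, hP, map_C, smul_eq_C_mul]; simp
    · rw [map_smul]; exact Dvd.dvd.mul_left (hP' p) _

theorem JM_stab (lam zt : Module.Dual ℂ H) (i : ℕ) : T.Stab lam (T.JM lam zt i) := by
  rintro x _ ⟨Q, rfl, hQ⟩
  refine ⟨T.act (linf lam zt) x Q, ?_, fun p => ?_⟩
  · have := T.eval_act lam zt 0 x Q
    rwa [zero_smul, add_zero] at this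
  · have := T.pair_act (linf lam zt) x p Q
    rw [← neg_eq_iff_eq_neg] at this
    rw [← this]
    exact (hQ _).neg_right

theorem JM_anti (lam zt : Module.Dual ℂ H) {i j : ℕ} (h : i ≤ j) : T.JM lam zt j ≤ T.JM lam zt i := by
  rintro _ ⟨Q, rfl, hQ⟩
  exact ⟨Q, rfl, fun p => (pow_dvd_pow _ h).trans (hQ p)⟩

theorem ev0_surj (p : MvPolynomial ι ℂ) : ev0 (MvPolynomial.map Polynomial.C p) = p := by
  rw [MvPolynomial.map_map]
  have : (Polynomial.evalRingHom (0 : ℂ)).comp Polynomial.C = RingHom.id ℂ := by ext; simp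
  rw [this, MvPolynomial.map_id]

theorem JM_one (lam zt : Module.Dual ℂ H) : T.JM lam zt 1 = T.rad lam := by
  ext q
  rw [mem_rad]
  constructor
  · rintro ⟨Q, rfl, hQ⟩ p
    have h1 := T.eval_pair lam zt 0 (MvPolynomial.map Polynomial.C p) Q
    rw [zero_smul, add_zero, ev0_surj] at h1
    rw [← h1]
    have := hQ (MvPolynomial.map Polynomial.C p)
    rw [pow_one, Polynomial.X_dvd_iff, Polynomial.coeff_zero_eq_eval_zero] at this
    exact this
  · intro h
    refine ⟨MvPolynomial.map Polynomial.C q, ev0_surj q, fun p => ?_⟩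
    rw [pow_one, Polynomial.X_dvd_iff, Polynomial.coeff_zero_eq_eval_zero, T.eval_pair, zero_smul, add_zero,
      ev0_surj]
    exact h _

theorem JM_inf (lam zt θ : Module.Dual ℂ H) (i : ℕ) :
    T.JM lam zt i ⊓ T.vw θ = (Mfil (T.gram (linf lam zt) θ) 0 i).map (T.combL θ) := by
  classical
  apply le_antisymm
  · rintro q ⟨⟨Q, hQ0, hQ⟩, hq⟩
    refine ⟨fun m => coeff m.1 q, ⟨fun m => coeff m.1 Q, ?_, ?_⟩, (T.eq_comb hq).symm⟩
    · intro π
      rw [gram_mulVec, map_zero, sub_zero]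
      have : T.pair (linf lam zt) (monomial π.1 1) (T.comb fun m : T.idx θ => coeff m.1 Q) =
          T.pair (linf lam zt) (monomial π.1 1) Q := by
        conv_rhs => rw [Q.as_sum]
        rw [comb, map_sum, map_sum]
        have e : ∀ m, (monomial m (coeff m Q)) = coeff m Q • (monomial m 1 : MvPolynomial ι (Polynomial ℂ)) := by
          intro m; simp [smul_monomial]
        simp_rw [e, map_smul]
        rw [Finset.sum_coe_sort (T.idx θ) (fun m => coeff m Q • T.pair (linf lam zt) (monomial π.1 1) (monomial m 1))]
        rw [← Finset.sum_subset (Finset.inter_subset_left (s₁ := T.idx θ) (s₂ := Q.support))]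
        · refine Finset.sum_subset Finset.inter_subset_right ?_
          intro m hm hm'
          by_contra hne
          apply hm'
          rw [Finset.mem_inter]
          refine ⟨?_, hm⟩
          have := T.pair_ne_zero _ (right_ne_zero_of_mul hne)
          rw [mem_idx, ← this]
          exact T.mem_idx.1 π.2
        · intro m hm hm'
          have : coeff m Q = 0 := by
            by_contra h
            exact hm' (Finset.mem_inter.2 ⟨hm, mem_support_iff.2 h⟩)
          rw [this, zero_smul]
      rw [this]
      exact hQ _
    · intro m
      change coeff m.1 q = _
      rw [← hQ0, ev0, coeff_map]; rfl
  · rintro _ ⟨v, ⟨x, hx, hv⟩, rfl⟩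
    refine ⟨⟨T.comb x, ?_, ?_⟩, T.comb_mem v⟩
    · rw [combL_apply, comb, comb, map_sum]
      refine Finset.sum_congr rfl fun m _ => ?_
      rw [smul_eq_C_mul, map_mul, map_C, map_monomial, hv, smul_eq_C_mul]; simp
    · intro p
      rw [p.as_sum, map_sum, LinearMap.sum_apply]
      refine Finset.dvd_sum fun π _ => ?_
      have e : (monomial π (coeff π p)) = coeff π p • (monomial π 1 : MvPolynomial ι (Polynomial ℂ)) := by
        simp [smul_monomial]
      rw [e, map_smul, LinearMap.smul_apply]
      apply Dvd.dvd.mul_left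
      by_cases hπ : T.wm π = θ
      · have := hx ⟨π, T.mem_idx.2 hπ⟩
        rw [gram_mulVec, map_zero, sub_zero] at this
        exact this
      · have : T.pair (linf lam zt) (monomial π 1) (T.comb x) = 0 := by
          by_contra h
          exact hπ (T.pair_ne_zero' _ (T.comb_mem x) h)
        rw [this]; exact dvd_zero _

theorem finrank_JM (lam zt θ : Module.Dual ℂ H) (i : ℕ) :
    Module.finrank ℂ (T.JM lam zt i ⊓ T.vw θ : Submodule ℂ (MvPolynomial ι ℂ)) =
      Module.finrank ℂ (Mfil (T.gram (linf lam zt) θ) 0 i) := by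
  rw [JM_inf]
  exact (LinearEquiv.finrank_eq (Submodule.equivMapOfInjective _ (T.combL_inj θ) _)).symm

variable {T} {rho : Module.Dual ℂ H} {S : Set ι} (hR : T.RootHyp rho S)
include hR

theorem RootHyp.jantzen (hrho : ∀ i, rho (T.co i) ≠ 0) {η : Module.Dual ℂ H}
    (hη : ∀ i j, i ≠ j → η (T.co i) * rho (T.co j) ≠ η (T.co j) * rho (T.co i))
    (lam θ : Module.Dual ℂ H) : ∃ N0 : ℕ, ∀ N ≥ N0,
      ∑ i ∈ Finset.Icc 1 N, Module.finrank ℂ (T.JM lam rho i ⊓ T.vw θ : Submodule ℂ (MvPolynomial ι ℂ)) =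
      ∑ i, ∑ n ∈ Finset.Icc 1 N, open Classical in
        if (lam + rho) (T.co i) = n then T.cnt (θ - n • T.wt i) else 0 := by
  classical
  refine ⟨max ((T.gram (linf lam rho) θ).det.rootMultiplicity 0) (∑ π ∈ T.idx θ, π.degree), fun N hN => ?_⟩
  have hN' : ∀ π ∈ T.idx θ, ∀ i, π i ≤ N := by
    intro π hπ i
    refine le_trans (Finsupp.le_degree i π) (le_trans ?_ ((le_max_right _ _).trans hN))
    exact Finset.single_le_sum (f := fun π : ι →₀ ℕ => π.degree) (fun _ _ => Nat.zero_le _) hπ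
  obtain ⟨h1, h2⟩ := hR.ord_det hrho hη lam θ N hN'
  rw [← h2]
  simp_rw [finrank_JM]
  exact sum_Mfil _ h1 0 N ((le_max_left _ _).trans hN)

end TriData
end Vrm


set_option linter.unusedSectionVars false
set_option linter.unusedSimpArgs false

namespace Vrm
open MvPolynomial

variable {ι : Type} [Fintype ι] [LinearOrder ι] {L : Type*} [LieRing L] [LieAlgebra ℂ L]
    {H : Type*} [AddCommGroup H] [Module ℂ H]

namespace TriData
variable (T : TriData ι L H)

/-- projection to a weight component -/
noncomputable def pj (θ : Module.Dual ℂ H) : MvPolynomial ι ℂ →ₗ[ℂ] MvPolynomial ι ℂ :=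
  (T.combL θ).comp (LinearMap.pi fun m : T.idx θ => MvPolynomial.lcoeff ℂ m.1)

theorem pj_mem (θ : Module.Dual ℂ H) (p : MvPolynomial ι ℂ) : T.pj θ p ∈ T.vw (R := ℂ) θ :=
  T.comb_mem _

theorem coeff_pj (θ : Module.Dual ℂ H) (p : MvPolynomial ι ℂ) (m : ι →₀ ℕ) (hm : T.wm m = θ) :
    coeff m (T.pj θ p) = coeff m p := by
  have := T.coeff_comb (fun m : T.idx θ => coeff m.1 p) ⟨m, (T.mem_idx).2 hm⟩
  exact this

theorem coeff_pj_ne (θ : Module.Dual ℂ H) (p : MvPolynomial ι ℂ) (m : ι →₀ ℕ) (hm : T.wm m ≠ θ) :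
    coeff m (T.pj θ p) = 0 := by
  by_contra h
  exact hm (T.pj_mem θ p m h)

theorem pj_of_mem {θ : Module.Dual ℂ H} {p : MvPolynomial ι ℂ} (hp : p ∈ T.vw (R := ℂ) θ) : T.pj θ p = p := by
  ext m
  by_cases hm : T.wm m = θ
  · exact T.coeff_pj θ p m hm
  · rw [T.coeff_pj_ne θ p m hm]
    by_contra h
    exact hm (hp m (Ne.symm h))

theorem pj_of_mem_ne {θ δ : Module.Dual ℂ H} (h : δ ≠ θ) {p : MvPolynomial ι ℂ} (hp : p ∈ T.vw (R := ℂ) δ) : T.pj θ p = 0 := by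
  ext m
  by_cases hm : T.wm m = θ
  · rw [T.coeff_pj θ p m hm, coeff_zero]
    by_contra h2
    exact h ((hp m h2).symm.trans hm)
  · rw [T.coeff_pj_ne θ p m hm, coeff_zero]

theorem pj_zero (p : MvPolynomial ι ℂ) : T.pj 0 p = coeff 0 p • 1 := by
  ext m
  by_cases hm : T.wm m = 0
  · rw [T.coeff_pj 0 p m hm]
    have := T.wm_eq_zero hm
    subst this; simp
  · rw [T.coeff_pj_ne 0 p m hm, coeff_smul, coeff_one, if_neg]
    · simp
    · rintro rfl; simp at hm

theorem comp_mem (χ : Module.Dual ℂ H) {A : Submodule ℂ (MvPolynomial ι ℂ)} (hA : T.Stab χ A)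
    {q : MvPolynomial ι ℂ} (hq : q ∈ A) (θ : Module.Dual ℂ H) : T.pj θ q ∈ A := by
  classical
  have key : ∀ S : Finset (Module.Dual ℂ H), θ ∉ S → ∀ q ∈ A, (∀ m, coeff m q ≠ 0 → T.wm m ∈ insert θ S) →
      T.pj θ q ∈ A := by
    intro S
    induction S using Finset.induction_on with
    | empty =>
      intro _ q hq hm
      rw [T.pj_of_mem (fun m h => by simpa using hm m h)]
      exact hq
    | insert θ1 S h1 ih =>
      intro hθ q hq hm
      rw [Finset.mem_insert, not_or] at hθ
      have : ∃ h, θ1 h - θ h ≠ 0 := by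
        by_contra hcon
        push Not at hcon
        exact hθ.1 (LinearMap.ext fun h => (sub_eq_zero.1 (hcon h)).symm)
      obtain ⟨h, hh⟩ := this
      set q' := T.act χ (T.hh h) q - (χ h - θ1 h) • q with hq'
      have hc : ∀ m, coeff m q' = (θ1 h - T.wm m h) * coeff m q := by
        intro m
        rw [hq', coeff_sub, coeff_smul, T.coeff_act_h χ]; simp; ring
      have hA' : q' ∈ A := Submodule.sub_mem _ (hA _ _ hq) (Submodule.smul_mem _ _ hq)
      have := ih hθ.2 q' hA' (by
        intro m hne
        rw [hc] at hne
        have h2 := hm m (right_ne_zero_of_mul hne)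
        have h3 : T.wm m ≠ θ1 := by
          rintro h4; rw [h4] at hne; simp at hne
        simp only [Finset.mem_insert] at h2 ⊢
        tauto)
      have e : T.pj θ q' = (θ1 h - θ h) • T.pj θ q := by
        ext m
        by_cases hm : T.wm m = θ
        · rw [T.coeff_pj _ _ _ hm, coeff_smul, T.coeff_pj _ _ _ hm, hc, hm]; rfl
        · rw [T.coeff_pj_ne _ _ _ hm, coeff_smul, T.coeff_pj_ne _ _ _ hm]; simp
      rw [e] at this
      exact (Submodule.smul_mem_iff _ hh).1 this
  refine key ((q.support.image T.wm).erase θ) (by simp) q hq fun m hm => ?_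
  by_cases h : T.wm m = θ
  · simp [h]
  · refine Finset.mem_insert_of_mem (Finset.mem_erase.2 ⟨h, Finset.mem_image_of_mem _ (mem_support_iff.2 hm)⟩)

/-- a polynomial is in a submodule if all its components are -/
theorem mem_of_comp {A : Submodule ℂ (MvPolynomial ι ℂ)} (q : MvPolynomial ι ℂ)
    (h : ∀ θ, T.pj θ q ∈ A) : q ∈ A := by
  classical
  have : q = ∑ θ ∈ q.support.image T.wm, T.pj θ q := by
    ext m
    rw [coeff_sum]
    by_cases hm : coeff m q = 0
    · rw [hm, Finset.sum_eq_zero]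
      intro θ _
      by_cases h2 : T.wm m = θ
      · rw [T.coeff_pj _ _ _ h2, hm]
      · rw [T.coeff_pj_ne _ _ _ h2]
    · rw [Finset.sum_eq_single (T.wm m), T.coeff_pj _ _ _ rfl]
      · intro θ _ h2
        rw [T.coeff_pj_ne _ _ _ (Ne.symm h2)]
      · intro h2
        exact absurd (Finset.mem_image_of_mem _ (mem_support_iff.2 hm)) h2
  rw [this]
  exact Submodule.sum_mem _ fun θ _ => h θ

theorem le_of_comp (χ : Module.Dual ℂ H) {A B : Submodule ℂ (MvPolynomial ι ℂ)} (hA : T.Stab χ A)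
    (h : ∀ θ, A ⊓ T.vw θ ≤ B) : A ≤ B := fun q hq =>
  T.mem_of_comp q fun θ => h θ ⟨T.comp_mem χ hA hq θ, T.pj_mem θ q⟩

/-- a proper stable subspace is in the radical -/
theorem le_rad_of_one (χ : Module.Dual ℂ H) {A : Submodule ℂ (MvPolynomial ι ℂ)} (hA : T.Stab χ A)
    (h1 : (1 : MvPolynomial ι ℂ) ∉ A) : A ≤ T.rad χ := by
  refine T.le_rad χ A hA fun q hq => ?_
  have := T.comp_mem χ hA hq 0
  rw [T.pj_zero] at this
  by_contra h
  exact h1 ((Submodule.smul_mem_iff _ h).1 this)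

theorem one_notMem_rad (χ : Module.Dual ℂ H) : (1 : MvPolynomial ι ℂ) ∉ T.rad χ := by
  intro h
  have := (T.mem_rad).1 h 1
  rw [pair_one] at this
  simp at this

theorem mem_rad_of_e (χ : Module.Dual ℂ H) {p : MvPolynomial ι ℂ} (h0 : coeff 0 p = 0)
    (h : ∀ i, T.act χ (T.e i) p ∈ T.rad χ) : p ∈ T.rad χ := by
  rw [mem_rad]
  let P : Submodule ℂ (MvPolynomial ι ℂ) :=
    { carrier := {r | T.pair χ r p = 0}
      zero_mem' := by simp
      add_mem' := fun {a b} ha hb => by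
        have ha' : T.pair χ a p = 0 := ha
        have hb' : T.pair χ b p = 0 := hb
        show T.pair χ (a + b) p = 0
        rw [map_add, LinearMap.add_apply, ha', hb', add_zero]
      smul_mem' := fun c a ha => by
        have ha' : T.pair χ a p = 0 := ha
        show T.pair χ (c • a) p = 0
        rw [map_smul, LinearMap.smul_apply, ha', smul_zero] }
  intro r
  have h1 : r ∈ P := by
    refine (T.op.ind (-χ)).mem_of_one P ?_ ?_ r
    · show T.pair χ 1 p = 0
      rw [pair_one, h0]
    · intro i r hr
      have := T.pair_act χ (T.op.f i) r p
      have h2 := (T.mem_rad).1 (h i) r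
      have h3 : T.pair χ r (T.act χ (T.op.f i) p) = 0 := h2
      rw [h3, neg_zero] at this
      exact this
  exact h1

theorem stab_sup (χ : Module.Dual ℂ H) {A B : Submodule ℂ (MvPolynomial ι ℂ)} (hA : T.Stab χ A) (hB : T.Stab χ B) :
    T.Stab χ (A ⊔ B) := by
  intro x p hp
  obtain ⟨a, ha, b, hb, rfl⟩ := Submodule.mem_sup.1 hp
  rw [map_add]
  exact Submodule.add_mem_sup (hA _ _ ha) (hB _ _ hb)

theorem stab_inf (χ : Module.Dual ℂ H) {A B : Submodule ℂ (MvPolynomial ι ℂ)} (hA : T.Stab χ A) (hB : T.Stab χ B) :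
    T.Stab χ (A ⊓ B) := fun x p hp => ⟨hA x p hp.1, hB x p hp.2⟩

theorem stab_top (χ : Module.Dual ℂ H) : T.Stab χ ⊤ := fun _ _ _ => trivial

theorem stab_bot (χ : Module.Dual ℂ H) : T.Stab χ ⊥ := fun x p hp => by
  rw [Submodule.mem_bot] at hp ⊢; rw [hp, map_zero]

/-- `L(χ-θ)` is a composition factor of `A/B`. -/
def Fac (χ : Module.Dual ℂ H) (A B : Submodule ℂ (MvPolynomial ι ℂ)) (θ : Module.Dual ℂ H) : Prop :=
  ∃ N, T.Stab χ N ∧ B ≤ N ∧ N ≤ A ∧ ∃ x ∈ A, x ∈ T.vw (R := ℂ) θ ∧ x ∉ N ∧ ∀ i, T.act χ (T.e i) x ∈ N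

variable {T} {χ : Module.Dual ℂ H} {A B C : Submodule ℂ (MvPolynomial ι ℂ)} {θ : Module.Dual ℂ H}

theorem Fac.of_top (h : T.Fac χ A C θ) (hBC : B ≤ C) : T.Fac χ A B θ := by
  obtain ⟨N, h1, h2, h3⟩ := h
  exact ⟨N, h1, hBC.trans h2, h3⟩

theorem Fac.of_bot (h : T.Fac χ C B θ) (hBC : C ≤ A) : T.Fac χ A B θ := by
  obtain ⟨N, h1, h2, h3, x, hx, h4⟩ := h
  exact ⟨N, h1, h2, h3.trans hBC, x, hBC hx, h4⟩

theorem Fac.split (hC : T.Stab χ C) (hBC : B ≤ C) (hCA : C ≤ A) (h : T.Fac χ A B θ) :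
    T.Fac χ A C θ ∨ T.Fac χ C B θ := by
  obtain ⟨N, h1, h2, h3, x, hx, h4, h5, h6⟩ := h
  by_cases hxN : x ∈ N ⊔ C
  · right
    obtain ⟨n, hn, c, hc, rfl⟩ := Submodule.mem_sup.1 hxN
    have hn' := T.comp_mem χ h1 hn θ
    have hc' := T.comp_mem χ hC hc θ
    have e : T.pj θ n + T.pj θ c = n + c := by rw [← map_add, T.pj_of_mem h4]
    refine ⟨N ⊓ C, T.stab_inf χ h1 hC, le_inf h2 hBC, inf_le_right, T.pj θ c, hc', T.pj_mem _ _, ?_, ?_⟩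
    · intro h
      apply h5
      rw [← e]
      exact Submodule.add_mem _ hn' h.1
    · intro i
      refine ⟨?_, hC _ _ hc'⟩
      have h7 := h6 i
      rw [← e, map_add] at h7
      exact (Submodule.add_mem_iff_right _ (h1 _ _ hn')).1 h7
  · left
    exact ⟨N ⊔ C, T.stab_sup χ h1 hC, le_sup_right, sup_le h3 hCA, x, hx, h4, hxN,
      fun i => Submodule.mem_sup_left (h6 i)⟩

theorem Fac.sup (hA : T.Stab χ A) (hC : T.Stab χ C) (h : T.Fac χ (A ⊔ C) ⊥ θ) :
    T.Fac χ A ⊥ θ ∨ T.Fac χ C ⊥ θ := by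
  rcases Fac.split hA bot_le le_sup_left h with h | h
  · right
    obtain ⟨N, h1, h2, h3, x, hx, h4, h5, h6⟩ := h
    obtain ⟨a, ha, c, hc, rfl⟩ := Submodule.mem_sup.1 hx
    have ha' := T.comp_mem χ hA ha θ
    have hc' := T.comp_mem χ hC hc θ
    have e : T.pj θ a + T.pj θ c = a + c := by rw [← map_add, T.pj_of_mem h4]
    refine ⟨N ⊓ C, T.stab_inf χ h1 hC, bot_le, inf_le_right, T.pj θ c, hc', T.pj_mem _ _, ?_, ?_⟩
    · intro h
      apply h5
      rw [← e]
      exact Submodule.add_mem _ (h2 ha') h.1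
    · intro i
      refine ⟨?_, hC _ _ hc'⟩
      have h7 := h6 i
      rw [← e, map_add] at h7
      exact (Submodule.add_mem_iff_right _ (h1 _ _ (h2 ha'))).1 h7
  · exact Or.inl h

end TriData
end Vrm


set_option linter.unusedSectionVars false
set_option linter.unusedSimpArgs false

namespace Vrm
open MvPolynomial

variable {ι : Type} [Fintype ι] [LinearOrder ι] {L : Type*} [LieRing L] [LieAlgebra ℂ L]
    {H : Type*} [AddCommGroup H] [Module ℂ H]

theorem dim_step {V : Type*} [AddCommGroup V] [Module ℂ V] {U : Type*} [AddCommGroup U] [Module ℂ U]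
    (g : U →ₗ[ℂ] V) (K P : Submodule ℂ V) (W R : Submodule ℂ U) [FiniteDimensional ℂ K]
    [FiniteDimensional ℂ W] (hP : P = K ⊔ W.map g) (hR : R ≤ W) (h : ∀ w ∈ W, g w ∈ K ↔ w ∈ R) :
    Module.finrank ℂ P + Module.finrank ℂ R = Module.finrank ℂ K + Module.finrank ℂ W := by
  subst hP
  let g' : W →ₗ[ℂ] V := g.comp W.subtype
  have h1 : W.map g = LinearMap.range g' := by
    rw [LinearMap.range_comp, Submodule.range_subtype]
  have h2 := Submodule.finrank_sup_add_finrank_inf_eq K (W.map g)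
  let G := g.domRestrict W
  have hfin : FiniteDimensional ℂ R := Submodule.finiteDimensional_of_le hR
  -- consider composite W → V/K
  let q : W →ₗ[ℂ] V ⧸ K := K.mkQ.comp g'
  have hk : LinearMap.ker q = R.comap W.subtype := by
    ext w
    rw [LinearMap.mem_ker, Submodule.mem_comap]
    show K.mkQ (g w) = 0 ↔ _
    rw [Submodule.mkQ_apply, Submodule.Quotient.mk_eq_zero]
    exact h w w.2
  have h3 := LinearMap.finrank_range_add_finrank_ker q
  have h4 : Module.finrank ℂ (LinearMap.ker q) = Module.finrank ℂ R := by
    rw [hk]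
    exact LinearEquiv.finrank_eq (Submodule.comapSubtypeEquivOfLe hR)
  -- restrict mkQ to W.map g
  let s : (W.map g) →ₗ[ℂ] V ⧸ K := K.mkQ.comp (W.map g).subtype
  have h5 := LinearMap.finrank_range_add_finrank_ker s
  have h6 : LinearMap.range s = LinearMap.range q := by
    rw [LinearMap.range_comp, Submodule.range_subtype, h1, ← LinearMap.range_comp]
  have h7 : LinearMap.ker s = (K ⊓ W.map g).comap (W.map g).subtype := by
    ext w
    rw [LinearMap.mem_ker, Submodule.mem_comap]
    show K.mkQ w = 0 ↔ _
    rw [Submodule.mkQ_apply, Submodule.Quotient.mk_eq_zero]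
    exact ⟨fun h => ⟨h, w.2⟩, fun h => h.1⟩
  have h8 : Module.finrank ℂ (LinearMap.ker s) = Module.finrank ℂ ↥(K ⊓ W.map g) := by
    rw [h7]
    exact LinearEquiv.finrank_eq (Submodule.comapSubtypeEquivOfLe inf_le_right)
  rw [h6] at h5
  omega

namespace TriData
variable (T : TriData ι L H)

/-- character of the simple quotient -/
noncomputable def ch (κ δ : Module.Dual ℂ H) : ℕ := T.cnt δ - Module.finrank ℂ ↥(T.rad κ ⊓ T.vw δ)

theorem fin_inf (A : Submodule ℂ (MvPolynomial ι ℂ)) (θ : Module.Dual ℂ H) :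
    FiniteDimensional ℂ ↥(A ⊓ T.vw (R := ℂ) θ) := by
  have := T.fin_vw θ
  exact Submodule.finiteDimensional_of_le inf_le_right

theorem rank_rad_le (κ δ : Module.Dual ℂ H) : Module.finrank ℂ ↥(T.rad κ ⊓ T.vw δ) ≤ T.cnt δ := by
  have := T.fin_vw δ
  rw [← T.finrank_vw]
  exact Submodule.finrank_mono inf_le_right

theorem ch_add (κ δ : Module.Dual ℂ H) : T.ch κ δ + Module.finrank ℂ ↥(T.rad κ ⊓ T.vw δ) = T.cnt δ :=
  Nat.sub_add_cancel (T.rank_rad_le κ δ)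

theorem ch_eq_zero (κ δ : Module.Dual ℂ H) (h : ∀ m, T.wm m ≠ δ) : T.ch κ δ = 0 := by
  have : T.cnt δ = 0 := by
    rw [cnt, Finset.card_eq_zero, Finset.eq_empty_iff_forall_notMem]
    intro m hm
    exact h m ((T.mem_idx).1 hm)
  rw [ch, this, Nat.zero_sub]

theorem ch_zero (κ : Module.Dual ℂ H) : T.ch κ 0 = 1 := by
  have h1 : T.cnt 0 = 1 := by
    rw [cnt, Finset.card_eq_one]
    refine ⟨0, ?_⟩
    ext m
    rw [T.mem_idx, Finset.mem_singleton]
    exact ⟨fun h => T.wm_eq_zero h, fun h => by rw [h, map_zero]⟩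
  have h2 : T.rad κ ⊓ T.vw 0 = ⊥ := by
    rw [Submodule.eq_bot_iff]
    rintro q ⟨hq, hq2⟩
    have h3 := T.pj_of_mem hq2
    rw [T.pj_zero] at h3
    by_contra hne
    apply T.one_notMem_rad κ
    rw [← h3] at hq
    refine (Submodule.smul_mem_iff _ ?_).1 hq
    intro h0
    rw [h0, zero_smul] at h3
    exact hne h3.symm
  have := T.ch_add κ 0
  rw [h1, h2, finrank_bot] at this
  exact this

theorem hom_pj (χ : Module.Dual ℂ H) {θ : Module.Dual ℂ H} {x : MvPolynomial ι ℂ} (hx : x ∈ T.vw (R := ℂ) θ)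
    (δ : Module.Dual ℂ H) (p : MvPolynomial ι ℂ) :
    T.pj (θ + δ) (T.hom (T.act χ) x p) = T.hom (T.act χ) x (T.pj δ p) := by
  induction p using MvPolynomial.induction_on' with
  | add p r hp hr => rw [map_add, map_add, map_add, map_add, hp, hr]
  | monomial m a =>
    have e : (monomial m a : MvPolynomial ι ℂ) = a • monomial m 1 := by simp [smul_monomial]
    have h1 : (monomial m a : MvPolynomial ι ℂ) ∈ T.vw (R := ℂ) (T.wm m) := by
      rw [e]; exact Submodule.smul_mem _ _ (T.mon_mem_vw (R := ℂ) m)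
    have h2 := T.hom_vw χ hx h1
    by_cases h : T.wm m = δ
    · rw [h] at h1 h2
      rw [T.pj_of_mem h1, T.pj_of_mem h2]
    · rw [T.pj_of_mem_ne h h1, map_zero, T.pj_of_mem_ne _ h2]
      intro h3
      exact h (add_left_cancel h3)

section step
variable {χ : Module.Dual ℂ H} {B : Submodule ℂ (MvPolynomial ι ℂ)} (hB : T.Stab χ B)
  {θ : Module.Dual ℂ H} {x : MvPolynomial ι ℂ} (hx : x ∈ T.vw (R := ℂ) θ) (hxB : x ∉ B)
  (hex : ∀ i, T.act χ (T.e i) x ∈ B)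

include hB in
theorem mkQ_hom (p : MvPolynomial ι ℂ) :
    B.mkQ (T.hom (T.act χ) x p) = T.hom (T.qact χ B hB) (B.mkQ x) p := by
  have key : ∀ m, B.mkQ (T.hom (T.act χ) x (monomial m 1)) = T.hom (T.qact χ B hB) (B.mkQ x) (monomial m 1) := by
    intro m
    induction m using IndData.mon_ind with
    | h0 =>
      have h1' : (monomial 0 1 : MvPolynomial ι ℂ) = 1 := rfl
      rw [h1', hom_one, hom_one]
    | hs j U hU ih =>
      have e1 : T.hom (T.act χ) x (monomial (U + Finsupp.single j 1) 1) =
          T.act χ (T.f j) (T.hom (T.act χ) x (monomial U 1)) := by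
        rw [hom, IndData.lift_mon, IndData.lift_mon, IndData.mprod_add _ _ _ _ _ hU]; rfl
      have e2 : T.hom (T.qact χ B hB) (B.mkQ x) (monomial (U + Finsupp.single j 1) 1) =
          T.qact χ B hB (T.f j) (T.hom (T.qact χ B hB) (B.mkQ x) (monomial U 1)) := by
        rw [hom, IndData.lift_mon, IndData.lift_mon, IndData.mprod_add _ _ _ _ _ hU]; rfl
      rw [e1, e2, ← ih, qact_mk]
  induction p using MvPolynomial.induction_on' with
  | add p r hp hr => rw [map_add, map_add, map_add, hp, hr]
  | monomial m a =>
    have e : (monomial m a : MvPolynomial ι ℂ) = a • monomial m 1 := by simp [smul_monomial]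
    rw [e, map_smul, map_smul, map_smul, key]

include hB hx hex in
theorem hom_mod (y : L) (p : MvPolynomial ι ℂ) :
    T.hom (T.act χ) x (T.act (χ - θ) y p) - T.act χ y (T.hom (T.act χ) x p) ∈ B := by
  rw [← Submodule.Quotient.mk_eq_zero, ← Submodule.mkQ_apply, map_sub, sub_eq_zero, ← T.qact_mk χ B hB,
    T.mkQ_hom hB, T.mkQ_hom hB]
  apply T.hom_act _ (T.qact_rep χ B hB)
  constructor
  · intro h
    rw [qact_mk, ((T.mem_vw_iff χ θ x).1 hx h), map_smul]; rfl
  · intro i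
    rw [qact_mk, Submodule.mkQ_apply, Submodule.Quotient.mk_eq_zero]
    exact hex i

include hB hx hex in
theorem stab_ext {R : Submodule ℂ (MvPolynomial ι ℂ)} (hR : T.Stab (χ - θ) R) :
    T.Stab χ (B ⊔ R.map (T.hom (T.act χ) x)) := by
  intro y p hp
  obtain ⟨b, hb, _, ⟨r, hr, rfl⟩, rfl⟩ := Submodule.mem_sup.1 hp
  rw [map_add]
  refine Submodule.add_mem _ (Submodule.mem_sup_left (hB _ _ hb)) ?_
  have h1 := T.hom_mod hB hx hex y r
  have h2 : T.hom (T.act χ) x (T.act (χ - θ) y r) ∈ R.map (T.hom (T.act χ) x) :=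
    Submodule.mem_map_of_mem (hR _ _ hr)
  have := Submodule.sub_mem _ (Submodule.mem_sup_right (S := B) h2) (Submodule.mem_sup_left h1)
  simpa using this

include hB hx hex in
theorem pull_le {N : Submodule ℂ (MvPolynomial ι ℂ)} (hN : T.Stab χ N) (hBN : B ≤ N) (hxN : x ∉ N) :
    N.comap (T.hom (T.act χ) x) ≤ T.rad (χ - θ) := by
  apply T.le_rad_of_one
  · intro y p hp
    have h1 := hBN (T.hom_mod hB hx hex y p)
    rw [Submodule.mem_comap] at hp ⊢
    have := Submodule.add_mem _ h1 (hN y _ hp)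
    simpa using this
  · rw [Submodule.mem_comap, hom_one]; exact hxN

include hB hx hxB hex in
theorem mem_K_iff (p : MvPolynomial ι ℂ) :
    T.hom (T.act χ) x p ∈ B ⊔ (T.rad (χ - θ)).map (T.hom (T.act χ) x) ↔ p ∈ T.rad (χ - θ) := by
  constructor
  · intro h
    obtain ⟨b, hb, _, ⟨r, hr, rfl⟩, h2⟩ := Submodule.mem_sup.1 h
    have h3 : p - r ∈ B.comap (T.hom (T.act χ) x) := by
      rw [Submodule.mem_comap, map_sub, ← h2, add_sub_cancel_right]; exact hb
    have h4 := T.pull_le hB hx hex hB le_rfl hxB h3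
    have := Submodule.add_mem _ h4 hr
    simpa using this
  · intro h
    exact Submodule.mem_sup_right (Submodule.mem_map_of_mem h)

include hB hx hxB hex in
theorem dim_PK (θ' : Module.Dual ℂ H) :
    Module.finrank ℂ ↥((B ⊔ (⊤ : Submodule ℂ (MvPolynomial ι ℂ)).map (T.hom (T.act χ) x)) ⊓ T.vw θ') =
    Module.finrank ℂ ↥((B ⊔ (T.rad (χ - θ)).map (T.hom (T.act χ) x)) ⊓ T.vw θ') + T.ch (χ - θ) (θ' - θ) := by
  set K := B ⊔ (T.rad (χ - θ)).map (T.hom (T.act χ) x) with hK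
  set P := B ⊔ (⊤ : Submodule ℂ (MvPolynomial ι ℂ)).map (T.hom (T.act χ) x) with hP
  have hKP : K ≤ P := sup_le_sup_left (Submodule.map_mono le_top) _
  have i1 := T.fin_inf K θ'
  have i2 := T.fin_vw (θ' - θ)
  have := dim_step (T.hom (T.act χ) x) (K ⊓ T.vw θ') (P ⊓ T.vw θ') (T.vw (θ' - θ))
    (T.rad (χ - θ) ⊓ T.vw (θ' - θ)) ?_ inf_le_right ?_
  · rw [T.finrank_vw, ← T.ch_add (χ - θ)] at this
    omega
  · apply le_antisymm
    · rintro z ⟨hz, hz2⟩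
      obtain ⟨b, hb, _, ⟨r, hr, rfl⟩, h2⟩ := Submodule.mem_sup.1 hz
      have h3 := T.pj_of_mem hz2
      have h4 := T.hom_pj χ hx (θ' - θ) r
      rw [add_sub_cancel] at h4
      rw [← h2, map_add, h4, h2] at h3
      rw [← h3]
      refine Submodule.add_mem_sup ⟨Submodule.mem_sup_left (T.comp_mem χ hB hb _), T.pj_mem _ _⟩
        (Submodule.mem_map_of_mem (T.pj_mem _ _))
    · refine sup_le (inf_le_inf_right _ hKP) ?_
      rintro _ ⟨w, hw, rfl⟩
      refine ⟨Submodule.mem_sup_right (Submodule.mem_map_of_mem trivial), ?_⟩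
      have := T.hom_vw χ hx hw
      rwa [add_sub_cancel] at this
  · intro w hw
    have h1 := T.mem_K_iff hB hx hxB hex w
    have h2 := T.hom_vw χ hx hw
    rw [add_sub_cancel] at h2
    constructor
    · intro h
      exact ⟨h1.1 h.1, hw⟩
    · intro h
      exact ⟨h1.2 h.1, h2⟩

include hB hx hxB hex in
theorem fac_PK (θ' : Module.Dual ℂ H) :
    T.Fac χ (B ⊔ (⊤ : Submodule ℂ (MvPolynomial ι ℂ)).map (T.hom (T.act χ) x))
      (B ⊔ (T.rad (χ - θ)).map (T.hom (T.act χ) x)) θ' ↔ θ' = θ := by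
  set K := B ⊔ (T.rad (χ - θ)).map (T.hom (T.act χ) x) with hK
  set P := B ⊔ (⊤ : Submodule ℂ (MvPolynomial ι ℂ)).map (T.hom (T.act χ) x) with hP
  have hKP : K ≤ P := sup_le_sup_left (Submodule.map_mono le_top) _
  have hKs : T.Stab χ K := T.stab_ext hB hx hex (T.rad_stab _)
  have hone := T.mem_K_iff hB hx hxB hex 1
  rw [hom_one] at hone
  have hxP : x ∈ P := Submodule.mem_sup_right ⟨1, trivial, T.hom_one _ _⟩
  have hxK : x ∉ K := fun h => T.one_notMem_rad _ (hone.1 h)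
  constructor
  · rintro ⟨N, h1, h2, h3, z, hz, h4, h5, h6⟩
    have hBN : B ≤ N := le_sup_left.trans h2
    by_cases hxN : x ∈ N
    · exfalso
      apply h5
      have h7 : N.comap (T.hom (T.act χ) x) = ⊤ := by
        rw [eq_top_iff]
        intro p _
        refine (T.ind (χ - θ)).mem_of_one _ ?_ ?_ p
        · rw [Submodule.mem_comap, hom_one]; exact hxN
        · intro i p hp
          rw [Submodule.mem_comap] at hp ⊢
          have h8 := hBN (T.hom_mod hB hx hex (T.f i) p)
          have := Submodule.add_mem _ h8 (h1 (T.f i) _ hp)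
          rw [sub_add_cancel] at this
          exact this
      have : P ≤ N := sup_le hBN (by rw [Submodule.map_le_iff_le_comap, h7])
      exact this hz
    · have hpull := T.pull_le hB hx hex h1 hBN hxN
      obtain ⟨b, hb, _, ⟨p, -, rfl⟩, hz2⟩ := Submodule.mem_sup.1 hz
      by_contra hne
      have hp : T.hom (T.act χ) x p = z - b := by rw [← hz2]; simp
      have hz' : z = T.pj θ' b + T.hom (T.act χ) x (T.pj (θ' - θ) p) := by
        have h4' := T.hom_pj χ hx (θ' - θ) p
        rw [add_sub_cancel] at h4'
        rw [← h4', hp, map_sub, T.pj_of_mem h4, add_sub_cancel]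
      set p' := T.pj (θ' - θ) p with hp'
      have hb' : T.pj θ' b ∈ N := hBN (T.comp_mem χ hB hb _)
      apply h5
      rw [hz']
      refine Submodule.add_mem _ hb' (h2 ((T.mem_K_iff hB hx hxB hex p').2 ?_))
      apply T.mem_rad_of_e
      · by_contra h0
        have := T.pj_mem (θ' - θ) p 0 h0
        rw [map_zero] at this
        exact hne (sub_eq_zero.1 this.symm)
      · intro i
        apply hpull
        rw [Submodule.mem_comap]
        have h8 := hBN (T.hom_mod hB hx hex (T.e i) p')
        have h9 := h6 i
        rw [hz', map_add] at h9
        have h10 := (Submodule.add_mem_iff_right _ (h1 _ _ hb')).1 h9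
        have := Submodule.add_mem _ h8 h10
        rw [sub_add_cancel] at this
        exact this
  · rintro rfl
    exact ⟨K, hKs, le_rfl, hKP, x, hxP, hx, hxK, fun i => Submodule.mem_sup_left (hex i)⟩

end step

end TriData
end Vrm


set_option linter.unusedSectionVars false
set_option linter.unusedSimpArgs false

namespace Vrm
open MvPolynomial

variable {ι : Type} [Fintype ι] [LinearOrder ι] {L : Type*} [LieRing L] [LieAlgebra ℂ L]
    {H : Type*} [AddCommGroup H] [Module ℂ H]

namespace TriData
variable (T : TriData ι L H)

open Classical in
/-- the interval of weights between 0 and `θ0`. -/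
noncomputable def DD (θ0 : Module.Dual ℂ H) : Finset (Module.Dual ℂ H) :=
  (T.idx θ0).biUnion fun M => (Finset.Iic M).image T.wm

theorem mem_DD {θ0 θ : Module.Dual ℂ H} : θ ∈ T.DD θ0 ↔ ∃ m m', T.wm m = θ ∧ T.wm m' = θ0 - θ := by
  classical
  rw [DD, Finset.mem_biUnion]
  constructor
  · rintro ⟨M, hM, h⟩
    obtain ⟨m, hm, rfl⟩ := Finset.mem_image.1 h
    refine ⟨m, M - m, rfl, ?_⟩
    rw [T.mem_idx] at hM
    rw [eq_sub_iff_add_eq, ← map_add, tsub_add_cancel_of_le (Finset.mem_Iic.1 hm), hM]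
  · rintro ⟨m, m', rfl, h⟩
    refine ⟨m + m', ?_, Finset.mem_image_of_mem _ (Finset.mem_Iic.2 (by simp))⟩
    rw [T.mem_idx, map_add, h, add_sub_cancel]

theorem hm_pos {m : ι →₀ ℕ} (h : m ≠ 0) : 0 < (T.wm m T.hz).re := by
  rw [T.wm_hz]
  have : T.hm m ≠ 0 := by
    intro h0
    apply h
    ext i
    have := T.le_hm m i
    simp; omega
  have : 0 < T.hm m := Nat.pos_of_ne_zero this
  simpa using this

theorem uniq (χ θ0 : Module.Dual ℂ H) (m m' : Module.Dual ℂ H → ℕ)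
    (h : ∀ θ' ∈ T.DD θ0, ∑ θ ∈ T.DD θ0, m θ * T.ch (χ - θ) (θ' - θ) =
      ∑ θ ∈ T.DD θ0, m' θ * T.ch (χ - θ) (θ' - θ)) : ∀ θ ∈ T.DD θ0, m θ = m' θ := by
  classical
  by_contra hcon
  push Not at hcon
  obtain ⟨θ1, h1, h1'⟩ := hcon
  obtain ⟨θ', hθ', hmin⟩ := Finset.exists_min_image ((T.DD θ0).filter fun θ => m θ ≠ m' θ)
    (fun θ => (θ T.hz).re) ⟨θ1, Finset.mem_filter.2 ⟨h1, h1'⟩⟩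
  rw [Finset.mem_filter] at hθ'
  have h2 := h θ' hθ'.1
  rw [← Finset.add_sum_erase _ _ hθ'.1, ← Finset.add_sum_erase _ _ hθ'.1, sub_self, T.ch_zero] at h2
  have h3 : ∑ θ ∈ (T.DD θ0).erase θ', m θ * T.ch (χ - θ) (θ' - θ) =
      ∑ θ ∈ (T.DD θ0).erase θ', m' θ * T.ch (χ - θ) (θ' - θ) := by
    refine Finset.sum_congr rfl fun θ hθ => ?_
    rw [Finset.mem_erase] at hθ
    by_cases he : m θ = m' θ
    · rw [he]
    · rw [T.ch_eq_zero, mul_zero, mul_zero]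
      intro k hk
      have h4 := hmin θ (Finset.mem_filter.2 ⟨hθ.2, he⟩)
      have h5 : k ≠ 0 := by
        rintro rfl
        rw [map_zero] at hk
        exact hθ.1 (sub_eq_zero.1 hk.symm).symm
      have h6 := T.hm_pos h5
      rw [hk, LinearMap.sub_apply, Complex.sub_re] at h6
      linarith
  rw [h3] at h2
  exact hθ'.2 (by omega)

theorem K0 (χ θ0 : Module.Dual ℂ H) (n : ℕ) : ∀ A B : Submodule ℂ (MvPolynomial ι ℂ),
    T.Stab χ A → T.Stab χ B → B ≤ A →
    ∑ θ ∈ T.DD θ0, Module.finrank ℂ ↥(A ⊓ T.vw θ) ≤ ∑ θ ∈ T.DD θ0, Module.finrank ℂ ↥(B ⊓ T.vw θ) + n →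
    ∃ m : Module.Dual ℂ H → ℕ,
      (∀ θ' ∈ T.DD θ0, Module.finrank ℂ ↥(A ⊓ T.vw θ') = Module.finrank ℂ ↥(B ⊓ T.vw θ') +
        ∑ θ ∈ T.DD θ0, m θ * T.ch (χ - θ) (θ' - θ)) ∧
      ∀ θ ∈ T.DD θ0, m θ ≠ 0 ↔ T.Fac χ A B θ := by
  classical
  induction n using Nat.strong_induction_on with
  | _ n ih =>
  intro A B hA hB hBA hn
  by_cases hall : ∀ θ ∈ T.DD θ0, A ⊓ T.vw θ ≤ B
  · refine ⟨0, ?_, ?_⟩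
    · intro θ' hθ'
      have : A ⊓ T.vw θ' = B ⊓ T.vw θ' :=
        le_antisymm (le_inf (hall θ' hθ') inf_le_right) (inf_le_inf_right _ hBA)
      rw [this]; simp
    · intro θ hθ
      constructor
      · intro h; exact absurd rfl h
      · rintro ⟨N, h1, h2, h3, x, hx, h4, h5, h6⟩
        exact absurd (h2 (hall θ hθ ⟨hx, h4⟩)) h5
  · push Not at hall
    obtain ⟨θ1, h1, h1'⟩ := hall
    obtain ⟨θ, hθ, hmin⟩ := Finset.exists_min_image ((T.DD θ0).filter fun θ => ¬ (A ⊓ T.vw θ ≤ B))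
      (fun θ => (θ T.hz).re) ⟨θ1, Finset.mem_filter.2 ⟨h1, h1'⟩⟩
    rw [Finset.mem_filter] at hθ
    obtain ⟨hθ, hne⟩ := hθ
    obtain ⟨x, ⟨hxA, hx⟩, hxB⟩ := SetLike.not_le_iff_exists.1 hne
    have hex : ∀ i, T.act χ (T.e i) x ∈ B := by
      intro i
      by_cases h0 : T.act χ (T.e i) x = 0
      · rw [h0]; exact Submodule.zero_mem _
      have hv := T.act_mem_vw χ (T.isW_e i) hx
      have hD : θ - T.wt i ∈ T.DD θ0 := by
        obtain ⟨m, hm⟩ := MvPolynomial.ne_zero_iff.1 h0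
        obtain ⟨k, k', hk, hk'⟩ := (T.mem_DD).1 hθ
        refine (T.mem_DD).2 ⟨m, k' + Finsupp.single i 1, hv m hm, ?_⟩
        rw [map_add, hk', wm_single]; abel
      by_contra hc
      have := hmin _ (Finset.mem_filter.2 ⟨hD, fun hle => hc (hle ⟨hA _ _ hxA, hv⟩)⟩)
      rw [LinearMap.sub_apply, Complex.sub_re, T.wt_hz, Complex.natCast_re] at this
      have h2 : (0 : ℝ) < T.ht i := by exact_mod_cast T.ht_pos i
      linarith
    set K := B ⊔ (T.rad (χ - θ)).map (T.hom (T.act χ) x) with hK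
    set P := B ⊔ (⊤ : Submodule ℂ (MvPolynomial ι ℂ)).map (T.hom (T.act χ) x) with hP
    have hKP : K ≤ P := sup_le_sup_left (Submodule.map_mono le_top) _
    have hBK : B ≤ K := le_sup_left
    have hKs : T.Stab χ K := T.stab_ext hB hx hex (T.rad_stab _)
    have hPs : T.Stab χ P := T.stab_ext hB hx hex (T.stab_top _)
    have hPA : P ≤ A := by
      refine sup_le hBA ?_
      rw [Submodule.map_le_iff_le_comap]
      intro p _
      refine (T.ind (χ - θ)).mem_of_one _ ?_ ?_ p
      · rw [Submodule.mem_comap, hom_one]; exact hxA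
      · intro i p hp
        rw [Submodule.mem_comap] at hp ⊢
        have h8 := hBA (T.hom_mod hB hx hex (T.f i) p)
        have := Submodule.add_mem _ h8 (hA (T.f i) _ hp)
        rw [sub_add_cancel] at this
        exact this
    have hdim := T.dim_PK hB hx hxB hex
    have hfac := T.fac_PK hB hx hxB hex
    have hlt : ∑ θ ∈ T.DD θ0, Module.finrank ℂ ↥(K ⊓ T.vw θ) < ∑ θ ∈ T.DD θ0, Module.finrank ℂ ↥(P ⊓ T.vw θ) := by
      apply Finset.sum_lt_sum
      · intro θ' _
        rw [hP, hK, hdim]; omega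
      · refine ⟨θ, hθ, ?_⟩
        rw [hP, hK, hdim, sub_self, ch_zero]; omega
    have mono : ∀ {C E : Submodule ℂ (MvPolynomial ι ℂ)}, C ≤ E →
        ∑ θ ∈ T.DD θ0, Module.finrank ℂ ↥(C ⊓ T.vw θ) ≤ ∑ θ ∈ T.DD θ0, Module.finrank ℂ ↥(E ⊓ T.vw θ) := by
      intro C E hCE
      refine Finset.sum_le_sum fun θ _ => ?_
      have := T.fin_inf E θ
      exact Submodule.finrank_mono (inf_le_inf_right _ hCE)
    have m1 := mono hBK
    have m2 := mono hPA
    obtain ⟨m₁, hm₁, hm₁'⟩ := ih (n - 1) (by omega) A P hA hPs hPA (by omega)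
    obtain ⟨m₂, hm₂, hm₂'⟩ := ih (n - 1) (by omega) K B hKs hB hBK (by omega)
    refine ⟨fun θ' => m₁ θ' + (if θ' = θ then 1 else 0) + m₂ θ', ?_, ?_⟩
    · intro θ' hθ'
      rw [hm₁ θ' hθ', hP, hdim, ← hK, hm₂ θ' hθ']
      simp only [add_mul, Finset.sum_add_distrib, ite_mul, one_mul, zero_mul,
        Finset.sum_ite_eq', hθ, if_true]
      omega
    · intro θ' hθ'
      have hf := hfac θ'
      constructor
      · intro h
        by_cases e1 : m₁ θ' ≠ 0
        · exact ((hm₁' θ' hθ').1 e1).of_top (hBK.trans hKP)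
        by_cases e2 : m₂ θ' ≠ 0
        · exact ((hm₂' θ' hθ').1 e2).of_bot (hKP.trans hPA)
        push Not at e1 e2
        by_cases e3 : θ' = θ
        · exact ((hf.2 e3).of_top hBK).of_bot hPA
        · simp [e1, e2, e3] at h
      · intro h
        rcases Fac.split hPs (hBK.trans hKP) hPA h with h | h
        · have := (hm₁' θ' hθ').2 h
          beta_reduce; omega
        · rcases Fac.split hKs hBK hKP h with h | h
          · simp [hf.1 h]
          · have := (hm₂' θ' hθ').2 h
            beta_reduce; omega

theorem K0' (χ θ0 : Module.Dual ℂ H) (A : Submodule ℂ (MvPolynomial ι ℂ)) (hA : T.Stab χ A) :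
    ∃ m : Module.Dual ℂ H → ℕ,
      (∀ θ' ∈ T.DD θ0, Module.finrank ℂ ↥(A ⊓ T.vw θ') =
        ∑ θ ∈ T.DD θ0, m θ * T.ch (χ - θ) (θ' - θ)) ∧
      ∀ θ ∈ T.DD θ0, m θ ≠ 0 ↔ T.Fac χ A ⊥ θ := by
  obtain ⟨m, h1, h2⟩ := T.K0 χ θ0 _ A ⊥ hA (T.stab_bot χ) bot_le (Nat.le_add_left _ _)
  refine ⟨m, fun θ' hθ' => ?_, h2⟩
  have := h1 θ' hθ'
  rw [bot_inf_eq, finrank_bot, zero_add] at this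
  exact this

theorem shift (χ θ0 δ : Module.Dual ℂ H) (k : ι →₀ ℕ) (hk : T.wm k = δ) : ∃ m : Module.Dual ℂ H → ℕ,
    (∀ θ' ∈ T.DD θ0, T.cnt (θ' - δ) = ∑ θ ∈ T.DD θ0, m θ * T.ch (χ - θ) (θ' - θ)) ∧
    (m θ0 ≠ 0 → T.Fac (χ - δ) ⊤ ⊥ (θ0 - δ)) := by
  classical
  obtain ⟨m, h1, h2⟩ := T.K0' (χ - δ) (θ0 - δ) ⊤ (T.stab_top _)
  refine ⟨fun θ => if θ - δ ∈ T.DD (θ0 - δ) then m (θ - δ) else 0, ?_, ?_⟩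
  · intro θ' hθ'
    obtain ⟨a, a', ha, ha'⟩ := (T.mem_DD).1 hθ'
    by_cases hD : θ' - δ ∈ T.DD (θ0 - δ)
    · have h3 := h1 _ hD
      rw [top_inf_eq, T.finrank_vw] at h3
      rw [h3]
      have hinj : Function.Injective (fun θ : Module.Dual ℂ H => θ + δ) := add_left_injective δ
      have : ∑ θ ∈ T.DD (θ0 - δ), m θ * T.ch (χ - δ - θ) (θ' - δ - θ) =
          ∑ θ ∈ (T.DD (θ0 - δ)).image (fun θ => θ + δ), (if θ - δ ∈ T.DD (θ0 - δ) then m (θ - δ) else 0) * T.ch (χ - θ) (θ' - θ) := by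
        rw [Finset.sum_image (fun a _ b _ h => hinj h)]
        refine Finset.sum_congr rfl fun θ hθ => ?_
        rw [add_sub_cancel_right, if_pos hθ, sub_sub, add_comm δ θ, sub_sub, add_comm δ θ]
      rw [this]
      apply Finset.sum_subset
      · intro z hz
        obtain ⟨θ, hθ, rfl⟩ := Finset.mem_image.1 hz
        obtain ⟨b, b', hb, hb'⟩ := (T.mem_DD).1 hθ
        refine (T.mem_DD).2 ⟨b + k, b', by rw [map_add, hb, hk], by rw [hb']; abel⟩
      · intro z _ hz
        rw [if_neg, zero_mul]
        intro hz2
        exact hz (Finset.mem_image.2 ⟨_, hz2, sub_add_cancel _ _⟩)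
    · have hno : ∀ b, T.wm b ≠ θ' - δ := by
        intro b hb
        apply hD
        exact (T.mem_DD).2 ⟨b, a', hb, by rw [ha']; abel⟩
      have h3 : T.cnt (θ' - δ) = 0 := by
        rw [cnt, Finset.card_eq_zero, Finset.eq_empty_iff_forall_notMem]
        intro b hb
        exact hno b ((T.mem_idx).1 hb)
      rw [h3, Finset.sum_eq_zero]
      intro θ _
      beta_reduce
      split_ifs with h
      · obtain ⟨b, b', hb, hb'⟩ := (T.mem_DD).1 h
        rw [T.ch_eq_zero, mul_zero]
        intro c hc
        apply hno (b + c)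
        rw [map_add, hb, hc]; abel
      · rw [zero_mul]
  · intro h
    beta_reduce at h
    split_ifs at h with h3
    · exact (h2 _ h3).1 h
    · exact absurd rfl h

theorem fac_rad {χ θ : Module.Dual ℂ H} (hθ : θ ≠ 0) (h : T.Fac χ ⊤ ⊥ θ) : T.Fac χ (T.rad χ) ⊥ θ := by
  rcases Fac.split (T.rad_stab χ) bot_le le_top h with h | h
  · exfalso
    obtain ⟨N, h1, h2, h3, x, hx, h4, h5, h6⟩ := h
    have hone : (1 : MvPolynomial ι ℂ) ∉ N := by
      intro h
      apply h5
      exact (T.ind χ).mem_of_one N h (fun i p hp => h1 _ _ hp) x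
    have hle := T.le_rad_of_one χ h1 hone
    apply h5
    apply h2
    apply T.mem_rad_of_e
    · by_contra h0
      have := h4 0 h0
      rw [map_zero] at this
      exact hθ this.symm
    · exact fun i => hle (h6 i)
  · exact h

variable {T} in
theorem RootHyp.S1 {rho : Module.Dual ℂ H} {S : Set ι} (hR : T.RootHyp rho S)
    (hrho : ∀ i, rho (T.co i) ≠ 0) {η : Module.Dual ℂ H}
    (hη : ∀ i j, i ≠ j → η (T.co i) * rho (T.co j) ≠ η (T.co j) * rho (T.co i))
    {lam θ0 : Module.Dual ℂ H} (hθ0 : θ0 ≠ 0) (h : T.Fac lam ⊤ ⊥ θ0) :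
    ∃ i, ∃ n : ℕ, 0 < n ∧ (lam + rho) (T.co i) = n ∧
      T.Fac (lam - n • T.wt i) ⊤ ⊥ (θ0 - n • T.wt i) := by
  classical
  have h1 := T.fac_rad hθ0 h
  have hmem : θ0 ∈ T.DD θ0 := by
    obtain ⟨N, _, _, _, x, _, h4, h5, _⟩ := h
    have h0 : x ≠ 0 := by rintro rfl; exact h5 (Submodule.zero_mem _)
    obtain ⟨m, hm⟩ := MvPolynomial.ne_zero_iff.1 h0
    exact (T.mem_DD).2 ⟨m, 0, h4 m hm, by simp⟩
  choose N0 hN0 using fun θ => hR.jantzen hrho hη lam θ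
  set N := 1 + ∑ θ ∈ T.DD θ0, N0 θ with hN
  have hNle : ∀ θ ∈ T.DD θ0, N0 θ ≤ N := fun θ hθ =>
    (Finset.single_le_sum (f := N0) (fun _ _ => Nat.zero_le _) hθ).trans (Nat.le_add_left _ _)
  choose mJ hJ hJ' using fun i => T.K0' lam θ0 (T.JM lam rho i) (T.JM_stab lam rho i)
  choose mV hV hV' using fun (i : ι) (n : ℕ) => T.shift lam θ0 (n • T.wt i) (Finsupp.single i n) (T.wm_single_n i n)
  have key := T.uniq lam θ0 (fun θ => ∑ i ∈ Finset.Icc 1 N, mJ i θ)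
    (fun θ => ∑ i, ∑ n ∈ Finset.Icc 1 N, if (lam + rho) (T.co i) = n then mV i n θ else 0) ?_ θ0 hmem
  · have h2 : mJ 1 θ0 ≠ 0 := by
      rw [hJ' 1 θ0 hmem, T.JM_one]; exact h1
    have h3 : mJ 1 θ0 ≤ ∑ i ∈ Finset.Icc 1 N, mJ i θ0 :=
      Finset.single_le_sum (f := fun i => mJ i θ0) (fun _ _ => Nat.zero_le _) (Finset.mem_Icc.2 ⟨le_rfl, by omega⟩)
    have h4 : (∑ i, ∑ n ∈ Finset.Icc 1 N, if (lam + rho) (T.co i) = n then mV i n θ0 else 0) ≠ 0 := by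
      rw [← key]; beta_reduce; omega
    obtain ⟨i, _, hi⟩ := Finset.exists_ne_zero_of_sum_ne_zero h4
    obtain ⟨n, hn, hin⟩ := Finset.exists_ne_zero_of_sum_ne_zero hi
    split_ifs at hin with hc
    · exact ⟨i, n, (Finset.mem_Icc.1 hn).1, hc, hV' i n hin⟩
    · exact absurd rfl hin
  · intro θ' hθ'
    have h5 := hN0 θ' N (hNle θ' hθ')
    have e1 : ∑ θ ∈ T.DD θ0, (∑ i ∈ Finset.Icc 1 N, mJ i θ) * T.ch (lam - θ) (θ' - θ) =
        ∑ i ∈ Finset.Icc 1 N, Module.finrank ℂ ↥(T.JM lam rho i ⊓ T.vw θ') := by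
      simp_rw [Finset.sum_mul]
      rw [Finset.sum_comm]
      refine Finset.sum_congr rfl fun i _ => (hJ i θ' hθ').symm
    have e2 : (∑ θ ∈ T.DD θ0, (∑ i, ∑ n ∈ Finset.Icc 1 N, if (lam + rho) (T.co i) = n then mV i n θ else 0) * T.ch (lam - θ) (θ' - θ)) =
        ∑ i, ∑ n ∈ Finset.Icc 1 N, if (lam + rho) (T.co i) = n then T.cnt (θ' - n • T.wt i) else 0 := ?_
    · rw [e1, e2, h5]
    simp_rw [Finset.sum_mul]
    rw [Finset.sum_comm]
    refine Finset.sum_congr rfl fun i _ => ?_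
    rw [Finset.sum_comm]
    refine Finset.sum_congr rfl fun n _ => ?_
    split_ifs with hc
    · exact (hV i n θ' hθ').symm
    · simp

end TriData
end Vrm


set_option linter.unusedSectionVars false
set_option linter.unusedSimpArgs false

namespace Vrm
open MvPolynomial

variable {ι : Type} [Fintype ι] [LinearOrder ι] {L : Type*} [LieRing L] [LieAlgebra ℂ L]
    {H : Type*} [AddCommGroup H] [Module ℂ H]

namespace TriData
variable (T : TriData ι L H)

/-- signed coroots -/
def IsCor (x : H) : Prop := ∃ k, x = T.co k ∨ x = - T.co k

/-- combinatorial hypotheses -/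
structure Comb (rho : Module.Dual ℂ H) (S : Set ι) (I : Finset ι) (G : Module.Dual ℂ H) : Prop where
  root : T.RootHyp rho S
  rho_pos : ∀ i, ∃ n : ℕ, 0 < n ∧ rho (T.co i) = n
  eta : ∃ η : Module.Dual ℂ H, ∀ i j, i ≠ j → η (T.co i) * rho (T.co j) ≠ η (T.co j) * rho (T.co i)
  int : ∀ i j, ∃ a : ℤ, T.wt i (T.co j) = a
  refl : ∀ i j, T.IsCor (T.co j - T.wt i (T.co j) • T.co i)
  string : ∀ i j (a : ℕ), i ≠ j → T.wt i (T.co j) = a → ∀ k ≤ a, T.IsCor (T.co j - (k : ℂ) • T.co i)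
  I_S : ∀ i ∈ I, i ∈ S
  G_nonneg : ∀ i, 0 ≤ (G (T.co i)).re
  gen : ∀ i, (G (T.co i)).re = 0 → T.co i ∈ AddSubmonoid.closure (T.co '' (I : Set ι))
  G_I : ∀ i ∈ I, (G (T.co i)).re = 0
  indep : ∀ i j, i ∈ I → (G (T.co j)).re ≠ 0 → ∀ c : ℂ, T.wt j ≠ c • T.wt i

variable {T} {rho : Module.Dual ℂ H} {S : Set ι} {I : Finset ι} {G : Module.Dual ℂ H} (hC : T.Comb rho S I G)

/-- integrality and positivity -/
def PosAt (T : TriData ι L H) (rho χ : Module.Dual ℂ H) (i : ι) : Prop := ∃ n : ℕ, 0 < n ∧ (χ + rho) (T.co i) = n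

open Classical in
/-- the length function -/
noncomputable def len (T : TriData ι L H) (rho χ : Module.Dual ℂ H) : ℕ := (Finset.univ.filter fun i => T.PosAt rho χ i).card

include hC

theorem Comb.co_inj : Function.Injective T.co := by
  intro i j h
  by_contra hne
  obtain ⟨η, hη⟩ := hC.eta
  exact hη i j hne (by rw [h])

theorem Comb.co_add_ne {i j : ι} : T.co i ≠ - T.co j := by
  intro h
  obtain ⟨n, hn, h1⟩ := hC.rho_pos i
  obtain ⟨m, hm, h2⟩ := hC.rho_pos j
  have := congrArg rho h
  rw [map_neg, h1, h2, eq_neg_iff_add_eq_zero] at this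
  have : n + m = 0 := by exact_mod_cast this
  omega

theorem Comb.refl_refl (i : ι) (x : H) : (x - T.wt i x • T.co i) - T.wt i (x - T.wt i x • T.co i) • T.co i = x := by
  rw [map_sub, map_smul, T.wt_co, smul_eq_mul, sub_sub, ← add_smul, sub_eq_self]
  convert zero_smul ℂ _ using 2
  ring

theorem Comb.card_le (i : ι) (P Q : ι → Prop) [DecidablePred P] [DecidablePred Q]
    (h1 : ∀ j k, P j → T.co j - T.wt i (T.co j) • T.co i = T.co k → Q k)
    (h2 : ∀ j k, P j → T.co j - T.wt i (T.co j) • T.co i = - T.co k → Q j) :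
    (Finset.univ.filter P).card ≤ (Finset.univ.filter Q).card := by
  classical
  have hex : ∀ j, ∃ k, (T.co j - T.wt i (T.co j) • T.co i = T.co k) ∨
      (k = j ∧ ∃ l, T.co j - T.wt i (T.co j) • T.co i = - T.co l) := by
    intro j
    obtain ⟨k, hk | hk⟩ := hC.refl i j
    · exact ⟨k, Or.inl hk⟩
    · exact ⟨j, Or.inr ⟨rfl, k, hk⟩⟩
  choose f hf using hex
  refine Finset.card_le_card_of_injOn f ?_ ?_
  · intro j hj
    have hj := (Finset.mem_filter.1 hj).2
    refine Finset.mem_filter.2 ⟨Finset.mem_univ _, ?_⟩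
    rcases hf j with h | ⟨h, l, hl⟩
    · exact h1 _ _ hj h
    · rw [h]; exact h2 _ _ hj hl
  · intro j _ j' _ he
    rcases hf j with h | ⟨h, l, hl⟩ <;> rcases hf j' with h' | ⟨h', l', hl'⟩
    · rw [he, ← h'] at h
      have := hC.refl_refl i (T.co j)
      rw [h, hC.refl_refl] at this
      exact (hC.co_inj this).symm
    · have h3 := hC.refl_refl i (T.co j)
      rw [h, he, h', hl'] at h3
      exact absurd h3.symm hC.co_add_ne
    · have h3 := hC.refl_refl i (T.co j')
      rw [h', ← he, h, hl] at h3
      exact absurd h3.symm hC.co_add_ne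
    · rw [← h, ← h', he]

theorem Comb.len_lt {χ : Module.Dual ℂ H} {i : ι} {n : ℕ} (hn : 0 < n) (h : (χ + rho) (T.co i) = n) :
    T.len rho (χ - n • T.wt i) < T.len rho χ := by
  classical
  have hv : ∀ j, (χ - n • T.wt i + rho) (T.co j) = (χ + rho) (T.co j - T.wt i (T.co j) • T.co i) := by
    intro j
    rw [map_sub, map_smul, h]
    simp; ring
  have h1 := hC.card_le i (fun j => T.PosAt rho (χ - n • T.wt i) j) (fun j => T.PosAt rho χ j ∧ j ≠ i) ?_ ?_
  · refine lt_of_le_of_lt h1 ?_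
    apply Finset.card_lt_card
    rw [Finset.ssubset_iff_of_subset]
    · exact ⟨i, Finset.mem_filter.2 ⟨Finset.mem_univ _, n, hn, h⟩, by simp⟩
    · intro j hj
      rw [Finset.mem_filter] at hj ⊢
      exact ⟨hj.1, hj.2.1⟩
  · rintro j k ⟨m, hm, hm2⟩ hjk
    rw [hv, hjk] at hm2
    refine ⟨⟨m, hm, hm2⟩, ?_⟩
    rintro rfl
    have := hC.refl_refl k (T.co j)
    rw [hjk, T.wt_co, two_smul, sub_add_cancel_left] at this
    exact hC.co_add_ne this.symm
  · rintro j k ⟨m, hm, hm2⟩ hjk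
    constructor
    · obtain ⟨a, ha⟩ := hC.int i j
      obtain ⟨r, hr, h3⟩ := hC.rho_pos i
      obtain ⟨s, hs, h4⟩ := hC.rho_pos j
      obtain ⟨t, ht, h5⟩ := hC.rho_pos k
      have h6 := congrArg rho hjk
      rw [map_sub, map_smul, map_neg, h3, h4, h5, ha, smul_eq_mul] at h6
      have h7 : (s : ℤ) - a * r = - t := by exact_mod_cast h6
      have ha0 : 0 < a := by
        by_contra hcon
        push Not at hcon
        have : a * r ≤ 0 := mul_nonpos_of_nonpos_of_nonneg hcon (by positivity)
        omega
      rw [hv, map_sub, map_smul, h, ha] at hm2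
      refine ⟨m + n * a.toNat, by positivity, ?_⟩
      have h8 : ((a.toNat : ℕ) : ℂ) = a := by
        have : ((a.toNat : ℕ) : ℤ) = a := Int.toNat_of_nonneg ha0.le
        exact_mod_cast congrArg (Int.cast : ℤ → ℂ) this
      push_cast
      rw [h8, ← hm2, smul_eq_mul]; ring
    · rintro rfl
      rw [hv, T.wt_co, two_smul, sub_add_cancel_left, map_neg, h] at hm2
      have : n + m = 0 := by
        have h9 : (n : ℂ) + m = 0 := by rw [← hm2]; ring
        exact_mod_cast h9
      omega

theorem Comb.len_ge {χ : Module.Dual ℂ H} (hreg : ∀ i, (χ + rho) (T.co i) ≠ 0) {i : ι} {n : ℕ}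
    (h : (χ + rho) (T.co i) = n) (hi : 0 < (G (T.co i)).re)
    (hmin : ∀ j, ∀ m : ℕ, 0 < m → 0 < (G (T.co j)).re → (χ + rho) (T.co j) = m → n ≤ m) :
    T.len rho χ ≤ T.len rho (χ - n • T.wt i) + 1 := by
  classical
  have hv : ∀ j, (χ - n • T.wt i + rho) (T.co j) = (χ + rho) (T.co j - T.wt i (T.co j) • T.co i) := by
    intro j
    rw [map_sub, map_smul, h]
    simp; ring
  have hcor : ∀ x, T.IsCor x → (χ + rho) x ≠ 0 := by
    rintro x ⟨k, rfl | rfl⟩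
    · exact hreg k
    · rw [map_neg, neg_ne_zero]; exact hreg k
  -- decomposition of co i is impossible
  have hdec : ∀ x z : H, T.IsCor x → T.IsCor z → x + z = T.co i → ∀ m m' : ℕ, 0 < m → 0 < m' →
      (χ + rho) x = m → (χ + rho) z = m' → False := by
    have aux : ∀ x z : H, T.IsCor x → x + z = T.co i → 0 < (G x).re → ∀ m m' : ℕ, 0 < m → 0 < m' →
      (χ + rho) x = m → (χ + rho) z = m' → False := by
      rintro x z ⟨k, hk⟩ hxz hG m m' hm hm' h1 h2
      have hk : x = T.co k := by
        rcases hk with hk | hk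
        · exact hk
        · rw [hk, map_neg, Complex.neg_re] at hG
          have := hC.G_nonneg k
          linarith
      rw [hk] at hG h1
      have h3 := hmin k m hm hG h1
      have h4 := congrArg (χ + rho) hxz
      rw [map_add, hk, h1, h2, h] at h4
      have : m + m' = n := by exact_mod_cast h4
      omega
    intro x z hx hz hxz m m' hm hm' h1 h2
    have h3 := congrArg (fun x => (G x).re) hxz
    simp only [map_add, Complex.add_re] at h3
    by_cases hG : 0 < (G x).re
    · exact aux x z hx hxz hG m m' hm hm' h1 h2
    · exact aux z x hz (by rw [add_comm]; exact hxz) (by linarith) m' m hm' hm h2 h1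
  have hnpos : 0 < n := by
    apply Nat.pos_of_ne_zero
    rintro rfl
    exact hreg i (by simpa using h)
  have h1 := hC.card_le i (fun j => T.PosAt rho χ j ∧ j ≠ i) (fun j => T.PosAt rho (χ - n • T.wt i) j) ?_ ?_
  · have : T.len rho χ ≤ (Finset.univ.filter fun j => T.PosAt rho χ j ∧ j ≠ i).card + 1 := by
      rw [len, ← Finset.card_insert_of_notMem (s := Finset.univ.filter fun j => T.PosAt rho χ j ∧ j ≠ i) (a := i) (by simp)]
      apply Finset.card_le_card
      intro j hj
      rw [Finset.mem_filter] at hj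
      by_cases hji : j = i
      · simp [hji]
      · exact Finset.mem_insert_of_mem (Finset.mem_filter.2 ⟨hj.1, hj.2, hji⟩)
    refine this.trans ?_
    rw [len]
    exact Nat.add_le_add_right h1 1
  · rintro j k ⟨⟨m, hm, hm2⟩, hji⟩ hjk
    refine ⟨m, hm, ?_⟩
    rw [hv, ← hm2, ← hjk, hC.refl_refl]
  · rintro j k ⟨⟨m, hm, hm2⟩, hji⟩ hjk
    obtain ⟨a, ha⟩ := hC.int i j
    rw [PosAt, hv]
    by_cases ha0 : a ≤ 0
    · refine ⟨m + n * (-a).toNat, by positivity, ?_⟩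
      have h8 : (((-a).toNat : ℕ) : ℂ) = -a := by
        have : (((-a).toNat : ℕ) : ℤ) = -a := Int.toNat_of_nonneg (by omega)
        exact_mod_cast congrArg (Int.cast : ℤ → ℂ) this
      rw [map_sub, map_smul, hm2, h, ha, smul_eq_mul]
      push_cast
      rw [h8]; ring
    · push Not at ha0
      obtain ⟨b, rfl⟩ := Int.eq_ofNat_of_zero_le ha0.le
      rw [Int.cast_natCast] at ha
      have hstr := hC.string i j b (Ne.symm hji) ha
      rw [ha]
      have key : ∀ k ≤ b, ∃ m : ℕ, 0 < m ∧ (χ + rho) (T.co j - (k : ℂ) • T.co i) = m := by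
        intro k
        induction k with
        | zero => intro _; exact ⟨m, hm, by simpa using hm2⟩
        | succ k ih =>
          intro hk
          obtain ⟨m1, hm1, e1⟩ := ih (by omega)
          have e2 : (χ + rho) (T.co j - ((k + 1 : ℕ) : ℂ) • T.co i) = m1 - n := by
            rw [← e1, ← h, ← map_sub]; congr 1; push_cast; rw [add_smul, one_smul]; abel
          by_cases hlt : n < m1
          · exact ⟨m1 - n, by omega, by rw [e2, Nat.cast_sub hlt.le]⟩
          · exfalso
            have hne : m1 ≠ n := by
              rintro rfl
              exact hcor _ (hstr (k + 1) hk) (by rw [e2, sub_self])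
            refine hdec (T.co j - (k : ℂ) • T.co i) (-(T.co j - ((k + 1 : ℕ) : ℂ) • T.co i)) (hstr k (by omega))
              ?_ ?_ m1 (n - m1) hm1 (by omega) e1 ?_
            · obtain ⟨l, hl | hl⟩ := hstr (k + 1) hk
              · exact ⟨l, Or.inr (by rw [hl])⟩
              · exact ⟨l, Or.inl (by rw [hl, neg_neg])⟩
            · push_cast; rw [add_smul, one_smul]; abel
            · rw [map_neg, e2, Nat.cast_sub (by omega)]; ring
      exact key b le_rfl

theorem Comb.chain (N : ℕ) : ∀ χ θ : Module.Dual ℂ H, T.len rho χ ≤ N → T.Fac χ ⊤ ⊥ θ →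
    θ = 0 ∨ T.len rho (χ - θ) < T.len rho χ := by
  have hrho : ∀ i, rho (T.co i) ≠ 0 := by
    intro i h
    obtain ⟨n, hn, h1⟩ := hC.rho_pos i
    rw [h] at h1
    have : n = 0 := by exact_mod_cast h1.symm
    omega
  obtain ⟨η, hη⟩ := hC.eta
  induction N with
  | zero =>
    intro χ θ hN hF
    by_contra hcon
    push Not at hcon
    obtain ⟨i, n, hn, h, _⟩ := hC.root.S1 hrho hη hcon.1 hF
    have := hC.len_lt hn h
    omega
  | succ N ih =>
    intro χ θ hN hF
    by_cases hθ : θ = 0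
    · exact Or.inl hθ
    right
    obtain ⟨i, n, hn, h, hF'⟩ := hC.root.S1 hrho hη hθ hF
    have h1 := hC.len_lt hn h
    rcases ih _ _ (by omega) hF' with h2 | h2
    · rw [sub_eq_zero.1 h2]; exact h1
    · rw [sub_sub_sub_cancel_right] at h2
      omega

omit hC in
variable (T) in
/-- submodule defining the parabolic Verma module -/
noncomputable def KI (I : Finset ι) (χ : Module.Dual ℂ H) (m : ι → ℕ) : Submodule ℂ (MvPolynomial ι ℂ) :=
  ⨆ i ∈ I, LinearMap.range (T.hom (T.act χ) ((T.act χ (T.f i) ^ (m i + 1)) 1))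

theorem Comb.sing {χ : Module.Dual ℂ H} {m : ι → ℕ} (hm : ∀ i ∈ I, χ (T.co i) = m i) {i : ι} (hi : i ∈ I) :
    T.IsSing (T.act χ) (χ - (m i + 1) • T.wt i) ((T.act χ (T.f i) ^ (m i + 1)) 1) := by
  apply hC.root.base (hC.I_S i hi) (Nat.succ_pos _)
  rw [LinearMap.add_apply, hm i hi, hC.root.rho_S i (hC.I_S i hi)]; push_cast; rfl

theorem Comb.KI_stab {χ : Module.Dual ℂ H} {m : ι → ℕ} (hm : ∀ i ∈ I, χ (T.co i) = m i) : T.Stab χ (T.KI I χ m) := by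
  intro x p hp
  have : T.KI I χ m ≤ (T.KI I χ m).comap (T.act χ x) := by
    conv_lhs => rw [KI]
    refine iSup₂_le fun i hi => ?_
    intro q hq
    exact (le_iSup₂_of_le (f := fun i (_ : i ∈ I) => LinearMap.range (T.hom (T.act χ) ((T.act χ (T.f i) ^ (m i + 1)) 1))) i hi le_rfl)
      (T.range_stab χ (hC.sing hm hi) x q hq)
  exact this hp

theorem Comb.KI_le_rad {χ : Module.Dual ℂ H} {m : ι → ℕ} (hm : ∀ i ∈ I, χ (T.co i) = m i) : T.KI I χ m ≤ T.rad χ :=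
  iSup₂_le fun i hi => T.range_le_rad χ (hC.sing hm hi) (T.wm_ne_neg (Nat.succ_pos _))

omit hC in
theorem Fac.pull {χ δ θ : Module.Dual ℂ H} {q : MvPolynomial ι ℂ} (hq0 : q ≠ 0)
    (hq : T.IsSing (T.act χ) (χ - δ) q) (h : T.Fac χ (LinearMap.range (T.hom (T.act χ) q)) ⊥ θ) :
    T.Fac (χ - δ) ⊤ ⊥ (θ - δ) := by
  obtain ⟨N, h1, h2, h3, x, ⟨p, rfl⟩, h4, h5, h6⟩ := h
  have hact := T.hom_act _ (T.isRep χ) hq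
  refine ⟨N.comap (T.hom (T.act χ) q), ?_, bot_le, le_top, p, trivial, ?_, h5, ?_⟩
  · intro y p hp
    rw [Submodule.mem_comap, hact]
    exact h1 _ _ hp
  · have h7 := T.hom_pj χ ((T.sing_iff χ).1 hq).1 (θ - δ) p
    rw [add_sub_cancel, T.pj_of_mem h4] at h7
    rw [T.hom_inj χ hq0 h7]
    exact T.pj_mem _ _
  · intro i
    rw [Submodule.mem_comap, hact]
    exact h6 i

theorem Comb.fac_KI {χ : Module.Dual ℂ H} {m : ι → ℕ} (hm : ∀ i ∈ I, χ (T.co i) = m i) {θ : Module.Dual ℂ H}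
    (h : T.Fac χ (T.KI I χ m) ⊥ θ) : ∃ i ∈ I, T.Fac (χ - (m i + 1) • T.wt i) ⊤ ⊥ (θ - (m i + 1) • T.wt i) := by
  classical
  have key : ∀ J : Finset ι, J ⊆ I →
      T.Stab χ (⨆ i ∈ J, LinearMap.range (T.hom (T.act χ) ((T.act χ (T.f i) ^ (m i + 1)) 1))) ∧
      (T.Fac χ (⨆ i ∈ J, LinearMap.range (T.hom (T.act χ) ((T.act χ (T.f i) ^ (m i + 1)) 1))) ⊥ θ →
      ∃ i ∈ J, T.Fac χ (LinearMap.range (T.hom (T.act χ) ((T.act χ (T.f i) ^ (m i + 1)) 1))) ⊥ θ) := by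
    intro J
    induction J using Finset.induction_on with
    | empty =>
      intro _
      simp only [Finset.notMem_empty, not_false_eq_true, iSup_neg, iSup_bot]
      refine ⟨T.stab_bot χ, ?_⟩
      rintro ⟨N, h1, h2, h3, x, hx, h4, h5, h6⟩
      rw [Submodule.mem_bot] at hx
      rw [hx] at h5
      exact absurd (Submodule.zero_mem _) h5
    | insert i J hiJ ih =>
      intro hJ
      obtain ⟨ih1, ih2⟩ := ih (fun j hj => hJ (Finset.mem_insert_of_mem hj))
      have hs := T.range_stab χ (hC.sing hm (hJ (Finset.mem_insert_self i J)))
      rw [Finset.iSup_insert]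
      refine ⟨T.stab_sup χ hs ih1, fun h => ?_⟩
      rcases Fac.sup hs ih1 h with h | h
      · exact ⟨i, Finset.mem_insert_self _ _, h⟩
      · obtain ⟨j, hj, hj'⟩ := ih2 h
        exact ⟨j, Finset.mem_insert_of_mem hj, hj'⟩
  obtain ⟨i, hi, hF⟩ := (key I subset_rfl).2 h
  refine ⟨i, hi, Fac.pull ?_ (hC.sing hm hi) hF⟩
  intro h0
  exact one_ne_zero (T.act_f_pow_inj χ i _ h0)

/-- the main criterion -/
theorem Comb.criterion {χ : Module.Dual ℂ H} {m : ι → ℕ} (hm : ∀ i ∈ I, χ (T.co i) = m i)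
    (hreg : ∀ i, (χ + rho) (T.co i) ≠ 0) :
    T.KI I χ m = T.rad χ ↔ ∀ i, 0 < (G (T.co i)).re → ¬ T.PosAt rho χ i := by
  classical
  have hgen : ∀ κ : Module.Dual ℂ H, (∀ i ∈ I, T.PosAt rho κ i) → ∀ i, (G (T.co i)).re = 0 → T.PosAt rho κ i := by
    intro κ hκ i hi
    let A : AddSubmonoid H :=
      { carrier := {x | ∃ n : ℕ, (κ + rho) x = n}
        zero_mem' := ⟨0, by simp⟩
        add_mem' := by
          rintro a b ⟨n, hn⟩ ⟨k, hk⟩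
          exact ⟨n + k, by rw [map_add, hn, hk]; push_cast; rfl⟩ }
    have hcl := hC.gen i hi
    have hne : T.co i ≠ 0 := by
      intro h0
      have := T.wt_co i
      rw [h0, map_zero] at this
      norm_num at this
    have hstrong : ∀ x ∈ AddSubmonoid.closure (T.co '' (I : Set ι)), x = 0 ∨ ∃ n : ℕ, 0 < n ∧ (κ + rho) x = n := by
      intro x hx
      induction hx using AddSubmonoid.closure_induction with
      | mem x hx =>
        obtain ⟨j, hj, rfl⟩ := hx
        exact Or.inr (hκ j hj)
      | zero => exact Or.inl rfl
      | add x y _ _ hx hy =>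
        rcases hx with rfl | ⟨n, hn, hx⟩
        · rw [zero_add]; exact hy
        · rcases hy with rfl | ⟨k, hk, hy⟩
          · rw [add_zero]; exact Or.inr ⟨n, hn, hx⟩
          · exact Or.inr ⟨n + k, by omega, by rw [map_add, hx, hy]; push_cast; rfl⟩
    exact (hstrong _ hcl).resolve_left hne
  have hposI : ∀ i ∈ I, T.PosAt rho χ i := fun i hi =>
    ⟨m i + 1, Nat.succ_pos _, by
      rw [LinearMap.add_apply, hm i hi, hC.root.rho_S i (hC.I_S i hi)]; push_cast; rfl⟩
  constructor
  · intro hK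
    by_contra hcon
    push Not at hcon
    obtain ⟨i0, hi0, n0, hn0, hn0'⟩ := hcon
    have hexn : ∃ n : ℕ, 0 < n ∧ ∃ i, 0 < (G (T.co i)).re ∧ (χ + rho) (T.co i) = n := ⟨n0, hn0, i0, hi0, hn0'⟩
    obtain ⟨hn, i, hi, hin⟩ := Nat.find_spec hexn
    set n := Nat.find hexn with hndef
    have hmin : ∀ j, ∀ m : ℕ, 0 < m → 0 < (G (T.co j)).re → (χ + rho) (T.co j) = m → n ≤ m :=
      fun j m hm hj hjm => Nat.find_min' hexn ⟨hm, j, hj, hjm⟩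
    have hlen := hC.len_ge hreg hin hi hmin
    obtain ⟨y, hy0, hy⟩ := hC.root.hasSing _ i le_rfl χ n hn hin
    obtain ⟨hyv, hye⟩ := (T.sing_iff χ).1 hy
    have hyr : y ∈ T.rad χ := T.range_le_rad χ hy (T.wm_ne_neg hn) ⟨1, T.hom_one _ _⟩
    rw [← hK] at hyr
    have hF : T.Fac χ (T.KI I χ m) ⊥ (n • T.wt i) :=
      ⟨⊥, T.stab_bot χ, le_rfl, bot_le, y, hyr, hyv, hy0, fun i => by rw [hye i]; exact Submodule.zero_mem _⟩
    obtain ⟨j, hj, hF'⟩ := hC.fac_KI hm hF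
    have hlj : (χ + rho) (T.co j) = ((m j + 1 : ℕ) : ℂ) := by
      rw [LinearMap.add_apply, hm j hj, hC.root.rho_S j (hC.I_S j hj)]; push_cast; rfl
    have h1 : T.len rho (χ - (m j + 1) • T.wt j) < T.len rho χ := hC.len_lt (Nat.succ_pos _) hlj
    rcases hC.chain _ _ _ le_rfl hF' with h2 | h2
    · have h3 := sub_eq_zero.1 h2
      refine hC.indep j i hj hi.ne' ((m j + 1 : ℕ) / n) ?_
      have hn' : (n : ℂ) ≠ 0 := by exact_mod_cast hn.ne'
      rw [div_eq_inv_mul, mul_smul, Nat.cast_smul_eq_nsmul, ← h3, ← Nat.cast_smul_eq_nsmul ℂ n, smul_smul,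
        inv_mul_cancel₀ hn', one_smul]
    · rw [sub_sub_sub_cancel_right] at h2
      omega
  · intro hJ
    refine le_antisymm (hC.KI_le_rad hm) ?_
    set K := T.KI I χ m with hKdef
    have hKs : T.Stab χ K := hC.KI_stab hm
    by_contra hcon
    have hex : ∃ θ, ¬ (T.rad χ ⊓ T.vw θ ≤ K) := by
      by_contra h
      push Not at h
      exact hcon (T.le_of_comp χ (T.rad_stab χ) h)
    -- minimal height
    have hex2 : ∃ N : ℕ, ∃ mm, T.hm mm = N ∧ ¬ (T.rad χ ⊓ T.vw (T.wm mm) ≤ K) := by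
      obtain ⟨θ, hθ⟩ := hex
      obtain ⟨x, ⟨hxr, hxv⟩, hxK⟩ := SetLike.not_le_iff_exists.1 hθ
      have h0 : x ≠ 0 := by rintro rfl; exact hxK (Submodule.zero_mem _)
      obtain ⟨mm, hmm⟩ := MvPolynomial.ne_zero_iff.1 h0
      refine ⟨_, mm, rfl, ?_⟩
      rw [hxv mm hmm]; exact hθ
    obtain ⟨mm, hmm, hnot⟩ := Nat.find_spec hex2
    obtain ⟨x, ⟨hxr, hxv⟩, hxK⟩ := SetLike.not_le_iff_exists.1 hnot
    set θ := T.wm mm with hθ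
    have hex : ∀ i, T.act χ (T.e i) x ∈ K := by
      intro i
      by_cases h0 : T.act χ (T.e i) x = 0
      · rw [h0]; exact Submodule.zero_mem _
      have hv := T.act_mem_vw χ (T.isW_e i) hxv
      obtain ⟨m', hm'⟩ := MvPolynomial.ne_zero_iff.1 h0
      have hw := hv m' hm'
      by_contra hc
      refine Nat.find_min hex2 (m := T.hm m') ?_ ⟨m', rfl, fun hle => hc (hle ⟨T.rad_stab χ _ _ hxr, ?_⟩)⟩
      · rw [← hmm]
        have h2 : T.wm (m' + Finsupp.single i 1) = T.wm mm := by
          rw [map_add, hw, wm_single]; abel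
        have h3 := congrArg (fun w => w T.hz) h2
        simp only [T.wm_hz] at h3
        have h4 : T.hm (m' + Finsupp.single i 1) = T.hm mm := by exact_mod_cast h3
        rw [map_add, T.hm_single] at h4
        have := T.ht_pos i
        omega
      · rw [hw]; exact hv
    have hθ0 : θ ≠ 0 := by
      intro h0
      rw [h0] at hxv
      have h3 := T.pj_of_mem hxv
      rw [T.pj_zero] at h3
      apply T.one_notMem_rad χ
      rw [← h3] at hxr
      refine (Submodule.smul_mem_iff _ ?_).1 hxr
      intro h0
      rw [h0, zero_smul] at h3
      exact hxK (h3 ▸ Submodule.zero_mem _)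
    have hF : T.Fac χ ⊤ ⊥ θ := ⟨K, hKs, bot_le, le_top, x, trivial, hxv, hxK, hex⟩
    have hlt := (hC.chain _ _ _ le_rfl hF).resolve_left hθ0
    have hposI' : ∀ i ∈ I, T.PosAt rho (χ - θ) i := by
      intro i hi
      have hnil := T.locnil_quot χ K hKs i (m i + 1) (by
        have : LinearMap.range (T.hom (T.act χ) ((T.act χ (T.f i) ^ (m i + 1)) 1)) ≤ K :=
          le_iSup₂_of_le (f := fun i (_ : i ∈ I) => LinearMap.range (T.hom (T.act χ) ((T.act χ (T.f i) ^ (m i + 1)) 1))) i hi le_rfl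
        exact this ⟨1, T.hom_one _ _⟩) x
      obtain ⟨k, hk, _⟩ := sl2_nat (T.qact_rep χ K hKs) (e := T.e i) (f := T.f i) (h := T.hh (T.co i)) (T.e_f i)
        (by rw [T.h_f, T.wt_co]) (n := K.mkQ x) (μ := (χ - θ) (T.co i))
        (by rw [qact_mk, Submodule.mkQ_apply, Submodule.Quotient.mk_eq_zero]; exact hex i)
        (by rw [qact_mk, ((T.mem_vw_iff χ θ x).1 hxv _), map_smul]; rfl)
        (by rw [Submodule.mkQ_apply, Ne, Submodule.Quotient.mk_eq_zero]; exact hxK) hnil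
      refine ⟨k + 1, Nat.succ_pos _, ?_⟩
      rw [LinearMap.add_apply, hk, hC.root.rho_S i (hC.I_S i hi)]; push_cast; rfl
    have hle : T.len rho χ ≤ T.len rho (χ - θ) := by
      apply Finset.card_le_card
      intro i hi
      rw [Finset.mem_filter] at hi ⊢
      refine ⟨hi.1, hgen _ hposI' i ?_⟩
      by_contra hne
      exact hJ i (lt_of_le_of_ne (hC.G_nonneg i) (Ne.symm hne)) hi.2
    omega

end TriData
end Vrm


set_option linter.unusedSectionVars false
set_option linter.unusedSimpArgs false

namespace Vrm

variable {H : Type*} [AddCommGroup H] [Module ℂ H]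

/-- reflection -/
noncomputable def sref (cor : Module.Dual ℂ H → H) (α β : Module.Dual ℂ H) : Module.Dual ℂ H := β - β (cor α) • α

/-- concrete root systems -/
structure RS (Φ : Finset (Module.Dual ℂ H)) (cor : Module.Dual ℂ H → H) : Prop where
  two : ∀ α ∈ Φ, α (cor α) = 2
  neg : ∀ α ∈ Φ, -α ∈ Φ
  cor_neg : ∀ α ∈ Φ, cor (-α) = - cor α
  int : ∀ α ∈ Φ, ∀ β ∈ Φ, ∃ a : ℤ, α (cor β) = a
  refl : ∀ α ∈ Φ, ∀ β ∈ Φ, sref cor α β ∈ Φ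
  cor_refl : ∀ α ∈ Φ, ∀ β ∈ Φ, cor (sref cor α β) = cor β - α (cor β) • cor α
  string : ∀ α ∈ Φ, ∀ β ∈ Φ, β ≠ α → ∀ n : ℕ, β (cor α) = n → ∀ k ≤ n, β - k • α ∈ Φ
  costring : ∀ α ∈ Φ, ∀ β ∈ Φ, β ≠ α → ∀ n : ℕ, α (cor β) = n → ∀ k ≤ n, ∃ γ ∈ Φ, cor γ = cor β - (k : ℂ) • cor α
  red : ∀ α ∈ Φ, ∀ β ∈ Φ, ∀ c : ℂ, β = c • α → β = α ∨ β = -α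
  cored : ∀ α ∈ Φ, ∀ β ∈ Φ, ∀ c : ℂ, cor β = c • cor α → β = α ∨ β = -α
  li : ∀ f : Module.Dual ℂ H →+ ℚ, (∀ α ∈ Φ, f α ≠ 0) →
    LinearIndepOn ℂ id {α | α ∈ Φ ∧ 0 < f α ∧ ∀ β ∈ Φ, ∀ γ ∈ Φ, 0 < f β → 0 < f γ → α ≠ β + γ}

/-- the canonical form on weights -/
noncomputable def BB (Φ : Finset (Module.Dual ℂ H)) (cor : Module.Dual ℂ H → H) :
    Module.Dual ℂ H →ₗ[ℂ] Module.Dual ℂ H →ₗ[ℂ] ℂ :=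
  ∑ γ ∈ Φ, (Module.Dual.eval ℂ H (cor γ)).smulRight (Module.Dual.eval ℂ H (cor γ))

theorem BB_apply (Φ : Finset (Module.Dual ℂ H)) (cor : Module.Dual ℂ H → H) (x y : Module.Dual ℂ H) :
    BB Φ cor x y = ∑ γ ∈ Φ, x (cor γ) * y (cor γ) := by
  simp [BB, LinearMap.sum_apply]

/-- the canonical form on coweights -/
noncomputable def CB (Φ : Finset (Module.Dual ℂ H)) (x : H) : Module.Dual ℂ H := ∑ γ ∈ Φ, γ x • γ

theorem CB_apply (Φ : Finset (Module.Dual ℂ H)) (x y : H) :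
    CB Φ x y = ∑ γ ∈ Φ, γ x * γ y := by
  simp [CB, LinearMap.sum_apply]

section
variable {Φ : Finset (Module.Dual ℂ H)} {cor : Module.Dual ℂ H → H}

theorem sref_sref {α : Module.Dual ℂ H} (h : α (cor α) = 2) (β : Module.Dual ℂ H) :
    sref cor α (sref cor α β) = β := by
  ext x
  simp only [sref, LinearMap.sub_apply, LinearMap.smul_apply, smul_eq_mul, h]
  ring

theorem sref_self {α : Module.Dual ℂ H} (h : α (cor α) = 2) : sref cor α α = -α := by
  ext x
  simp only [sref, LinearMap.sub_apply, LinearMap.smul_apply, smul_eq_mul, h, LinearMap.neg_apply]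
  ring

theorem sref_neg (α β : Module.Dual ℂ H) : sref cor α (-β) = - sref cor α β := by
  ext x
  simp only [sref, LinearMap.sub_apply, LinearMap.smul_apply, smul_eq_mul, LinearMap.neg_apply]
  ring

theorem sref_cor {α : Module.Dual ℂ H} (h : α (cor α) = 2) (β : Module.Dual ℂ H) :
    (sref cor α β) (cor α) = - β (cor α) := by
  simp only [sref, LinearMap.sub_apply, LinearMap.smul_apply, smul_eq_mul, h]
  ring

theorem sum_stab {α : Module.Dual ℂ H} (h : α (cor α) = 2) {U : Finset (Module.Dual ℂ H)}
    (hU : ∀ β ∈ U, sref cor α β ∈ U) {A : Type*} [AddCommMonoid A] (F : Module.Dual ℂ H → A) :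
    ∑ β ∈ U, F (sref cor α β) = ∑ β ∈ U, F β :=
  Finset.sum_nbij' (sref cor α) (sref cor α) hU hU (fun β _ => sref_sref h β) (fun β _ => sref_sref h β)
    (fun _ _ => rfl)

theorem sum_anti {α : Module.Dual ℂ H} (h : α (cor α) = 2) {U : Finset (Module.Dual ℂ H)}
    (hU : ∀ β ∈ U, sref cor α β ∈ U) (F : Module.Dual ℂ H → ℂ) (hF : ∀ β ∈ U, F (sref cor α β) = - F β) :
    ∑ β ∈ U, F β = 0 := by
  have h1 := sum_stab h hU F
  rw [Finset.sum_congr rfl hF, Finset.sum_neg_distrib] at h1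
  linear_combination (-1/2) * h1

variable (hR : RS Φ cor)
include hR

theorem RS.ne_zero {α : Module.Dual ℂ H} (hα : α ∈ Φ) : α ≠ 0 := by
  rintro rfl
  have := hR.two _ hα
  simp at this

theorem RS.ne_neg {α : Module.Dual ℂ H} (hα : α ∈ Φ) : α ≠ -α := by
  intro h
  have h1 := congrArg (fun x => x (cor α)) h
  simp only [LinearMap.neg_apply, hR.two _ hα] at h1
  norm_num at h1

theorem RS.B_root {α : Module.Dual ℂ H} (hα : α ∈ Φ) (x : Module.Dual ℂ H) :
    BB Φ cor x α = (1/2) * BB Φ cor α α * x (cor α) := by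
  have h2 := hR.two _ hα
  have h1 := sum_stab h2 (hR.refl α hα) (fun γ => x (cor γ) * α (cor γ))
  rw [BB_apply, BB_apply, Finset.mul_sum, Finset.sum_mul]
  have h3 : ∑ β ∈ Φ, x (cor (sref cor α β)) * α (cor (sref cor α β)) =
      ∑ β ∈ Φ, (α (cor β) * α (cor β) * x (cor α) - x (cor β) * α (cor β)) := by
    refine Finset.sum_congr rfl fun β hβ => ?_
    rw [hR.cor_refl _ hα _ hβ]
    simp only [map_sub, map_smul, smul_eq_mul, h2]
    ring
  rw [h3, Finset.sum_sub_distrib, sub_eq_iff_eq_add, ← two_mul] at h1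
  have : ∑ i ∈ Φ, 1 / 2 * (α (cor i) * α (cor i)) * x (cor α) = (1/2) * ∑ i ∈ Φ, (α (cor i) * α (cor i)) * x (cor α) := by
    rw [Finset.mul_sum]; exact Finset.sum_congr rfl fun _ _ => by ring
  rw [this, h1]
  ring

theorem RS.C_root {α : Module.Dual ℂ H} (hα : α ∈ Φ) (x : H) :
    CB Φ x (cor α) = (1/2) * CB Φ (cor α) (cor α) * α x := by
  have h2 := hR.two _ hα
  have h1 := sum_stab h2 (hR.refl α hα) (fun γ => γ x * γ (cor α))
  rw [CB_apply, CB_apply, Finset.mul_sum, Finset.sum_mul]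
  have h3 : ∑ β ∈ Φ, (sref cor α β) x * (sref cor α β) (cor α) =
      ∑ β ∈ Φ, (β (cor α) * β (cor α) * α x - β x * β (cor α)) := by
    refine Finset.sum_congr rfl fun β hβ => ?_
    rw [sref_cor h2]
    simp only [sref, LinearMap.sub_apply, LinearMap.smul_apply, smul_eq_mul]
    ring
  rw [h3, Finset.sum_sub_distrib, sub_eq_iff_eq_add, ← two_mul] at h1
  have : ∑ i ∈ Φ, 1 / 2 * (i (cor α) * i (cor α)) * α x = (1/2) * ∑ i ∈ Φ, (i (cor α) * i (cor α)) * α x := by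
    rw [Finset.mul_sum]; exact Finset.sum_congr rfl fun _ _ => by ring
  rw [this, h1]
  ring

theorem RS.real {α β : Module.Dual ℂ H} (hα : α ∈ Φ) (hβ : β ∈ Φ) : ((α (cor β)).re : ℂ) = α (cor β) := by
  obtain ⟨a, ha⟩ := hR.int α hα β hβ
  rw [ha]; simp

theorem RS.B_pos {α : Module.Dual ℂ H} (hα : α ∈ Φ) : ∃ r : ℝ, 0 < r ∧ BB Φ cor α α = r := by
  refine ⟨∑ γ ∈ Φ, (α (cor γ)).re * (α (cor γ)).re, ?_, ?_⟩
  · refine Finset.sum_pos' (fun γ _ => mul_self_nonneg _) ⟨α, hα, ?_⟩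
    rw [hR.two _ hα]; norm_num
  · rw [BB_apply]; push_cast
    exact Finset.sum_congr rfl fun γ hγ => by rw [hR.real hα hγ]

theorem RS.C_pos {α : Module.Dual ℂ H} (hα : α ∈ Φ) : ∃ r : ℝ, 0 < r ∧ CB Φ (cor α) (cor α) = r := by
  refine ⟨∑ γ ∈ Φ, (γ (cor α)).re * (γ (cor α)).re, ?_, ?_⟩
  · refine Finset.sum_pos' (fun γ _ => mul_self_nonneg _) ⟨α, hα, ?_⟩
    rw [hR.two _ hα]; norm_num
  · rw [CB_apply]; push_cast
    exact Finset.sum_congr rfl fun γ hγ => by rw [hR.real hγ hα]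

/-- real part of the form against a root -/
theorem RS.B_re {α : Module.Dual ℂ H} (hα : α ∈ Φ) : ∃ r : ℝ, 0 < r ∧ ∀ x, (BB Φ cor x α).re = r * (x (cor α)).re := by
  obtain ⟨r, hr, h⟩ := hR.B_pos hα
  refine ⟨r / 2, by positivity, fun x => ?_⟩
  rw [hR.B_root hα, h]
  have : (1 / 2 * (r : ℂ) * x (cor α)) = ((r / 2 : ℝ) : ℂ) * x (cor α) := by push_cast; ring
  rw [this, Complex.re_ofReal_mul]

theorem RS.C_re {α : Module.Dual ℂ H} (hα : α ∈ Φ) : ∃ r : ℝ, 0 < r ∧ ∀ x, (CB Φ x (cor α)).re = r * (α x).re := by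
  obtain ⟨r, hr, h⟩ := hR.C_pos hα
  refine ⟨r / 2, by positivity, fun x => ?_⟩
  rw [hR.C_root hα, h]
  have : (1 / 2 * (r : ℂ) * α x) = ((r / 2 : ℝ) : ℂ) * α x := by push_cast; ring
  rw [this, Complex.re_ofReal_mul]

theorem RS.int_re {α β : Module.Dual ℂ H} (hα : α ∈ Φ) (hβ : β ∈ Φ) : ∃ a : ℤ, α (cor β) = a ∧ (α (cor β)).re = a := by
  obtain ⟨a, ha⟩ := hR.int α hα β hβ
  exact ⟨a, ha, by rw [ha]; simp⟩

omit hR in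
theorem BB_symm (x y : Module.Dual ℂ H) : BB Φ cor x y = BB Φ cor y x := by
  rw [BB_apply, BB_apply]; exact Finset.sum_congr rfl fun _ _ => mul_comm _ _

/-- sign symmetry -/
theorem RS.sign {α β : Module.Dual ℂ H} (hα : α ∈ Φ) (hβ : β ∈ Φ) : (α (cor β)).re < 0 ↔ (β (cor α)).re < 0 := by
  obtain ⟨r, hr, h⟩ := hR.B_re hα
  obtain ⟨s, hs, h'⟩ := hR.B_re hβ
  have h1 := h β
  rw [BB_symm, h' α] at h1
  constructor <;> intro h2 <;> by_contra h3 <;> nlinarith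

theorem RS.neg_iff {α : Module.Dual ℂ H} : -α ∈ Φ ↔ α ∈ Φ :=
  ⟨fun h => by simpa using hR.neg _ h, hR.neg _⟩

theorem RS.string_neg {α β : Module.Dual ℂ H} (hα : α ∈ Φ) (hβ : β ∈ Φ) (hne : β ≠ -α) {n : ℕ}
    (h : β (cor α) = -(n : ℂ)) {k : ℕ} (hk : k ≤ n) : β + k • α ∈ Φ := by
  have := hR.string (-α) (hR.neg _ hα) β hβ hne n (by rw [hR.cor_neg _ hα, map_neg, h, neg_neg]) k hk
  simpa using this

end

/-- closed positive subsets -/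
structure PS (Φ P : Finset (Module.Dual ℂ H)) : Prop where
  sub : P ⊆ Φ
  neg : ∀ α ∈ P, -α ∉ P
  add : ∀ α ∈ P, ∀ β ∈ P, α + β ∈ Φ → α + β ∈ P
  diff : ∀ α ∈ P, ∀ β ∈ P, α - β ∈ Φ → α - β ∈ P ∨ β - α ∈ P

/-- indecomposable elements -/
def Ind (P : Finset (Module.Dual ℂ H)) (δ : Module.Dual ℂ H) : Prop := δ ∈ P ∧ ∀ β ∈ P, ∀ γ ∈ P, δ ≠ β + γ

section
variable {Φ P : Finset (Module.Dual ℂ H)} {cor : Module.Dual ℂ H → H}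

theorem sum_ge_two {V : Type*} [DecidableEq V] (P : Finset V) (s : V → V) (hs : ∀ x, s (s x) = x) (F : V → ℝ)
    (hF : ∀ x ∈ P, F (s x) = - F x) (hn : ∀ x ∈ P, F x < 0 → s x ∈ P) {a : V} (ha : a ∈ P) (hFa : F a = 2) (hsa : s a ∉ P) :
    2 ≤ ∑ x ∈ P, F x := by
  classical
  have hinj : Function.Injective s := fun x y h => by rw [← hs x, h, hs]
  set T := P.filter (fun x => F x < 0) with hT
  have h1 : ∑ x ∈ P, F x = ∑ x ∈ T, F x + ∑ x ∈ P.filter (fun x => ¬ F x < 0), F x :=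
    (Finset.sum_filter_add_sum_filter_not _ _ _).symm
  have hna : a ∉ T.image s := by
    intro h
    obtain ⟨x, hx, rfl⟩ := Finset.mem_image.1 h
    rw [hs] at hsa
    exact hsa (Finset.mem_filter.1 hx).1
  have h2 : ∑ x ∈ insert a (T.image s), F x ≤ ∑ x ∈ P.filter (fun x => ¬ F x < 0), F x := by
    refine Finset.sum_le_sum_of_subset_of_nonneg ?_ ?_
    · intro x hx
      rcases Finset.mem_insert.1 hx with rfl | hx
      · exact Finset.mem_filter.2 ⟨ha, by rw [hFa]; norm_num⟩
      · obtain ⟨y, hy, rfl⟩ := Finset.mem_image.1 hx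
        obtain ⟨hy1, hy2⟩ := Finset.mem_filter.1 hy
        exact Finset.mem_filter.2 ⟨hn _ hy1 hy2, by rw [hF _ hy1]; linarith⟩
    · intro x hx _
      exact not_lt.1 (Finset.mem_filter.1 hx).2
  rw [Finset.sum_insert hna, Finset.sum_image hinj.injOn, hFa, Finset.sum_congr rfl (g := fun x => - F x)
    (fun x hx => hF x (Finset.mem_filter.1 hx).1), Finset.sum_neg_distrib] at h2
  linarith

variable (hR : RS Φ cor) (hP : PS Φ P)
include hR hP

theorem PS.string {α β : Module.Dual ℂ H} (hα : α ∈ P) (hβ : β ∈ P) {n : ℕ}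
    (h : β (cor α) = -(n : ℂ)) {k : ℕ} (hk : k ≤ n) : β + k • α ∈ P := by
  have hne : β ≠ -α := by rintro rfl; exact hP.neg _ hα hβ
  induction k with
  | zero => simpa using hβ
  | succ k ih =>
    have h1 := ih (by omega)
    have h2 := hR.string_neg (hP.sub hα) (hP.sub hβ) hne h hk
    rw [succ_nsmul, ← add_assoc] at h2 ⊢
    exact hP.add _ h1 _ hα h2

theorem PS.refl_of_neg {α β : Module.Dual ℂ H} (hα : α ∈ P) (hβ : β ∈ P) (h : (β (cor α)).re ≤ 0) :
    sref cor α β ∈ P := by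
  obtain ⟨a, ha, ha'⟩ := hR.int_re (hP.sub hβ) (hP.sub hα)
  rw [ha'] at h
  have h0 : a ≤ 0 := by exact_mod_cast h
  obtain ⟨n, hn⟩ := Int.eq_ofNat_of_zero_le (neg_nonneg.2 h0)
  have ha2 : β (cor α) = -(n : ℂ) := by
    rw [ha, ← neg_eq_iff_eq_neg]; exact_mod_cast congrArg (Int.cast : ℤ → ℂ) hn
  have := hP.string hR hα hβ ha2 le_rfl
  rwa [sref, ha2, neg_smul, sub_neg_eq_add, Nat.cast_smul_eq_nsmul]

theorem PS.rho_ge {α : Module.Dual ℂ H} (hα : α ∈ P) : 2 ≤ ∑ β ∈ P, (β (cor α)).re := by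
  classical
  have h2 := hR.two _ (hP.sub hα)
  refine sum_ge_two P (sref cor α) (sref_sref h2) (fun β => (β (cor α)).re) ?_ ?_ hα (by simp [h2]) ?_
  · intro β _
    simp only [sref_cor h2, Complex.neg_re]
  · intro β hβ h
    exact hP.refl_of_neg hR hα hβ h.le
  · rw [sref_self h2]; exact hP.neg _ hα

theorem PS.ht_ge {α : Module.Dual ℂ H} (hα : α ∈ P) : 2 ≤ ∑ β ∈ P, (α (cor β)).re := by
  classical
  have h2 := hR.two _ (hP.sub hα)
  refine sum_ge_two P (sref cor α) (sref_sref h2) (fun β => (α (cor β)).re) ?_ ?_ hα (by simp [h2]) ?_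
  · intro β hβ
    simp only [hR.cor_refl _ (hP.sub hα) _ (hP.sub hβ), map_sub, map_smul, h2, ← Complex.neg_re]
    congr 1
    simp only [smul_eq_mul]; ring
  · intro β hβ h
    exact hP.refl_of_neg hR hα hβ ((hR.sign (hP.sub hα) (hP.sub hβ)).1 h).le
  · rw [sref_self h2]; exact hP.neg _ hα

theorem PS.refl_simple {δ β : Module.Dual ℂ H} (hδ : Ind P δ) (hβ : β ∈ P) (hne : β ≠ δ) : sref cor δ β ∈ P := by
  rcases le_or_gt (β (cor δ)).re 0 with h | h
  · exact hP.refl_of_neg hR hδ.1 hβ h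
  obtain ⟨a, ha, ha'⟩ := hR.int_re (hP.sub hβ) (hP.sub hδ.1)
  rw [ha'] at h
  have h0 : 0 ≤ a := by
    have : 0 < a := by exact_mod_cast h
    exact this.le
  obtain ⟨n, rfl⟩ := Int.eq_ofNat_of_zero_le h0
  rw [Int.cast_natCast] at ha
  have key : ∀ k ≤ n, β - k • δ ∈ P := by
    intro k
    induction k with
    | zero => intro _; simpa using hβ
    | succ k ih =>
      intro hk
      have h1 := ih (by omega)
      have h2 := hR.string _ (hP.sub hδ.1) _ (hP.sub hβ) hne n ha (k + 1) hk
      rw [succ_nsmul, ← sub_sub] at h2 ⊢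
      rcases hP.diff _ h1 _ hδ.1 h2 with h3 | h3
      · exact h3
      · exact absurd (by abel) (hδ.2 _ h1 _ h3)
  have := key n le_rfl
  rwa [sref, ha, Nat.cast_smul_eq_nsmul]

theorem PS.refl_simple_ne {δ β : Module.Dual ℂ H} (hδ : Ind P δ) (hβ : β ∈ P) : sref cor δ β ≠ δ := by
  intro h
  have h2 := hR.two _ (hP.sub hδ.1)
  have := sref_sref h2 β
  rw [h, sref_self h2] at this
  exact hP.neg _ hδ.1 (this ▸ hβ)

open Classical in
theorem PS.sum_simple {δ : Module.Dual ℂ H} (hδ : Ind P δ) : ∑ β ∈ P, β (cor δ) = 2 := by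
  have h2 := hR.two _ (hP.sub hδ.1)
  have h1 : ∑ β ∈ P.erase δ, β (cor δ) = 0 := by
    refine sum_anti h2 (U := P.erase δ) ?_ (fun β => β (cor δ)) (fun β _ => sref_cor h2 β)
    intro β hβ
    obtain ⟨h3, h4⟩ := Finset.mem_erase.1 hβ
    exact Finset.mem_erase.2 ⟨hP.refl_simple_ne hR hδ h4, hP.refl_simple hR hδ h4 h3⟩
  rw [← Finset.sum_erase_add _ _ hδ.1, h1, h2, zero_add]

/-- heights -/
theorem PS.height {α : Module.Dual ℂ H} (hα : α ∈ P) : ∃ n : ℕ, 0 < n ∧ α (∑ β ∈ P, cor β) = n := by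
  have h1 := hP.ht_ge hR hα
  have h2 : ∃ a : ℤ, α (∑ β ∈ P, cor β) = a ∧ ∑ β ∈ P, (α (cor β)).re = a := by
    have h3 : ∀ β, ∃ a : ℤ, β ∈ P → α (cor β) = a := fun β => by
      by_cases hβ : β ∈ P
      · obtain ⟨a, ha⟩ := hR.int α (hP.sub hα) β (hP.sub hβ)
        exact ⟨a, fun _ => ha⟩
      · exact ⟨0, fun h => absurd h hβ⟩
    choose a ha using h3
    refine ⟨∑ β ∈ P, a β, ?_, ?_⟩
    · rw [map_sum]; push_cast; exact Finset.sum_congr rfl ha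
    · push_cast; exact Finset.sum_congr rfl fun β hβ => by rw [ha β hβ]; simp
  obtain ⟨a, ha, ha'⟩ := h2
  rw [ha'] at h1
  have h3 : 2 ≤ a := by exact_mod_cast h1
  obtain ⟨n, rfl⟩ := Int.eq_ofNat_of_zero_le (by omega : 0 ≤ a)
  exact ⟨n, by omega, by simpa using ha⟩

theorem PS.induct (C : Module.Dual ℂ H → Prop) (h1 : ∀ δ, Ind P δ → C δ)
    (h2 : ∀ β ∈ P, ∀ γ ∈ P, C β → C γ → C (β + γ)) : ∀ α ∈ P, C α := by
  have key : ∀ n : ℕ, ∀ α ∈ P, α (∑ β ∈ P, cor β) = n → C α := by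
    intro n
    induction n using Nat.strong_induction_on with
    | _ n ih =>
      intro α hα hn
      by_cases hI : Ind P α
      · exact h1 _ hI
      · simp only [Ind, hα, true_and, not_forall, not_not] at hI
        obtain ⟨β, hβ, γ, hγ, rfl⟩ := hI
        obtain ⟨m, hm, hm'⟩ := hP.height hR hβ
        obtain ⟨l, hl, hl'⟩ := hP.height hR hγ
        have h3 : m + l = n := by
          rw [LinearMap.add_apply, hm', hl'] at hn; exact_mod_cast hn
        exact h2 _ hβ _ hγ (ih m (by omega) _ hβ hm') (ih l (by omega) _ hγ hl')
  intro α hα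
  obtain ⟨m, hm, hm'⟩ := hP.height hR hα
  exact key m _ hα hm'

end
end Vrm


set_option linter.unusedSectionVars false
set_option linter.unusedSimpArgs false

namespace Vrm

variable {H : Type*} [AddCommGroup H] [Module ℂ H]

section
variable {Φ P : Finset (Module.Dual ℂ H)} {cor : Module.Dual ℂ H → H}

theorem RS.sref_neg_left (hR : RS Φ cor) {α : Module.Dual ℂ H} (hα : α ∈ Φ) (β : Module.Dual ℂ H) :
    sref cor (-α) β = sref cor α β := by
  ext x
  simp only [sref, LinearMap.sub_apply, LinearMap.smul_apply, smul_eq_mul, LinearMap.neg_apply, hR.cor_neg _ hα, map_neg]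
  ring

theorem RS.stable_aux (hR : RS Φ cor) {Sg : Set (Module.Dual ℂ H)}
    (hSg : ∀ α ∈ Φ, ∀ β ∈ Φ, α ∈ Sg → β ∈ Sg → α + β ∈ Φ → α + β ∈ Sg)
    {δ β : Module.Dual ℂ H} (hδ : δ ∈ Φ) (h2 : -δ ∈ Sg) (hβ : β ∈ Φ) (hβS : β ∈ Sg)
    (h : 0 ≤ (β (cor δ)).re) : sref cor δ β ∈ Sg := by
  obtain ⟨a, ha, ha'⟩ := hR.int_re hβ hδ
  rw [ha'] at h
  obtain ⟨n, rfl⟩ := Int.eq_ofNat_of_zero_le (by exact_mod_cast h : 0 ≤ a)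
  rw [Int.cast_natCast] at ha
  by_cases hne : β = δ
  · rw [hne, sref_self (hR.two _ hδ)]; exact h2
  have key : ∀ k ≤ n, β - k • δ ∈ Sg := by
    intro k
    induction k with
    | zero => intro _; simpa using hβS
    | succ k ih =>
      intro hk
      have h1 := ih (by omega)
      have h3 := hR.string _ hδ _ hβ hne n ha (k + 1) hk
      have h4 := hR.string _ hδ _ hβ hne n ha k (by omega)
      rw [succ_nsmul, ← sub_sub, sub_eq_add_neg] at h3 ⊢
      exact hSg _ h4 _ (hR.neg _ hδ) h1 h2 h3
  have := key n le_rfl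
  rwa [sref, ha, Nat.cast_smul_eq_nsmul]

theorem RS.stable (hR : RS Φ cor) {Sg : Set (Module.Dual ℂ H)}
    (hSg : ∀ α ∈ Φ, ∀ β ∈ Φ, α ∈ Sg → β ∈ Sg → α + β ∈ Φ → α + β ∈ Sg)
    {δ β : Module.Dual ℂ H} (hδ : δ ∈ Φ) (h1 : δ ∈ Sg) (h2 : -δ ∈ Sg) (hβ : β ∈ Φ) (hβS : β ∈ Sg) :
    sref cor δ β ∈ Sg := by
  rcases le_total 0 (β (cor δ)).re with h | h
  · exact hR.stable_aux hSg hδ h2 hβ hβS h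
  · rw [← hR.sref_neg_left hδ]
    refine hR.stable_aux hSg (hR.neg _ hδ) (by rwa [neg_neg]) hβ hβS ?_
    rw [hR.cor_neg _ hδ, map_neg, Complex.neg_re]; linarith

open Classical in
theorem PS.of_choice (hR : RS Φ cor) (hsub : P ⊆ Φ) (htot : ∀ α ∈ Φ, α ∈ P ∨ -α ∈ P) (hneg : ∀ α ∈ P, -α ∉ P)
    {Sg : Set (Module.Dual ℂ H)} (hPS : ∀ α ∈ P, α ∈ Sg)
    (hSg : ∀ α ∈ Φ, ∀ β ∈ Φ, α ∈ Sg → β ∈ Sg → α + β ∈ Φ → α + β ∈ Sg)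
    {ρ : Module.Dual ℂ H} (hρ : 2 • ρ = ∑ α ∈ P, α)
    (hnz : ∀ α ∈ Φ, α ∈ Sg → -α ∈ Sg → ρ (cor α) ≠ 0) : PS Φ P := by
  set Z := Φ.filter (fun α => α ∈ Sg ∧ -α ∈ Sg) with hZ
  have mZ : ∀ {α}, α ∈ Z ↔ α ∈ Φ ∧ α ∈ Sg ∧ -α ∈ Sg := by intro α; simp [hZ]
  have negZ : ∀ {α}, α ∈ Z → -α ∈ Z := fun {α} h => by
    rw [mZ] at h ⊢; exact ⟨hR.neg _ h.1, h.2.2, by simpa using h.2.1⟩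
  have hρ2 : ∀ x, 2 * ρ x = ∑ α ∈ P, α x := fun x => by
    have := congrArg (fun f => f x) hρ
    simpa [two_mul, two_nsmul, LinearMap.sum_apply] using this
  -- the part outside Z
  have hU : ∀ δ ∈ Z, ∑ β ∈ P.filter (fun α => α ∉ Z), β (cor δ) = 0 := by
    intro δ hδ
    obtain ⟨hδ1, hδ2, hδ3⟩ := mZ.1 hδ
    have h2 := hR.two _ hδ1
    refine sum_anti h2 ?_ (fun β => β (cor δ)) (fun β _ => sref_cor h2 β)
    intro β hβ
    obtain ⟨hβP, hβZ⟩ := Finset.mem_filter.1 hβ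
    have h3 := hR.refl _ hδ1 _ (hsub hβP)
    have h4 := hR.stable hSg hδ1 hδ2 hδ3 (hsub hβP) (hPS _ hβP)
    have h5 : - sref cor δ β ∉ Sg := by
      intro h
      have := hR.stable hSg hδ1 hδ2 hδ3 (hR.neg _ h3) h
      rw [sref_neg, sref_sref h2] at this
      exact hβZ (mZ.2 ⟨hsub hβP, hPS _ hβP, this⟩)
    refine Finset.mem_filter.2 ⟨?_, fun h => h5 (mZ.1 h).2.2⟩
    rcases htot _ h3 with h6 | h6
    · exact h6
    · exact absurd (hPS _ h6) h5
  set X := P.filter (fun α => α ∈ Z) with hX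
  have hρX : ∀ δ ∈ Z, 2 * ρ (cor δ) = ∑ β ∈ X, β (cor δ) := by
    intro δ hδ
    rw [hρ2, ← Finset.sum_filter_add_sum_filter_not P (fun α => α ∈ Z), hU δ hδ, add_zero]
  have hρre : ∀ δ ∈ Φ, ((ρ (cor δ)).re : ℂ) = ρ (cor δ) := by
    intro δ hδ
    have h1 := hρ2 (cor δ)
    have h2 : ∑ α ∈ P, α (cor δ) = ((∑ α ∈ P, (α (cor δ)).re : ℝ) : ℂ) := by
      push_cast
      exact Finset.sum_congr rfl fun α hα => (hR.real (hsub hα) hδ).symm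
    have h3 : ρ (cor δ) = (((∑ α ∈ P, (α (cor δ)).re) / 2 : ℝ) : ℂ) := by
      push_cast at h2 ⊢
      rw [← h2, ← h1]; ring
    rw [h3, Complex.ofReal_re]
  set φ : Module.Dual ℂ H → ℝ := fun x => (BB Φ cor ρ x).re with hφ
  have φadd : ∀ x y, φ (x + y) = φ x + φ y := fun x y => by simp [hφ]
  have φneg : ∀ x, φ (-x) = - φ x := fun x => by simp [hφ]
  have φpos : ∀ α ∈ Φ, (0 < φ α ↔ 0 < (ρ (cor α)).re) := by
    intro α hα
    obtain ⟨r, hr, h⟩ := hR.B_re hα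
    rw [hφ]; beta_reduce; rw [h]
    exact mul_pos_iff_of_pos_left hr
  have φnz : ∀ α ∈ Z, φ α ≠ 0 := by
    intro α hα
    obtain ⟨h1, h2, h3⟩ := mZ.1 hα
    obtain ⟨r, hr, h⟩ := hR.B_re h1
    rw [hφ]; beta_reduce; rw [h]
    refine mul_ne_zero hr.ne' fun h0 => hnz _ h1 h2 h3 ?_
    rw [← hρre _ h1, h0, Complex.ofReal_zero]
  set Q := Z.filter (fun α => 0 < φ α) with hQ
  have mQ : ∀ {α}, α ∈ Q ↔ α ∈ Z ∧ 0 < φ α := by intro α; simp [hQ]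
  have hQP : PS Φ Q := by
    refine ⟨fun α hα => (mZ.1 (mQ.1 hα).1).1, ?_, ?_, ?_⟩
    · intro α hα h
      have h1 := (mQ.1 hα).2
      have h2 := (mQ.1 h).2
      rw [φneg] at h2; linarith
    · intro α hα β hβ h
      obtain ⟨ha, ha'⟩ := mQ.1 hα
      obtain ⟨hb, hb'⟩ := mQ.1 hβ
      rw [mZ] at ha hb
      refine mQ.2 ⟨mZ.2 ⟨h, hSg _ ha.1 _ hb.1 ha.2.1 hb.2.1 h, ?_⟩, by rw [φadd]; linarith⟩
      rw [neg_add]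
      refine hSg _ (hR.neg _ ha.1) _ (hR.neg _ hb.1) ha.2.2 hb.2.2 ?_
      rw [← neg_add]; exact hR.neg _ h
    · intro α hα β hβ h
      obtain ⟨ha, ha'⟩ := mQ.1 hα
      obtain ⟨hb, hb'⟩ := mQ.1 hβ
      rw [mZ] at ha hb
      have h1 : α - β ∈ Z := by
        refine mZ.2 ⟨h, ?_, ?_⟩
        · rw [sub_eq_add_neg] at h ⊢
          exact hSg _ ha.1 _ (hR.neg _ hb.1) ha.2.1 hb.2.2 h
        · have h' := hR.neg _ h
          rw [neg_sub, sub_eq_add_neg] at h' ⊢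
          exact hSg _ hb.1 _ (hR.neg _ ha.1) hb.2.1 ha.2.2 h'
      rcases lt_or_gt_of_ne (φnz _ h1) with h2 | h2
      · right
        refine mQ.2 ⟨?_, ?_⟩
        · have := negZ h1
          rwa [neg_sub] at this
        · rw [← neg_sub, φneg]; linarith
      · exact Or.inl (mQ.2 ⟨h1, h2⟩)
  set A := Q.filter (fun α => α ∉ P) with hA
  set a := ∑ α ∈ A, α with ha
  have hsum : ∀ x, ∑ β ∈ X, β x = ∑ β ∈ Q, β x - 2 * a x := by
    intro x
    have h1 : ∑ β ∈ Q, β x = ∑ β ∈ Q.filter (fun α => α ∈ P), β x + a x := by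
      rw [ha, LinearMap.sum_apply]
      exact (Finset.sum_filter_add_sum_filter_not _ _ _).symm
    have h2 : ∑ β ∈ X, β x = ∑ β ∈ X.filter (fun α => α ∈ Q), β x + ∑ β ∈ X.filter (fun α => α ∉ Q), β x :=
      (Finset.sum_filter_add_sum_filter_not _ _ _).symm
    have h3 : X.filter (fun α => α ∈ Q) = Q.filter (fun α => α ∈ P) := by
      ext α
      simp only [hX, Finset.mem_filter]
      constructor
      · rintro ⟨⟨h, _⟩, h'⟩; exact ⟨h', h⟩
      · rintro ⟨h, h'⟩; exact ⟨⟨h', (mQ.1 h).1⟩, h⟩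
    have h4 : ∑ β ∈ X.filter (fun α => α ∉ Q), β x = - a x := by
      rw [ha, LinearMap.sum_apply, ← Finset.sum_neg_distrib]
      refine Finset.sum_nbij' (fun α => -α) (fun α => -α) ?_ ?_ (fun _ _ => neg_neg _) (fun _ _ => neg_neg _)
        (fun β _ => by simp)
      · intro β hβ
        simp only [hX, Finset.mem_filter] at hβ
        obtain ⟨⟨h5, h6⟩, h7⟩ := hβ
        refine Finset.mem_filter.2 ⟨mQ.2 ⟨negZ h6, ?_⟩, hneg _ h5⟩
        rw [φneg]
        rcases lt_or_gt_of_ne (φnz _ h6) with h8 | h8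
        · linarith
        · exact absurd (mQ.2 ⟨h6, h8⟩) h7
      · intro β hβ
        obtain ⟨h5, h6⟩ := Finset.mem_filter.1 hβ
        obtain ⟨h7, h8⟩ := mQ.1 h5
        simp only [hX, Finset.mem_filter]
        refine ⟨⟨?_, negZ h7⟩, hQP.neg _ h5⟩
        rcases htot _ (mZ.1 h7).1 with h9 | h9
        · exact absurd h9 h6
        · exact h9
    rw [h2, h3, h4, h1]; ring
  have hAQ : ∀ {γ}, γ ∈ A → γ ∈ Q := fun h => (Finset.mem_filter.1 h).1
  have hintg : ∀ γ ∈ Φ, ∃ k : ℤ, a (cor γ) = k := by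
    intro γ hγ
    rw [ha, LinearMap.sum_apply]
    refine Finset.sum_induction _ (fun z : ℂ => ∃ k : ℤ, z = k) ?_ ⟨0, by simp⟩ ?_
    · rintro _ _ ⟨k, rfl⟩ ⟨l, rfl⟩; exact ⟨k + l, by push_cast; rfl⟩
    · intro α hα
      exact hR.int _ (hQP.sub (hAQ hα)) _ hγ
  have hB : ∀ γ ∈ Q, (BB Φ cor a γ).re ≤ 0 := by
    refine hQP.induct hR _ ?_ ?_
    · intro δ hδ
      have hδΦ := hQP.sub hδ.1
      obtain ⟨r, hr, h⟩ := hR.B_re hδΦ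
      rw [h]
      have h1 := hρX δ (mQ.1 hδ.1).1
      rw [hsum, hQP.sum_simple hR hδ] at h1
      have h2 : ρ (cor δ) = 1 - a (cor δ) := by linear_combination (1/2) * h1
      have h3 := (φpos _ hδΦ).1 (mQ.1 hδ.1).2
      obtain ⟨k, hk⟩ := hintg _ hδΦ
      rw [h2, hk] at h3
      rw [hk]
      have h4 : (0 : ℝ) < 1 - k := by simpa using h3
      have h5 : k ≤ 0 := by
        have : (0 : ℤ) < 1 - k := by exact_mod_cast h4
        omega
      have h6 : (k : ℝ) ≤ 0 := by exact_mod_cast h5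
      have : ((k : ℂ)).re = k := by simp
      rw [this]
      exact mul_nonpos_of_nonneg_of_nonpos hr.le h6
    · intro β _ γ _ h1 h2
      rw [map_add, Complex.add_re]; linarith
  have hBaa : (BB Φ cor a a).re ≤ 0 := by
    have : BB Φ cor a a = ∑ γ ∈ A, BB Φ cor a γ := by rw [← map_sum, ← ha]
    rw [this, Complex.re_sum]
    exact Finset.sum_nonpos fun γ hγ => hB γ (hAQ hγ)
  have ha0 : ∀ γ ∈ Φ, a (cor γ) = 0 := by
    have h1 : ∀ γ ∈ Φ, 0 ≤ (a (cor γ) * a (cor γ)).re := by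
      intro γ hγ
      obtain ⟨k, hk⟩ := hintg γ hγ
      rw [hk]; simp; exact mul_self_nonneg _
    rw [BB_apply, Complex.re_sum] at hBaa
    have h2 := (Finset.sum_eq_zero_iff_of_nonneg h1).1 (le_antisymm hBaa (Finset.sum_nonneg h1))
    intro γ hγ
    have h3 := h2 γ hγ
    obtain ⟨k, hk⟩ := hintg γ hγ
    rw [hk] at h3 ⊢
    simpa using h3
  have hAe : A = ∅ := by
    by_contra hne
    have h1 : φ a = 0 := by
      simp only [hφ]
      rw [BB_apply, Finset.sum_eq_zero (fun γ hγ => by rw [ha0 γ hγ, mul_zero])]; simp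
    have h2 : φ a = ∑ γ ∈ A, φ γ := by
      simp only [hφ]
      rw [← Complex.re_sum, ← map_sum, ← ha]
    have h3 : 0 < ∑ γ ∈ A, φ γ :=
      Finset.sum_pos (fun γ hγ => (mQ.1 (hAQ hγ)).2) (Finset.nonempty_iff_ne_empty.2 hne)
    linarith
  have hQsub : ∀ γ ∈ Q, γ ∈ P := by
    intro γ hγ
    by_contra h
    have : γ ∈ A := Finset.mem_filter.2 ⟨hγ, h⟩
    rw [hAe] at this; simp at this
  have hXQ : ∀ α ∈ P, α ∈ Z → 0 < φ α := by
    intro α hα hαZ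
    rcases lt_or_gt_of_ne (φnz _ hαZ) with h | h
    · exact absurd (hQsub _ (mQ.2 ⟨negZ hαZ, by rw [φneg]; linarith⟩)) (hneg _ hα)
    · exact h
  refine ⟨hsub, hneg, ?_, ?_⟩
  · intro α hα β hβ h
    rcases htot _ h with h1 | h1
    · exact h1
    exfalso
    have hs := hSg _ (hsub hα) _ (hsub hβ) (hPS _ hα) (hPS _ hβ) h
    have e1 : -(α + β) + β = -α := by abel
    have e2 : -(α + β) + α = -β := by abel
    have h2 : -α ∈ Sg := by
      rw [← e1]; refine hSg _ (hsub h1) _ (hsub hβ) (hPS _ h1) (hPS _ hβ) ?_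
      rw [e1]; exact hR.neg _ (hsub hα)
    have h3 : -β ∈ Sg := by
      rw [← e2]; refine hSg _ (hsub h1) _ (hsub hα) (hPS _ h1) (hPS _ hα) ?_
      rw [e2]; exact hR.neg _ (hsub hβ)
    have h4 := hXQ _ hα (mZ.2 ⟨hsub hα, hPS _ hα, h2⟩)
    have h5 := hXQ _ hβ (mZ.2 ⟨hsub hβ, hPS _ hβ, h3⟩)
    have h6 := hXQ _ h1 (mZ.2 ⟨hsub h1, hPS _ h1, by rwa [neg_neg]⟩)
    rw [φneg, φadd] at h6
    linarith
  · intro α _ β _ h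
    rcases htot _ h with h1 | h1
    · exact Or.inl h1
    · right; rwa [neg_sub] at h1

end
end Vrm


set_option linter.unusedSectionVars false
set_option linter.unusedSimpArgs false

namespace Vrm

variable {H : Type*} [AddCommGroup H] [Module ℂ H]

section
variable {Φ P : Finset (Module.Dual ℂ H)} {cor : Module.Dual ℂ H → H}
variable (hR : RS Φ cor) (hP : PS Φ P) (htot : ∀ α ∈ Φ, α ∈ P ∨ -α ∈ P)
variable {I : Finset (Module.Dual ℂ H)} (hI : ∀ δ ∈ I, Ind P δ)

/-- existence of a coweight separating `I` -/
theorem exists_x0 [FiniteDimensional ℂ H] (hR : RS Φ cor) (hP : PS Φ P) (htot : ∀ α ∈ Φ, α ∈ P ∨ -α ∈ P)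
    (I : Finset (Module.Dual ℂ H)) :
    ∃ x0 : H, ∀ δ, Ind P δ → (δ ∈ I → δ x0 = 0) ∧ (δ ∉ I → δ x0 = 1) := by
  classical
  obtain ⟨g, hg⟩ := LinearMap.exists_leftInverse_of_injective (Algebra.linearMap ℚ ℂ)
    (LinearMap.ker_eq_bot.2 (algebraMap ℚ ℂ).injective)
  have hgn : ∀ n : ℕ, g (n : ℂ) = n := fun n => by
    have := congrArg (fun φ => φ (n : ℚ)) hg
    simpa using this
  set hz := ∑ β ∈ P, cor β with hhz
  let f : Module.Dual ℂ H →+ ℚ := g.toAddMonoidHom.comp (Module.Dual.eval ℂ H hz).toAddMonoidHom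
  have hf : ∀ α, f α = g (α hz) := fun α => rfl
  have hpos : ∀ α ∈ P, 0 < f α := by
    intro α hα
    obtain ⟨n, hn, h⟩ := hP.height hR hα
    rw [hf, h, hgn]; exact_mod_cast hn
  have hiff : ∀ α ∈ Φ, (0 < f α ↔ α ∈ P) := by
    intro α hα
    refine ⟨fun h => ?_, hpos α⟩
    rcases htot _ hα with h1 | h1
    · exact h1
    · have := hpos _ h1
      rw [map_neg] at this; linarith
  have hnz : ∀ α ∈ Φ, f α ≠ 0 := by
    intro α hα h0
    rcases htot _ hα with h1 | h1
    · have := hpos _ h1; linarith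
    · have := hpos _ h1
      rw [map_neg] at this; linarith
  have hli := hR.li f hnz
  let b := Module.Basis.extend hli
  let φ : Module.Dual ℂ (Module.Dual ℂ H) := b.constr ℂ (fun x => if x.1 ∈ I then (0 : ℂ) else 1)
  refine ⟨(Module.evalEquiv ℂ H).symm φ, fun δ hδ => ?_⟩
  have hmem : δ ∈ {α | α ∈ Φ ∧ 0 < f α ∧ ∀ β ∈ Φ, ∀ γ ∈ Φ, 0 < f β → 0 < f γ → α ≠ β + γ} :=
    ⟨hP.sub hδ.1, hpos _ hδ.1, fun β hβ γ hγ h1 h2 => hδ.2 _ ((hiff _ hβ).1 h1) _ ((hiff _ hγ).1 h2)⟩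
  have h1 : δ ((Module.evalEquiv ℂ H).symm φ) = φ δ := by simp
  have h2 : φ δ = if δ ∈ I then (0 : ℂ) else 1 := by
    have h3 : b ⟨δ, Module.Basis.subset_extend hli hmem⟩ = δ := Module.Basis.extend_apply_self _ _
    have h4 := b.constr_basis ℂ (fun x => if x.1 ∈ I then (0 : ℂ) else 1) ⟨δ, Module.Basis.subset_extend hli hmem⟩
    rw [h3] at h4
    exact h4
  rw [h1, h2]
  exact ⟨fun h => if_pos h, fun h => if_neg h⟩

theorem PS.x0_nat (hR : RS Φ cor) (hP : PS Φ P) {x0 : H}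
    (hx : ∀ δ, Ind P δ → (δ ∈ I → δ x0 = 0) ∧ (δ ∉ I → δ x0 = 1)) :
    ∀ α ∈ P, ∃ n : ℕ, α x0 = n ∧ (n = 0 → α ∈ AddSubmonoid.closure (I : Set (Module.Dual ℂ H))) := by
  refine hP.induct hR _ ?_ ?_
  · intro δ hδ
    by_cases h : δ ∈ I
    · exact ⟨0, by simpa using (hx δ hδ).1 h, fun _ => AddSubmonoid.subset_closure h⟩
    · exact ⟨1, by simpa using (hx δ hδ).2 h, fun h => absurd h one_ne_zero⟩
  · rintro β _ γ _ ⟨n, hn, hn'⟩ ⟨m, hm, hm'⟩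
    refine ⟨n + m, by rw [LinearMap.add_apply, hn, hm]; push_cast; rfl, fun h => ?_⟩
    exact AddSubmonoid.add_mem _ (hn' (by omega)) (hm' (by omega))

theorem RS.exists_pos (hR : RS Φ cor) {J : Set (Module.Dual ℂ H)} (hJ : ∀ δ ∈ J, δ ∈ Φ) {α : Module.Dual ℂ H}
    (hα : α ∈ Φ) (hc : α ∈ AddSubmonoid.closure J) : ∃ δ ∈ J, ∃ n : ℕ, 0 < n ∧ α (cor δ) = n := by
  by_contra hcon
  push Not at hcon
  have h1 : ∀ δ ∈ J, (BB Φ cor α δ).re ≤ 0 := by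
    intro δ hδ
    obtain ⟨r, hr, h⟩ := hR.B_re (hJ δ hδ)
    rw [h]
    obtain ⟨a, ha, ha'⟩ := hR.int_re hα (hJ _ hδ)
    rw [ha']
    by_contra h2
    have h3 : 0 < a := by
      by_contra h3
      exact h2 (mul_nonpos_of_nonneg_of_nonpos hr.le (by exact_mod_cast not_lt.1 h3))
    obtain ⟨n, rfl⟩ := Int.eq_ofNat_of_zero_le h3.le
    exact hcon δ hδ n (by omega) (by simpa using ha)
  have h2 : ∀ x ∈ AddSubmonoid.closure J, (BB Φ cor α x).re ≤ 0 := by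
    intro x hx
    induction hx using AddSubmonoid.closure_induction with
    | mem x hx => exact h1 x hx
    | zero => simp
    | add x y _ _ hx hy => rw [map_add, Complex.add_re]; linarith
  obtain ⟨r, hr, h⟩ := hR.B_pos hα
  have := h2 _ hc
  rw [h, Complex.ofReal_re] at this
  linarith

theorem RS.pos_symm (hR : RS Φ cor) {α β : Module.Dual ℂ H} (hα : α ∈ Φ) (hβ : β ∈ Φ) {n : ℕ} (hn : 0 < n)
    (h : α (cor β) = n) : ∃ m : ℕ, 0 < m ∧ β (cor α) = m := by
  obtain ⟨a, ha, ha'⟩ := hR.int_re hβ hα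
  have h1 : (β (cor (-α))).re < 0 := by
    rw [← hR.sign (hR.neg _ hα) hβ]
    rw [LinearMap.neg_apply, h]; simpa using hn
  rw [hR.cor_neg _ hα, map_neg, Complex.neg_re, ha'] at h1
  have h2 : 0 < a := by
    have : (0 : ℝ) < a := by linarith
    exact_mod_cast this
  obtain ⟨m, rfl⟩ := Int.eq_ofNat_of_zero_le h2.le
  exact ⟨m, by omega, by simpa using ha⟩

/-- coroots of the Levi -/
theorem PS.gen (hR : RS Φ cor) (hP : PS Φ P) (hI : ∀ δ ∈ I, Ind P δ) {x0 : H}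
    (hx : ∀ δ, Ind P δ → (δ ∈ I → δ x0 = 0) ∧ (δ ∉ I → δ x0 = 1)) :
    ∀ α ∈ P, α x0 = 0 → cor α ∈ AddSubmonoid.closure (cor '' (I : Set (Module.Dual ℂ H))) := by
  have key : ∀ n : ℕ, ∀ α ∈ P, α (∑ β ∈ P, cor β) = n → α x0 = 0 →
      cor α ∈ AddSubmonoid.closure (cor '' (I : Set (Module.Dual ℂ H))) := by
    intro n
    induction n using Nat.strong_induction_on with
    | _ n ih =>
      intro α hα hn h0
      obtain ⟨k, hk, hk'⟩ := hP.x0_nat hR hx α hα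
      rw [h0] at hk
      have hcl := hk' (by exact_mod_cast hk.symm)
      obtain ⟨δ, hδ, a, ha, ha'⟩ := hR.exists_pos (fun δ hδ => hP.sub (hI δ hδ).1) (hP.sub hα) hcl
      have hδI := hI δ hδ
      by_cases hne : α = δ
      · rw [hne]; exact AddSubmonoid.subset_closure ⟨δ, hδ, rfl⟩
      have h1 := hP.refl_simple hR hδI hα hne
      obtain ⟨m, hm, hm'⟩ := hP.height hR h1
      obtain ⟨l, hl, hl'⟩ := hP.height hR hδI.1
      have h2 : m < n := by
        have h3 := hm'
        rw [sref, LinearMap.sub_apply, LinearMap.smul_apply, hn, ha', hl', smul_eq_mul, sub_eq_iff_eq_add] at h3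
        have h4 : n = m + a * l := by exact_mod_cast h3
        have : 0 < a * l := by positivity
        omega
      have h3 := ih m h2 _ h1 hm' (by
        rw [sref, LinearMap.sub_apply, LinearMap.smul_apply, h0, (hx δ hδI).1 hδ]; simp)
      obtain ⟨b, hb, hb'⟩ := hR.pos_symm (hP.sub hα) (hP.sub hδI.1) ha ha'
      rw [hR.cor_refl _ (hP.sub hδI.1) _ (hP.sub hα), hb'] at h3
      have h4 : cor α = (cor α - (b : ℂ) • cor δ) + b • cor δ := by
        rw [Nat.cast_smul_eq_nsmul]; abel
      rw [h4]
      have h5 : cor δ ∈ AddSubmonoid.closure (cor '' (I : Set _)) := AddSubmonoid.subset_closure ⟨δ, hδ, rfl⟩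
      exact AddSubmonoid.add_mem _ h3 (AddSubmonoid.nsmul_mem _ h5 _)
  intro α hα h0
  obtain ⟨m, hm, hm'⟩ := hP.height hR hα
  exact key m α hα hm' h0

theorem PS.rho_simple (hR : RS Φ cor) (hP : PS Φ P) {ρ : Module.Dual ℂ H} (hρ : 2 • ρ = ∑ α ∈ P, α)
    {δ : Module.Dual ℂ H} (hδ : Ind P δ) : ρ (cor δ) = 1 := by
  have h1 := congrArg (fun f => f (cor δ)) hρ
  simp only [two_nsmul, LinearMap.add_apply, LinearMap.sum_apply] at h1
  rw [hP.sum_simple hR hδ] at h1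
  linear_combination (1/2) * h1

theorem PS.rho_pos [FiniteDimensional ℂ H] (hR : RS Φ cor) (hP : PS Φ P) (htot : ∀ α ∈ Φ, α ∈ P ∨ -α ∈ P)
    {ρ : Module.Dual ℂ H} (hρ : 2 • ρ = ∑ α ∈ P, α)
    {α : Module.Dual ℂ H} (hα : α ∈ P) : ∃ n : ℕ, 0 < n ∧ ρ (cor α) = n := by
  classical
  let J := P.filter (fun δ => Ind P δ)
  have hJ : ∀ δ ∈ J, Ind P δ := fun δ h => (Finset.mem_filter.1 h).2
  have hx : ∀ δ, Ind P δ → (δ ∈ J → δ (0 : H) = 0) ∧ (δ ∉ J → δ (0 : H) = 1) :=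
    fun δ hδ => ⟨fun _ => by simp, fun h => absurd (Finset.mem_filter.2 ⟨hδ.1, hδ⟩) h⟩
  have h1 := hP.gen hR hJ hx α hα (by simp)
  have h2 : ∀ x ∈ AddSubmonoid.closure (cor '' (J : Set (Module.Dual ℂ H))), ∃ n : ℕ, ρ x = n := by
    intro x hx
    induction hx using AddSubmonoid.closure_induction with
    | mem x hx =>
      obtain ⟨δ, hδ, rfl⟩ := hx
      exact ⟨1, by simpa using hP.rho_simple hR hρ (hJ δ hδ)⟩
    | zero => exact ⟨0, by simp⟩
    | add x y _ _ hx hy =>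
      obtain ⟨n, hn⟩ := hx
      obtain ⟨m, hm⟩ := hy
      exact ⟨n + m, by rw [map_add, hn, hm]; push_cast; rfl⟩
  obtain ⟨n, hn⟩ := h2 _ h1
  refine ⟨n, ?_, hn⟩
  have h3 := hP.rho_ge hR hα
  have h4 := congrArg (fun f => (f (cor α)).re) hρ
  simp only [two_nsmul, LinearMap.add_apply, LinearMap.sum_apply, Complex.re_sum, hn, Complex.add_re,
    Complex.natCast_re] at h4
  rw [← h4] at h3
  have : (0 : ℝ) < n := by linarith
  exact_mod_cast this

end

section
variable {ι : Type} [Fintype ι] [LinearOrder ι] {L : Type*} [LieRing L] [LieAlgebra ℂ L]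
variable {Φ P : Finset (Module.Dual ℂ H)} {cor : Module.Dual ℂ H → H}

namespace TriData

theorem rootHyp_of (T : TriData ι L H) (hR : RS Φ cor) (hP : PS Φ P)
    (hw : ∀ i, T.wt i ∈ P) (hw' : ∀ α ∈ P, ∃ i, T.wt i = α) (hco : ∀ i, T.co i = cor (T.wt i))
    {ρ : Module.Dual ℂ H} (hρ : 2 • ρ = ∑ α ∈ P, α) : T.RootHyp ρ {i | Ind P (T.wt i)} where
  rho_S g hg := by rw [hco]; exact hP.rho_simple hR hρ hg
  indec g hg n m hm := by
    have hg' : Ind P (T.wt g) := hg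
    have h2 := hR.two _ (hP.sub hg'.1)
    let s : Module.Dual ℂ H →ₗ[ℂ] Module.Dual ℂ H :=
      LinearMap.id - (Module.Dual.eval ℂ H (cor (T.wt g))).smulRight (T.wt g)
    have hs : ∀ x, s x = sref cor (T.wt g) x := fun x => by simp [s, sref]
    have hpos : ∀ α ∈ P, 0 < (α T.hz).re := by
      intro α hα
      obtain ⟨i, rfl⟩ := hw' α hα
      rw [T.wt_hz]; simpa using T.ht_pos i
    let K : ι → ℝ := fun i => ((T.wt i + s (T.wt i)) T.hz).re
    have hKg : T.wt g + s (T.wt g) = 0 := by rw [hs, sref_self h2]; simp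
    have hK : ∀ i, i ≠ g → 0 < K i := by
      intro i hi
      have h3 := hpos _ (hw i)
      have h4 := hpos _ (hP.refl_simple hR hg' (hw i) (fun h => hi (T.wt_inj h)))
      simp only [K, hs, LinearMap.add_apply, Complex.add_re]
      linarith
    have hK0 : ∀ i, 0 ≤ K i := by
      intro i
      by_cases hi : i = g
      · have : K i = 0 := by
          show ((T.wt i + s (T.wt i)) T.hz).re = 0
          rw [hi, hKg]; simp
        exact this.ge
      · exact (hK i hi).le
    have hsum : T.wm m = ∑ i, m i • T.wt i := by
      rw [wm, Finsupp.liftAddHom_apply, Finsupp.sum_fintype _ _ (fun i => by simp)]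
      simp
    have h5 : ∑ i, (m i : ℝ) * K i = 0 := by
      have h6 : T.wm m + s (T.wm m) = 0 := by
        rw [hm, map_nsmul, ← smul_add, hKg, smul_zero]
      have h7 := congrArg (fun x => (x T.hz).re) h6
      rw [hsum, map_sum, ← Finset.sum_add_distrib] at h7
      simp only [map_nsmul, ← smul_add, LinearMap.sum_apply, Complex.re_sum, LinearMap.zero_apply, Complex.zero_re] at h7
      rw [← h7]
      refine Finset.sum_congr rfl fun i _ => ?_
      rw [LinearMap.smul_apply, nsmul_eq_mul, ← Complex.ofReal_natCast, Complex.re_ofReal_mul]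
    have h6 := (Finset.sum_eq_zero_iff_of_nonneg (fun i _ => mul_nonneg (Nat.cast_nonneg _) (hK0 i))).1 h5
    have h7 : ∀ i, i ≠ g → m i = 0 := by
      intro i hi
      have := h6 i (Finset.mem_univ i)
      rcases mul_eq_zero.1 this with h | h
      · exact_mod_cast h
      · exact absurd h (hK i hi).ne'
    have h8 : m = Finsupp.single g (m g) := by
      ext i
      by_cases hi : i = g
      · subst hi; simp
      · rw [h7 i hi, Finsupp.single_apply, if_neg (Ne.symm hi)]
    rw [h8, T.wm_single_n] at hm
    have h9 := congrArg (fun x => (x T.hz)) hm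
    simp only [LinearMap.smul_apply, T.wt_hz, nsmul_eq_mul] at h9
    have h10 : m g * T.ht g = n * T.ht g := by exact_mod_cast h9
    rw [h8, Nat.eq_of_mul_eq_mul_right (T.ht_pos g) h10]
  step i hi := by
    have hi' : ¬ Ind P (T.wt i) := hi
    have hcl : T.wt i ∈ AddSubmonoid.closure {δ | Ind P δ} := by
      refine hP.induct hR (fun α => α ∈ AddSubmonoid.closure {δ | Ind P δ}) (fun δ hδ => AddSubmonoid.subset_closure hδ)
        (fun β _ γ _ h1 h2 => AddSubmonoid.add_mem _ h1 h2) _ (hw i)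
    obtain ⟨δ, hδ, k, hk, hk'⟩ := hR.exists_pos (fun δ (hδ : Ind P δ) => hP.sub hδ.1) (hP.sub (hw i)) hcl
    have hδ' : Ind P δ := hδ
    have hne : T.wt i ≠ δ := fun h => hi' (h ▸ hδ')
    obtain ⟨g, rfl⟩ := hw' δ hδ'.1
    have h1 := hP.refl_simple hR hδ' (hw i) hne
    obtain ⟨j, hj⟩ := hw' _ h1
    have hj' : T.wt j = T.wt i - k • T.wt g := by rw [hj, sref, hk', Nat.cast_smul_eq_nsmul]
    refine ⟨g, hδ', j, k, by rw [hco]; exact hk', hj', ?_, ?_, ?_⟩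
    · rw [hco, hj, hR.cor_refl _ (hP.sub hδ'.1) _ (hP.sub (hw i)), hco, hco]
    · have h2 := congrArg (fun x => x T.hz) hj'
      simp only [LinearMap.sub_apply, LinearMap.smul_apply, T.wt_hz, nsmul_eq_mul, eq_sub_iff_add_eq] at h2
      have h3 : T.ht j + k * T.ht g = T.ht i := by exact_mod_cast h2
      have := Nat.mul_pos hk (T.ht_pos g)
      omega
    · have hnot : T.co g ∉ Submodule.span ℂ {T.co i} := by
        intro h
        obtain ⟨c, hc⟩ := Submodule.mem_span_singleton.1 h
        rw [hco, hco] at hc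
        rcases hR.cored _ (hP.sub (hw i)) _ (hP.sub hδ'.1) c hc.symm with h3 | h3
        · exact hne h3.symm
        · exact hP.neg _ (hw i) (h3 ▸ hδ'.1)
      obtain ⟨f, hf, hf'⟩ := Submodule.exists_le_ker_of_notMem hnot
      refine ⟨(f (T.co g))⁻¹ • f, ?_, ?_⟩
      · have : f (T.co i) = 0 := hf' (Submodule.mem_span_singleton_self _)
        simp [this]
      · simp [hf]

theorem isCor_of (T : TriData ι L H) (hR : RS Φ cor) (htot : ∀ α ∈ Φ, α ∈ P ∨ -α ∈ P) (hw' : ∀ α ∈ P, ∃ i, T.wt i = α)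
    (hco : ∀ i, T.co i = cor (T.wt i)) {γ : Module.Dual ℂ H} (hγ : γ ∈ Φ) : T.IsCor (cor γ) := by
  rcases htot _ hγ with h | h
  · obtain ⟨i, rfl⟩ := hw' _ h
    exact ⟨i, Or.inl (hco i).symm⟩
  · obtain ⟨i, hi⟩ := hw' _ h
    refine ⟨i, Or.inr ?_⟩
    rw [hco, hi, hR.cor_neg _ hγ, neg_neg]

theorem comb_of [FiniteDimensional ℂ H] (T : TriData ι L H) (hR : RS Φ cor) (hP : PS Φ P) (htot : ∀ α ∈ Φ, α ∈ P ∨ -α ∈ P)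
    (hw : ∀ i, T.wt i ∈ P) (hw' : ∀ α ∈ P, ∃ i, T.wt i = α) (hco : ∀ i, T.co i = cor (T.wt i))
    {ρ : Module.Dual ℂ H} (hρ : 2 • ρ = ∑ α ∈ P, α) {I0 : Finset (Module.Dual ℂ H)} (hI : ∀ δ ∈ I0, Ind P δ) {x0 : H}
    (hx : ∀ δ, Ind P δ → (δ ∈ I0 → δ x0 = 0) ∧ (δ ∉ I0 → δ x0 = 1)) {I : Finset ι} (hI0 : ∀ i, i ∈ I ↔ T.wt i ∈ I0) :
    T.Comb ρ {i | Ind P (T.wt i)} I (CB Φ x0) := by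
  have hwΦ : ∀ i, T.wt i ∈ Φ := fun i => hP.sub (hw i)
  have hGre : ∀ i, ∃ r : ℝ, 0 < r ∧ (CB Φ x0 (T.co i)).re = r * (T.wt i x0).re := by
    intro i
    obtain ⟨r, hr, h⟩ := hR.C_re (hwΦ i)
    exact ⟨r, hr, by rw [hco, h]⟩
  have hGI : ∀ i ∈ I, (CB Φ x0 (T.co i)).re = 0 := by
    intro i hi
    obtain ⟨r, hr, h⟩ := hGre i
    have h1 := (hI0 i).1 hi
    rw [h, (hx _ (hI _ h1)).1 h1]; simp
  refine ⟨T.rootHyp_of hR hP hw hw' hco hρ, ?_, ?_, ?_, ?_, ?_, ?_, ?_, ?_, hGI, ?_⟩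
  · intro i; rw [hco]; exact hP.rho_pos hR htot hρ (hw i)
  · obtain ⟨η, hη⟩ := Module.exists_dual_forall_apply_ne_zero (K := ℂ)
      (fun p : {p : ι × ι // p.1 ≠ p.2} => ρ (T.co p.1.2) • T.co p.1.1 - ρ (T.co p.1.1) • T.co p.1.2) (by
        rintro ⟨⟨i, j⟩, hij⟩ h0
        dsimp only at h0 hij
        obtain ⟨n, hn, hn'⟩ := hP.rho_pos hR htot hρ (hw i)
        obtain ⟨m, hm, hm'⟩ := hP.rho_pos hR htot hρ (hw j)
        rw [hco, hco, hn', hm', sub_eq_zero] at h0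
        have hm0 : (m : ℂ) ≠ 0 := by exact_mod_cast hm.ne'
        have h1 : cor (T.wt i) = ((m : ℂ)⁻¹ * n) • cor (T.wt j) := by
          rw [mul_smul, ← h0, smul_smul, inv_mul_cancel₀ hm0, one_smul]
        rcases hR.cored _ (hwΦ j) _ (hwΦ i) _ h1 with h2 | h2
        · exact hij (T.wt_inj h2)
        · exact hP.neg _ (hw j) (h2 ▸ hw i))
    refine ⟨η, fun i j hij h => hη ⟨⟨i, j⟩, hij⟩ ?_⟩
    simp only [map_sub, map_smul, smul_eq_mul]
    rw [mul_comm, h]; ring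
  · intro i j; rw [hco]; exact hR.int _ (hwΦ i) _ (hwΦ j)
  · intro i j
    rw [hco, hco, ← hR.cor_refl _ (hwΦ i) _ (hwΦ j)]
    exact T.isCor_of hR htot hw' hco (hR.refl _ (hwΦ i) _ (hwΦ j))
  · intro i j a hij ha k hk
    rw [hco] at ha
    obtain ⟨γ, hγ, h⟩ := hR.costring _ (hwΦ i) _ (hwΦ j) (fun h => hij (T.wt_inj h).symm) a ha k hk
    rw [hco, hco, ← h]
    exact T.isCor_of hR htot hw' hco hγ
  · intro i hi; exact hI _ ((hI0 i).1 hi)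
  · intro i
    obtain ⟨r, hr, h⟩ := hGre i
    obtain ⟨n, hn, _⟩ := hP.x0_nat hR hx _ (hw i)
    rw [h, hn]
    exact mul_nonneg hr.le (by simp)
  · intro i h0
    obtain ⟨r, hr, h⟩ := hGre i
    obtain ⟨n, hn, _⟩ := hP.x0_nat hR hx _ (hw i)
    rw [h, hn] at h0
    have h1 : n = 0 := by
      rcases mul_eq_zero.1 h0 with h2 | h2
      · exact absurd h2 hr.ne'
      · simpa using h2
    have h2 := hP.gen hR hI hx _ (hw i) (by rw [hn, h1]; simp)
    have h3 : cor '' (I0 : Set (Module.Dual ℂ H)) = T.co '' (I : Set ι) := by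
      ext y; constructor
      · rintro ⟨δ, hδ, rfl⟩
        obtain ⟨j, rfl⟩ := hw' _ (hI δ hδ).1
        exact ⟨j, (hI0 j).2 hδ, hco j⟩
      · rintro ⟨j, hj, rfl⟩
        exact ⟨T.wt j, (hI0 j).1 hj, (hco j).symm⟩
    rw [hco, ← h3]; exact h2
  · intro i j hi hj c hc
    rcases hR.red _ (hwΦ i) _ (hwΦ j) c hc with h | h
    · have := T.wt_inj h
      subst this
      exact hj (hGI _ hi)
    · exact hP.neg _ (hw i) (h ▸ hw j)

end TriData
end
end Vrm


set_option linter.unusedSectionVars false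
set_option linter.unusedSimpArgs false
namespace Vrm

section RSof
variable {ι H : Type*} [Finite ι] [AddCommGroup H] [Module ℂ H]

theorem string_aux {M N : Type*} [AddCommGroup M] [Module ℂ M] [AddCommGroup N] [Module ℂ N]
    (P : RootPairing ι ℂ M N) [P.IsCrystallographic] [P.IsReduced] (i j : ι) (hij : P.root j ≠ P.root i)
    (n : ℕ) (hn : P.pairing j i = n) (k : ℕ) (hk : k ≤ n) :
    ∃ l, P.root l = P.root j - k • P.root i := by
  have hli : LinearIndependent ℂ ![P.root i, P.root j] := by
    by_contra h
    rcases RootPairing.IsReduced.eq_or_eq_neg i j h with h1 | h1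
    · exact hij h1.symm
    · have h2 : P.pairing j i = -2 := by
        rw [← P.root_coroot_eq_pairing, show P.root j = - P.root i by rw [h1, neg_neg], map_neg, LinearMap.neg_apply,
          P.root_coroot_eq_pairing, P.pairing_same]
      rw [h2] at hn
      have : ((-2 : ℤ) : ℂ) = (n : ℤ) := by push_cast; exact hn
      have : (-2 : ℤ) = n := by exact_mod_cast this
      omega
  have h1 := RootPairing.chainBotCoeff_sub_chainTopCoeff hli
  have h2 : P.pairingIn ℤ j i = n := by
    have : ((P.pairingIn ℤ j i : ℤ) : ℂ) = (n : ℤ) := by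
      have := P.algebraMap_pairingIn ℤ j i
      rw [hn] at this
      simpa using this
    exact_mod_cast this
  have h3 := (RootPairing.root_sub_zsmul_mem_range_iff (P := P) hli (z := (k : ℤ))).2
    (by rw [Set.mem_Icc]; omega)
  obtain ⟨l, hl⟩ := h3
  exact ⟨l, by rw [hl]; simp⟩

theorem RS.of_pairing (P : RootPairing ι ℂ (Module.Dual ℂ H) H) [P.IsRootSystem] [P.IsCrystallographic] [P.IsReduced]
    [Module.IsTorsionFree ℂ H]
    (hP : ∀ f x, P.toLinearMap f x = f x) {Φ : Finset (Module.Dual ℂ H)} {cor : Module.Dual ℂ H → H}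
    (hΦ : ∀ α, α ∈ Φ ↔ ∃ i, P.root i = α) (hcor : ∀ i, cor (P.root i) = P.coroot i) : RS Φ cor := by
  have hpair : ∀ i j, P.root i (P.coroot j) = P.pairing i j := fun i j => by
    rw [← hP, P.root_coroot_eq_pairing]
  have hr : ∀ i j, sref cor (P.root i) (P.root j) = P.root (P.reflectionPerm i j) := by
    intro i j
    rw [P.root_reflectionPerm, sref, hcor, hpair, P.reflection_apply]; simp
  have hneg : ∀ i, P.root (P.reflectionPerm i i) = - P.root i := fun i => by simp
  have hcneg : ∀ i, P.coroot (P.reflectionPerm i i) = - P.coroot i := fun i => by simp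
  refine ⟨?_, ?_, ?_, ?_, ?_, ?_, ?_, ?_, ?_, ?_, ?_⟩
  · intro α hα
    obtain ⟨i, rfl⟩ := (hΦ _).1 hα
    rw [hcor, hpair]; simp
  · intro α hα
    obtain ⟨i, rfl⟩ := (hΦ _).1 hα
    exact (hΦ _).2 ⟨_, hneg i⟩
  · intro α hα
    obtain ⟨i, rfl⟩ := (hΦ _).1 hα
    rw [← hneg, hcor, hcor, hcneg]
  · intro α hα β hβ
    obtain ⟨i, rfl⟩ := (hΦ _).1 hα
    obtain ⟨j, rfl⟩ := (hΦ _).1 hβ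
    refine ⟨P.pairingIn ℤ i j, ?_⟩
    rw [hcor, hpair, ← P.algebraMap_pairingIn ℤ i j]; simp
  · intro α hα β hβ
    obtain ⟨i, rfl⟩ := (hΦ _).1 hα
    obtain ⟨j, rfl⟩ := (hΦ _).1 hβ
    rw [hr]; exact (hΦ _).2 ⟨_, rfl⟩
  · intro α hα β hβ
    obtain ⟨i, rfl⟩ := (hΦ _).1 hα
    obtain ⟨j, rfl⟩ := (hΦ _).1 hβ
    rw [hr, hcor, hcor, hcor, hpair, P.coroot_reflectionPerm, P.coreflection_apply, ← hpair]
    simp [hP]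
  · intro α hα β hβ hne n hn k hk
    obtain ⟨i, rfl⟩ := (hΦ _).1 hα
    obtain ⟨j, rfl⟩ := (hΦ _).1 hβ
    rw [hcor, hpair] at hn
    obtain ⟨l, hl⟩ := string_aux P i j hne n hn k hk
    exact (hΦ _).2 ⟨l, hl⟩
  · intro α hα β hβ hne n hn k hk
    obtain ⟨i, rfl⟩ := (hΦ _).1 hα
    obtain ⟨j, rfl⟩ := (hΦ _).1 hβ
    rw [hcor, hpair] at hn
    obtain ⟨l, hl⟩ := string_aux P.flip i j (fun h => hne (by
      have : j = i := P.coroot.injective h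
      rw [this])) n (by simpa using hn) k hk
    refine ⟨_, (hΦ _).2 ⟨l, rfl⟩, ?_⟩
    rw [hcor, hcor, hcor, Nat.cast_smul_eq_nsmul]
    exact hl
  · intro α hα β hβ c hc
    obtain ⟨i, rfl⟩ := (hΦ _).1 hα
    obtain ⟨j, rfl⟩ := (hΦ _).1 hβ
    refine RootPairing.IsReduced.eq_or_eq_neg (P := P) j i (fun h => ?_)
    rw [LinearIndependent.pair_iff] at h
    have := (h 1 (-c) (by rw [hc]; module)).1
    exact one_ne_zero this
  · intro α hα β hβ c hc
    obtain ⟨i, rfl⟩ := (hΦ _).1 hα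
    obtain ⟨j, rfl⟩ := (hΦ _).1 hβ
    rw [hcor, hcor] at hc
    have h1 : P.coroot j = P.coroot i ∨ P.coroot j = - P.coroot i := by
      refine RootPairing.IsReduced.eq_or_eq_neg (P := P.flip) j i (fun h => ?_)
      rw [LinearIndependent.pair_iff] at h
      have h3 : (1:ℂ) • P.coroot j + (-c) • P.coroot i = 0 := by rw [hc]; module
      have := (h 1 (-c) h3).1
      exact one_ne_zero this
    rcases h1 with h1 | h1
    · left; rw [P.coroot.injective h1]
    · right
      rw [← hcneg] at h1
      rw [P.coroot.injective h1, hneg]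
  · intro f hf
    have h1 := P.linearIndepOn_root_baseOf f (fun i => hf _ ((hΦ _).2 ⟨i, rfl⟩))
    have h2 := h1.id_image
    refine h2.mono ?_
    rintro α ⟨hα, h0, hind⟩
    obtain ⟨i, rfl⟩ := (hΦ _).1 hα
    refine ⟨i, ?_, rfl⟩
    refine ⟨h0, ?_⟩
    intro j hj k hk
    exact fun h => (hind _ ((hΦ _).2 ⟨j, rfl⟩) _ ((hΦ _).2 ⟨k, rfl⟩) hj hk h).elim
end RSof

section
open LieAlgebra LieAlgebra.IsKilling LieModule
variable {L : Type*} [LieRing L] [LieAlgebra ℂ L] [FiniteDimensional ℂ L] [IsKilling ℂ L]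
  {H : LieSubalgebra ℂ L} [H.IsCartanSubalgebra]

theorem RS.of_killing {Φ : Finset (Module.Dual ℂ H)} {cor : Module.Dual ℂ H → H}
    (hΦ : ∀ α, α ∈ Φ ↔ α ≠ 0 ∧ rootSpace H (⇑α) ≠ ⊥)
    (hcor : ∀ α ∈ Φ, cor α ∈ corootSpace (⇑α) ∧ α (cor α) = 2) : RS Φ cor := by
  have hΦ' : ∀ α, α ∈ Φ ↔ ∃ i, (rootSystem H).root i = α := by
    intro α
    rw [hΦ]
    constructor
    · rintro ⟨h0, h1⟩
      refine ⟨⟨⟨α, h1⟩, ?_⟩, ?_⟩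
      · simp only [LieSubalgebra.root, Finset.mem_filter, Finset.mem_univ, true_and]
        intro h
        apply h0
        ext x
        exact congrFun h x
      · ext x; rfl
    · rintro ⟨i, rfl⟩
      refine ⟨(rootSystem H).ne_zero i, i.1.2⟩
  refine RS.of_pairing (rootSystem H) (fun f x => rfl) hΦ' ?_
  intro i
  have h1 := hcor _ ((hΦ' _).2 ⟨i, rfl⟩)
  exact eq_coroot_of_mem_corootSpace_of_two i.1 h1.1 h1.2
end
end Vrm


set_option linter.unusedSectionVars false
set_option linter.unusedSimpArgs false
namespace Vrm

section
open LieAlgebra LieAlgebra.IsKilling LieModule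
variable {L : Type*} [LieRing L] [LieAlgebra ℂ L] [FiniteDimensional ℂ L] [IsKilling ℂ L]
  {H : LieSubalgebra ℂ L} [H.IsCartanSubalgebra]

/-- `Φ` is the set of roots and `cor` the coroot map -/
structure RootsOf (H : LieSubalgebra ℂ L) [H.IsCartanSubalgebra] (Φ : Finset (Module.Dual ℂ H))
    (cor : Module.Dual ℂ H → H) : Prop where
  mem : ∀ α, α ∈ Φ ↔ α ≠ 0 ∧ rootSpace H (⇑α) ≠ ⊥
  cor : ∀ α ∈ Φ, cor α ∈ corootSpace (⇑α) ∧ α (cor α) = 2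

variable {Φ : Finset (Module.Dual ℂ H)} {cor : Module.Dual ℂ H → H}

theorem RootsOf.rs (h : RootsOf H Φ cor) : RS Φ cor := RS.of_killing h.mem h.cor

theorem RootsOf.wt (h : RootsOf H Φ cor) {α : Module.Dual ℂ H} (hα : α ∈ Φ) :
    ∃ w : Weight ℂ H L, (w : H → ℂ) = α ∧ w.IsNonZero := by
  have h1 := (h.mem α).1 hα
  refine ⟨⟨α, h1.2⟩, rfl, fun h2 => h1.1 ?_⟩
  ext x
  exact congrFun h2 x

theorem RootsOf.ef (h : RootsOf H Φ cor) {α : Module.Dual ℂ H} (hα : α ∈ Φ) :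
    ∃ e f : L, IsSl2Triple (cor α : L) e f ∧ e ∈ rootSpace H (⇑α) ∧ f ∈ rootSpace H (⇑(-α)) := by
  obtain ⟨w, hw, hw0⟩ := h.wt hα
  obtain ⟨x, e, f, ht, he, hf⟩ := exists_isSl2Triple_of_weight_isNonZero hw0
  have h1 := ht.h_eq_coroot hw0 he hf
  have h2 := h.cor α hα
  have h3 : cor α = coroot w := by
    refine eq_coroot_of_mem_corootSpace_of_two w ?_ ?_
    · rw [hw]; exact h2.1
    · rw [hw]; exact h2.2
  refine ⟨e, f, ?_, ?_, ?_⟩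
  · rw [h3, ← h1]; exact ht
  · rw [← hw]; exact he
  · have : (⇑(-α) : H → ℂ) = -(w : H → ℂ) := by rw [hw]; rfl
    rw [this]; exact hf

theorem RootsOf.one (h : RootsOf H Φ cor) {α : Module.Dual ℂ H} (hα : α ∈ Φ) {e x : L}
    (he : e ∈ rootSpace H (⇑α)) (he0 : e ≠ 0) (hx : x ∈ rootSpace H (⇑α)) : ∃ c : ℂ, x = c • e := by
  obtain ⟨w, hw, hw0⟩ := h.wt hα
  rw [← hw] at he hx
  obtain ⟨c, hc⟩ := (finrank_eq_one_iff_of_nonzero' ⟨e, he⟩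
        (by rwa [ne_eq, LieSubmodule.mk_eq_zero])).mp (finrank_rootSpace_eq_one w hw0) ⟨x, hx⟩
  exact ⟨c, by simpa using (congrArg Subtype.val hc).symm⟩

theorem lie_root {α : Module.Dual ℂ H} {x : L} (hx : x ∈ rootSpace H (⇑α)) (h : H) : ⁅(h : L), x⁆ = α h • x :=
  lie_eq_smul_of_mem_rootSpace hx h

theorem lie_mem_root {α β : Module.Dual ℂ H} {x y : L} (hx : x ∈ rootSpace H (⇑α)) (hy : y ∈ rootSpace H (⇑β)) :
    ⁅x, y⁆ ∈ rootSpace H (⇑(α + β)) :=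
  lie_mem_genWeightSpace_of_mem_genWeightSpace hx hy

theorem RootsOf.add (h : RootsOf H Φ cor) {α β : Module.Dual ℂ H} (hα : α ∈ Φ) (hβ : β ∈ Φ) (hαβ : α + β ∈ Φ)
    {x : L} (hx : x ∈ rootSpace H (⇑(α + β))) :
    ∃ y ∈ rootSpace H (⇑α), ∃ z ∈ rootSpace H (⇑β), x = ⁅y, z⁆ := by
  obtain ⟨e, f, ht, he, hf⟩ := h.ef hα
  obtain ⟨b, _, htb, hb, _⟩ := h.ef hβ
  obtain ⟨u, _, htu, hu, _⟩ := h.ef hαβ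
  by_cases hne : ⁅e, b⁆ = 0
  swap
  · obtain ⟨c, hc⟩ := h.one hαβ (lie_mem_root he hb) hne hx
    exact ⟨c • e, Submodule.smul_mem _ _ he, b, hb, by rw [hc, smul_lie]⟩
  exfalso
  have P : ht.HasPrimitiveVectorWith b (β (cor α)) :=
    { ne_zero := htb.e_ne_zero
      lie_h := lie_root hb _
      lie_e := hne }
  obtain ⟨m, hm⟩ := P.exists_nat
  have hfu : ⁅f, u⁆ ∈ rootSpace H (⇑β) := by
    have := lie_mem_root hf hu
    rwa [neg_add_cancel_left] at this
  obtain ⟨c, hc⟩ := h.one hβ hb htb.e_ne_zero hfu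
  have hα2 := h.rs.two α hα
  have key : ∀ k : ℕ, ((ad ℂ L e) ^ k) u ≠ 0 ∧ ((ad ℂ L e) ^ k) u ∈ rootSpace H (⇑(α + β + k • α)) ∧
      ∃ s : ℕ, ⁅e, ⁅f, ((ad ℂ L e) ^ k) u⁆⁆ = (-(s : ℂ)) • ((ad ℂ L e) ^ k) u := by
    intro k
    induction k with
    | zero => 
      refine ⟨by simpa using htu.e_ne_zero, by simpa using hu, 0, ?_⟩
      simp [hc, hne]
    | succ k ih =>
      obtain ⟨h0, h1, s, hs⟩ := ih
      set w := ((ad ℂ L e) ^ k) u with hw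
      have hsucc : ((ad ℂ L e) ^ (k + 1)) u = ⁅e, w⁆ := by
        rw [pow_succ', Module.End.mul_apply, ad_apply]
      rw [hsucc]
      have h2 : ⁅f, ⁅e, w⁆⁆ = (-((s + (m + 2 + 2 * k) : ℕ) : ℂ)) • w := by
        have h3 : ⁅e, ⁅f, w⁆⁆ = ⁅(cor α : L), w⁆ + ⁅f, ⁅e, w⁆⁆ := by
          rw [← ht.lie_e_f]; exact leibniz_lie e f w
        have h4 := lie_root h1 (cor α)
        rw [h4, hs] at h3
        have h5 : ⁅f, ⁅e, w⁆⁆ = (-(s : ℂ)) • w - (α + β + k • α) (cor α) • w := by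
          rw [h3]; abel
        rw [h5, ← sub_smul]
        congr 1
        simp only [LinearMap.add_apply, LinearMap.smul_apply, hα2, hm, nsmul_eq_mul]
        push_cast; ring
      refine ⟨?_, ?_, s + (m + 2 + 2 * k), ?_⟩
      · intro h3
        rw [h3, lie_zero] at h2
        rcases smul_eq_zero.1 h2.symm with h4 | h4
        · rw [neg_eq_zero] at h4
          have : s + (m + 2 + 2 * k) = 0 := by exact_mod_cast h4
          omega
        · exact h0 h4
      · have := lie_mem_root he h1
        rwa [show α + (α + β + k • α) = α + β + (k + 1) • α by rw [succ_nsmul]; abel] at this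
      · rw [h2, lie_smul]
  have hn : IsNilpotent (ad ℂ L e) := LieAlgebra.isNilpotent_ad_of_mem_rootSpace H
    (χ := ⇑α) (fun h0 => ((h.mem α).1 hα).1 (by ext x; exact congrFun h0 x)) he
  obtain ⟨n, hn⟩ := hn
  exact (key n).1 (by rw [hn]; rfl)

theorem RootsOf.top (h : RootsOf H Φ cor) (A : Submodule ℂ L) (hH : ∀ x : H, (x : L) ∈ A)
    (hA : ∀ α ∈ Φ, ∀ x ∈ rootSpace H (⇑α), x ∈ A) : A = ⊤ := by
  rw [eq_top_iff]
  have h1 := iSup_genWeightSpace_eq_top' ℂ H L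
  have h2 := congrArg LieSubmodule.toSubmodule h1
  rw [LieSubmodule.iSup_toSubmodule, LieSubmodule.top_toSubmodule] at h2
  rw [← h2]
  refine iSup_le fun w => ?_
  intro x hx
  by_cases hw : w.IsZero
  · have hx' : x ∈ rootSpace H (w : H → ℂ) := hx
    rw [hw, rootSpace_zero_eq] at hx'
    exact hH ⟨x, hx'⟩
  · refine hA w.toLinear ((h.mem _).2 ⟨?_, w.2⟩) x hx
    intro h3
    apply hw
    funext y
    exact congrArg (fun f => f y) h3

theorem kill_zero {α β : Module.Dual ℂ H} (hab : α + β ≠ 0) {x y : L} (hx : x ∈ rootSpace H (⇑α))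
    (hy : y ∈ rootSpace H (⇑β)) : killingForm ℂ L x y = 0 := by
  refine killingForm_apply_eq_zero_of_mem_rootSpace_of_add_ne_zero ℂ L H hx hy ?_
  intro h; apply hab; ext z; exact congrFun h z

theorem mem_root_zero (x : H) : (x : L) ∈ rootSpace H (⇑(0 : Module.Dual ℂ H)) := by
  have : (⇑(0 : Module.Dual ℂ H) : H → ℂ) = 0 := rfl
  rw [this, rootSpace_zero_eq]; exact x.2

theorem RootsOf.kill_ne (h : RootsOf H Φ cor) {α : Module.Dual ℂ H} (hα : α ∈ Φ) {e f : L}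
    (ht : IsSl2Triple (cor α : L) e f) (he : e ∈ rootSpace H (⇑α)) (hf : f ∈ rootSpace H (⇑(-α))) :
    killingForm ℂ L e f ≠ 0 := by
  intro h0
  obtain ⟨w, hw, hw0⟩ := h.wt hα
  have h1 := lie_eq_killingForm_smul_of_mem_rootSpace_of_mem_rootSpace_neg (α := w) (e := e) (f := f)
    (by rw [hw]; exact he) (by rw [hw]; exact hf)
  rw [h0, zero_smul, ht.lie_e_f] at h1
  exact ht.h_ne_zero h1
end
end Vrm


set_option linter.unusedSectionVars false
set_option linter.unusedSimpArgs false
namespace Vrm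

section
open LieAlgebra LieAlgebra.IsKilling LieModule
variable {L : Type*} [LieRing L] [LieAlgebra ℂ L] [FiniteDimensional ℂ L] [IsKilling ℂ L]
  {H : LieSubalgebra ℂ L} [H.IsCartanSubalgebra]
variable {Φ P : Finset (Module.Dual ℂ H)} {cor : Module.Dual ℂ H → H}

theorem RootsOf.tri (h : RootsOf H Φ cor) (hP : PS Φ P) (htot : ∀ α ∈ Φ, α ∈ P ∨ -α ∈ P) :
    ∃ (N : ℕ) (T : TriData (Fin N) L H), (∀ x : H, T.hh x = x) ∧ (∀ i, T.wt i ∈ P) ∧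
      (∀ α ∈ P, ∃ i, T.wt i = α) ∧ (∀ i, T.co i = cor (T.wt i)) ∧
      (∀ i, T.e i ∈ rootSpace H (⇑(T.wt i))) ∧ (∀ i, T.f i ∈ rootSpace H (⇑(-(T.wt i)))) := by
  classical
  have hR := h.rs
  let E := P.equivFin.symm
  let wt : Fin P.card → Module.Dual ℂ H := fun i => (E i).1
  have hwt : ∀ i, wt i ∈ P := fun i => (E i).2
  have hwts : ∀ α ∈ P, ∃ i, wt i = α := fun α hα => ⟨E.symm ⟨α, hα⟩, by simp [wt]⟩
  have hinj : Function.Injective wt := fun i j hij => E.injective (Subtype.ext hij)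
  choose e f ht he hf using fun i => h.ef (hP.sub (hwt i))
  choose ht' hpos hht using fun i => hP.height hR (hwt i)
  have hk := fun i => h.kill_ne (hP.sub (hwt i)) (ht i) (he i) (hf i)
  have hsum0 : ∀ i j, wt i + wt j ≠ 0 := fun i j h0 => by
    have := hP.neg _ (hwt i)
    rw [← eq_neg_iff_add_eq_zero.2 (by rw [add_comm]; exact h0)] at this
    exact this (hwt j)
  have hn0 : ∀ i, wt i ≠ 0 := fun i h0 => ((h.mem _).1 (hP.sub (hwt i))).1 h0
  have kee : ∀ i j, killingForm ℂ L (e i) (e j) = 0 := fun i j => kill_zero (hsum0 i j) (he i) (he j)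
  have kff : ∀ i j, killingForm ℂ L (f i) (f j) = 0 := fun i j => kill_zero (by
    intro h0; apply hsum0 i j; rw [← neg_add] at h0; exact neg_eq_zero.1 h0) (hf i) (hf j)
  have keh : ∀ i (x : H), killingForm ℂ L (e i) x = 0 := fun i x => kill_zero (by
    rw [add_zero]; exact hn0 i) (he i) (mem_root_zero x)
  have kfh : ∀ i (x : H), killingForm ℂ L (f i) x = 0 := fun i x => kill_zero (by
    rw [add_zero]; exact neg_ne_zero.2 (hn0 i)) (hf i) (mem_root_zero x)
  have kef : ∀ i j, i ≠ j → killingForm ℂ L (e i) (f j) = 0 := fun i j hij => kill_zero (by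
    intro h0; apply hij; apply hinj; exact add_neg_eq_zero.1 h0) (he i) (hf j)
  have kfe : ∀ i j, i ≠ j → killingForm ℂ L (f i) (e j) = 0 := fun i j hij => by
    rw [LieModule.traceForm_comm]; exact kef j i hij.symm
  let Ψ : ((Fin P.card → ℂ) × H × (Fin P.card → ℂ)) →ₗ[ℂ] L :=
    (Fintype.linearCombination ℂ f).coprod (H.toSubmodule.subtype.coprod (Fintype.linearCombination ℂ e))
  have hΨ : ∀ a x b, Ψ (a, x, b) = ∑ i, a i • f i + ((x : L) + ∑ i, b i • e i) := by
    intro a x b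
    simp [Ψ, Fintype.linearCombination_apply]
  have hbij : Function.Bijective Ψ := by
    constructor
    · rw [← LinearMap.ker_eq_bot, LinearMap.ker_eq_bot']
      rintro ⟨a, x, b⟩ h0
      rw [hΨ] at h0
      have ha : a = 0 := by
        funext j
        have h1 := congrArg (killingForm ℂ L (e j)) h0
        simp only [map_add, map_sum, map_smul, map_zero, keh, kee, smul_zero, Finset.sum_const_zero, add_zero] at h1
        rw [Finset.sum_eq_single j (fun i _ hij => by rw [kef j i hij.symm, smul_zero]) (by simp)] at h1
        exact (smul_eq_zero.1 h1).resolve_right (hk j)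
      have hb : b = 0 := by
        funext j
        have h1 := congrArg (killingForm ℂ L (f j)) h0
        simp only [map_add, map_sum, map_smul, map_zero, kfh, kff, smul_zero, Finset.sum_const_zero, add_zero, zero_add] at h1
        rw [Finset.sum_eq_single j (fun i _ hij => by rw [kfe j i hij.symm, smul_zero]) (by simp)] at h1
        exact (smul_eq_zero.1 h1).resolve_right (by rw [LieModule.traceForm_comm]; exact hk j)
      subst ha; subst hb
      have hx : (x : L) = 0 := by simpa using h0
      have hx' : x = 0 := by exact_mod_cast hx
      rw [hx']; rfl
    · rw [← LinearMap.range_eq_top]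
      refine h.top _ (fun x => ⟨(0, x, 0), by rw [hΨ]; simp⟩) ?_
      intro α hα x hx
      rcases htot α hα with hp | hp
      · obtain ⟨i, rfl⟩ := hwts α hp
        obtain ⟨c, rfl⟩ := h.one hα (he i) (ht i).e_ne_zero hx
        refine ⟨(0, 0, Pi.single i c), ?_⟩
        rw [hΨ]; simp [Pi.single_apply]
      · obtain ⟨i, hi⟩ := hwts _ hp
        have hα' : α = - wt i := by rw [hi, neg_neg]
        rw [hα'] at hx hα
        obtain ⟨c, rfl⟩ := h.one hα (hf i) (ht i).f_ne_zero hx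
        refine ⟨(Pi.single i c, 0, 0), ?_⟩
        rw [hΨ]; simp [Pi.single_apply]
  let Θ := LinearEquiv.ofBijective Ψ hbij
  have hΘ : ∀ p, Θ.symm (Ψ p) = p := fun p => Θ.symm_apply_apply p
  have tf : ∀ i, Θ.symm (f i) = (Pi.single i 1, 0, 0) := fun i => by
    rw [← hΘ (Pi.single i 1, 0, 0), hΨ]; simp [Pi.single_apply]
  have te : ∀ i, Θ.symm (e i) = (0, 0, Pi.single i 1) := fun i => by
    rw [← hΘ (0, 0, Pi.single i 1), hΨ]; simp [Pi.single_apply]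
  have th : ∀ x : H, Θ.symm (x : L) = (0, x, 0) := fun x => by
    rw [← hΘ (0, x, 0), hΨ]; simp
  refine ⟨P.card, 
    { hh := H.toSubmodule.subtype
      e := e
      f := f
      c := LinearMap.fst ℂ _ _ ∘ₗ Θ.symm.toLinearMap
      pH := LinearMap.fst ℂ _ _ ∘ₗ LinearMap.snd ℂ _ _ ∘ₗ Θ.symm.toLinearMap
      d := LinearMap.snd ℂ _ _ ∘ₗ LinearMap.snd ℂ _ _ ∘ₗ Θ.symm.toLinearMap
      wt := wt
      co := fun i => cor (wt i)
      hz := ∑ β ∈ P, cor β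
      ht := ht'
      decomp := ?_
      c_f := ?_
      d_e := ?_
      c_h := ?_
      d_h := ?_
      c_e := ?_
      d_f := ?_
      pH_h := ?_
      pH_e := ?_
      pH_f := ?_
      hh_lie := ?_
      h_e := fun x i => lie_root (he i) x
      h_f := fun x i => by
        have := lie_root (hf i) x
        rw [LinearMap.neg_apply, neg_smul] at this
        exact this
      e_f := fun i => (ht i).lie_e_f
      wt_co := fun i => hR.two _ (hP.sub (hwt i))
      ht_pos := hpos
      wt_hz := hht
      wt_inj := hinj }, fun x => rfl, hwt, hwts, fun i => rfl, he, hf⟩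
  · intro x
    have := Θ.apply_symm_apply x
    conv_lhs => rw [← this]
    change Ψ ((Θ.symm x).1, (Θ.symm x).2.1, (Θ.symm x).2.2) = _
    rw [hΨ, add_assoc]; rfl
  · intro i; funext k; simp [tf, Pi.single_apply]
  · intro i; funext k; simp [te, Pi.single_apply]
  · exact fun x => congrArg (fun p => p.1) (th x)
  · exact fun x => congrArg (fun p => p.2.2) (th x)
  · intro i; simp [te]
  · intro i; simp [tf]
  · exact fun x => congrArg (fun p => p.2.1) (th x)
  · intro i; simp [te]
  · intro i; simp [tf]
  · intro x y
    change ⁅(x : L), (y : L)⁆ = 0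
    have := lie_root (mem_root_zero y) x
    simpa using this
end
end Vrm


set_option linter.unusedSectionVars false
set_option linter.unusedSimpArgs false
namespace Vrm

/-- the Lie ring module attached to a representation -/
@[reducible] def lrm {L N : Type*} [LieRing L] [LieAlgebra ℂ L] [AddCommGroup N] [Module ℂ N]
    (a : L →ₗ[ℂ] (N →ₗ[ℂ] N)) (ha : IsRep a) : LieRingModule L N where
  bracket x n := a x n
  add_lie x y n := by change a (x + y) n = a x n + a y n; simp
  lie_add x m n := by change a x (m + n) = a x m + a x n; simp
  leibniz_lie x y n := by
    change a x (a y n) = a ⁅x, y⁆ n + a y (a x n)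
    rw [ha]; abel

theorem lrm_lm {L N : Type*} [LieRing L] [LieAlgebra ℂ L] [AddCommGroup N] [Module ℂ N]
    (a : L →ₗ[ℂ] (N →ₗ[ℂ] N)) (ha : IsRep a) : @LieModule ℂ L N _ _ _ _ _ (lrm a ha) :=
  letI := lrm a ha
  { smul_lie := fun t x n => by change a (t • x) n = t • a x n; simp
    lie_smul := fun t x n => by change a x (t • n) = t • a x n; simp }

/-- the representation attached to a Lie module -/
def toRep (L N : Type*) [LieRing L] [LieAlgebra ℂ L] [AddCommGroup N] [Module ℂ N] [LieRingModule L N]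
    [LieModule ℂ L N] : L →ₗ[ℂ] (N →ₗ[ℂ] N) := (LieModule.toEnd ℂ L N : L →ₗ[ℂ] Module.End ℂ N)

section
variable {L N : Type*} [LieRing L] [LieAlgebra ℂ L] [AddCommGroup N] [Module ℂ N] [LieRingModule L N]
    [LieModule ℂ L N]

theorem toRep_apply (x : L) (n : N) : toRep L N x n = ⁅x, n⁆ := rfl

theorem toRep_rep : IsRep (toRep L N) := fun x y n => by
  simp only [toRep_apply, lie_lie]

variable {ι : Type} [Fintype ι] [LinearOrder ι] {H : Type*} [AddCommGroup H] [Module ℂ H]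
variable (T : TriData ι L H)

theorem TriData.top_of_one (χ : Module.Dual ℂ H) {A : Submodule ℂ (MvPolynomial ι ℂ)} (hA : T.Stab χ A)
    (h1 : (1 : MvPolynomial ι ℂ) ∈ A) : A = ⊤ := by
  rw [eq_top_iff]
  intro p _
  exact (T.ind χ).mem_of_one A h1 (fun i p hp => hA (T.f i) p hp) p

theorem TriData.irr_iff (χ : Module.Dual ℂ H) {K : Submodule ℂ (MvPolynomial ι ℂ)} (hK : K ≤ T.rad χ)
    (g : MvPolynomial ι ℂ →ₗ[ℂ] N) (hg : ∀ x p, g (T.act χ x p) = ⁅x, g p⁆) (hs : Function.Surjective g)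
    (hker : ∀ p, g p = 0 ↔ p ∈ K) : LieModule.IsIrreducible ℂ L N ↔ K = T.rad χ := by
  constructor
  · intro hirr
    refine le_antisymm hK ?_
    let A : LieSubmodule ℂ L N :=
      { (T.rad χ).map g with
        lie_mem := by
          rintro x _ ⟨p, hp, rfl⟩
          exact ⟨_, T.rad_stab χ x p hp, hg x p⟩ }
    have hA : ∀ n, n ∈ A ↔ ∃ p ∈ T.rad χ, g p = n := fun n => Iff.rfl
    rcases hirr.eq_bot_or_eq_top A with h | h
    · intro p hp
      rw [← hker]
      have : g p ∈ A := (hA _).2 ⟨p, hp, rfl⟩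
      rw [h] at this
      simpa using this
    · exfalso
      have : g 1 ∈ A := by rw [h]; trivial
      obtain ⟨p, hp, hp'⟩ := (hA _).1 this
      have h2 : 1 - p ∈ K := by rw [← hker, map_sub, hp', sub_self]
      apply T.one_notMem_rad χ
      have := Submodule.add_mem _ (hK h2) hp
      simpa using this
  · rintro rfl
    have h0 : g 1 ≠ 0 := fun h => T.one_notMem_rad χ ((hker 1).1 h)
    haveI : Nontrivial N := ⟨g 1, 0, h0⟩
    refine LieModule.IsIrreducible.mk ?_
    intro A hA
    have hstab : T.Stab χ ((A : Submodule ℂ N).comap g) := by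
      intro x p hp
      rw [Submodule.mem_comap, hg] at *
      exact A.lie_mem hp
    by_cases h1 : (1 : MvPolynomial ι ℂ) ∈ (A : Submodule ℂ N).comap g
    · have := T.top_of_one χ hstab h1
      rw [eq_top_iff]
      intro n _
      obtain ⟨p, rfl⟩ := hs n
      have h2 : p ∈ (A : Submodule ℂ N).comap g := by rw [this]; trivial
      exact h2
    · exfalso
      apply hA
      have h2 := T.le_rad_of_one χ hstab h1
      rw [eq_bot_iff]
      intro n hn
      obtain ⟨p, rfl⟩ := hs n
      have := h2 (show p ∈ (A : Submodule ℂ N).comap g from hn)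
      rw [← hker] at this
      simpa using this
end

/-- universe lift of a representation -/
noncomputable def ulRep {L N : Type*} [LieRing L] [LieAlgebra ℂ L] [AddCommGroup N] [Module ℂ N]
    (a : L →ₗ[ℂ] (N →ₗ[ℂ] N)) : L →ₗ[ℂ] (ULift N →ₗ[ℂ] ULift N) where
  toFun x := ULift.moduleEquiv.symm.toLinearMap ∘ₗ a x ∘ₗ ULift.moduleEquiv.toLinearMap
  map_add' x y := by refine LinearMap.ext fun p => ?_; simp; rfl
  map_smul' t x := by refine LinearMap.ext fun p => ?_; simp

theorem ulRep_apply {L N : Type*} [LieRing L] [LieAlgebra ℂ L] [AddCommGroup N] [Module ℂ N]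
    (a : L →ₗ[ℂ] (N →ₗ[ℂ] N)) (x : L) (n : N) : ulRep a x (ULift.up n) = ULift.up (a x n) := rfl

theorem ulRep_rep {L N : Type*} [LieRing L] [LieAlgebra ℂ L] [AddCommGroup N] [Module ℂ N]
    {a : L →ₗ[ℂ] (N →ₗ[ℂ] N)} (ha : IsRep a) : IsRep (ulRep a) := by
  rintro x y ⟨n⟩
  simp only [ulRep_apply, ha x y n]; rfl

theorem ulRep_pow {L N : Type*} [LieRing L] [LieAlgebra ℂ L] [AddCommGroup N] [Module ℂ N]
    (a : L →ₗ[ℂ] (N →ₗ[ℂ] N)) (x : L) (k : ℕ) (n : N) : (ulRep a x ^ k) (ULift.up n) = ULift.up ((a x ^ k) n) := by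
  induction k with
  | zero => rfl
  | succ k ih => rw [pow_succ', Module.End.mul_apply, ih, ulRep_apply, pow_succ', Module.End.mul_apply]
end Vrm


open LieAlgebra

universe u v

open scoped Classical

namespace Vrm
open LieAlgebra LieModule
section
variable {L : Type u} [LieRing L] [LieAlgebra ℂ L] [FiniteDimensional ℂ L] [LieAlgebra.IsKilling ℂ L]
  {H : LieSubalgebra ℂ L} [H.IsCartanSubalgebra]

theorem TriData.e_ne {ι : Type} [Fintype ι] {L : Type*} [LieRing L] [LieAlgebra ℂ L] {H : Type*} [AddCommGroup H]
    [Module ℂ H] (T : TriData ι L H) (i : ι) : T.e i ≠ 0 := by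
  intro h
  have := congrFun (T.d_e i) i
  rw [h, map_zero] at this
  simp at this

theorem TriData.f_ne {ι : Type} [Fintype ι] {L : Type*} [LieRing L] [LieAlgebra ℂ L] {H : Type*} [AddCommGroup H]
    [Module ℂ H] (T : TriData ι L H) (i : ι) : T.f i ≠ 0 := by
  intro h
  have := congrFun (T.c_f i) i
  rw [h, map_zero] at this
  simp at this

theorem para_irr {Φ P I : Finset (Module.Dual ℂ H)} {cor : Module.Dual ℂ H → H} (h : RootsOf H Φ cor) (hP : PS Φ P)
    {N : ℕ} (T : TriData (Fin N) L H) (hh : ∀ x : H, T.hh x = x) (hw : ∀ i, T.wt i ∈ P)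
    (hw' : ∀ α ∈ P, ∃ i, T.wt i = α) (hco : ∀ i, T.co i = cor (T.wt i))
    (he : ∀ i, T.e i ∈ rootSpace H (⇑(T.wt i))) (hf : ∀ i, T.f i ∈ rootSpace H (⇑(-(T.wt i))))
    (hIP : ∀ α ∈ I, α ∈ P)
    {I' : Finset (Fin N)} (hI' : ∀ i, i ∈ I' ↔ T.wt i ∈ I) {lam : Module.Dual ℂ H} {m : Fin N → ℕ}
    (hm : ∀ i ∈ I', lam (T.co i) = m i) {rho G : Module.Dual ℂ H} {S : Set (Fin N)} (hC : T.Comb rho S I' G)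
    (M : Type v) [AddCommGroup M] [Module ℂ M] [LieRingModule L M] [LieModule ℂ L M]
    (hM : IsParabolicVermaModule P I cor lam M) :
    LieModule.IsIrreducible ℂ L M ↔ T.KI I' lam m = T.rad lam := by
  obtain ⟨v, ⟨⟨hv0, hvh, hve⟩, hvp⟩, huniv⟩ := hM
  have hrep := toRep_rep (L := L) (N := M)
  have hsing : T.IsSing (toRep L M) lam v := by
    refine ⟨fun x => ?_, fun i => ?_⟩
    · rw [hh, toRep_apply]; exact hvh x
    · exact hve _ (hw i) _ (he i)
  set g := T.hom (toRep L M) v with hgdef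
  have hg : ∀ x p, g (T.act lam x p) = ⁅x, g p⁆ := fun x p => T.hom_act (toRep L M) hrep hsing x p
  have hg1 : g 1 = v := T.hom_one _ _
  have hKs := hC.KI_stab hm
  have hKr := hC.KI_le_rad hm
  refine T.irr_iff lam hKr g hg ?_ ?_
  · -- surjectivity
    let A : LieSubmodule ℂ L M :=
      { LinearMap.range g with
        lie_mem := by
          rintro x _ ⟨p, rfl⟩
          exact ⟨_, hg x p⟩ }
    have hvA : v ∈ A := ⟨1, hg1⟩
    have hpow : ∀ (y : L) (k : ℕ) (n : A), (((LieModule.toEnd ℂ L A y) ^ k) n : M) = ((LieModule.toEnd ℂ L M y) ^ k) (n : M) := by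
      intro y k n
      induction k with
      | zero => rfl
      | succ k ih =>
        rw [pow_succ', pow_succ', Module.End.mul_apply, Module.End.mul_apply, ← ih]; rfl
    obtain ⟨φ, hφ, -⟩ := huniv A _ _ _ _ ⟨v, hvA⟩ ⟨⟨fun h0 => hv0 (congrArg Subtype.val h0), fun x => Subtype.ext (hvh x),
      fun α hα x hx => Subtype.ext (hve α hα x hx)⟩, fun α hα n hn y hy => Subtype.ext (by
        rw [hpow]; exact hvp α hα n hn y hy)⟩
    obtain ⟨ψ, -, hψ⟩ := huniv M _ _ _ _ v ⟨⟨hv0, hvh, hve⟩, hvp⟩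
    have h1 := hψ (A.incl.comp φ) (by
      change ((φ v : A) : M) = v
      rw [hφ])
    have h2 := hψ LieModuleHom.id rfl
    have h3 := h1.trans h2.symm
    intro n
    have h4 := congrArg (fun F => F n) h3
    have h5 : ((φ n : A) : M) = n := h4
    obtain ⟨p, hp⟩ := (φ n).2
    exact ⟨p, hp.trans h5⟩
  · -- kernel
    intro p
    constructor
    · intro hp
      let a := ulRep.{u, 0, v} (T.qact lam _ hKs)
      have ha : IsRep a := ulRep_rep (T.qact_rep lam _ hKs)
      letI := lrm a ha
      haveI := lrm_lm a ha
      let n : ULift.{v} (MvPolynomial (Fin N) ℂ ⧸ T.KI I' lam m) := ULift.up ((T.KI I' lam m).mkQ 1)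
      have hbr : ∀ (x : L) (q : MvPolynomial (Fin N) ℂ), ⁅x, (ULift.up ((T.KI I' lam m).mkQ q) : ULift.{v} (MvPolynomial (Fin N) ℂ ⧸ T.KI I' lam m))⁆
          = ULift.up ((T.KI I' lam m).mkQ (T.act lam x q)) := fun x q => rfl
      have hone := T.one_sing lam
      have hn : IsParaHWVector P I cor lam n := by
        refine ⟨⟨?_, ?_, ?_⟩, ?_⟩
        · intro h0
          have h1 : (T.KI I' lam m).mkQ 1 = 0 := congrArg ULift.down h0
          rw [Submodule.mkQ_apply, Submodule.Quotient.mk_eq_zero] at h1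
          exact T.one_notMem_rad lam (hKr h1)
        · intro x
          rw [hbr, ← hh, hone.1 x, map_smul]; rfl
        · intro α hα x hx
          obtain ⟨i, rfl⟩ := hw' α hα
          obtain ⟨c, rfl⟩ := h.one (hP.sub hα) (he i) (T.e_ne i) hx
          rw [smul_lie, hbr, hone.2 i, map_zero]
          exact smul_zero c
        · intro α hα k hk y hy
          obtain ⟨i, rfl⟩ := hw' α (hIP α hα)
          obtain ⟨c, rfl⟩ := h.one (h.rs.neg _ (hP.sub (hw i))) (hf i) (T.f_ne i) hy
          have hi : i ∈ I' := (hI' i).2 hα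
          have hmk : m i = k := by
            have := hm i hi
            rw [hco, hk] at this
            exact_mod_cast this.symm
          have h1 : LieModule.toEnd ℂ L (ULift.{v} (MvPolynomial (Fin N) ℂ ⧸ T.KI I' lam m)) (c • T.f i) = c • a (T.f i) := by
            rw [map_smul]; rfl
          rw [h1, smul_pow, LinearMap.smul_apply, ulRep_pow, T.qact_pow]
          have h2 : (T.act lam (T.f i) ^ (k + 1)) 1 ∈ T.KI I' lam m := by
            rw [← hmk]
            exact (le_iSup₂_of_le (f := fun i (_ : i ∈ I') =>
              LinearMap.range (T.hom (T.act lam) ((T.act lam (T.f i) ^ (m i + 1)) 1))) i hi le_rfl) ⟨1, T.hom_one _ _⟩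
          rw [show (T.KI I' lam m).mkQ ((T.act lam (T.f i) ^ (k + 1)) 1) = 0 by
            rw [Submodule.mkQ_apply, Submodule.Quotient.mk_eq_zero]; exact h2]
          exact smul_zero _
      obtain ⟨φ, hφ, -⟩ := huniv _ _ _ _ _ n hn
      let q : MvPolynomial (Fin N) ℂ →ₗ[ℂ] ULift.{v} (MvPolynomial (Fin N) ℂ ⧸ T.KI I' lam m) :=
        ULift.moduleEquiv.symm.toLinearMap ∘ₗ (T.KI I' lam m).mkQ
      have htop : LinearMap.eqLocus ((φ : M →ₗ[ℂ] _) ∘ₗ g) q = ⊤ := by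
        refine T.top_of_one lam ?_ ?_
        · intro x r hr
          have hr' : φ (g r) = ULift.up ((T.KI I' lam m).mkQ r) := hr
          change φ (g (T.act lam x r)) = ULift.up ((T.KI I' lam m).mkQ (T.act lam x r))
          rw [hg, LieModuleHom.map_lie, hr', hbr]
        · change φ (g 1) = n
          rw [hg1, hφ]
      have hp' : p ∈ LinearMap.eqLocus ((φ : M →ₗ[ℂ] _) ∘ₗ g) q := by rw [htop]; trivial
      have hp2 : φ (g p) = ULift.up ((T.KI I' lam m).mkQ p) := hp'
      rw [hp, map_zero] at hp2
      have h1 : (T.KI I' lam m).mkQ p = 0 := (congrArg ULift.down hp2).symm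
      rwa [Submodule.mkQ_apply, Submodule.Quotient.mk_eq_zero] at h1
    · intro hp
      have : T.KI I' lam m ≤ LinearMap.ker g := by
        refine iSup₂_le fun i hi => ?_
        have hs := hC.sing hm hi
        rintro _ ⟨r, rfl⟩
        have htop : (LinearMap.ker g).comap (T.hom (T.act lam) ((T.act lam (T.f i) ^ (m i + 1)) 1)) = ⊤ := by
          refine T.top_of_one (lam - (m i + 1) • T.wt i) ?_ ?_
          · intro x r hr
            rw [Submodule.mem_comap, LinearMap.mem_ker] at *
            rw [T.hom_act _ (T.isRep lam) hs, hg, hr, lie_zero]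
          · rw [Submodule.mem_comap, LinearMap.mem_ker, T.hom_one, T.hom_pow _ hrep hsing, T.hom_one]
            refine hvp (T.wt i) ((hI' i).1 hi) (m i) ?_ _ (hf i)
            rw [← hco]; exact hm i hi
        have hr : r ∈ (LinearMap.ker g).comap (T.hom (T.act lam) ((T.act lam (T.f i) ^ (m i + 1)) 1)) := by
          rw [htop]; trivial
        exact hr
      exact this hp
end
end Vrm


namespace Vrm
open LieAlgebra LieModule

theorem wI_props {H : Type*} [AddCommGroup H] [Module ℂ H] {Φ : Finset (Module.Dual ℂ H)} {cor : Module.Dual ℂ H → H}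
    (hR : RS Φ cor) {x0 : H} (l : List (Module.Dual ℂ H)) (hl : ∀ α ∈ l, α ∈ Φ ∧ α x0 = 0)
    (w : Module.Dual ℂ H → Module.Dual ℂ H) (hw : w = l.foldr (fun α f => sref cor α ∘ f) id) :
    ∃ w' : Module.Dual ℂ H → Module.Dual ℂ H, (∀ x, w (w' x) = x) ∧
      (∀ β ∈ Φ, w β ∈ Φ ∧ w β x0 = β x0 ∧ ∀ μ, (w μ) (cor (w β)) = μ (cor β)) ∧
      (∀ β ∈ Φ, w' β ∈ Φ ∧ w' β x0 = β x0) := by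
  induction l generalizing w with
  | nil =>
    subst hw
    exact ⟨id, fun x => rfl, fun β h => ⟨h, rfl, fun _ => rfl⟩, fun β h => ⟨h, rfl⟩⟩
  | cons α l ih =>
    obtain ⟨w', h1, h2, h3⟩ := ih (fun a ha => hl a (List.mem_cons_of_mem _ ha)) _ rfl
    obtain ⟨hα, hα0⟩ := hl α List.mem_cons_self
    have hs0 : ∀ β, sref cor α β x0 = β x0 := fun β => by simp [sref, hα0]
    have hw2 : ∀ x, w x = sref cor α (l.foldr (fun α f => sref cor α ∘ f) id x) := fun x => by rw [hw]; rfl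
    refine ⟨w' ∘ sref cor α, fun x => ?_, fun β hβ => ?_, fun β hβ => ?_⟩
    · rw [hw2, Function.comp_apply, h1, sref_sref (hR.two α hα)]
    · obtain ⟨a, b, c⟩ := h2 β hβ
      refine ⟨?_, ?_, fun μ => ?_⟩
      · rw [hw2]; exact hR.refl α hα _ a
      · rw [hw2, hs0, b]
      · rw [hw2, hw2, ← c μ, hR.cor_refl α hα _ a]
        simp only [sref, LinearMap.sub_apply, LinearMap.smul_apply, map_sub, map_smul, smul_eq_mul, hR.two α hα]
        ring
    · obtain ⟨a, b⟩ := h3 _ (hR.refl α hα β hβ)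
      exact ⟨a, by rw [Function.comp_apply, b, hs0]⟩

section
variable {L : Type u} [LieRing L] [LieAlgebra ℂ L] [FiniteDimensional ℂ L] [LieAlgebra.IsKilling ℂ L]
  {H : LieSubalgebra ℂ L} [H.IsCartanSubalgebra]

theorem coroot_space_neg (α : Module.Dual ℂ H) {x : H} (hx : x ∈ corootSpace (⇑α)) : x ∈ corootSpace (⇑(-α)) := by
  rw [mem_corootSpace] at hx ⊢
  refine Submodule.span_induction ?_ (Submodule.zero_mem _) (fun _ _ _ _ => Submodule.add_mem _)
    (fun c _ _ => Submodule.smul_mem _ c) hx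
  rintro _ ⟨y, hy, z, hz, rfl⟩
  rw [← lie_skew]
  refine Submodule.neg_mem _ (Submodule.subset_span ⟨z, hz, y, ?_, rfl⟩)
  have : (-⇑(-α) : H → ℂ) = ⇑α := by funext t; simp
  rw [this]; exact hy

theorem roots_of {P : Finset (Module.Dual ℂ H)} {cor : Module.Dual ℂ H → H} {ρ : Module.Dual ℂ H}
    (h : IsRootData P cor ρ) : RootsOf H (P ∪ P.image (fun α => -α)) cor := by
  have hm : ∀ α, α ∈ P ∪ P.image (fun α => -α) ↔ α ∈ P ∨ -α ∈ P := by
    intro α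
    simp only [Finset.mem_union, Finset.mem_image]
    refine or_congr_right ⟨?_, fun h => ⟨_, h, neg_neg α⟩⟩
    rintro ⟨β, hβ, rfl⟩; rwa [neg_neg]
  refine ⟨fun α => ?_, fun α hα => ?_⟩
  · rw [hm, h.root_iff]
  · rcases (hm α).1 hα with h1 | h1
    · exact h.coroot_mem α h1
    · obtain ⟨h2, h3⟩ := h.coroot_mem _ h1
      have h4 := coroot_space_neg _ h2
      rw [neg_neg, h.coroot_neg] at h4
      rw [h.coroot_neg] at h3
      exact ⟨by simpa using (corootSpace (⇑α)).neg_mem h4, by simpa using h3⟩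

theorem main {P : Finset (Module.Dual ℂ H)} {cor : Module.Dual ℂ H → H} {ρ : Module.Dual ℂ H}
    (hRD : IsRootData P cor ρ) (I : Finset (Module.Dual ℂ H)) (hI : I ⊆ simpleRoots P)
    (lam : Module.Dual ℂ H)
    (hlamI : ∀ α ∈ P, α ∈ Submodule.span ℤ (I : Set (Module.Dual ℂ H)) → ∃ n : ℕ, lam (cor α) = (n : ℂ))
    (hreg : ∀ α ∈ P, (lam + ρ) (cor α) ≠ 0)
    (wI : Module.Dual ℂ H → Module.Dual ℂ H)
    (l : List (Module.Dual ℂ H))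
    (hl : ∀ α ∈ l, α ∈ P ∧ α ∈ Submodule.span ℤ (I : Set (Module.Dual ℂ H)))
    (hwI : wI = l.foldr (fun α f => sref cor α ∘ f) id)
    (hwIlong : ∀ α ∈ P, α ∈ Submodule.span ℤ (I : Set (Module.Dual ℂ H)) →
      -(wI α) ∈ P ∧ -(wI α) ∈ Submodule.span ℤ (I : Set (Module.Dual ℂ H)))
    (M : Type v) [AddCommGroup M] [Module ℂ M] [LieRingModule L M] [LieModule ℂ L M]
    (hM : IsParabolicVermaModule P I cor lam M) :
    LieModule.IsIrreducible ℂ L M ↔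
      ∃ ν : Module.Dual ℂ H, IsAntidominantWt P cor ρ ν ∧ lam = wI (ν + ρ) - ρ := by
  have hro := roots_of hRD
  set Φ := P ∪ P.image (fun α => -α) with hΦ
  have hR := hro.rs
  have hsub : P ⊆ Φ := Finset.subset_union_left
  have htot : ∀ α ∈ Φ, α ∈ P ∨ -α ∈ P := fun α hα => (hRD.root_iff α).1 ((hro.mem α).1 hα)
  have hP : PS Φ P := by
    obtain ⟨v, ⟨⟨hv0, hvh, hve⟩, -⟩, -⟩ := hM
    refine PS.of_choice hR hsub htot hRD.pos_neg (Sg := {α | ∀ x ∈ rootSpace H (⇑α), ⁅x, v⁆ = 0})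
      (fun α hα => hve α hα) ?_ hRD.rho_def ?_
    · intro α hα β hβ h1 h2 h3 x hx
      obtain ⟨y, hy, z, hz, rfl⟩ := hro.add hα hβ h3 hx
      rw [lie_lie, h1 y hy, h2 z hz, lie_zero, lie_zero, sub_zero]
    · intro α hα h1 h2 h3
      obtain ⟨e, f, ht, he, hf⟩ := hro.ef hα
      have h4 : ⁅((cor α : H) : L), v⁆ = 0 := by
        rw [← ht.lie_e_f, lie_lie, h1 e he, h2 f hf, lie_zero, lie_zero, sub_zero]
      rw [hvh, smul_eq_zero] at h4
      have h5 := h4.resolve_right hv0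
      rcases htot α hα with h | h
      · exact hreg α h (by rw [LinearMap.add_apply, h5, h3, add_zero])
      · exact hreg _ h (by rw [hRD.coroot_neg, map_neg, LinearMap.add_apply, h5, h3, add_zero, neg_zero])
  obtain ⟨N, T, hh, hw, hw', hco, he, hf⟩ := hro.tri hP htot
  have hInd : ∀ δ ∈ I, Ind P δ := by
    intro δ hδ
    have := hI hδ
    rw [simpleRoots, Finset.mem_filter] at this
    exact ⟨this.1, fun β hβ γ hγ h => this.2 ⟨β, hβ, γ, hγ, h⟩⟩
  obtain ⟨x0, hx⟩ := exists_x0 hR hP htot I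
  set I' : Finset (Fin N) := Finset.univ.filter (fun i => T.wt i ∈ I) with hI'
  have hI'm : ∀ i, i ∈ I' ↔ T.wt i ∈ I := fun i => by simp [hI']
  have hC := T.comb_of hR hP htot hw hw' hco hRD.rho_def hInd hx hI'm
  have hm0 : ∀ i, ∃ n : ℕ, i ∈ I' → lam (T.co i) = n := by
    intro i
    by_cases hi : i ∈ I'
    · obtain ⟨n, hn⟩ := hlamI _ (hw i) (Submodule.subset_span ((hI'm i).1 hi))
      exact ⟨n, fun _ => by rw [hco, hn]⟩
    · exact ⟨0, fun h => absurd h hi⟩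
  choose m hm using hm0
  rw [para_irr hro hP T hh hw hw' hco he hf (fun α hα => (hInd α hα).1) hI'm hm hC M hM,
    hC.criterion hm (fun i => by rw [hco]; exact hreg _ (hw i))]
  have hsp : ∀ β ∈ Submodule.span ℤ (I : Set (Module.Dual ℂ H)), β x0 = 0 := by
    intro β hβ
    induction hβ using Submodule.span_induction with
    | mem x hx' => exact (hx x (hInd x hx')).1 hx'
    | zero => rfl
    | add x y _ _ h1 h2 => rw [LinearMap.add_apply, h1, h2, add_zero]
    | smul c x _ h1 => rw [LinearMap.smul_apply, h1, smul_zero]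
  have hsp' : ∀ β ∈ P, β x0 = 0 → β ∈ Submodule.span ℤ (I : Set (Module.Dual ℂ H)) := by
    intro β hβ h0
    obtain ⟨n, hn, h1⟩ := hP.x0_nat hR hx β hβ
    rw [h0] at hn
    have h2 := h1 (by exact_mod_cast hn.symm)
    exact (AddSubmonoid.closure_le (S := (Submodule.span ℤ (I : Set (Module.Dual ℂ H))).toAddSubmonoid)).2
      Submodule.subset_span h2
  have hpos : ∀ β ∈ Φ, β x0 ≠ 0 → (β ∈ P ↔ 0 < (β x0).re) := by
    intro β hβ h0
    have key : ∀ γ ∈ P, γ x0 ≠ 0 → 0 < (γ x0).re := by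
      intro γ hγ h0
      obtain ⟨n, hn, -⟩ := hP.x0_nat hR hx γ hγ
      rw [hn] at h0 ⊢
      have : n ≠ 0 := by exact_mod_cast h0
      simpa using Nat.pos_of_ne_zero this
    refine ⟨fun h => key β h h0, fun h => ?_⟩
    rcases htot β hβ with h1 | h1
    · exact h1
    · have := key _ h1 (by simpa using h0)
      simp at this; linarith
  obtain ⟨w', hww', hwp, hwp'⟩ := wI_props hR (x0 := x0) l
    (fun α hα => ⟨hsub (hl α hα).1, hsp _ (hl α hα).2⟩) wI hwI
  have hcond : (∀ i, 0 < (CB Φ x0 (T.co i)).re → ¬ T.PosAt ρ lam i) ↔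
      ∀ β ∈ P, β x0 ≠ 0 → ¬ ∃ n : ℤ, 0 < n ∧ (lam + ρ) (cor β) = n := by
    have hsg : ∀ i, 0 < (CB Φ x0 (T.co i)).re ↔ T.wt i x0 ≠ 0 := by
      intro i
      obtain ⟨r, hr, h1⟩ := hR.C_re (hsub (hw i))
      rw [hco, h1]
      constructor
      · intro h2 h3; rw [h3] at h2; simp at h2
      · intro h2; exact mul_pos hr ((hpos _ (hsub (hw i)) h2).1 (hw i))
    constructor
    · rintro h β hβ h0 ⟨n, hn, h1⟩
      obtain ⟨i, rfl⟩ := hw' β hβ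
      refine h i ((hsg i).2 h0) ⟨n.toNat, by omega, ?_⟩
      rw [hco, h1]
      have : ((n.toNat : ℤ) : ℂ) = n := by rw [Int.toNat_of_nonneg hn.le]
      exact_mod_cast this.symm
    · rintro h i h0 ⟨n, hn, h1⟩
      refine h _ (hw i) ((hsg i).1 h0) ⟨n, by exact_mod_cast hn, ?_⟩
      rw [← hco, h1]; simp
  rw [hcond]
  constructor
  · intro h
    refine ⟨w' (lam + ρ) - ρ, ?_, by rw [sub_add_cancel, hww', add_sub_cancel_right]⟩
    rintro β hβ ⟨n, hn, h1⟩
    rw [sub_add_cancel] at h1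
    obtain ⟨a, b, c⟩ := hwp β (hsub hβ)
    have h2 := c (w' (lam + ρ))
    rw [hww', h1] at h2
    by_cases h0 : β x0 = 0
    · obtain ⟨h3, h4⟩ := hwIlong β hβ (hsp' β hβ h0)
      obtain ⟨k, hk⟩ := hlamI _ h3 h4
      obtain ⟨j, hj, hj'⟩ := hP.rho_pos hR htot hRD.rho_def h3
      rw [hRD.coroot_neg, map_neg] at hk hj'
      rw [LinearMap.add_apply] at h2
      have h5 : ((n + k + j : ℤ) : ℂ) = 0 := by
        push_cast
        rw [← hk, ← hj', ← h2]; ring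
      have h6 : (n + k + j : ℤ) = 0 := by exact_mod_cast h5
      omega
    · have h3 : wI β x0 ≠ 0 := by rwa [b]
      exact h _ ((hpos _ a h3).2 (by rw [b]; exact (hpos β (hsub hβ) h0).1 hβ)) h3 ⟨n, hn, h2⟩
  · rintro ⟨ν, hν, hlam⟩ β hβ h0 ⟨n, hn, h1⟩
    obtain ⟨a, b⟩ := hwp' β (hsub hβ)
    have h3 : w' β x0 ≠ 0 := by rwa [b]
    refine hν (w' β) ((hpos _ a h3).2 (by rw [b]; exact (hpos β (hsub hβ) h0).1 hβ)) ⟨n, hn, ?_⟩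
    rw [← (hwp _ a).2.2, hww', ← h1, hlam, sub_add_cancel]
end
end Vrm


variable {L : Type u} [LieRing L] [LieAlgebra ℂ L]
  {H : LieSubalgebra ℂ L}

/-- for regular `λ ∈ Λ_I⁺`, the parabolic Verma module `M_I(λ)` is
simple (isomorphic to `L(λ)`) if and only if `λ = w_I · ν` for some antidominant
weight `ν`, where `w_I` is the longest element of `W_I` and `·` is the dot
action. -/
theorem stmt19 [FiniteDimensional ℂ L] [LieAlgebra.IsSemisimple ℂ L]
    [H.IsCartanSubalgebra]
    (Φpos : Finset (Module.Dual ℂ H)) (coroot : Module.Dual ℂ H → H)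
    (ρ : Module.Dual ℂ H) (hRD : IsRootData Φpos coroot ρ)
    (I : Finset (Module.Dual ℂ H)) (hI : I ⊆ simpleRoots Φpos)
    (lam : Module.Dual ℂ H)
    -- `λ ∈ Λ_I⁺`
    (hlamI : ∀ α ∈ Φpos.filter
        (fun α => α ∈ Submodule.span ℤ (I : Set (Module.Dual ℂ H))),
      ∃ n : ℕ, lam (coroot α) = (n : ℂ))
    -- `λ` is regular
    (hreg : ∀ α ∈ Φpos, (lam + ρ) (coroot α) ≠ 0)
    -- `w_I`, the longest element of `W_I`, acting on `h*`
    (wI : Module.Dual ℂ H → Module.Dual ℂ H)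
    (hwI : ∃ l : List (Module.Dual ℂ H),
      (∀ α ∈ l, α ∈ Φpos.filter
        (fun α => α ∈ Submodule.span ℤ (I : Set (Module.Dual ℂ H)))) ∧
      wI = l.foldr (fun α f => reflWt coroot α ∘ f) id)
    (hwIlong : ∀ α ∈ Φpos.filter
        (fun α => α ∈ Submodule.span ℤ (I : Set (Module.Dual ℂ H))),
      -(wI α) ∈ Φpos.filter
        (fun α => α ∈ Submodule.span ℤ (I : Set (Module.Dual ℂ H))))
    (M : Type v) [AddCommGroup M] [Module ℂ M] [LieRingModule L M] [LieModule ℂ L M]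
    (hM : IsParabolicVermaModule Φpos I coroot lam M) :
    LieModule.IsIrreducible ℂ L M ↔
      ∃ ν : Module.Dual ℂ H, IsAntidominantWt Φpos coroot ρ ν
        ∧ lam = wI (ν + ρ) - ρ := by
  haveI : LieAlgebra.IsKilling ℂ L := inferInstance
  obtain ⟨l, hl, hw⟩ := hwI
  exact Vrm.main hRD I hI lam (fun α h1 h2 => hlamI α (Finset.mem_filter.2 ⟨h1, h2⟩)) hreg wI l
    (fun α h => Finset.mem_filter.1 (hl α h)) hw
    (fun α h1 h2 => Finset.mem_filter.1 (hwIlong α (Finset.mem_filter.2 ⟨h1, h2⟩))) M hM
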